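/- Combinatorial Hard Lefschetz: with Λ = Λ_σ the flattened boundary fan of a cone σ, G• a minimal extension sheaf on Λ, ψ the strictly convex piecewise linear function on Λ induced by the projection, and m = dim σ − 1, if the vanishing condition V(σ) holds then multiplication by ψ induces maps μ̄^{2q}: Ḡ^{2q}_Λ → Ḡ^{2q+2}_Λ that are injective for 2q ≤ m−1 and surjective for 2q ≥ m−1. -/

import Mathlib

open Module Function

set_option synthInstance.maxHeartbeats 1000000
set_option maxHeartbeats 1000000
set_option maxSynthPendingDepth 3

noncomputable section

/-! ## Cones and fans -/

/-- The convex cone generated by a finite set of vectors. -/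
def coneGen {V : Type} [AddCommGroup V] [Module ℝ V] (s : Finset V) : Set V :=
  { x | ∃ c : V → ℝ, (∀ v ∈ s, 0 ≤ c v) ∧ x = ∑ v ∈ s, c v • v }

/-- A (strictly convex, i.e. pointed) polyhedral cone in a real vector space. -/
structure Cone (V : Type) [AddCommGroup V] [Module ℝ V] where
  carrier : Set V
  isPoly : ∃ s : Finset V, carrier = coneGen s
  pointed : ∀ x ∈ carrier, -x ∈ carrier → x = 0

namespace Cone

variable {V : Type} [AddCommGroup V] [Module ℝ V]

/-- The linear span `V_σ` of a cone. -/
def spanC (σ : Cone V) : Submodule ℝ V := Submodule.span ℝ σ.carrier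

/-- The dimension of a cone. -/
def dim (σ : Cone V) : ℕ := Module.finrank ℝ σ.spanC

/-- `τ` is a face of `σ` (cut out by a supporting linear form); `σ` is a face of itself. -/
def IsFaceOf (τ σ : Cone V) : Prop :=
  ∃ f : V →ₗ[ℝ] ℝ, (∀ x ∈ σ.carrier, 0 ≤ f x) ∧
    τ.carrier = σ.carrier ∩ {x | f x = 0}

def IsProperFaceOf (τ σ : Cone V) : Prop := τ.IsFaceOf σ ∧ τ ≠ σ

/-- A cone is simplicial if it is generated by linearly independent vectors. -/
def IsSimplicial (σ : Cone V) : Prop :=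
  ∃ s : Finset V, (LinearIndependent ℝ (fun v : s => (v : V))) ∧ σ.carrier = coneGen s

end Cone

/-- The zero cone `o`. -/
def zeroCone (V : Type) [AddCommGroup V] [Module ℝ V] : Cone V where
  carrier := {0}
  isPoly := ⟨∅, by ext x; simp [coneGen]⟩
  pointed := by intro x hx _; simpa using hx

/-- A fan in `V`: a finite collection of pointed polyhedral cones, closed under taking
faces, such that the intersection of any two cones is a common face of both. -/
structure Fan (V : Type) [AddCommGroup V] [Module ℝ V] where
  cones : Set (Cone V)
  finite : cones.Finite
  zero_mem : zeroCone V ∈ cones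
  face_mem : ∀ σ ∈ cones, ∀ τ : Cone V, τ.IsFaceOf σ → τ ∈ cones
  inter_mem : ∀ σ ∈ cones, ∀ σ' ∈ cones, ∃ τ ∈ cones,
    τ.IsFaceOf σ ∧ τ.IsFaceOf σ' ∧ τ.carrier = σ.carrier ∩ σ'.carrier

namespace Fan

variable {V : Type} [AddCommGroup V] [Module ℝ V]

/-- A subfan of `Δ`: a subset of the cones closed under taking faces.  The subfans are
exactly the open subsets of the fan topology. -/
def IsSubfan (Δ : Fan V) (Λ : Set (Cone V)) : Prop :=
  Λ ⊆ Δ.cones ∧ ∀ σ ∈ Λ, ∀ τ : Cone V, τ.IsFaceOf σ → τ ∈ Λ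

/-- The support `|Δ|` of a fan. -/
def support (Δ : Fan V) : Set V := ⋃ σ ∈ Δ.cones, σ.carrier

/-- A fan is complete if its support is the whole space. -/
def IsComplete (Δ : Fan V) : Prop := Δ.support = Set.univ

/-- A fan is simplicial if all its cones are. -/
def IsSimplicial (Δ : Fan V) : Prop := ∀ σ ∈ Δ.cones, σ.IsSimplicial

/-- A fan is purely `n`-dimensional if every cone is a face of an `n`-dimensional cone. -/
def IsPurely (Δ : Fan V) (n : ℕ) : Prop :=
  ∀ σ ∈ Δ.cones, ∃ σ' ∈ Δ.cones, σ.IsFaceOf σ' ∧ σ'.dim = n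

/-- The boundary subfan `∂Δ`: the cones supported in the topological boundary of `|Δ|`. -/
def boundary [TopologicalSpace V] (Δ : Fan V) : Set (Cone V) :=
  {τ ∈ Δ.cones | τ.carrier ⊆ frontier Δ.support}

end Fan

/-! ## The graded algebra `A•` of polynomial functions (linear forms in degree 2) -/

/-- The algebra of polynomial functions on `V`, i.e. the subalgebra of `V → ℝ`
generated by the linear forms. -/
def polyAlg (V : Type) [AddCommGroup V] [Module ℝ V] : Subalgebra ℝ (V → ℝ) :=
  Algebra.adjoin ℝ {f : V → ℝ | IsLinearMap ℝ f}

/-- `A• = S•(V*)` as a commutative ring. -/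
abbrev PolyRing (V : Type) [AddCommGroup V] [Module ℝ V] : Type := polyAlg V

variable (V : Type) [AddCommGroup V] [Module ℝ V]

/-- Polynomial functions homogeneous of (topological) degree `2k`. -/
def AdegN (k : ℕ) : Submodule ℝ (PolyRing V) where
  carrier := {f | ∀ (t : ℝ) (x : V), (f : V → ℝ) (t • x) = t ^ k * (f : V → ℝ) x}
  add_mem' := by intro f g hf hg t x; simp [hf t x, hg t x]; ring
  zero_mem' := by intro t x; simp
  smul_mem' := by intro c f hf t x; simp [hf t x]; ring

/-- The degree-`q` part `A^q` of `A•`, with linear forms in degree `2`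
(so `A^q = 0` for odd `q`). -/
def Adeg (q : ℤ) : Submodule ℝ (PolyRing V) :=
  ⨆ (k : ℕ) (_ : q = 2 * k), AdegN V k

/-- Evaluation of a polynomial function at a point, as a ring homomorphism. -/
def evalRH (x : V) : PolyRing V →+* ℝ :=
  (Pi.evalRingHom (fun _ : V => ℝ) x).comp (polyAlg V).val.toRingHom

/-- The maximal graded ideal `m = A^{>0}` of polynomial functions vanishing at the origin. -/
def mId : Ideal (PolyRing V) := RingHom.ker (evalRH V 0)

/-- The ideal of polynomial functions vanishing on a subset `s ⊆ V`;
for `s = σ` a cone, `A•/I(σ) = A•_σ = S•(V_σ*)`. -/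
def vanishingIdeal (s : Set V) : Ideal (PolyRing V) :=
  RingHom.ker (Pi.ringHom (fun x : s => evalRH V x.1))

/-- `A•_σ`, realized as the quotient of `A•` by the functions vanishing on `σ`. -/
abbrev coneRing (σ : Cone V) : Type := PolyRing V ⧸ vanishingIdeal V σ.carrier

/-! ## Graded `A•`-modules -/

/-- A graded `A•`-module (with real structure): an `A•`-module with an internal
`ℤ`-grading by real subspaces, compatible with the grading of `A•`. -/
structure GAMod where
  M : Type
  [acg : AddCommGroup M]
  [modA : Module (PolyRing V) M]
  [modR : Module ℝ M]
  [tower : IsScalarTower ℝ (PolyRing V) M]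
  deg : ℤ → Submodule ℝ M
  internal : DirectSum.IsInternal deg
  smul_deg : ∀ (p q : ℤ), ∀ a ∈ Adeg V p, ∀ x ∈ deg q, a • x ∈ deg (p + q)

attribute [instance] GAMod.acg GAMod.modA GAMod.modR GAMod.tower

variable {V}

/-- A homomorphism of graded `A•`-modules, homogeneous of degree 0. -/
structure GHom (M N : GAMod V) where
  toLin : M.M →ₗ[PolyRing V] N.M
  deg_mem : ∀ q : ℤ, ∀ x ∈ M.deg q, toLin x ∈ N.deg q

def GHom.id (M : GAMod V) : GHom M M := ⟨LinearMap.id, fun _ _ h => h⟩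

def GHom.comp {M N P : GAMod V} (g : GHom N P) (f : GHom M N) : GHom M P :=
  ⟨g.toLin ∘ₗ f.toLin, fun q x hx => g.deg_mem q _ (f.deg_mem q x hx)⟩

variable (V)

/-- `M` is (the `A•`-module underlying) a free `A•_σ`-module. -/
def FreeOverCone (σ : Cone V) (M : Type) [AddCommGroup M] [Module (PolyRing V) M] : Prop :=
  ∃ h : Module.IsTorsionBySet (PolyRing V) M (vanishingIdeal V σ.carrier),
    letI := h.module
    Module.Free (coneRing V σ) M

/-! ## Reduction modulo the maximal graded ideal -/

/-- The submodule `m·M`. -/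
def mSub (M : Type) [AddCommGroup M] [Module (PolyRing V) M] :
    Submodule (PolyRing V) M := (mId V) • (⊤ : Submodule (PolyRing V) M)

/-- The reduction `M̄ = M/mM`. -/
abbrev mRed (M : Type) [AddCommGroup M] [Module (PolyRing V) M] : Type := M ⧸ mSub V M

lemma mSub_le_comap {M N : Type} [AddCommGroup M] [Module (PolyRing V) M]
    [AddCommGroup N] [Module (PolyRing V) N] (f : M →ₗ[PolyRing V] N) :
    mSub V M ≤ (mSub V N).comap f := by
  rw [mSub, Submodule.smul_le]
  intro r hr x _
  simp only [Submodule.mem_comap, map_smul]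
  exact Submodule.smul_mem_smul hr trivial

/-- The reduced map `M̄ → N̄` induced by an `A•`-linear map. -/
def mRedMap {M N : Type} [AddCommGroup M] [Module (PolyRing V) M]
    [AddCommGroup N] [Module (PolyRing V) N] (f : M →ₗ[PolyRing V] N) :
    mRed V M →ₗ[PolyRing V] mRed V N :=
  Submodule.mapQ _ _ f (mSub_le_comap V f)

/-- The image in `M̄` of an `ℝ`-subspace of `M` (e.g. of a graded piece). -/
def mRedPiece {M : Type} [AddCommGroup M] [Module (PolyRing V) M] [Module ℝ M]
    [IsScalarTower ℝ (PolyRing V) M] (p : Submodule ℝ M) : Submodule ℝ (mRed V M) :=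
  p.map ((mSub V M).mkQ.restrictScalars ℝ)

/-! ## Sheaves of graded `A•`-modules on a fan -/

open scoped Classical

/-- The zero cone as an element of a fan. -/
def Fan.ozero {V : Type} [AddCommGroup V] [Module ℝ V] (Δ : Fan V) : Δ.cones :=
  ⟨zeroCone V, Δ.zero_mem⟩


variable {V}

/-- A sheaf of graded `A•`-modules on the fan space `Δ`, given (as the fan topology
dictates) by its stalks on the cones together with compatible restriction maps. -/
structure FanSheaf (Δ : Fan V) where
  stalk : Δ.cones → GAMod V
  res : ∀ σ τ : Δ.cones, Cone.IsFaceOf τ.1 σ.1 → GHom (stalk σ) (stalk τ)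
  res_self : ∀ (σ : Δ.cones) (h : Cone.IsFaceOf σ.1 σ.1), (res σ σ h).toLin = LinearMap.id
  res_comp : ∀ (σ τ υ : Δ.cones) (h1 : Cone.IsFaceOf τ.1 σ.1) (h2 : Cone.IsFaceOf υ.1 τ.1)
      (h3 : Cone.IsFaceOf υ.1 σ.1),
      (res τ υ h2).toLin ∘ₗ (res σ τ h1).toLin = (res σ υ h3).toLin

namespace FanSheaf

variable {Δ : Fan V} (F : FanSheaf Δ)

/-- The sections of `F` over a collection `Λ` of cones of `Δ` (e.g. a subfan):
compatible families of elements of the stalks over `Λ`, extended by zero. -/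
def secSub (Λ : Set (Cone V)) :
    Submodule (PolyRing V) (∀ σ : Δ.cones, (F.stalk σ).M) where
  carrier := { s | (∀ σ : Δ.cones, σ.1 ∉ Λ → s σ = 0) ∧
    ∀ (σ τ : Δ.cones), σ.1 ∈ Λ → τ.1 ∈ Λ → ∀ h : Cone.IsFaceOf τ.1 σ.1,
      (F.res σ τ h).toLin (s σ) = s τ }
  add_mem' := by
    rintro a b ⟨ha0, ha⟩ ⟨hb0, hb⟩
    refine ⟨fun σ hσ => by simp [ha0 σ hσ, hb0 σ hσ], fun σ τ hσ hτ h => ?_⟩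
    simp [map_add, ha σ τ hσ hτ h, hb σ τ hσ hτ h]
  zero_mem' := ⟨fun _ _ => rfl, fun σ τ _ _ h => by simp⟩
  smul_mem' := by
    rintro c a ⟨ha0, ha⟩
    refine ⟨fun σ hσ => by simp [ha0 σ hσ], fun σ τ hσ hτ h => ?_⟩
    simp [map_smul, ha σ τ hσ hτ h]

/-- The `A•`-module of sections of `F` over `Λ`. -/
abbrev Sec (Λ : Set (Cone V)) : Type := F.secSub Λ

/-- The global sections `E•(Δ)`. -/
abbrev globalSec : Type := F.Sec Δ.cones

/-- The degree-`q` part of the module of sections. -/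
def secDeg (Λ : Set (Cone V)) (q : ℤ) : Submodule ℝ (F.Sec Λ) where
  carrier := { s | ∀ σ : Δ.cones, s.1 σ ∈ (F.stalk σ).deg q }
  add_mem' := by intro a b ha hb σ; exact add_mem (ha σ) (hb σ)
  zero_mem' := fun σ => zero_mem _
  smul_mem' := by intro c a ha σ; exact Submodule.smul_mem _ c (ha σ)

/-- Restriction of sections to a smaller collection of cones. -/
def resSec (Λ' Λ : Set (Cone V)) (hΛ : Λ ⊆ Λ') : F.Sec Λ' →ₗ[PolyRing V] F.Sec Λ where
  toFun s := ⟨fun σ => if σ.1 ∈ Λ then s.1 σ else 0, by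
    classical
    refine ⟨fun σ hσ => by simp [hσ], fun σ τ hσ hτ h => ?_⟩
    simp only [hσ, hτ, if_pos]
    exact s.2.2 σ τ (hΛ hσ) (hΛ hτ) h⟩
  map_add' a b := by
    apply Subtype.ext; funext σ; by_cases h : σ.1 ∈ Λ <;> simp [h]
  map_smul' c a := by
    apply Subtype.ext; funext σ; by_cases h : σ.1 ∈ Λ <;> simp [h]

/-- A sheaf is flabby if all restrictions from global sections to subfans are surjective. -/
def Flabby : Prop :=
  ∀ Λ : Set (Cone V), ∀ h : Δ.IsSubfan Λ, Function.Surjective (F.resSec Δ.cones Λ h.1)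

/-- The boundary fan `∂σ` of a cone of `Δ`, as a set of cones. -/
def bdFan (σ : Δ.cones) : Set (Cone V) := {τ : Cone V | τ.IsProperFaceOf σ.1}

/-- The restriction map `E•_σ → E•_{∂σ}` from the stalk to the sections over the
boundary fan of `σ`. -/
def bdRes (σ : Δ.cones) : (F.stalk σ).M →ₗ[PolyRing V] F.Sec (bdFan σ) where
  toFun x := ⟨fun τ => if h : Cone.IsProperFaceOf τ.1 σ.1 then (F.res σ τ h.1).toLin x else 0, by
    refine ⟨fun τ hτ => by simp [bdFan] at hτ; simp [hτ], ?_⟩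
    intro τ υ hτ hυ h
    simp only [bdFan, Set.mem_setOf_eq] at hτ hυ
    simp only [dif_pos hτ, dif_pos hυ]
    rw [← F.res_comp σ τ υ hτ.1 h hυ.1]; rfl⟩
  map_add' a b := by
    apply Subtype.ext; funext τ
    by_cases h : Cone.IsProperFaceOf τ.1 σ.1 <;> simp [h]
  map_smul' c a := by
    apply Subtype.ext; funext τ
    by_cases h : Cone.IsProperFaceOf τ.1 σ.1 <;> simp [h]

/-- The reduced restriction map `Ē•_σ → Ē•_{∂σ}` modulo `m`. -/
def bdResRed (σ : Δ.cones) :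
    mRed V (F.stalk σ).M →ₗ[PolyRing V] mRed V (F.Sec (bdFan σ)) :=
  mRedMap V (F.bdRes σ)

/-- Condition (N): `E•_o ≅ A•_o = ℝ•`, i.e. the stalk at the zero cone is the
trivial one-dimensional graded module concentrated in degree `0`. -/
def CondN : Prop :=
  Module.IsTorsionBySet (PolyRing V) (F.stalk Δ.ozero).M (mId V : Set (PolyRing V)) ∧
  Module.finrank ℝ (F.stalk Δ.ozero).M = 1 ∧
  ∀ q : ℤ, q ≠ 0 → (F.stalk Δ.ozero).deg q = ⊥

/-- Condition (PF): each stalk `E•_σ` is a free `A•_σ`-module. -/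
def CondPF : Prop := ∀ σ : Δ.cones, FreeOverCone V σ.1 (F.stalk σ).M

/-- Condition (LME): for each nonzero cone `σ`, the restriction `E•_σ → E•_{∂σ}`
induces, modulo `m`, an isomorphism of graded real vector spaces. -/
def CondLME : Prop :=
  ∀ σ : Δ.cones, σ.1 ≠ zeroCone V → ∀ q : ℤ,
    Set.BijOn (F.bdResRed σ)
      (mRedPiece V ((F.stalk σ).deg q) : Set (mRed V (F.stalk σ).M))
      (mRedPiece V (M := F.Sec (bdFan σ)) (F.secDeg (bdFan σ) q) : Set (mRed V (F.Sec (bdFan σ))))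

/-- A minimal extension sheaf on the fan `Δ`. -/
def IsMES : Prop := F.CondN ∧ F.CondPF ∧ F.CondLME

end FanSheaf

/-! ## Quasi-convexity, boundary sections, and Poincaré polynomials -/

section

variable {V : Type} [AddCommGroup V] [Module ℝ V]

/-- A fan is quasi-convex if the global sections of a minimal extension sheaf on it
form a free `A•`-module. -/
def Fan.QuasiConvex (Δ : Fan V) : Prop :=
  ∀ F : FanSheaf Δ, F.IsMES → Module.Free (PolyRing V) F.globalSec

lemma Fan.boundary_subset [TopologicalSpace V] (Δ : Fan V) : Δ.boundary ⊆ Δ.cones :=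
  fun _ h => h.1

/-- The module `E•_{(Δ,∂Δ)}` of global sections vanishing on the boundary subfan. -/
def FanSheaf.relSec [TopologicalSpace V] {Δ : Fan V} (F : FanSheaf Δ) :
    Submodule (PolyRing V) F.globalSec :=
  LinearMap.ker (F.resSec Δ.cones Δ.boundary (Fan.boundary_subset Δ))

/-- The degree-`q` part of `E•_{(Δ,∂Δ)}`. -/
def FanSheaf.relDeg [TopologicalSpace V] {Δ : Fan V} (F : FanSheaf Δ) (q : ℤ) :
    Submodule ℝ F.relSec :=
  (F.secDeg Δ.cones q).comap ((F.relSec.subtype).restrictScalars ℝ)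

/-- The polynomial `Σ_q d(q)·t^q` associated with a (finitely supported) dimension
function. -/
def poincareOf (d : ℕ → ℕ) : Polynomial ℝ :=
  if h : (Function.support d).Finite then ∑ q ∈ h.toFinset, (d q : ℝ) • Polynomial.X ^ q
  else 0

/-- The local Poincaré polynomial `P_σ(t) = Σ_q dim Ē^q_σ · t^q`. -/
def FanSheaf.localP {Δ : Fan V} (F : FanSheaf Δ) (σ : Δ.cones) : Polynomial ℝ :=
  poincareOf fun q => Module.finrank ℝ (mRedPiece V ((F.stalk σ).deg q))

/-- The global Poincaré polynomial `P_Δ(t) = Σ_q dim Ē^q_Δ · t^q`. -/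
def FanSheaf.globalP {Δ : Fan V} (F : FanSheaf Δ) : Polynomial ℝ :=
  poincareOf fun q =>
    Module.finrank ℝ (mRedPiece V (M := F.globalSec) (F.secDeg Δ.cones q))

/-- The relative Poincaré polynomial `P_{(Δ,∂Δ)}(t)`. -/
def FanSheaf.relP [TopologicalSpace V] {Δ : Fan V} (F : FanSheaf Δ) : Polynomial ℝ :=
  poincareOf fun q =>
    Module.finrank ℝ (mRedPiece V (M := F.relSec) (F.relDeg q))

end

section helpers
set_option linter.all false


/-! ## Shortcut instances -/
section inst
variable {V : Type} [AddCommGroup V] [Module ℝ V]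
@[reducible] def polyAlgR : Algebra ℝ (PolyRing V) := (polyAlg V).algebra
@[reducible] def polyModR : Module ℝ (PolyRing V) := Algebra.toModule
@[reducible] def polySMulR : SMul ℝ (PolyRing V) := Algebra.toSMul
@[reducible] def polyModSelf : Module (PolyRing V) (PolyRing V) := Semiring.toModule
@[reducible] def polySMulSelf : SMul (PolyRing V) (PolyRing V) :=
  (Semiring.toModule : Module (PolyRing V) (PolyRing V)).toDistribMulAction.toDistribSMul.toSMulZeroClass.toSMul
end inst
attribute [local instance] polyAlgR polyModR polySMulR polyModSelf polySMulSelf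

/-! ## Part 1: polynomial functions -/
section Poly
variable {V W : Type} [AddCommGroup V] [Module ℝ V] [AddCommGroup W] [Module ℝ W]

def linP (f : V →ₗ[ℝ] ℝ) : PolyRing V :=
  ⟨f, Algebra.subset_adjoin (by exact f.isLinear)⟩

@[simp] lemma linP_apply (f : V →ₗ[ℝ] ℝ) (x : V) : (linP f).1 x = f x := rfl

lemma linP_add (f g : V →ₗ[ℝ] ℝ) : linP (f + g) = linP f + linP g := rfl

lemma poly_ext {a b : PolyRing V} (h : ∀ x, a.1 x = b.1 x) : a = b := Subtype.ext (funext h)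

@[simp] lemma poly_add (a b : PolyRing V) (x : V) : (a + b).1 x = a.1 x + b.1 x := rfl
@[simp] lemma poly_mul (a b : PolyRing V) (x : V) : (a * b).1 x = a.1 x * b.1 x := rfl
@[simp] lemma poly_sub (a b : PolyRing V) (x : V) : (a - b).1 x = a.1 x - b.1 x := rfl
@[simp] lemma poly_neg (a : PolyRing V) (x : V) : (-a).1 x = - a.1 x := rfl
@[simp] lemma poly_zero (x : V) : (0 : PolyRing V).1 x = 0 := rfl
@[simp] lemma poly_one (x : V) : (1 : PolyRing V).1 x = 1 := rfl
@[simp] lemma poly_smul (c : ℝ) (a : PolyRing V) (x : V) : (c • a).1 x = c * a.1 x := rfl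
@[simp] lemma poly_pow (a : PolyRing V) (n : ℕ) (x : V) : (a ^ n).1 x = a.1 x ^ n := rfl
@[simp] lemma poly_algebraMap (c : ℝ) (x : V) : (algebraMap ℝ (PolyRing V) c).1 x = c := rfl
lemma poly_sum {ι : Type*} (s : Finset ι) (a : ι → PolyRing V) (x : V) :
    (∑ i ∈ s, a i).1 x = ∑ i ∈ s, (a i).1 x := map_sum (evalRH V x) a s
lemma poly_prod {ι : Type*} (s : Finset ι) (a : ι → PolyRing V) (x : V) :
    (∏ i ∈ s, a i).1 x = ∏ i ∈ s, (a i).1 x := map_prod (evalRH V x) a s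

lemma poly_ind {p : PolyRing V → Prop} (hc : ∀ c : ℝ, p (algebraMap ℝ _ c))
    (hl : ∀ f : V →ₗ[ℝ] ℝ, p (linP f)) (ha : ∀ a b, p a → p b → p (a + b))
    (hm : ∀ a b, p a → p b → p (a * b)) (a : PolyRing V) : p a := by
  obtain ⟨a, h⟩ := a
  induction h using Algebra.adjoin_induction with
  | mem x hx => exact hl (IsLinearMap.mk' x hx)
  | algebraMap r => exact hc r
  | add x y hx hy h1 h2 => exact ha ⟨x, hx⟩ ⟨y, hy⟩ h1 h2
  | mul x y hx hy h1 h2 => exact hm ⟨x, hx⟩ ⟨y, hy⟩ h1 h2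

/-- pull back of polynomial functions -/
def pb (f : V →ₗ[ℝ] W) : PolyRing W →+* PolyRing V where
  toFun a := ⟨fun x => a.1 (f x), by
    induction a using poly_ind with
    | hc c => exact (algebraMap ℝ (PolyRing V) c).2
    | hl g => exact (linP (g ∘ₗ f)).2
    | ha a b h1 h2 => exact (polyAlg V).add_mem h1 h2
    | hm a b h1 h2 => exact (polyAlg V).mul_mem h1 h2⟩
  map_one' := rfl
  map_mul' _ _ := rfl
  map_zero' := rfl
  map_add' _ _ := rfl

@[simp] lemma pb_apply (f : V →ₗ[ℝ] W) (a : PolyRing W) (x : V) : (pb f a).1 x = a.1 (f x) := rfl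

@[simp] lemma pb_algebraMap (f : V →ₗ[ℝ] W) (c : ℝ) :
    pb f (algebraMap ℝ _ c) = algebraMap ℝ _ c := rfl
lemma pb_smul (f : V →ₗ[ℝ] W) (c : ℝ) (a : PolyRing W) : pb f (c • a) = c • pb f a := rfl

lemma poly_line (a : PolyRing V) (x y : V) :
    ∃ p : Polynomial ℝ, ∀ t : ℝ, a.1 (x + t • y) = p.eval t := by
  induction a using poly_ind with
  | hc c => exact ⟨Polynomial.C c, fun t => by simp⟩
  | hl f => exact ⟨Polynomial.C (f x) + Polynomial.X * Polynomial.C (f y), fun t => by simp; ring⟩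
  | ha a b h1 h2 =>
    obtain ⟨p, hp⟩ := h1; obtain ⟨r, hr⟩ := h2
    exact ⟨p + r, fun t => by simp [hp, hr]⟩
  | hm a b h1 h2 =>
    obtain ⟨p, hp⟩ := h1; obtain ⟨r, hr⟩ := h2
    exact ⟨p * r, fun t => by simp [hp, hr]⟩

lemma poly_zero_of_large {p : Polynomial ℝ} (M : ℝ) (h : ∀ t, M ≤ t → p.eval t = 0) : p = 0 :=
  p.eq_zero_of_infinite_isRoot ((Set.Ici_infinite M).mono fun t ht => h t ht)

lemma mem_vanish {s : Set V} {a : PolyRing V} :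
    a ∈ vanishingIdeal V s ↔ ∀ x ∈ s, a.1 x = 0 := by
  rw [vanishingIdeal, RingHom.mem_ker]
  constructor
  · intro h x hx; exact congrFun h ⟨x, hx⟩
  · intro h; funext x; exact h x.1 x.2

/-- ideal of a subspace -/
abbrev IV (U : Submodule ℝ V) : Ideal (PolyRing V) := vanishingIdeal V (U : Set V)

lemma mem_IV {U : Submodule ℝ V} {a : PolyRing V} : a ∈ IV U ↔ ∀ x ∈ U, a.1 x = 0 := mem_vanish

lemma IV_prime (U : Submodule ℝ V) : (IV U).IsPrime := by
  refine ⟨fun h => ?_, fun {a b} hab => ?_⟩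
  · have := mem_IV.1 ((Ideal.eq_top_iff_one _).1 h) 0 U.zero_mem
    simp at this
  · by_contra hcon
    simp only [not_or, mem_IV, not_forall] at hcon
    obtain ⟨⟨x, hx, hax⟩, ⟨y, hy, hby⟩⟩ := hcon
    obtain ⟨p, hp⟩ := poly_line a x (y - x)
    obtain ⟨r, hr⟩ := poly_line b x (y - x)
    have hpr : p * r = 0 := poly_zero_of_large 0 fun t _ => by
      have := mem_IV.1 hab (x + t • (y - x)) (U.add_mem hx (U.smul_mem _ (U.sub_mem hy hx)))
      simpa [hp, hr] using this
    rcases mul_eq_zero.1 hpr with h | h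
    · exact hax (by simpa [h] using hp 0)
    · exact hby (by simpa [h] using hr 1)

lemma IV_top : IV (⊤ : Submodule ℝ V) = ⊥ := by
  ext a; simp only [mem_IV, Submodule.mem_top, true_implies, Ideal.mem_bot]
  exact ⟨fun h => poly_ext (by simpa using h), fun h => by simp [h]⟩

instance : IsDomain (PolyRing V) := by
  have h := IV_prime (⊤ : Submodule ℝ V)
  rw [IV_top] at h
  exact (Ideal.Quotient.isDomain_iff_prime (⊥ : Ideal (PolyRing V))).2 h |> fun h => (RingEquiv.quotientBot (PolyRing V)).symm.toMulEquiv.isDomain _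

lemma IV_mono {U U' : Submodule ℝ V} (h : U ≤ U') : IV U' ≤ IV U := fun a ha =>
  mem_IV.2 fun x hx => mem_IV.1 ha x (h hx)

lemma mem_coneGen_sum (s : Finset V) (x : V) (hx : x ∈ Submodule.span ℝ (s : Set V)) :
    ∃ M : ℝ, ∀ t, M ≤ t → x + t • (∑ v ∈ s, v) ∈ coneGen s := by
  obtain ⟨c, -, hc⟩ := Submodule.mem_span_finset.1 hx
  refine ⟨∑ v ∈ s, |c v|, fun t ht => ⟨fun v => c v + t, fun v hv => ?_, ?_⟩⟩
  · have : |c v| ≤ ∑ v ∈ s, |c v| := Finset.single_le_sum (fun i _ => abs_nonneg (c i)) hv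
    have := neg_abs_le (c v)
    linarith
  · simp [add_smul, Finset.sum_add_distrib, hc, Finset.smul_sum]

lemma gen_mem_coneGen (s : Finset V) {v : V} (hv : v ∈ s) : v ∈ coneGen s :=
  ⟨fun w => if w = v then 1 else 0, fun w _ => by dsimp only; split_ifs <;> norm_num, by simp [hv]⟩

lemma coneGen_le_span (s : Finset V) : coneGen s ⊆ (Submodule.span ℝ (s : Set V)) := by
  rintro x ⟨c, -, rfl⟩
  exact Submodule.sum_mem _ fun v hv => Submodule.smul_mem _ _ (Submodule.subset_span hv)

lemma Cone.spanC_eq {σ : Cone V} {s : Finset V} (h : σ.carrier = coneGen s) :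
    σ.spanC = Submodule.span ℝ (s : Set V) := by
  apply le_antisymm
  · rw [Cone.spanC, Submodule.span_le, h]; exact coneGen_le_span s
  · rw [Submodule.span_le]; intro v hv
    exact Submodule.subset_span (h ▸ gen_mem_coneGen s hv)

lemma vanish_cone (σ : Cone V) : vanishingIdeal V σ.carrier = IV σ.spanC := by
  obtain ⟨s, hs⟩ := σ.isPoly
  ext a
  rw [mem_IV, mem_vanish]
  constructor
  · intro h x hx
    rw [Cone.spanC_eq hs] at hx
    obtain ⟨M, hM⟩ := mem_coneGen_sum s x hx
    obtain ⟨p, hp⟩ := poly_line a x (∑ v ∈ s, v)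
    have h0 : p = 0 := poly_zero_of_large M fun t ht => by
      rw [← hp]; exact h _ (hs ▸ hM t ht)
    simpa [h0] using hp 0
  · intro h x hx; exact h x (Submodule.subset_span hx)

/-- division by a linear form -/
lemma IV_div (U : Submodule ℝ V) (h : V →ₗ[ℝ] ℝ) (n : V) (hn : n ∈ U) (hhn : h n = 1)
    (a : PolyRing V) (ha : ∀ x ∈ U, h x = 0 → a.1 x = 0) :
    ∃ b, a - linP h * b ∈ IV U := by
  have key : ∀ a : PolyRing V, ∃ b : PolyRing V, ∀ x, a.1 x - a.1 (x - h x • n) = h x * b.1 x := by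
    intro a
    induction a using poly_ind with
    | hc c => exact ⟨0, fun x => by simp⟩
    | hl f => exact ⟨algebraMap ℝ _ (f n), fun x => by simp⟩
    | ha a b h1 h2 =>
      obtain ⟨p, hp⟩ := h1; obtain ⟨r, hr⟩ := h2
      exact ⟨p + r, fun x => by simp only [poly_add]; linear_combination hp x + hr x⟩
    | hm a b h1 h2 =>
      obtain ⟨p, hp⟩ := h1; obtain ⟨r, hr⟩ := h2
      refine ⟨p * b + pb (LinearMap.id - h.smulRight n) a * r, fun x => ?_⟩
      simp only [poly_add, poly_mul, pb_apply, LinearMap.sub_apply, LinearMap.id_apply,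
        LinearMap.smulRight_apply]
      linear_combination b.1 x * hp x + a.1 (x - h x • n) * hr x
  obtain ⟨b, hb⟩ := key a
  refine ⟨b, mem_IV.2 fun x hx => ?_⟩
  have := ha (x - h x • n) (U.sub_mem hx (U.smul_mem _ hn)) (by simp [hhn])
  have h2 := hb x
  simp only [poly_sub, poly_mul, linP_apply]
  linarith

lemma mem_mId {a : PolyRing V} : a ∈ mId V ↔ a.1 0 = 0 := by
  rw [mId, RingHom.mem_ker]; rfl

lemma IV_le_mId (U : Submodule ℝ V) : IV U ≤ mId V := fun a ha =>
  mem_mId.2 (mem_IV.1 ha 0 U.zero_mem)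

instance [FiniteDimensional ℝ V] : IsNoetherianRing (PolyRing V) := by
  have hft : Algebra.FiniteType ℝ (PolyRing V) := by
    refine (Subalgebra.fg_iff_finiteType _).1 ?_
    let b := Module.finBasis ℝ V
    refine ⟨Finset.univ.image fun i => (b.coord i : V → ℝ), ?_⟩
    apply le_antisymm
    · rw [Algebra.adjoin_le_iff]
      intro f hf
      simp only [Finset.coe_image, Finset.coe_univ, Set.image_univ, Set.mem_range] at hf
      obtain ⟨i, rfl⟩ := hf
      exact Algebra.subset_adjoin (b.coord i).isLinear
    · apply Algebra.adjoin_le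
      intro f hf
      have : f = ∑ i, (f (b i)) • (b.coord i : V → ℝ) := by
        funext x
        have h1 := congrArg (IsLinearMap.mk' f hf) (b.sum_repr x)
        simp only [map_sum, map_smul] at h1
        simp only [Finset.sum_apply, Pi.smul_apply, smul_eq_mul, Basis.coord_apply]
        rw [show f x = IsLinearMap.mk' f hf x from rfl, ← h1]
        exact Finset.sum_congr rfl fun i _ => by simp [mul_comm]
      rw [this]
      refine Subalgebra.sum_mem _ fun i _ => Subalgebra.smul_mem _ (Algebra.subset_adjoin ?_) _
      simp
  exact Algebra.FiniteType.isNoetherianRing ℝ _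

/-! ### parameters -/
variable {H : Type} [AddCommGroup H] [Module ℝ H]

/-- `q` restricts to an isomorphism `U ≅ H`. -/
def IsPar (q : V →ₗ[ℝ] H) (U : Submodule ℝ V) : Prop := Function.Bijective (q.domRestrict U)

lemma IsPar.section' {q : V →ₗ[ℝ] H} {U : Submodule ℝ V} (h : IsPar q U) :
    ∃ s : H →ₗ[ℝ] V, (∀ y, s y ∈ U) ∧ (∀ y, q (s y) = y) ∧ ∀ x ∈ U, s (q x) = x := by
  let e := LinearEquiv.ofBijective (q.domRestrict U) h
  refine ⟨U.subtype ∘ₗ e.symm.toLinearMap, fun y => (e.symm y).2, fun y => ?_, fun x hx => ?_⟩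
  · exact e.apply_symm_apply y
  · exact congrArg Subtype.val (e.symm_apply_apply ⟨x, hx⟩)

lemma IsPar.exists_pb {q : V →ₗ[ℝ] H} {U : Submodule ℝ V} (h : IsPar q U) (a : PolyRing V) :
    ∃ r, a - pb q r ∈ IV U := by
  obtain ⟨s, h1, h2, h3⟩ := h.section'
  exact ⟨pb s a, mem_IV.2 fun x hx => by simp [h3 x hx]⟩

lemma IsPar.pb_mem {q : V →ₗ[ℝ] H} {U : Submodule ℝ V} (h : IsPar q U) {r : PolyRing H} :
    pb q r ∈ IV U ↔ r = 0 := by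
  obtain ⟨s, h1, h2, h3⟩ := h.section'
  refine ⟨fun hr => poly_ext fun y => ?_, fun hr => by simp [hr]⟩
  have := mem_IV.1 hr (s y) (h1 y)
  simpa [h2] using this

/-- polynomial ring in one more variable -/
def thetaP (q : V →ₗ[ℝ] H) (T : V →ₗ[ℝ] ℝ) : Polynomial (PolyRing H) →+* PolyRing V :=
  Polynomial.eval₂RingHom (pb q) (linP T)

@[simp] lemma thetaP_C (q : V →ₗ[ℝ] H) (T : V →ₗ[ℝ] ℝ) (r : PolyRing H) :
    thetaP q T (Polynomial.C r) = pb q r := by simp [thetaP]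
@[simp] lemma thetaP_X (q : V →ₗ[ℝ] H) (T : V →ₗ[ℝ] ℝ) :
    thetaP q T Polynomial.X = linP T := by simp [thetaP]

lemma thetaP_apply (q : V →ₗ[ℝ] H) (T : V →ₗ[ℝ] ℝ) (p : Polynomial (PolyRing H)) (x : V) :
    (thetaP q T p).1 x = (p.map (evalRH H (q x))).eval (T x) := by
  induction p using Polynomial.induction_on' with
  | add p r h1 h2 => simp [h1, h2]
  | monomial n a =>
    rw [← Polynomial.C_mul_X_pow_eq_monomial]
    simp [evalRH]

lemma thetaP_exists {q : V →ₗ[ℝ] H} {T : V →ₗ[ℝ] ℝ} {U : Submodule ℝ V}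
    (h : IsPar (q.prod T) U) (a : PolyRing V) : ∃ p, a - thetaP q T p ∈ IV U := by
  obtain ⟨s, h1, h2, h3⟩ := h.section'
  induction a using poly_ind with
  | hc c => exact ⟨Polynomial.C (algebraMap ℝ _ c), by simp⟩
  | hl f =>
    refine ⟨Polynomial.C (linP (f ∘ₗ s ∘ₗ LinearMap.inl ℝ H ℝ)) +
      Polynomial.X * Polynomial.C (algebraMap ℝ _ (f (s (0, 1)))), mem_IV.2 fun x hx => ?_⟩
    have : f x = f (s (q x, 0)) + T x * f (s (0, 1)) := by
      rw [← smul_eq_mul, ← map_smul, ← map_smul, ← map_add, ← map_add]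
      conv_lhs => rw [← h3 x hx]
      simp
    simp [this]; ring
  | ha a b h1 h2 =>
    obtain ⟨p, hp⟩ := h1; obtain ⟨r, hr⟩ := h2
    refine ⟨p + r, ?_⟩
    rw [map_add]
    convert Ideal.add_mem _ hp hr using 1; ring
  | hm a b h1 h2 =>
    obtain ⟨p, hp⟩ := h1; obtain ⟨r, hr⟩ := h2
    refine ⟨p * r, ?_⟩
    rw [map_mul]
    convert Ideal.add_mem _ (Ideal.mul_mem_right b _ hp)
      (Ideal.mul_mem_left _ (thetaP q T p) hr) using 1
    ring

lemma thetaP_mem {q : V →ₗ[ℝ] H} {T : V →ₗ[ℝ] ℝ} {U : Submodule ℝ V}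
    (h : IsPar (q.prod T) U) {p : Polynomial (PolyRing H)} : thetaP q T p ∈ IV U ↔ p = 0 := by
  obtain ⟨s, h1, h2, h3⟩ := h.section'
  refine ⟨fun hp => ?_, fun hr => by simp [hr]⟩
  have h0 : ∀ y : H, p.map (evalRH H y) = 0 := fun y => poly_zero_of_large 0 fun t _ => by
    have h5 := mem_IV.1 hp (s (y, t)) (h1 _)
    rw [thetaP_apply] at h5
    have h4 := h2 (y, t)
    have h6 : q (s (y, t)) = y := congrArg Prod.fst h4
    have h7 : T (s (y, t)) = t := congrArg Prod.snd h4
    rwa [h6, h7] at h5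
  ext i
  have := congrArg (fun r => Polynomial.coeff r i) (h0 (by assumption))
  simpa [evalRH] using this

end Poly


/-! ## Part 2: geometry of polyhedral cones -/
section Geom
variable {V : Type} [AddCommGroup V] [Module ℝ V]

lemma Cone.ext' {σ τ : Cone V} (h : σ.carrier = τ.carrier) : σ = τ := by
  cases σ; cases τ; cases h; rfl

lemma Cone.zero_mem (σ : Cone V) : (0 : V) ∈ σ.carrier := by
  obtain ⟨s, hs⟩ := σ.isPoly
  rw [hs]; exact ⟨0, fun _ _ => le_rfl, by simp⟩

lemma Cone.add_mem (σ : Cone V) {x y : V} (hx : x ∈ σ.carrier) (hy : y ∈ σ.carrier) :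
    x + y ∈ σ.carrier := by
  obtain ⟨s, hs⟩ := σ.isPoly
  rw [hs] at hx hy ⊢
  obtain ⟨c, hc, rfl⟩ := hx
  obtain ⟨d, hd, rfl⟩ := hy
  exact ⟨c + d, fun v hv => add_nonneg (hc v hv) (hd v hv), by
    simp [add_smul, Finset.sum_add_distrib]⟩

lemma Cone.smul_mem (σ : Cone V) {x : V} (hx : x ∈ σ.carrier) {t : ℝ} (ht : 0 ≤ t) :
    t • x ∈ σ.carrier := by
  obtain ⟨s, hs⟩ := σ.isPoly
  rw [hs] at hx ⊢
  obtain ⟨c, hc, rfl⟩ := hx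
  exact ⟨t • c, fun v hv => mul_nonneg ht (hc v hv), by simp [Finset.smul_sum, smul_smul]⟩

lemma Cone.sum_mem (σ : Cone V) {ι : Type*} (s : Finset ι) (f : ι → V)
    (h : ∀ i ∈ s, f i ∈ σ.carrier) : ∑ i ∈ s, f i ∈ σ.carrier := by
  induction s using Finset.induction_on with
  | empty => simpa using σ.zero_mem
  | insert a s ha ih =>
    rw [Finset.sum_insert ha]
    exact σ.add_mem (h _ (by simp)) (ih fun i hi => h i (by simp [hi]))

lemma Cone.mem_span (σ : Cone V) {x : V} (hx : x ∈ σ.carrier) : x ∈ σ.spanC :=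
  Submodule.subset_span hx

lemma coneGen_face {s : Finset V} {f : V →ₗ[ℝ] ℝ} (hf : ∀ x ∈ coneGen s, 0 ≤ f x) :
    coneGen s ∩ {x | f x = 0} = coneGen (s.filter fun v => f v = 0) := by
  ext x; constructor
  · rintro ⟨⟨c, hc, rfl⟩, hx⟩
    have hx : f (∑ v ∈ s, c v • v) = 0 := hx
    rw [map_sum] at hx
    have h1 : ∀ v ∈ s, 0 ≤ f (c v • v) := fun v hv => by
      rw [map_smul]; exact mul_nonneg (hc v hv) (hf v (gen_mem_coneGen s hv))
    rw [Finset.sum_eq_zero_iff_of_nonneg h1] at hx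
    refine ⟨c, fun v hv => hc v (Finset.mem_filter.1 hv).1, ?_⟩
    symm
    apply Finset.sum_subset (Finset.filter_subset _ _)
    intro v hv hv2
    have h2 := hx v hv
    simp only [map_smul, smul_eq_mul, mul_eq_zero] at h2
    rcases h2 with h2 | h2
    · simp [h2]
    · exact absurd (Finset.mem_filter.2 ⟨hv, h2⟩) hv2
  · rintro ⟨c, hc, rfl⟩
    refine ⟨⟨fun v => if f v = 0 then c v else 0, fun v hv => ?_, ?_⟩, ?_⟩
    · dsimp only; split_ifs with h
      · exact hc v (by simp [hv, h])
      · exact le_rfl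
    · simp [Finset.sum_filter, ite_smul]
    · show f _ = 0
      rw [map_sum]
      exact Finset.sum_eq_zero fun v hv => by simp [(Finset.mem_filter.1 hv).2]

/-- the face of `σ` cut out by `f` -/
def faceCone (σ : Cone V) (f : V →ₗ[ℝ] ℝ) (hf : ∀ x ∈ σ.carrier, 0 ≤ f x) : Cone V where
  carrier := σ.carrier ∩ {x | f x = 0}
  isPoly := by
    obtain ⟨s, hs⟩ := σ.isPoly
    refine ⟨s.filter fun v => f v = 0, ?_⟩
    rw [hs] at hf ⊢; exact coneGen_face hf
  pointed x hx hx' := σ.pointed x hx.1 hx'.1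

lemma faceCone_isFace (σ : Cone V) (f : V →ₗ[ℝ] ℝ) (hf : ∀ x ∈ σ.carrier, 0 ≤ f x) :
    (faceCone σ f hf).IsFaceOf σ := ⟨f, hf, rfl⟩

lemma Cone.IsFaceOf.sub {τ σ : Cone V} (h : τ.IsFaceOf σ) : τ.carrier ⊆ σ.carrier := by
  obtain ⟨f, -, h⟩ := h; rw [h]; exact Set.inter_subset_left

lemma Cone.IsFaceOf.span_le {τ σ : Cone V} (h : τ.IsFaceOf σ) : τ.spanC ≤ σ.spanC :=
  Submodule.span_mono h.sub

lemma Cone.face_refl (σ : Cone V) : σ.IsFaceOf σ := ⟨0, by simp, by ext; simp⟩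

lemma Cone.IsFaceOf.antisymm {τ σ : Cone V} (h : τ.IsFaceOf σ) (h' : σ.IsFaceOf τ) : τ = σ :=
  Cone.ext' (h.sub.antisymm h'.sub)

lemma Cone.IsFaceOf.of_sub {ζ ρ τ : Cone V} (h : ζ.IsFaceOf τ) (h' : ρ.IsFaceOf τ)
    (hs : ζ.carrier ⊆ ρ.carrier) : ζ.IsFaceOf ρ := by
  obtain ⟨f, hf, h⟩ := h
  refine ⟨f, fun x hx => hf x (h'.sub hx), ?_⟩
  ext x; constructor
  · intro hx; refine ⟨hs hx, ?_⟩; rw [h] at hx; exact hx.2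
  · rintro ⟨h1, h2⟩; rw [h]; exact ⟨h'.sub h1, h2⟩

lemma Cone.IsFaceOf.trans {ζ ρ τ : Cone V} (h : ζ.IsFaceOf ρ) (h' : ρ.IsFaceOf τ) :
    ζ.IsFaceOf τ := by
  obtain ⟨g, hg, h⟩ := h
  obtain ⟨f, hf, h'⟩ := h'
  obtain ⟨s, hs⟩ := τ.isPoly
  have hf' : ∀ v ∈ s, 0 ≤ f v := fun v hv => hf v (hs ▸ gen_mem_coneGen s hv)
  have hM : ∃ M : ℝ, 0 ≤ M ∧ ∀ v ∈ s, 0 < f v → 0 < M * f v + g v := by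
    refine ⟨∑ v ∈ s, |g v| / f v + 1, ?_, fun v hv hfv => ?_⟩
    · have : 0 ≤ ∑ v ∈ s, |g v| / f v :=
        Finset.sum_nonneg fun v hv => div_nonneg (abs_nonneg _) (hf' v hv)
      linarith
    · have h1 : |g v| / f v ≤ ∑ v ∈ s, |g v| / f v :=
        Finset.single_le_sum (fun v hv => div_nonneg (abs_nonneg (g v)) (hf' v hv)) hv
      have h2 : |g v| ≤ (∑ v ∈ s, |g v| / f v) * f v := by rwa [div_le_iff₀ hfv] at h1
      have := neg_abs_le (g v)
      nlinarith
  obtain ⟨M, hM0, hM⟩ := hM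
  have hgen : ∀ v ∈ s, 0 ≤ (M • f + g) v := by
    intro v hv
    rcases (hf' v hv).lt_or_eq with h1 | h1
    · exact (hM v hv h1).le
    · have : v ∈ ρ.carrier := by rw [h', hs]; exact ⟨gen_mem_coneGen s hv, h1.symm⟩
      simpa [← h1] using hg v this
  have hall : ∀ x ∈ τ.carrier, 0 ≤ (M • f + g) x := by
    intro x hx; rw [hs] at hx
    obtain ⟨c, hc, rfl⟩ := hx
    rw [map_sum]
    exact Finset.sum_nonneg fun v hv => by
      rw [map_smul]; exact mul_nonneg (hc v hv) (hgen v hv)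
  refine ⟨M • f + g, hall, ?_⟩
  ext x; constructor
  · intro hx
    rw [h, h'] at hx
    refine ⟨hx.1.1, ?_⟩
    have h1 : f x = 0 := hx.1.2
    have h2 : g x = 0 := hx.2
    show (M • f + g) x = 0
    simp [h1, h2]
  · rintro ⟨h1, h2⟩
    have h3 : x ∈ coneGen (s.filter fun v => (M • f + g) v = 0) := by
      rw [← coneGen_face (hs ▸ hall), ← hs]; exact ⟨h1, h2⟩
    have h4 : ∀ v ∈ s.filter (fun v => (M • f + g) v = 0), f v = 0 := by
      intro v hv
      obtain ⟨hv1, hv2⟩ := Finset.mem_filter.1 hv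
      rcases (hf' v hv1).lt_or_eq with h1 | h1
      · have := hM v hv1 h1
        simp only [LinearMap.add_apply, LinearMap.smul_apply, smul_eq_mul] at hv2
        linarith
      · exact h1.symm
    have h5 : f x = 0 := by
      obtain ⟨c, -, rfl⟩ := h3
      rw [map_sum]
      exact Finset.sum_eq_zero fun v hv => by rw [map_smul, h4 v hv, smul_zero]
    have h6 : g x = 0 := by
      have : (M • f + g) x = 0 := h2
      simpa [h5] using this
    rw [h, h']; exact ⟨⟨h1, h5⟩, h6⟩

/-- relative interior points -/
lemma Cone.exists_relint (σ : Cone V) : ∃ z ∈ σ.carrier,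
    ∀ g : V →ₗ[ℝ] ℝ, (∀ x ∈ σ.carrier, 0 ≤ g x) → g z = 0 → ∀ x ∈ σ.spanC, g x = 0 := by
  obtain ⟨s, hs⟩ := σ.isPoly
  refine ⟨∑ v ∈ s, v, σ.sum_mem _ _ fun v hv => hs ▸ gen_mem_coneGen s hv, ?_⟩
  intro g hg h0 x hx
  rw [map_sum, Finset.sum_eq_zero_iff_of_nonneg
    fun v hv => hg v (hs ▸ gen_mem_coneGen s hv)] at h0
  rw [Cone.spanC_eq hs] at hx
  have : Submodule.span ℝ (s : Set V) ≤ LinearMap.ker g := Submodule.span_le.2 h0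
  exact this hx

variable [FiniteDimensional ℝ V]

lemma fourier_motzkin (s : Finset V) :
    ∃ F : Finset (V →ₗ[ℝ] ℝ), ∀ x, x ∈ coneGen s ↔ ∀ f ∈ F, 0 ≤ f x := by
  induction s using Finset.induction_on with
  | empty =>
    let b := Module.finBasis ℝ V
    refine ⟨Finset.univ.image (fun i => b.coord i) ∪ Finset.univ.image (fun i => -b.coord i),
      fun x => ?_⟩
    constructor
    · rintro ⟨c, -, rfl⟩; simp
    · intro h
      have : x = 0 := by
        apply b.ext_elem
        intro i
        have h1 := h (b.coord i) (by simp)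
        have h2 := h (-b.coord i) (by simp)
        simp only [LinearMap.neg_apply, Basis.coord_apply] at h1 h2
        simp only [map_zero, Finsupp.coe_zero, Pi.zero_apply]
        linarith
      exact ⟨0, by simp, by simp [this]⟩
  | insert v s hv ih =>
    obtain ⟨F, hF⟩ := ih
    refine ⟨F.filter (fun f => 0 ≤ f v) ∪ ((F.filter fun f => 0 < f v) ×ˢ
      (F.filter fun f => f v < 0)).image (fun p => p.1 v • p.2 - p.2 v • p.1), fun x => ?_⟩
    have h1 : x ∈ coneGen (insert v s) ↔ ∃ t : ℝ, 0 ≤ t ∧ x - t • v ∈ coneGen s := by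
      constructor
      · rintro ⟨c, hc, rfl⟩
        refine ⟨c v, hc v (by simp), c, fun w hw => hc w (by simp [hw]), ?_⟩
        rw [Finset.sum_insert hv]; abel
      · rintro ⟨t, ht, c, hc, hx⟩
        refine ⟨fun w => if w = v then t else c w, fun w hw => ?_, ?_⟩
        · dsimp only; split_ifs with h
          · exact ht
          · exact hc w ((Finset.mem_insert.1 hw).resolve_left h)
        · rw [Finset.sum_insert hv]; simp only [if_true]
          rw [sub_eq_iff_eq_add'] at hx
          rw [hx]
          congr 1
          refine Finset.sum_congr rfl fun w hw => ?_
          rw [if_neg (fun h : w = v => hv (h ▸ hw))]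
    rw [h1]
    constructor
    · rintro ⟨t, ht, hx⟩ f hf
      rw [hF] at hx
      rcases Finset.mem_union.1 hf with hf | hf
      · obtain ⟨hf1, hf2⟩ := Finset.mem_filter.1 hf
        have := hx f hf1
        simp only [map_sub, map_smul, smul_eq_mul] at this
        nlinarith
      · obtain ⟨⟨f, g⟩, hp, rfl⟩ := Finset.mem_image.1 hf
        simp only [Finset.mem_product, Finset.mem_filter] at hp
        have h2 := hx f hp.1.1
        have h3 := hx g hp.2.1
        simp only [map_sub, map_smul, smul_eq_mul, LinearMap.sub_apply, LinearMap.smul_apply]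
          at h2 h3 ⊢
        nlinarith [mul_nonneg hp.1.2.le h3, mul_nonneg (neg_nonneg.2 hp.2.2.le) h2]
    · intro h
      have hA : ∀ f ∈ F, 0 ≤ f v → 0 ≤ f x := fun f hf hfv =>
        h f (Finset.mem_union_left _ (Finset.mem_filter.2 ⟨hf, hfv⟩))
      have hB : ∀ f ∈ F, ∀ g ∈ F, 0 < f v → g v < 0 → 0 ≤ f v * g x - g v * f x :=
        fun f hf g hg hfv hgv => by
          have := h (f v • g - g v • f) (Finset.mem_union_right _ (Finset.mem_image.2
            ⟨(f, g), by simp [hf, hg, hfv, hgv], rfl⟩))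
          simpa using this
      -- choose t = max of 0 and the lower bounds
      let L : Finset ℝ := insert 0 ((F.filter fun f => f v < 0).image fun g => g x / g v)
      have hLne : L.Nonempty := ⟨0, Finset.mem_insert_self _ _⟩
      refine ⟨L.max' hLne, Finset.le_max' _ _ (Finset.mem_insert_self _ _), ?_⟩
      rw [hF]
      intro f hf
      simp only [map_sub, map_smul, smul_eq_mul, sub_nonneg]
      have hmax := L.max'_mem hLne
      rcases lt_trichotomy (f v) 0 with hfv | hfv | hfv
      · have : f x / f v ≤ L.max' hLne := by
          refine Finset.le_max' _ _ ?_
          exact Finset.mem_insert_of_mem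
            (Finset.mem_image.2 ⟨f, Finset.mem_filter.2 ⟨hf, hfv⟩, rfl⟩)
        rw [div_le_iff_of_neg hfv] at this; exact this
      · rw [hfv]; simpa using hA f hf hfv.ge
      · rcases Finset.mem_insert.1 hmax with h0 | h0
        · rw [h0]; simpa using hA f hf hfv.le
        · obtain ⟨g, hg, hgL⟩ := Finset.mem_image.1 h0
          obtain ⟨hg1, hg2⟩ := Finset.mem_filter.1 hg
          rw [← hgL]
          have := hB f hf g hg1 hfv hg2
          rw [div_mul_eq_mul_div, div_le_iff_of_neg hg2]
          nlinarith

lemma exists_small {ι : Type*} (s : Finset ι) (a b : ι → ℝ) (ha : ∀ i ∈ s, 0 < a i) :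
    ∃ ε : ℝ, 0 < ε ∧ ∀ δ, |δ| ≤ ε → ∀ i ∈ s, 0 < a i + δ * b i := by
  induction s using Finset.induction_on with
  | empty => exact ⟨1, one_pos, by simp⟩
  | insert j s hj ih =>
    obtain ⟨ε, hε, h⟩ := ih fun i hi => ha i (by simp [hi])
    have haj := ha j (by simp)
    have hden : 0 < 2 * (|b j| + 1) := by positivity
    refine ⟨min ε (a j / (2 * (|b j| + 1))), lt_min hε (by positivity), fun δ hδ i hi => ?_⟩
    rcases Finset.mem_insert.1 hi with rfl | hi
    · have h1 : |δ| * (2 * (|b i| + 1)) ≤ a i := by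
        rw [← le_div_iff₀ hden]; exact hδ.trans (min_le_right _ _)
      have h2 : |δ * b i| ≤ |δ| * |b i| := (abs_mul _ _).le
      have h3 := neg_abs_le (δ * b i)
      have h4 := abs_nonneg δ
      have h5 := mul_nonneg h4 (abs_nonneg (b i))
      nlinarith
    · exact h δ (hδ.trans (min_le_left _ _)) i hi

lemma facet_rep (σ : Cone V) : ∃ J : Finset (V →ₗ[ℝ] ℝ),
    (∀ x ∈ σ.spanC, x ∈ σ.carrier ↔ ∀ f ∈ J, 0 ≤ f x) ∧
    (∃ l ∈ σ.carrier, ∀ f ∈ J, 0 < f l) ∧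
    (∀ f ∈ J, ∃ z ∈ σ.carrier, f z = 0 ∧ ∀ g ∈ J, g ≠ f → 0 < g z) := by
  obtain ⟨s, hs⟩ := σ.isPoly
  obtain ⟨F, hF⟩ := fourier_motzkin s
  rw [← hs] at hF
  let P : Finset (V →ₗ[ℝ] ℝ) → Prop := fun J => ∀ x ∈ σ.spanC, x ∈ σ.carrier ↔ ∀ f ∈ J, 0 ≤ f x
  let F0 := F.filter fun f => ∃ x ∈ σ.carrier, f x ≠ 0
  have hP0 : P F0 := by
    intro x hx
    rw [hF]
    refine ⟨fun h f hf => h f (Finset.mem_filter.1 hf).1, fun h f hf => ?_⟩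
    by_cases h1 : ∃ x ∈ σ.carrier, f x ≠ 0
    · exact h f (Finset.mem_filter.2 ⟨hf, h1⟩)
    · push Not at h1
      have : σ.spanC ≤ LinearMap.ker f := Submodule.span_le.2 h1
      exact (this hx).ge
  obtain ⟨J, hJ, hmin⟩ := (F0.powerset.filter P).exists_minimal
    ⟨F0, by simp [hP0]⟩
  simp only [Finset.mem_filter, Finset.mem_powerset] at hJ hmin
  obtain ⟨hJF, hPJ⟩ := hJ
  have hl : ∀ f ∈ J, ∃ x ∈ σ.carrier, 0 < f x := fun f hf => by
    obtain ⟨x, hx, hfx⟩ := (Finset.mem_filter.1 (hJF hf)).2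
    exact ⟨x, hx, lt_of_le_of_ne ((hPJ x (σ.mem_span hx)).1 hx f hf) (Ne.symm hfx)⟩
  choose! w hw hw2 using hl
  have hlm : (∑ f ∈ J, w f) ∈ σ.carrier := σ.sum_mem _ _ hw
  have hlp : ∀ f ∈ J, 0 < f (∑ f ∈ J, w f) := fun f hf => by
    rw [map_sum]
    exact Finset.sum_pos' (fun g hg => (hPJ _ (σ.mem_span (hw g hg))).1 (hw g hg) f hf)
      ⟨f, hf, hw2 f hf⟩
  refine ⟨J, hPJ, ⟨_, hlm, hlp⟩, fun f hf => ?_⟩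
  have hnot : ¬ P (J.erase f) := fun hP => by
    have := hmin ⟨(Finset.erase_subset _ _).trans hJF, hP⟩ (Finset.erase_subset _ _)
    exact Finset.notMem_erase f J (this hf)
  simp only [P, not_forall] at hnot
  obtain ⟨y, hy, hy2⟩ := hnot
  have hyc : y ∉ σ.carrier := fun h => hy2 ⟨fun _ g hg =>
    (hPJ y hy).1 h g (Finset.mem_of_mem_erase hg), fun _ => h⟩
  have hyg : ∀ g ∈ J.erase f, 0 ≤ g y := by
    by_contra h
    exact hy2 ⟨fun h1 => absurd h1 hyc, fun h1 => absurd h1 h⟩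
  have hfy : f y < 0 := by
    by_contra h
    apply hyc
    rw [hPJ y hy]
    intro g hg
    by_cases hgf : g = f
    · rw [hgf]; exact not_lt.1 h
    · exact hyg g (Finset.mem_erase.2 ⟨hgf, hg⟩)
  set l := ∑ f ∈ J, w f with hldef
  have hz : ∀ g ∈ J, g ≠ f → 0 < g (f l • y - f y • l) := fun g hg hgf => by
    simp only [map_sub, map_smul, smul_eq_mul]
    have h1 := hyg g (Finset.mem_erase.2 ⟨hgf, hg⟩)
    have h2 := mul_nonneg (hlp f hf).le h1
    have h3 := mul_pos_of_neg_of_neg hfy (neg_neg_of_pos (hlp g hg))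
    linarith
  have hz0 : f (f l • y - f y • l) = 0 := by simp [mul_comm]
  refine ⟨f l • y - f y • l, ?_, hz0, hz⟩
  rw [hPJ _ (Submodule.sub_mem _ (Submodule.smul_mem _ _ hy)
    (Submodule.smul_mem _ _ (σ.mem_span hlm)))]
  intro g hg
  by_cases hgf : g = f
  · rw [hgf, hz0]
  · exact (hz g hg hgf).le

def IsFacet (τ σ : Cone V) : Prop := τ.IsFaceOf σ ∧ τ.dim + 1 = σ.dim

/-- a fixed positive definite form -/
def Bf : V →ₗ[ℝ] V →ₗ[ℝ] ℝ :=
  ∑ i, ((Module.finBasis ℝ V).coord i).smulRight ((Module.finBasis ℝ V).coord i)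

lemma Bf_apply (x y : V) : Bf x y =
    ∑ i, (Module.finBasis ℝ V).coord i x * (Module.finBasis ℝ V).coord i y := by
  simp [Bf, LinearMap.sum_apply]

lemma Bf_comm (x y : V) : Bf x y = Bf y x := by simp [Bf_apply, mul_comm]

lemma Bf_pos {x : V} (hx : x ≠ 0) : 0 < Bf x x := by
  rw [Bf_apply]
  have h0 : ∀ i ∈ Finset.univ, 0 ≤ (Module.finBasis ℝ V).coord i x * (Module.finBasis ℝ V).coord i x :=
    fun i _ => mul_self_nonneg _
  refine lt_of_le_of_ne (Finset.sum_nonneg h0) fun h => hx ?_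
  rw [eq_comm, Finset.sum_eq_zero_iff_of_nonneg h0] at h
  exact (Module.finBasis ℝ V).ext_elem fun i => by simpa using h i (Finset.mem_univ i)

lemma Bf_riesz (U : Submodule ℝ V) (f : V →ₗ[ℝ] ℝ) : ∃ n ∈ U, ∀ x ∈ U, Bf n x = f x := by
  let Φ : U →ₗ[ℝ] Module.Dual ℝ U := (LinearMap.lcomp ℝ ℝ U.subtype) ∘ₗ Bf ∘ₗ U.subtype
  have hinj : Function.Injective Φ := by
    rw [← LinearMap.ker_eq_bot, LinearMap.ker_eq_bot']
    intro x hx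
    by_contra hne
    have h1 : Bf (x : V) (x : V) = 0 := LinearMap.congr_fun hx x
    exact (Bf_pos (fun h => hne (Subtype.ext h))).ne' h1
  have hs : Function.Surjective Φ :=
    (LinearMap.injective_iff_surjective_of_finrank_eq_finrank
      (Subspace.dual_finrank_eq (K := ℝ) (V := U)).symm).1 hinj
  obtain ⟨n, hn⟩ := hs (f ∘ₗ U.subtype)
  exact ⟨n, n.2, fun x hx => LinearMap.congr_fun hn ⟨x, hx⟩⟩

end Geom


/-! ## Part 3: facets, normals, diamond property, line shellings -/
section Facets
variable {V : Type} [AddCommGroup V] [Module ℝ V] [FiniteDimensional ℝ V]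

lemma finrank_inf_ker (U : Submodule ℝ V) (f : V →ₗ[ℝ] ℝ) {l : V} (hl : l ∈ U) (hf : f l ≠ 0) :
    Module.finrank ℝ (U ⊓ LinearMap.ker f : Submodule ℝ V) + 1 = Module.finrank ℝ U := by
  have h1 := LinearMap.finrank_range_add_finrank_ker (f.domRestrict U)
  have h2 : Module.finrank ℝ (LinearMap.range (f.domRestrict U)) = 1 := by
    rw [LinearMap.range_eq_top.2, finrank_top, Module.finrank_self]
    intro t
    exact ⟨⟨(t / f l) • l, U.smul_mem _ hl⟩, by simp [hf]⟩
  have h3 : Module.finrank ℝ (LinearMap.ker (f.domRestrict U)) =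
      Module.finrank ℝ (U ⊓ LinearMap.ker f : Submodule ℝ V) := by
    have : (LinearMap.ker (f.domRestrict U)).map U.subtype = U ⊓ LinearMap.ker f := by
      ext x; constructor
      · rintro ⟨y, hy, rfl⟩; exact ⟨y.2, hy⟩
      · rintro ⟨h1, h2⟩; exact ⟨⟨x, h1⟩, h2, rfl⟩
    rw [← this]
    exact (Submodule.finrank_map_subtype_eq U _).symm
  omega

/-- all the facts about facets, in terms of a finite set `J` of forms -/
lemma facet_main (σ : Cone V) : ∃ J : Finset (V →ₗ[ℝ] ℝ),
    (∀ x ∈ σ.spanC, x ∈ σ.carrier ↔ ∀ f ∈ J, 0 ≤ f x) ∧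
    (∃ l ∈ σ.carrier, ∀ f ∈ J, 0 < f l) ∧
    (∀ f ∈ J, ∃ z ∈ σ.carrier, f z = 0 ∧ ∀ g ∈ J, g ≠ f → 0 < g z) ∧
    (∀ f ∈ J, ∃ τ, IsFacet τ σ ∧ τ.carrier = σ.carrier ∩ {x | f x = 0} ∧
      τ.spanC = σ.spanC ⊓ LinearMap.ker f) ∧
    (∀ ζ : Cone V, ζ.IsProperFaceOf σ → ∃ f ∈ J, ∀ x ∈ ζ.carrier, f x = 0) := by
  obtain ⟨J, h1, h2, h3⟩ := facet_rep σ
  refine ⟨J, h1, h2, h3, fun f hf => ?_, fun ζ hζ => ?_⟩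
  · have hf0 : ∀ x ∈ σ.carrier, 0 ≤ f x := fun x hx => (h1 x (σ.mem_span hx)).1 hx f hf
    obtain ⟨z, hz, hz0, hzp⟩ := h3 f hf
    obtain ⟨l, hl, hlp⟩ := h2
    have hspan : (faceCone σ f hf0).spanC = σ.spanC ⊓ LinearMap.ker f := by
      apply le_antisymm
      · refine Submodule.span_le.2 fun x hx => ⟨σ.mem_span hx.1, hx.2⟩
      · rintro x ⟨hx1, hx2⟩
        obtain ⟨ε, hε, hs⟩ := exists_small (J.erase f) (fun g => g z) (fun g => g x)
          fun g hg => hzp g (Finset.mem_of_mem_erase hg) (Finset.ne_of_mem_erase hg)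
        have hx2 : f x = 0 := hx2
        have hm : z + ε • x ∈ (faceCone σ f hf0).carrier := by
          refine ⟨(h1 _ (Submodule.add_mem _ (σ.mem_span hz) (Submodule.smul_mem _ _ hx1))).2 ?_, ?_⟩
          · intro g hg
            by_cases hgf : g = f
            · subst hgf; simp [hz0, hx2]
            · simpa using (hs ε (abs_of_pos hε).le g (Finset.mem_erase.2 ⟨hgf, hg⟩)).le
          · show f _ = 0
            simp [hz0, hx2]
        have hm2 : z ∈ (faceCone σ f hf0).carrier := ⟨hz, hz0⟩
        have : x = ε⁻¹ • ((z + ε • x) - z) := by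
          rw [add_sub_cancel_left, smul_smul, inv_mul_cancel₀ hε.ne', one_smul]
        rw [this]
        exact Submodule.smul_mem _ _ (Submodule.sub_mem _ (Cone.mem_span _ hm) (Cone.mem_span _ hm2))
    refine ⟨faceCone σ f hf0, ⟨faceCone_isFace _ _ _, ?_⟩, rfl, hspan⟩
    rw [Cone.dim, hspan]
    exact finrank_inf_ker _ f (σ.mem_span hl) (hlp f hf).ne'
  · obtain ⟨⟨g, hg, hζ1⟩, hne⟩ := hζ
    obtain ⟨z, hz, hz2⟩ := ζ.exists_relint
    have hzσ : z ∈ σ.carrier := by rw [hζ1] at hz; exact hz.1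
    have hgz : g z = 0 := by rw [hζ1] at hz; exact hz.2
    by_contra hcon
    push Not at hcon
    have hpos : ∀ f ∈ J, 0 < f z := fun f hf => by
      refine lt_of_le_of_ne ((h1 z (σ.mem_span hzσ)).1 hzσ f hf) fun h => ?_
      obtain ⟨x, hx, hx2⟩ := hcon f hf
      refine hx2 (hz2 f (fun y hy => ?_) h.symm x (ζ.mem_span hx))
      rw [hζ1] at hy
      exact (h1 y (σ.mem_span hy.1)).1 hy.1 f hf
    apply hne
    apply Cone.ext'
    rw [hζ1]
    apply Set.inter_eq_left.2
    intro x hx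
    obtain ⟨ε, hε, hs⟩ := exists_small J (fun g => g z) (fun g => g x) hpos
    have hm : z + (-ε) • x ∈ σ.carrier := by
      refine (h1 _ (Submodule.add_mem _ (σ.mem_span hzσ)
        (Submodule.smul_mem _ _ (σ.mem_span hx)))).2 fun f hf => ?_
      simpa using (hs (-ε) (by simp [abs_of_pos hε]) f hf).le
    have h4 := hg _ hm
    have h5 := hg x hx
    simp only [map_add, map_smul, hgz, smul_eq_mul] at h4
    show g x = 0
    nlinarith

lemma Cone.dim_le_of_sub {τ σ : Cone V} (h : τ.carrier ⊆ σ.carrier) : τ.dim ≤ σ.dim :=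
  Submodule.finrank_mono (Submodule.span_mono h)

lemma Cone.face_eq_of_span {τ τ' σ : Cone V} (h : τ.IsFaceOf σ) (h' : τ'.IsFaceOf σ)
    (hs : τ.spanC = τ'.spanC) : τ = τ' := by
  have key : ∀ {τ τ' : Cone V}, τ.IsFaceOf σ → τ'.IsFaceOf σ → τ.spanC = τ'.spanC →
      τ.carrier ⊆ τ'.carrier := by
    rintro τ τ' h ⟨f, hf, h'⟩ hs x hx
    rw [h']
    refine ⟨h.sub hx, ?_⟩
    have h1 : τ'.spanC ≤ LinearMap.ker f := Submodule.span_le.2 fun y hy => by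
      rw [h'] at hy; exact hy.2
    exact h1 (hs ▸ τ.mem_span hx)
  exact Cone.ext' ((key h h' hs).antisymm (key h' h hs.symm))

lemma exists_facet_of_proper {ζ σ : Cone V} (h : ζ.IsProperFaceOf σ) :
    ∃ τ, IsFacet τ σ ∧ ζ.IsFaceOf τ := by
  obtain ⟨J, h1, h2, h3, h4, h5⟩ := facet_main σ
  obtain ⟨f, hf, hf2⟩ := h5 ζ h
  obtain ⟨τ, hτ, hτ1, hτ2⟩ := h4 f hf
  exact ⟨τ, hτ, h.1.of_sub hτ.1 fun x hx => hτ1 ▸ ⟨h.1.sub hx, hf2 x hx⟩⟩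

lemma Cone.IsProperFaceOf.dim_lt {ζ σ : Cone V} (h : ζ.IsProperFaceOf σ) : ζ.dim < σ.dim := by
  obtain ⟨τ, hτ, h2⟩ := exists_facet_of_proper h
  have := Cone.dim_le_of_sub h2.sub
  have := hτ.2
  omega

lemma IsFacet.proper {τ σ : Cone V} (h : IsFacet τ σ) : τ.IsProperFaceOf σ :=
  ⟨h.1, fun he => by have := h.2; rw [he] at this; omega⟩

lemma IsFacet.rep {τ σ : Cone V} (h : IsFacet τ σ) : ∃ n ∈ σ.spanC, Bf n n = 1 ∧
    (∀ x ∈ σ.spanC, Bf n x = 0 ↔ x ∈ τ.spanC) ∧ (∀ x ∈ σ.carrier, 0 ≤ Bf n x) := by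
  obtain ⟨J, h1, ⟨l, hl, hlp⟩, h3, h4, h5⟩ := facet_main σ
  obtain ⟨f, hf, hf2⟩ := h5 τ h.proper
  obtain ⟨τ', hτ', hτ1, hτ2⟩ := h4 f hf
  have hle : τ.spanC ≤ τ'.spanC := by
    rw [hτ2]; exact Submodule.span_le.2 fun x hx => ⟨σ.mem_span (h.1.sub hx), hf2 x hx⟩
  have heq : τ.spanC = τ'.spanC := by
    apply Submodule.eq_of_le_of_finrank_eq hle
    have h6 := h.2; have h7 := hτ'.2
    simp only [Cone.dim] at h6 h7 ⊢
    omega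
  obtain ⟨n', hn', hnf⟩ := Bf_riesz σ.spanC f
  have hn0 : n' ≠ 0 := by
    rintro rfl
    have := hnf l (σ.mem_span hl)
    simp only [map_zero, LinearMap.zero_apply] at this
    exact (hlp f hf).ne this
  have hpos := Bf_pos hn0
  set c := Real.sqrt (Bf n' n') with hc
  have hc0 : 0 < c := Real.sqrt_pos.2 hpos
  have hc2 : c * c = Bf n' n' := Real.mul_self_sqrt hpos.le
  refine ⟨c⁻¹ • n', Submodule.smul_mem _ _ hn', ?_, fun x hx => ?_, fun x hx => ?_⟩
  · simp only [map_smul, LinearMap.smul_apply, smul_eq_mul, ← hc2]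
    field_simp
  · simp only [map_smul, LinearMap.smul_apply, smul_eq_mul, hnf x hx, heq, hτ2]
    simp [hc0.ne', hx]
  · simp only [map_smul, LinearMap.smul_apply, smul_eq_mul, hnf x (σ.mem_span hx)]
    exact mul_nonneg (inv_nonneg.2 hc0.le) ((h1 x (σ.mem_span hx)).1 hx f hf)

/-- inner unit normal of the facet `τ` of `σ` -/
def nv (σ τ : Cone V) : V := if h : IsFacet τ σ then h.rep.choose else 0

/-- the linear form of the facet `τ` of `σ` -/
def hl (σ τ : Cone V) : V →ₗ[ℝ] ℝ := Bf (nv σ τ)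

section
variable {σ τ : Cone V}

lemma nv_spec (h : IsFacet τ σ) : nv σ τ ∈ σ.spanC ∧ Bf (nv σ τ) (nv σ τ) = 1 ∧
    (∀ x ∈ σ.spanC, Bf (nv σ τ) x = 0 ↔ x ∈ τ.spanC) ∧ (∀ x ∈ σ.carrier, 0 ≤ Bf (nv σ τ) x) := by
  have := h.rep.choose_spec
  rw [nv, dif_pos h]
  exact this

lemma nv_mem (h : IsFacet τ σ) : nv σ τ ∈ σ.spanC := (nv_spec h).1
lemma hl_nv (h : IsFacet τ σ) : hl σ τ (nv σ τ) = 1 := (nv_spec h).2.1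
lemma hl_zero_iff (h : IsFacet τ σ) {x : V} (hx : x ∈ σ.spanC) : hl σ τ x = 0 ↔ x ∈ τ.spanC := (nv_spec h).2.2.1 x hx
lemma hl_nonneg (h : IsFacet τ σ) {x : V} (hx : x ∈ σ.carrier) : 0 ≤ hl σ τ x := (nv_spec h).2.2.2 x hx
lemma hl_zero (h : IsFacet τ σ) {x : V} (hx : x ∈ τ.spanC) : hl σ τ x = 0 := (hl_zero_iff h (h.1.span_le hx)).2 hx

lemma IsFacet.mem_iff (h : IsFacet τ σ) {x : V} (hx : x ∈ σ.carrier) : x ∈ τ.carrier ↔ hl σ τ x = 0 := by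
  refine ⟨fun h1 => hl_zero h (τ.mem_span h1), fun h1 => ?_⟩
  have h2 := (hl_zero_iff h (σ.mem_span hx)).1 h1
  obtain ⟨f, hf, h'⟩ := h.1
  rw [h']
  refine ⟨hx, ?_⟩
  have h1 : τ.spanC ≤ LinearMap.ker f := Submodule.span_le.2 fun y hy => by
    rw [h'] at hy; exact hy.2
  exact h1 h2

lemma sub_nv_mem (h : IsFacet τ σ) {x : V} (hx : x ∈ σ.spanC) : x - hl σ τ x • nv σ τ ∈ τ.spanC := by
  rw [← hl_zero_iff h (Submodule.sub_mem _ hx (Submodule.smul_mem _ _ (nv_mem h)))]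
  simp [hl_nv h]

/-- a form vanishing on `V_τ` is a multiple of `hl` -/
lemma form_eq_smul_hl (h : IsFacet τ σ) (g : V →ₗ[ℝ] ℝ) (hg : ∀ x ∈ τ.spanC, g x = 0) {x : V} (hx : x ∈ σ.spanC) :
    g x = g (nv σ τ) * hl σ τ x := by
  have := hg _ (sub_nv_mem h hx)
  simp only [map_sub, map_smul, smul_eq_mul] at this
  linarith

lemma exists_hl_pos (h : IsFacet τ σ) : ∃ x ∈ σ.carrier, 0 < hl σ τ x := by
  by_contra hcon
  push Not at hcon
  apply h.proper.2
  apply Cone.ext'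
  refine h.1.sub.antisymm fun x hx => ?_
  exact (h.mem_iff hx).2 (le_antisymm (hcon x hx) (hl_nonneg h hx))

lemma form_pos_mul (h : IsFacet τ σ) (g : V →ₗ[ℝ] ℝ) (hg : ∀ x ∈ τ.spanC, g x = 0)
    (hg0 : ∀ x ∈ σ.carrier, 0 ≤ g x) : 0 ≤ g (nv σ τ) := by
  obtain ⟨x, hx, hx2⟩ := exists_hl_pos h
  have := hg0 x hx
  rw [form_eq_smul_hl h g hg (σ.mem_span hx)] at this
  by_contra hn
  push Not at hn
  nlinarith [mul_pos_of_neg_of_neg hn (neg_neg_of_pos hx2)]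

end

/-- translation of `facet_main` -/
lemma facet_J (σ : Cone V) : ∃ J : Finset (V →ₗ[ℝ] ℝ),
    (∀ x ∈ σ.spanC, x ∈ σ.carrier ↔ ∀ f ∈ J, 0 ≤ f x) ∧
    (∃ l ∈ σ.carrier, ∀ f ∈ J, 0 < f l) ∧
    (∀ f ∈ J, ∃ z ∈ σ.carrier, f z = 0 ∧ ∀ g ∈ J, g ≠ f → 0 < g z) ∧
    (∀ f ∈ J, ∃ τ, IsFacet τ σ ∧ ∃ c : ℝ, 0 < c ∧ ∀ x ∈ σ.spanC, f x = c * hl σ τ x) ∧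
    (∀ τ, IsFacet τ σ → ∃ f ∈ J, ∃ c : ℝ, 0 < c ∧ ∀ x ∈ σ.spanC, f x = c * hl σ τ x) := by
  obtain ⟨J, h1, h2, h3, h4, h5⟩ := facet_main σ
  have key : ∀ f ∈ J, ∀ τ, IsFacet τ σ → (∀ x ∈ τ.spanC, f x = 0) →
      ∃ c : ℝ, 0 < c ∧ ∀ x ∈ σ.spanC, f x = c * hl σ τ x := by
    intro f hf τ hτ h0
    refine ⟨f (nv σ τ), ?_, fun x hx => form_eq_smul_hl hτ f h0 hx⟩
    refine lt_of_le_of_ne (form_pos_mul hτ f h0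
      fun x hx => (h1 x (σ.mem_span hx)).1 hx f hf) fun h => ?_
    obtain ⟨l, hl, hlp⟩ := h2
    have := hlp f hf
    rw [form_eq_smul_hl hτ f h0 (σ.mem_span hl), ← h] at this
    simp at this
  refine ⟨J, h1, h2, h3, fun f hf => ?_, fun τ hτ => ?_⟩
  · obtain ⟨τ, hτ, hτ1, hτ2⟩ := h4 f hf
    exact ⟨τ, hτ, key f hf τ hτ fun x hx => by rw [hτ2] at hx; exact hx.2⟩
  · obtain ⟨f, hf, hf2⟩ := h5 τ hτ.proper
    refine ⟨f, hf, key f hf τ hτ fun x hx => ?_⟩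
    have : τ.spanC ≤ LinearMap.ker f := Submodule.span_le.2 hf2
    exact this hx

lemma facet_eq_of_form {σ τ τ' : Cone V} (h : IsFacet τ σ) (h' : IsFacet τ' σ) {c c' : ℝ}
    (hc : 0 < c) (hc' : 0 < c') (he : ∀ x ∈ σ.spanC, c * hl σ τ x = c' * hl σ τ' x) : τ = τ' := by
  apply Cone.ext'
  ext x
  constructor
  · intro hx
    have h1 := he x (σ.mem_span (h.1.sub hx))
    rw [(h.mem_iff (h.1.sub hx)).1 hx, mul_zero] at h1
    exact (h'.mem_iff (h.1.sub hx)).2 (by simpa [hc'.ne'] using h1.symm)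
  · intro hx
    have h1 := he x (σ.mem_span (h'.1.sub hx))
    rw [(h'.mem_iff (h'.1.sub hx)).1 hx, mul_zero] at h1
    exact (h.mem_iff (h'.1.sub hx)).2 (by simpa [hc.ne'] using h1)

lemma facets_finite (σ : Cone V) : {τ : Cone V | IsFacet τ σ}.Finite := by
  obtain ⟨J, h1, h2, h3, h4, h5⟩ := facet_J σ
  have : ∀ τ : {τ : Cone V | IsFacet τ σ}, ∃ f : J, ∃ c : ℝ, 0 < c ∧
      ∀ x ∈ σ.spanC, f.1 x = c * hl σ τ.1 x := fun τ => by
    obtain ⟨f, hf, h⟩ := h5 τ.1 τ.2; exact ⟨⟨f, hf⟩, h⟩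
  choose f c hc hf using this
  have hinj : Function.Injective f := by
    intro τ τ' he
    apply Subtype.ext
    refine facet_eq_of_form τ.2 τ'.2 (hc τ) (hc τ') fun x hx => ?_
    rw [← hf τ x hx, ← hf τ' x hx, he]
  haveI := Finite.of_injective f hinj
  exact Set.toFinite _

def facets (σ : Cone V) : Finset (Cone V) := (facets_finite σ).toFinset

@[simp] lemma mem_facets {σ τ : Cone V} : τ ∈ facets σ ↔ IsFacet τ σ := by simp [facets]

lemma cone_iff (σ : Cone V) {x : V} (hx : x ∈ σ.spanC) :
    x ∈ σ.carrier ↔ ∀ τ, IsFacet τ σ → 0 ≤ hl σ τ x := by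
  refine ⟨fun h τ hτ => hl_nonneg hτ h, fun h => ?_⟩
  obtain ⟨J, h1, h2, h3, h4, h5⟩ := facet_J σ
  rw [h1 x hx]
  intro f hf
  obtain ⟨τ, hτ, c, hc, h6⟩ := h4 f hf
  rw [h6 x hx]; exact mul_nonneg hc.le (h τ hτ)

/-- interior points -/
def IsInt (σ : Cone V) (l : V) : Prop := l ∈ σ.carrier ∧ ∀ τ, IsFacet τ σ → 0 < hl σ τ l

lemma exists_int (σ : Cone V) : ∃ l, IsInt σ l := by
  obtain ⟨J, h1, ⟨l, hlm, hlp⟩, h3, h4, h5⟩ := facet_J σ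
  refine ⟨l, hlm, fun τ hτ => ?_⟩
  obtain ⟨f, hf, c, hc, h6⟩ := h5 τ hτ
  have := hlp f hf
  rw [h6 l (σ.mem_span hlm)] at this
  exact pos_of_mul_pos_right this hc.le |> fun h => h

lemma isInt_of {σ : Cone V} {l : V} (hlm : l ∈ σ.carrier)
    (h : ∀ τ, IsFacet τ σ → l ∉ τ.carrier) : IsInt σ l :=
  ⟨hlm, fun τ hτ => lt_of_le_of_ne (hl_nonneg hτ hlm)
    fun he => h τ hτ ((hτ.mem_iff hlm).2 he.symm)⟩

lemma exists_facet_pt {σ τ : Cone V} (h : IsFacet τ σ) : ∃ z ∈ σ.carrier, hl σ τ z = 0 ∧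
    ∀ τ', IsFacet τ' σ → τ' ≠ τ → 0 < hl σ τ' z := by
  obtain ⟨J, h1, h2, h3, h4, h5⟩ := facet_J σ
  obtain ⟨f, hf, c, hc, h6⟩ := h5 τ h
  obtain ⟨z, hz, hz0, hzp⟩ := h3 f hf
  refine ⟨z, hz, ?_, fun τ' hτ' hne => ?_⟩
  · rw [h6 z (σ.mem_span hz)] at hz0; simpa [hc.ne'] using hz0
  · obtain ⟨f', hf', c', hc', h6'⟩ := h5 τ' hτ'
    have hff : f' ≠ f := by
      rintro rfl
      exact hne (facet_eq_of_form hτ' h hc' hc fun x hx => by rw [← h6 x hx, ← h6' x hx])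
    have := hzp f' hf' hff
    rw [h6' z (σ.mem_span hz)] at this
    exact pos_of_mul_pos_right this hc'.le |> fun h => h

lemma zero_face (σ : Cone V) : (zeroCone V).IsFaceOf σ := by
  refine ⟨∑ τ ∈ facets σ, hl σ τ, fun x hx => ?_, ?_⟩
  · rw [LinearMap.sum_apply]
    exact Finset.sum_nonneg fun τ hτ => hl_nonneg (mem_facets.1 hτ) hx
  · ext x; constructor
    · intro hx
      have hx : x = 0 := hx
      subst hx
      exact ⟨σ.zero_mem, by show _ = _; simp⟩
    · rintro ⟨hx, hx2⟩
      have hx2 : (∑ τ ∈ facets σ, hl σ τ) x = 0 := hx2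
      rw [LinearMap.sum_apply, Finset.sum_eq_zero_iff_of_nonneg
        fun τ hτ => hl_nonneg (mem_facets.1 hτ) hx] at hx2
      refine σ.pointed x hx ((cone_iff σ (Submodule.neg_mem _ (σ.mem_span hx))).2 fun τ hτ => ?_)
      simp [hx2 τ (mem_facets.2 hτ)]

lemma zeroCone_span : (zeroCone V).spanC = ⊥ := by
  rw [Cone.spanC]; exact Submodule.span_zero_singleton ℝ

lemma zeroCone_dim : (zeroCone V).dim = 0 := by
  rw [Cone.dim, zeroCone_span]; exact finrank_bot ℝ V

lemma dim_eq_zero_iff {σ : Cone V} : σ.dim = 0 ↔ σ = zeroCone V := by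
  refine ⟨fun h => ?_, fun h => by rw [h, zeroCone_dim]⟩
  by_contra hne
  have := Cone.IsProperFaceOf.dim_lt (σ := σ) ⟨zero_face σ, fun h => hne h.symm⟩
  omega

/-- the diamond: existence of the second facet -/
lemma exists_other {σ τ ρ : Cone V} (h : IsFacet τ σ) (h' : IsFacet ρ τ) :
    ∃ τ', IsFacet τ' σ ∧ τ' ≠ τ ∧ IsFacet ρ τ' := by
  obtain ⟨z, hz, hz2⟩ := ρ.exists_relint
  by_contra hcon
  push Not at hcon
  have hpos : ∀ τ' ∈ (facets σ).erase τ, 0 < hl σ τ' z := by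
    intro τ' hτ'
    have hF := mem_facets.1 (Finset.mem_of_mem_erase hτ')
    have hzσ := h.1.sub (h'.1.sub hz)
    refine lt_of_le_of_ne (hl_nonneg hF hzσ) fun he => ?_
    apply hcon τ' hF (Finset.ne_of_mem_erase hτ')
    refine ⟨(h'.1.trans h.1).of_sub hF.1 fun x hx => ?_, ?_⟩
    · have hxσ := h.1.sub (h'.1.sub hx)
      rw [hF.mem_iff hxσ]
      exact hz2 _ (fun y hy => hl_nonneg hF (h.1.sub (h'.1.sub hy))) he.symm x (ρ.mem_span hx)
    · have := h.2; have := h'.2; have := hF.2; omega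
  obtain ⟨ε, hε, hs⟩ := exists_small _ (fun τ' => hl σ τ' z) (fun τ' => hl σ τ' (nv τ ρ)) hpos
  have hzτ := h'.1.sub hz
  have hm : z + (-ε) • nv τ ρ ∈ τ.carrier := by
    have hspan : z + (-ε) • nv τ ρ ∈ τ.spanC :=
      Submodule.add_mem _ (τ.mem_span hzτ) (Submodule.smul_mem _ _ (nv_mem h'))
    have hσ : z + (-ε) • nv τ ρ ∈ σ.carrier := by
      rw [cone_iff σ (h.1.span_le hspan)]
      intro τ' hτ'
      by_cases he : τ' = τ
      · subst he; rw [hl_zero h hspan]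
      · simpa using (hs (-ε) (by simp [abs_of_pos hε]) τ' (by simp [he, hτ'])).le
    exact (h.mem_iff hσ).2 (hl_zero h hspan)
  have h1 := hl_nonneg h' hm
  simp only [map_add, map_smul, hl_nv h', hl_zero h' (ρ.mem_span hz), smul_eq_mul] at h1
  linarith

section
variable {σ τ τ' ρ : Cone V}

lemma gam_pos (h : IsFacet τ σ) (h' : IsFacet τ' σ) (hne : τ' ≠ τ)
    (hρ : IsFacet ρ τ) (hρ' : IsFacet ρ τ') : 0 < hl σ τ' (nv τ ρ) := by
  have h0 : ∀ x ∈ ρ.spanC, hl σ τ' x = 0 := fun x hx => hl_zero h' (hρ'.1.span_le hx)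
  refine lt_of_le_of_ne (form_pos_mul hρ _ h0 fun x hx => hl_nonneg h' (h.1.sub hx)) fun he => ?_
  apply hne
  have hle : τ.spanC ≤ τ'.spanC := fun x hx => by
    rw [← hl_zero_iff h' (h.1.span_le hx), form_eq_smul_hl hρ _ h0 hx, ← he, zero_mul]
  have : τ.spanC = τ'.spanC := by
    apply Submodule.eq_of_le_of_finrank_eq hle
    have h6 := h.2; have h7 := h'.2
    simp only [Cone.dim] at h6 h7 ⊢
    omega
  exact (Cone.face_eq_of_span h.1 h'.1 this).symm

lemma gam_sq (h : IsFacet τ σ) (h' : IsFacet τ' σ) (hne : τ' ≠ τ)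
    (hρ : IsFacet ρ τ) (hρ' : IsFacet ρ τ') : (hl σ τ' (nv τ ρ)) ^ 2 = 1 - (Bf (nv σ τ') (nv σ τ)) ^ 2 := by
  set u := nv σ τ; set u' := nv σ τ'; set w := nv τ ρ
  have hw : w ∈ τ.spanC := nv_mem hρ
  have h1 : u' - hl σ τ u' • u ∈ τ.spanC := sub_nv_mem h (nv_mem h')
  have h2 := sub_nv_mem hρ h1
  set r := u' - hl σ τ u' • u - hl τ ρ (u' - hl σ τ u' • u) • w with hr
  have e1 : ∀ x ∈ ρ.spanC, Bf r x = 0 := fun x hx => by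
    have a1 : Bf u' x = 0 := hl_zero h' (hρ'.1.span_le hx)
    have a2 : Bf u x = 0 := hl_zero h (hρ.1.span_le hx)
    have a3 : Bf w x = 0 := hl_zero hρ hx
    simp [hr, a1, a2, a3]
  have hr0 : r = 0 := by
    by_contra hne
    exact (Bf_pos hne).ne' (e1 r h2)
  have a1 : Bf u u = 1 := hl_nv h
  have a2 : Bf u' u' = 1 := hl_nv h'
  have a3 : Bf w w = 1 := hl_nv hρ
  have a4 : Bf u w = 0 := hl_zero h hw
  have a4' : Bf w u = 0 := by rw [Bf_comm]; exact a4
  have hexp : u' = Bf u u' • u + Bf w u' • w := by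
    have : u' - Bf u u' • u - Bf w (u' - Bf u u' • u) • w = 0 := hr0
    simp only [map_sub, map_smul, a4', smul_zero, sub_zero] at this
    rw [sub_sub, sub_eq_zero] at this; exact this
  have : Bf u' u' = Bf u u' * Bf u u' + Bf w u' * Bf w u' := by
    conv_lhs => rw [hexp]
    simp only [map_add, map_smul, LinearMap.add_apply, LinearMap.smul_apply, smul_eq_mul, a1, a3, a4, a4']
    ring
  show (Bf u' w) ^ 2 = _
  rw [Bf_comm u' w, Bf_comm u' u]
  rw [a2] at this
  linarith

lemma gam_symm (h : IsFacet τ σ) (h' : IsFacet τ' σ) (hne : τ' ≠ τ)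
    (hρ : IsFacet ρ τ) (hρ' : IsFacet ρ τ') : hl σ τ' (nv τ ρ) = hl σ τ (nv τ' ρ) := by
  have h1 := gam_pos h h' hne hρ hρ'
  have h2 := gam_pos h' h hne.symm hρ' hρ
  have h3 := gam_sq h h' hne hρ hρ'
  have h4 := gam_sq h' h hne.symm hρ' hρ
  rw [Bf_comm] at h4
  rw [← h4] at h3
  exact (pow_left_inj₀ h1.le h2.le two_ne_zero).1 h3

/-- The basic relation in the diamond -/
lemma diamond (h : IsFacet τ σ) (h' : IsFacet τ' σ) (hne : τ' ≠ τ)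
    (hρ : IsFacet ρ τ) (hρ' : IsFacet ρ τ') : ∃ γ : ℝ, 0 < γ ∧ (∀ x ∈ τ.spanC, hl σ τ' x = γ * hl τ ρ x) ∧
    (∀ x ∈ τ'.spanC, hl σ τ x = γ * hl τ' ρ x) := by
  refine ⟨hl σ τ' (nv τ ρ), gam_pos h h' hne hρ hρ', fun x hx => ?_, fun x hx => ?_⟩
  · exact form_eq_smul_hl hρ _ (fun y hy => hl_zero h' (hρ'.1.span_le hy)) hx
  · rw [gam_symm h h' hne hρ hρ']
    exact form_eq_smul_hl hρ' _ (fun y hy => hl_zero h (hρ.1.span_le hy)) hx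

lemma other_unique (h : IsFacet τ σ) (h' : IsFacet τ' σ) (hne : τ' ≠ τ)
    (hρ : IsFacet ρ τ) (hρ' : IsFacet ρ τ') {τ'' : Cone V} (h'' : IsFacet τ'' σ) (hρ'' : ρ.IsFaceOf τ'') :
    τ'' = τ ∨ τ'' = τ' := by
  by_contra hcon
  push Not at hcon
  have hF : IsFacet ρ τ'' := ⟨hρ'', by have := h''.2; have := h.2; have := hρ.2; omega⟩
  obtain ⟨γ, hγ, e1, -⟩ := diamond h h' hne hρ hρ'
  obtain ⟨δ, hδ, e2, -⟩ := diamond h h'' hcon.1 hρ hF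
  have h0 : ∀ x ∈ τ.spanC, (δ • hl σ τ' - γ • hl σ τ'') x = 0 := fun x hx => by
    simp [e1 x hx, e2 x hx]; ring
  obtain ⟨z, hz, hz0, hzp⟩ := exists_facet_pt h'
  obtain ⟨y, hy, hy0, hyp⟩ := exists_facet_pt h''
  have a1 := form_eq_smul_hl h _ h0 (σ.mem_span hz)
  have a2 := form_eq_smul_hl h _ h0 (σ.mem_span hy)
  have b1 := hzp τ'' h'' hcon.2
  have b2 := hzp τ h hne.symm
  have b3 := hyp τ' h' (Ne.symm hcon.2)
  have b4 := hyp τ h (Ne.symm hcon.1)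
  set α := (δ • hl σ τ' - γ • hl σ τ'') (nv σ τ)
  simp only [LinearMap.sub_apply, LinearMap.smul_apply, smul_eq_mul, hz0, hy0] at a1 a2
  have c1 := mul_pos hγ b1
  have c2 := mul_pos hδ b3
  rcases lt_trichotomy α 0 with hα | hα | hα
  · nlinarith [mul_pos (neg_pos.2 hα) b4]
  · rw [hα] at a1; nlinarith
  · nlinarith [mul_pos hα b2]

end

/-! ### line shellings -/

def kap (σ : Cone V) (l v : V) (τ : Cone V) : ℝ := hl σ τ v / hl σ τ l
def pt (σ : Cone V) (l v : V) (τ : Cone V) : V := v - kap σ l v τ • l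

section
variable {σ : Cone V} {l v : V}

lemma pt_mem (hIl : IsInt σ l) (hv : v ∈ σ.spanC) {τ : Cone V} (h : IsFacet τ σ) : pt σ l v τ ∈ τ.spanC := by
  rw [pt, ← hl_zero_iff h (Submodule.sub_mem _ hv (Submodule.smul_mem _ _ (σ.mem_span hIl.1)))]
  have := (hIl.2 τ h).ne'
  simp [kap, this]

lemma hl_pt (hIl : IsInt σ l) {τ τ' : Cone V} (h' : IsFacet τ' σ) :
    hl σ τ' (pt σ l v τ) = hl σ τ' l * (kap σ l v τ' - kap σ l v τ) := by
  have := (hIl.2 τ' h').ne'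
  have e : hl σ τ' l * kap σ l v τ' = hl σ τ' v := by rw [kap]; field_simp
  rw [pt, map_sub, map_smul, smul_eq_mul, mul_sub, e]; ring

lemma shell_a (hIl : IsInt σ l) (hv : v ∈ σ.spanC) {τ τ' ζ : Cone V} (h : IsFacet τ σ) (h' : IsFacet τ' σ) (hζ : ζ.IsFaceOf τ)
    (hζ' : ζ.IsFaceOf τ') (hk : kap σ l v τ' < kap σ l v τ) :
    ∃ ρ, IsFacet ρ τ ∧ ζ.IsFaceOf ρ ∧ hl τ ρ (pt σ l v τ) < 0 := by
  by_contra hcon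
  push Not at hcon
  obtain ⟨z, hz, hz2⟩ := ζ.exists_relint
  have hzτ := hζ.sub hz
  set p := pt σ l v τ with hp
  have hpos : ∀ ρ ∈ (facets τ).filter (fun ρ => ¬ ζ.IsFaceOf ρ), 0 < hl τ ρ z := by
    intro ρ hρ
    obtain ⟨h1, h2⟩ := Finset.mem_filter.1 hρ
    have hF := mem_facets.1 h1
    refine lt_of_le_of_ne (hl_nonneg hF hzτ) fun he => h2 (hζ.of_sub hF.1 fun x hx => ?_)
    rw [hF.mem_iff (hζ.sub hx)]
    exact hz2 _ (fun y hy => hl_nonneg hF (hζ.sub hy)) he.symm x (ζ.mem_span hx)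
  obtain ⟨ε, hε, hs⟩ := exists_small _ (fun ρ => hl τ ρ z) (fun ρ => hl τ ρ p) hpos
  have hm : z + ε • p ∈ τ.carrier := by
    rw [cone_iff τ (Submodule.add_mem _ (τ.mem_span hzτ)
      (Submodule.smul_mem _ _ (pt_mem hIl hv h)))]
    intro ρ hρ
    by_cases hc : ζ.IsFaceOf ρ
    · have := hcon ρ hρ hc
      have := hl_nonneg hρ hzτ
      simp only [map_add, map_smul, smul_eq_mul]
      positivity
    · simpa using (hs ε (abs_of_pos hε).le ρ (by simp [hρ, hc])).le
  have h3 := hl_nonneg h' (h.1.sub hm)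
  rw [map_add, map_smul, hl_pt hIl h', hl_zero h' (τ'.mem_span (hζ'.sub hz)), zero_add,
    smul_eq_mul] at h3
  have h4 := mul_pos hε (mul_pos (hIl.2 τ' h') (sub_pos.2 hk))
  nlinarith

lemma shell_b (hIl : IsInt σ l) {τ τ' ρ : Cone V} (h : IsFacet τ σ) (h' : IsFacet τ' σ) (hne : τ' ≠ τ)
    (hρ : IsFacet ρ τ) (hρ' : IsFacet ρ τ') (hneg : hl τ ρ (pt σ l v τ) < 0)
    (hv : v ∈ σ.spanC) : kap σ l v τ' < kap σ l v τ := by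
  obtain ⟨γ, hγ, e1, -⟩ := diamond h h' hne hρ hρ'
  have h1 := e1 _ (pt_mem hIl hv h)
  rw [hl_pt hIl h'] at h1
  have h2 := mul_neg_of_pos_of_neg hγ hneg
  rw [← h1] at h2
  have := neg_of_mul_neg_right h2 (hIl.2 τ' h').le
  linarith

end

lemma exists_generic (σ : Cone V) {v : V} (hv : v ∈ σ.spanC) : ∃ l, IsInt σ l ∧
    ∀ τ τ', IsFacet τ σ → IsFacet τ' σ → hl σ τ v < 0 → hl σ τ' v < 0 →
      kap σ l v τ = kap σ l v τ' → τ = τ' := by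
  obtain ⟨l, hl1, hl2⟩ := exists_int σ
  let Q : Finset (Cone V × Cone V) := (facets σ ×ˢ facets σ).filter
    fun p => hl σ p.1 v < 0 ∧ hl σ p.2 v < 0 ∧ p.1 ≠ p.2
  let g : Cone V × Cone V → (V →ₗ[ℝ] ℝ) := fun p => (-hl σ p.2 v) • hl σ p.1 + hl σ p.1 v • hl σ p.2
  have hg : ∀ p ∈ Q, ∃ x ∈ σ.spanC, g p x ≠ 0 := by
    rintro ⟨τ, τ'⟩ hp
    simp only [Q, Finset.mem_filter, Finset.mem_product, mem_facets] at hp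
    by_contra hcon
    push Not at hcon
    refine hp.2.2.2 (facet_eq_of_form hp.1.1 hp.1.2 (neg_pos.2 hp.2.2.1) (neg_pos.2 hp.2.1)
      fun x hx => ?_)
    have := hcon x hx
    simp only [g, LinearMap.add_apply, LinearMap.smul_apply, smul_eq_mul] at this
    linarith
  -- a vector where no form of Q vanishes
  have hw : ∃ w ∈ σ.spanC, ∀ p ∈ Q, g p w ≠ 0 := by
    have gen : ∀ Q' : Finset (Cone V × Cone V), (∀ p ∈ Q', ∃ x ∈ σ.spanC, g p x ≠ 0) →
        ∃ w ∈ σ.spanC, ∀ p ∈ Q', g p w ≠ 0 := by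
      intro Q'
      induction Q' using Finset.induction_on with
      | empty => intro _; exact ⟨0, Submodule.zero_mem _, by simp⟩
      | insert a s ha ih =>
        intro h
        obtain ⟨w, hw, hw2⟩ := ih fun p hp => h p (by simp [hp])
        obtain ⟨x, hx, hx2⟩ := h a (by simp)
        -- w + t x
        have hbad : ((insert a s).image fun p => - g p w / g p x).finite_toSet.toFinset.Nonempty ∨ True :=
          Or.inr trivial
        obtain ⟨t, ht⟩ := Infinite.exists_notMem_finset
          ((insert a s).image fun p => - g p w / g p x)
        refine ⟨w + t • x, Submodule.add_mem _ hw (Submodule.smul_mem _ _ hx), fun p hp he => ?_⟩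
        simp only [map_add, map_smul, smul_eq_mul] at he
        by_cases h0 : g p x = 0
        · rw [h0, mul_zero, add_zero] at he
          rcases Finset.mem_insert.1 hp with rfl | hp
          · exact hx2 h0
          · exact hw2 p hp he
        · apply ht
          refine Finset.mem_image.2 ⟨p, hp, ?_⟩
          field_simp; linarith
    exact gen Q hg
  obtain ⟨w, hw, hw2⟩ := hw
  obtain ⟨ε, hε, hs⟩ := exists_small (facets σ) (fun τ => hl σ τ l) (fun τ => hl σ τ w)
    fun τ hτ => hl2 τ (mem_facets.1 hτ)
  obtain ⟨t, ht, ht2⟩ := (Set.Ioo_infinite hε).exists_notMem_finset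
    (Q.image fun p => - g p l / g p w)
  have hspan : l + t • w ∈ σ.spanC :=
    Submodule.add_mem _ (σ.mem_span hl1) (Submodule.smul_mem _ _ hw)
  have hpos : ∀ τ, IsFacet τ σ → 0 < hl σ τ (l + t • w) := fun τ hτ => by
    simpa using hs t (by rw [abs_of_pos ht.1]; exact ht.2.le) τ (mem_facets.2 hτ)
  refine ⟨l + t • w, ⟨(cone_iff σ hspan).2 fun τ hτ => (hpos τ hτ).le, hpos⟩, ?_⟩
  intro τ τ' h h' hn hn' he
  by_contra hne
  have hQ : (τ, τ') ∈ Q := by simp [Q, h, h', hn, hn', hne]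
  apply ht2
  refine Finset.mem_image.2 ⟨_, hQ, ?_⟩
  have h0 := hw2 _ hQ
  have h1 : g (τ, τ') (l + t • w) = 0 := by
    rw [kap, kap, div_eq_div_iff (hpos τ h).ne' (hpos τ' h').ne'] at he
    simp only [g, LinearMap.add_apply, LinearMap.smul_apply, smul_eq_mul]
    linarith
  simp only [map_add, map_smul, smul_eq_mul] at h1
  field_simp; linarith

end Facets

/-! ### Gradings -/

section grading
variable {M : Type} [AddCommGroup M] [Module ℝ M]

def Gr (d : ℤ → Submodule ℝ M) : Prop :=
  ∃ p : ℤ → M →ₗ[ℝ] M, (∀ q x, p q x ∈ d q) ∧ (∀ q, ∀ x ∈ d q, p q x = x) ∧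
    (∀ q q', q ≠ q' → ∀ x ∈ d q', p q x = 0) ∧ ∀ x, ∃ s : Finset ℤ, x = ∑ q ∈ s, p q x

def pr (d : ℤ → Submodule ℝ M) (q : ℤ) : M →ₗ[ℝ] M :=
  if h : Gr d then h.choose q else 0

variable {d : ℤ → Submodule ℝ M}

lemma pr_spec (h : Gr d) : (∀ q x, pr d q x ∈ d q) ∧ (∀ q, ∀ x ∈ d q, pr d q x = x) ∧
    (∀ q q', q ≠ q' → ∀ x ∈ d q', pr d q x = 0) ∧ ∀ x, ∃ s : Finset ℤ, x = ∑ q ∈ s, pr d q x := by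
  have := h.choose_spec
  simp only [pr, dif_pos h]
  exact this

lemma pr_mem (h : Gr d) (q : ℤ) (x : M) : pr d q x ∈ d q := (pr_spec h).1 q x
lemma pr_of_mem (h : Gr d) {q : ℤ} {x : M} (hx : x ∈ d q) : pr d q x = x := (pr_spec h).2.1 q x hx
lemma pr_of_ne (h : Gr d) {q q' : ℤ} {x : M} (hx : x ∈ d q') (hne : q ≠ q') : pr d q x = 0 :=
  (pr_spec h).2.2.1 q q' hne x hx
lemma pr_ite (h : Gr d) {q' : ℤ} {x : M} (hx : x ∈ d q') (q : ℤ) :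
    pr d q x = if q = q' then x else 0 := by
  split_ifs with e
  · subst e; exact pr_of_mem h hx
  · exact pr_of_ne h hx e
lemma pr_sum (h : Gr d) (x : M) : ∃ s : Finset ℤ, ∀ t, s ⊆ t → x = ∑ q ∈ t, pr d q x := by
  obtain ⟨s, hs⟩ := (pr_spec h).2.2.2 x
  refine ⟨s, fun t ht => ?_⟩
  rw [← Finset.sum_subset ht, ← hs]
  intro q _ hq
  rw [hs, map_sum]
  refine Finset.sum_eq_zero fun q' hq' => pr_of_ne h (pr_mem h q' x) ?_
  rintro rfl; exact hq hq'

lemma gr_ext (h : Gr d) {x y : M} (hxy : ∀ q, pr d q x = pr d q y) : x = y := by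
  obtain ⟨s, hs⟩ := pr_sum h x
  obtain ⟨t, ht⟩ := pr_sum h y
  rw [hs (s ∪ t) Finset.subset_union_left, ht (s ∪ t) Finset.subset_union_right]
  exact Finset.sum_congr rfl fun q _ => hxy q

lemma gr_ind (h : Gr d) {P : M → Prop} (h0 : P 0) (ha : ∀ x y, P x → P y → P (x + y))
    (hd : ∀ q, ∀ x ∈ d q, P x) (x : M) : P x := by
  obtain ⟨s, hs⟩ := pr_sum h x
  rw [hs s subset_rfl]
  exact Finset.sum_induction _ P ha h0 fun q _ => hd q _ (pr_mem h q x)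

lemma gr_mem (h : Gr d) {q : ℤ} {x : M} (hx : ∀ q', q' ≠ q → pr d q' x = 0) : x ∈ d q := by
  have : x = pr d q x := gr_ext h fun q' => by
    rw [pr_ite h (pr_mem h q x)]
    split_ifs with e
    · subst e; rfl
    · exact hx q' e
  rw [this]; exact pr_mem h q x

lemma Gr.of_internal (h : DirectSum.IsInternal d) : Gr d := by
  let e := LinearEquiv.ofBijective (DirectSum.coeLinearMap d) h
  have hof : ∀ q (x : d q), e.symm (x : M) = DirectSum.lof ℝ ℤ (fun q => d q) q x := fun q x => by
    rw [LinearEquiv.symm_apply_eq]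
    exact (DirectSum.coeLinearMap_lof d q x).symm
  refine ⟨fun q => (d q).subtype ∘ₗ DirectSum.component ℝ ℤ (fun q => d q) q ∘ₗ e.symm.toLinearMap,
    fun q x => by simp, fun q x hx => ?_, fun q q' hne x hx => ?_, fun x => ?_⟩
  · have := hof q ⟨x, hx⟩
    simp only at this
    simp [this]
  · have := hof q' ⟨x, hx⟩
    simp only at this
    simp [this, DirectSum.component.of, hne.symm]
  · refine ⟨DFinsupp.support (e.symm x), ?_⟩
    conv_lhs => rw [← e.apply_symm_apply x]
    exact DirectSum.coeLinearMap_eq_dfinsuppSum d (e.symm x)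

lemma Gr.mk' (ex : ∀ x, ∃ (s : Finset ℤ) (y : ℤ → M), (∀ q, y q ∈ d q) ∧ x = ∑ q ∈ s, y q)
    (ind : ∀ (s : Finset ℤ) (y : ℤ → M), (∀ q, y q ∈ d q) → ∑ q ∈ s, y q = 0 → ∀ q ∈ s, y q = 0) :
    Gr d := by
  apply Gr.of_internal
  have e : ⇑(DirectSum.coeAddMonoidHom d) = DirectSum.coeLinearMap d := rfl
  constructor
  · rw [e, injective_iff_map_eq_zero]
    intro x hx
    rw [DirectSum.coeLinearMap_eq_dfinsuppSum] at hx
    have := ind (DFinsupp.support x) (fun q => (x q : M)) (fun q => (x q).2) hx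
    refine DFinsupp.ext fun q => ?_
    by_cases hq : q ∈ DFinsupp.support x
    · exact Subtype.ext (this q hq)
    · simpa using hq
  · intro x
    obtain ⟨s, y, hy, rfl⟩ := ex x
    refine ⟨∑ q ∈ s, DirectSum.of (fun q => d q) q ⟨y q, hy q⟩, ?_⟩
    rw [map_sum]
    exact Finset.sum_congr rfl fun q _ => by simp

variable {N : Type} [AddCommGroup N] [Module ℝ N]

lemma Gr.map (h : Gr d) (f : M →ₗ[ℝ] N) (hf : Surjective f)
    (hk : ∀ x, f x = 0 → ∀ q, f (pr d q x) = 0) : Gr (fun q => (d q).map f) := by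
  apply Gr.mk'
  · intro x
    obtain ⟨x, rfl⟩ := hf x
    obtain ⟨s, hs⟩ := pr_sum h x
    refine ⟨s, fun q => f (pr d q x), fun q => ⟨_, pr_mem h q x, rfl⟩, ?_⟩
    rw [← map_sum, ← hs s subset_rfl]
  · intro s y hy h0 q hq
    choose x hx hxy using hy
    have : f (∑ q ∈ s, x q) = 0 := by rw [map_sum, ← h0]; exact Finset.sum_congr rfl fun q _ => hxy q
    have := hk _ this q
    rw [map_sum, Finset.sum_eq_single q, pr_of_mem h (hx q), hxy] at this
    · exact this
    · intro q' _ hne; exact pr_of_ne h (hx q') hne.symm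
    · intro h; exact absurd hq h

lemma Gr.comap (h : Gr d) (f : N →ₗ[ℝ] M) (hf : Injective f)
    (hk : ∀ x q, ∃ y, f y = pr d q (f x)) : Gr (fun q => (d q).comap f) := by
  apply Gr.mk'
  · intro x
    choose y hy using hk x
    obtain ⟨s, hs⟩ := pr_sum h (f x)
    refine ⟨s, y, fun q => ?_, hf ?_⟩
    · show f (y q) ∈ d q
      rw [hy]; exact pr_mem h _ _
    · rw [map_sum, hs s subset_rfl]; exact Finset.sum_congr rfl fun q _ => (hy q).symm
  · intro s y hy h0 q hq
    apply hf
    have h1 : ∑ q ∈ s, f (y q) = 0 := by rw [← map_sum, h0, map_zero]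
    have := congrArg (pr d q) h1
    rw [map_sum, Finset.sum_eq_single q, pr_of_mem h (hy q), map_zero] at this
    · rw [this, map_zero]
    · intro q' _ hne; exact pr_of_ne h (hy q') hne.symm
    · intro h; exact absurd hq h

lemma pr_comm {d' : ℤ → Submodule ℝ N} (h : Gr d) (h' : Gr d') (f : M →+ N) (e : ℤ)
    (hf : ∀ q, ∀ x ∈ d q, f x ∈ d' (q + e)) (q : ℤ) (x : M) :
    pr d' (q + e) (f x) = f (pr d q x) := by
  revert x
  refine gr_ind h ?_ ?_ ?_
  · simp
  · intro x y hx hy; simp only [map_add, hx, hy]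
  · intro q' x hx
    rw [pr_ite h hx, pr_ite h' (hf q' x hx)]
    by_cases e' : q = q'
    · simp [e']
    · simp [e']

lemma pr_comm0 {d' : ℤ → Submodule ℝ N} (h : Gr d) (h' : Gr d') (f : M →+ N)
    (hf : ∀ q, ∀ x ∈ d q, f x ∈ d' q) (q : ℤ) (x : M) :
    pr d' q (f x) = f (pr d q x) := by
  have := pr_comm h h' f 0 (by simpa using hf) q x
  simpa using this

end grading

lemma Gr.pi {ι : Type} [Finite ι] {M : ι → Type} [∀ i, AddCommGroup (M i)] [∀ i, Module ℝ (M i)]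
    {d : ∀ i, ℤ → Submodule ℝ (M i)} (h : ∀ i, Gr (d i)) :
    Gr (fun q => Submodule.pi Set.univ (fun i => d i q)) := by
  haveI := Fintype.ofFinite ι
  refine ⟨fun q => LinearMap.pi fun i => pr (d i) q ∘ₗ LinearMap.proj i, ?_, ?_, ?_, ?_⟩
  · intro q x i _; exact pr_mem (h i) _ _
  · intro q x hx; funext i; exact pr_of_mem (h i) (hx i trivial)
  · intro q q' hne x hx; funext i; exact pr_of_ne (h i) (hx i trivial) hne
  · intro x
    choose s hs using fun i => pr_sum (h i) (x i)
    refine ⟨Finset.univ.biUnion s, ?_⟩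
    funext i
    rw [Finset.sum_apply]
    exact hs i _ (Finset.subset_biUnion_of_mem s (Finset.mem_univ i))

section
variable {V : Type} [AddCommGroup V] [Module ℝ V]

lemma Adeg_two (k : ℕ) : Adeg V (2 * k) = AdegN V k := by
  apply le_antisymm
  · refine iSup₂_le fun j hj => ?_
    have : k = j := by omega
    rw [this]
  · exact le_iSup₂_of_le k rfl le_rfl

lemma Adeg_bot {q : ℤ} (h : ∀ k : ℕ, q ≠ 2 * k) : Adeg V q = ⊥ := by
  rw [eq_bot_iff]
  exact iSup₂_le fun j hj => absurd hj (h j)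

lemma mem_AdegN {k : ℕ} {a : PolyRing V} : a ∈ AdegN V k ↔ ∀ (t : ℝ) x, a.1 (t • x) = t ^ k * a.1 x :=
  Iff.rfl

lemma Adeg_cases (q : ℤ) : (∃ k : ℕ, q = 2 * k) ∨ Adeg V q = ⊥ := by
  by_cases h : ∃ k : ℕ, q = 2 * k
  · exact Or.inl h
  · push Not at h; exact Or.inr (Adeg_bot h)

lemma mem_Adeg {q : ℤ} {a : PolyRing V} :
    a ∈ Adeg V q ↔ a = 0 ∨ ∃ k : ℕ, q = 2 * k ∧ a ∈ AdegN V k := by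
  rcases Adeg_cases (V := V) q with ⟨k, rfl⟩ | h
  · rw [Adeg_two]
    constructor
    · intro h; exact Or.inr ⟨k, rfl, h⟩
    · rintro (rfl | ⟨j, hj, h⟩)
      · exact zero_mem _
      · have : k = j := by omega
        rw [this]; exact h
  · by_cases h' : ∃ k : ℕ, q = 2 * k
    · obtain ⟨k, rfl⟩ := h'
      rw [Adeg_two]
      constructor
      · intro h; exact Or.inr ⟨k, rfl, h⟩
      · rintro (rfl | ⟨j, hj, h⟩)
        · exact zero_mem _
        · have : k = j := by omega
          rw [this]; exact h
    · rw [h, Submodule.mem_bot]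
      constructor
      · exact Or.inl
      · rintro (h | ⟨k, hk, -⟩)
        · exact h
        · exact absurd ⟨k, hk⟩ h'

lemma Adeg_mul {p q : ℤ} {a b : PolyRing V} (ha : a ∈ Adeg V p) (hb : b ∈ Adeg V q) :
    a * b ∈ Adeg V (p + q) := by
  rw [mem_Adeg] at *
  rcases ha with rfl | ⟨k, rfl, ha⟩
  · simp
  rcases hb with rfl | ⟨j, rfl, hb⟩
  · simp
  refine Or.inr ⟨k + j, by push_cast; ring, fun t x => ?_⟩
  rw [mem_AdegN] at ha hb
  rw [poly_mul, poly_mul, ha, hb]; ring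

lemma linP_deg (f : V →ₗ[ℝ] ℝ) : linP f ∈ Adeg V 2 :=
  mem_Adeg.2 (Or.inr ⟨1, by norm_num, fun t x => by simp⟩)

lemma algebraMap_deg (c : ℝ) : algebraMap ℝ (PolyRing V) c ∈ Adeg V 0 :=
  mem_Adeg.2 (Or.inr ⟨0, by norm_num, fun t x => by simp⟩)

lemma Adeg_zero_eq {a : PolyRing V} (h : a ∈ Adeg V 0) : a = algebraMap ℝ _ (a.1 0) := by
  rcases mem_Adeg.1 h with rfl | ⟨k, hk, h⟩
  · simp
  · have : k = 0 := by omega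
    subst this
    refine poly_ext fun x => ?_
    have := mem_AdegN.1 h 0 x
    rw [zero_smul, pow_zero, one_mul] at this
    rw [poly_algebraMap]; exact this.symm

lemma Adeg_pos {q : ℤ} {a : PolyRing V} (h : a ∈ Adeg V q) (hq : q ≠ 0) : a.1 0 = 0 := by
  rcases mem_Adeg.1 h with rfl | ⟨k, rfl, h'⟩
  · simp
  · have := mem_AdegN.1 h' 0 (0 : V)
    rwa [zero_smul, zero_pow (by rintro rfl; simp at hq), zero_mul] at this

lemma Adeg_neg {q : ℤ} {a : PolyRing V} (h : a ∈ Adeg V q) (hq : q < 0) : a = 0 := by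
  rcases mem_Adeg.1 h with rfl | ⟨k, rfl, h⟩
  · rfl
  · omega

lemma gr_A : Gr (Adeg V) := by
  apply Gr.mk'
  · intro a
    let N : Submodule ℝ (PolyRing V) := ⨆ q, Adeg V q
    have key : ∀ a : PolyRing V, ∃ f : ℤ →₀ PolyRing V, (∀ q, f q ∈ Adeg V q) ∧ a = f.sum fun _ x => x := by
      intro a
      have hN : a ∈ ⨆ q, Adeg V q := by
        induction a using poly_ind with
        | hc c => exact Submodule.mem_iSup_of_mem 0 (algebraMap_deg c)
        | hl f => exact Submodule.mem_iSup_of_mem 2 (linP_deg f)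
        | ha a b ha hb => exact add_mem ha hb
        | hm a b ha hb =>
          refine Submodule.iSup_induction (motive := fun a => a * b ∈ ⨆ q, Adeg V q) _ ha ?_ ?_ ?_
          · intro p a ha
            refine Submodule.iSup_induction (motive := fun b => a * b ∈ ⨆ q, Adeg V q) _ hb ?_ ?_ ?_
            · intro q b hb; exact Submodule.mem_iSup_of_mem _ (Adeg_mul ha hb)
            · simp
            · intro x y hx hy; rw [mul_add]; exact add_mem hx hy
          · simp
          · intro x y hx hy; rw [add_mul]; exact add_mem hx hy
      obtain ⟨f, hf, hs⟩ := (Submodule.mem_iSup_iff_exists_finsupp _ _).1 hN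
      exact ⟨f, hf, hs.symm⟩
    obtain ⟨f, hf, hs⟩ := key a
    exact ⟨f.support, f, hf, hs⟩
  · intro s y hy h0 q hq
    rcases mem_Adeg.1 (hy q) with h | ⟨k, rfl, hk⟩
    · exact h
    refine poly_ext fun x => ?_
    let P : Polynomial ℝ := ∑ q ∈ s, Polynomial.C ((y q).1 x) * Polynomial.X ^ (q / 2).toNat
    have hP : P = 0 := by
      refine poly_zero_of_large 0 fun t _ => ?_
      have := congrArg (fun a : PolyRing V => a.1 (t • x)) h0
      simp only [poly_sum, poly_zero] at this
      rw [← this, Polynomial.eval_finset_sum]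
      refine Finset.sum_congr rfl fun q' _ => ?_
      rcases mem_Adeg.1 (hy q') with h | ⟨j, rfl, hj⟩
      · simp [h]
      · rw [mem_AdegN.1 hj t x]
        have : ((2 * (j : ℤ)) / 2).toNat = j := by omega
        rw [this, Polynomial.eval_mul, Polynomial.eval_C, Polynomial.eval_pow, Polynomial.eval_X]
        ring
    have := congrArg (fun p => p.coeff k) hP
    simp only [P, Polynomial.finset_sum_coeff, Polynomial.coeff_C_mul, Polynomial.coeff_X_pow,
      Polynomial.coeff_zero] at this
    rw [Finset.sum_eq_single (2 * (k : ℤ))] at this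
    · simpa using this
    · intro q' _ hne
      rcases mem_Adeg.1 (hy q') with h | ⟨j, rfl, hj⟩
      · simp [h]
      · have : k ≠ j := by rintro rfl; exact hne rfl
        simp [this]
    · intro h; exact absurd hq h

lemma pr_A_zero (a : PolyRing V) : pr (Adeg V) 0 a = algebraMap ℝ _ (a.1 0) := by
  revert a
  refine gr_ind gr_A ?_ ?_ ?_
  · simp
  · intro x y hx hy; simp [hx, hy]
  · intro q x hx
    rw [pr_ite gr_A hx]
    split_ifs with e
    · subst e; exact Adeg_zero_eq hx
    · rw [Adeg_pos hx (Ne.symm e)]; simp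

/-- graded modules -/
structure GrM (V : Type) [AddCommGroup V] [Module ℝ V] {M : Type} [AddCommGroup M] [Module ℝ M]
    [Module (PolyRing V) M] (d : ℤ → Submodule ℝ M) : Prop where
  gr : Gr d
  smul : ∀ (p q : ℤ), ∀ a ∈ Adeg V p, ∀ x ∈ d q, a • x ∈ d (p + q)

lemma grM_A : GrM V (Adeg V) := ⟨gr_A, fun p q a ha x hx => Adeg_mul ha hx⟩

variable {M : Type} [AddCommGroup M] [Module ℝ M] [Module (PolyRing V) M]
  {d : ℤ → Submodule ℝ M}

lemma pr_smul_left (h : GrM V d) (a : PolyRing V) {q : ℤ} {x : M} (hx : x ∈ d q) (e : ℤ) :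
    pr d e (a • x) = pr (Adeg V) (e - q) a • x := by
  revert a
  refine gr_ind gr_A ?_ ?_ ?_
  · simp
  · intro a b ha hb; simp only [add_smul, map_add, ha, hb]
  · intro p a ha
    rw [pr_ite h.gr (h.smul p q a ha x hx), pr_ite gr_A ha]
    by_cases e' : e = p + q
    · simp [e']
    · rw [if_neg e', if_neg (by omega), zero_smul]

lemma pr_smul_right (h : GrM V d) {p : ℤ} {a : PolyRing V} (ha : a ∈ Adeg V p) (x : M) (e : ℤ) :
    pr d e (a • x) = a • pr d (e - p) x := by
  revert x
  refine gr_ind h.gr ?_ ?_ ?_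
  · simp
  · intro x y hx hy; simp only [smul_add, map_add, hx, hy]
  · intro q x hx
    rw [pr_ite h.gr (h.smul p q a ha x hx), pr_ite h.gr hx]
    by_cases e' : e = p + q
    · simp [e']
    · rw [if_neg e', if_neg (by omega), smul_zero]

/-- graded submodule -/
def GrSub (d : ℤ → Submodule ℝ M) (N : Submodule (PolyRing V) M) : Prop :=
  ∀ x ∈ N, ∀ q, pr d q x ∈ N

variable [IsScalarTower ℝ (PolyRing V) M]

/-- induced grading -/
def subD (d : ℤ → Submodule ℝ M) (N : Submodule (PolyRing V) M) (q : ℤ) : Submodule ℝ N :=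
  (d q).comap (N.subtype.restrictScalars ℝ)

lemma mem_subD {N : Submodule (PolyRing V) M} {q : ℤ} {x : N} : x ∈ subD d N q ↔ x.1 ∈ d q := Iff.rfl

lemma GrM.sub (h : GrM V d) {N : Submodule (PolyRing V) M} (hN : GrSub d N) : GrM V (subD d N) :=
  ⟨h.gr.comap _ N.injective_subtype fun x q => ⟨⟨_, hN x.1 x.2 q⟩, rfl⟩,
    fun p q a ha x hx => h.smul p q a ha x.1 hx⟩

lemma pr_subD (h : GrM V d) {N : Submodule (PolyRing V) M} (hN : GrSub d N) (q : ℤ) (x : N) :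
    (pr (subD d N) q x).1 = pr d q x.1 :=
  (pr_comm0 (h.sub hN).gr h.gr N.subtype.toAddMonoidHom (fun q x hx => hx) q x).symm

lemma mSub_gr (h : GrM V d) : GrSub d (mSub V M) := by
  intro x hx
  rw [mSub] at hx
  refine Submodule.smul_induction_on hx ?_ ?_
  · intro a ha x0 _ q
    suffices H : ∀ x : M, pr d q (a • x) ∈ mSub V M from H x0
    refine gr_ind h.gr ?_ ?_ ?_
    · simp
    · intro x y hx hy; rw [smul_add, map_add]; exact add_mem hx hy
    · intro e x hx
      rw [pr_smul_left h a hx]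
      refine Submodule.smul_mem_smul ?_ trivial
      by_cases e' : q - e = 0
      · rw [e', pr_A_zero, mem_mId.1 ha]; simp
      · exact mem_mId.2 (Adeg_pos (pr_mem gr_A _ _) e')
  · intro x y hx hy q; rw [map_add]; exact add_mem (hx q) (hy q)

/-- graded Nakayama -/
lemma gr_nak (h : GrM V d) [Module.Finite (PolyRing V) M] {N : Submodule (PolyRing V) M}
    (hN : GrSub d N) (hs : ∀ x, ∃ y ∈ N, x - y ∈ mSub V M) (x : M) : x ∈ N := by
  obtain ⟨r, hr, hle⟩ := Submodule.exists_sub_one_mem_and_smul_le_of_fg_of_le_sup (I := mId V)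
    (N := N) (N' := (⊤ : Submodule (PolyRing V) M)) (P := ⊤) Module.Finite.fg_top le_top
    (fun x _ => by
      obtain ⟨y, hy, hxy⟩ := hs x
      exact Submodule.mem_sup.2 ⟨y, hy, x - y, hxy, by abel⟩)
  revert x
  refine gr_ind h.gr ?_ ?_ ?_
  · exact zero_mem _
  · intro x y hx hy; exact add_mem hx hy
  · intro q x hx
    have h1 : r • x ∈ N := hle (Submodule.smul_mem_pointwise_smul _ _ _ trivial)
    have h2 := hN _ h1 q
    rw [pr_smul_left h r hx, sub_self, pr_A_zero] at h2
    have : r.1 0 = 1 := by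
      have := mem_mId.1 hr; simp at this; linarith
    rw [this, map_one, one_smul] at h2
    exact h2

end

/-! ### Algebra: freeness -/

section alg

lemma L2abs {R M : Type} [CommRing R] [IsDomain R] [AddCommGroup M] [Module R M]
    [Module.Projective R M] (m : Ideal R) (hm : m ≠ ⊤) {n : ℕ} (b : Fin n → M)
    (hspan : ∀ x, ∃ c : Fin n → R, x = ∑ i, c i • b i)
    (hrel : ∀ c : Fin n → R, ∑ i, c i • b i = 0 → ∀ i, c i ∈ m) :
    ∀ c : Fin n → R, ∑ i, c i • b i = 0 → c = 0 := by
  let p := Fintype.linearCombination R b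
  have hp : ∀ c, p c = ∑ i, c i • b i := fun c => Fintype.linearCombination_apply R b c
  have hsurj : Surjective p := fun x => by
    obtain ⟨c, hc⟩ := hspan x; exact ⟨c, by rw [hp, hc]⟩
  obtain ⟨s, hs⟩ := Module.projective_lifting_property p LinearMap.id hsurj
  have hs' : ∀ x, p (s x) = x := fun x => LinearMap.congr_fun hs x
  have hX : LinearMap.ker p = LinearMap.range (LinearMap.id - s ∘ₗ p) := by
    ext ξ; constructor
    · intro h; exact ⟨ξ, by simp [LinearMap.mem_ker.1 h]⟩
    · rintro ⟨η, rfl⟩; simp [hs']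
  have hfg : (LinearMap.ker p).FG := by
    rw [hX, LinearMap.range_eq_map]; exact Module.Finite.fg_top.map _
  have hle : LinearMap.ker p ≤ m • LinearMap.ker p := by
    intro ξ hξ
    have h1 : ξ = ∑ j, ξ j • ((LinearMap.id - s ∘ₗ p : (Fin n → R) →ₗ[R] _) (Pi.single j 1)) := by
      have h0 : (LinearMap.id - s ∘ₗ p : (Fin n → R) →ₗ[R] _) ξ = ξ := by
        simp [LinearMap.mem_ker.1 hξ]
      conv_lhs => rw [← h0, pi_eq_sum_univ' ξ]
      rw [map_sum]
      refine Finset.sum_congr rfl fun j _ => ?_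
      rw [map_smul]
    rw [h1]
    refine Submodule.sum_mem _ fun j _ => Submodule.smul_mem_smul ?_ ?_
    · exact hrel ξ (by rw [← hp]; exact hξ) j
    · rw [hX]; exact ⟨_, rfl⟩
  obtain ⟨r, hr, hr0⟩ := Submodule.exists_sub_one_mem_and_smul_eq_zero_of_fg_of_le_smul m _ hfg hle
  intro c hc
  have hrne : r ≠ 0 := by
    rintro rfl
    apply hm
    rw [Ideal.eq_top_iff_one]
    have := m.neg_mem hr
    simpa using this
  have := hr0 c (by rw [LinearMap.mem_ker, hp, hc])
  exact (smul_eq_zero.1 this).resolve_left hrne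

open Polynomial in
lemma L3aux {R M : Type} [CommRing R] [AddCommGroup M] [Module R[X] M] {r : ℕ} (y : Fin r → M)
    (hspan : ∀ x, ∃ c : Fin r → R, x = ∑ i, (C (c i) : R[X]) • y i)
    (hind : ∀ c : Fin r → R, ∑ i, (C (c i) : R[X]) • y i = 0 → c = 0) :
    Module.Projective R[X] (LinearMap.ker (Fintype.linearCombination R[X] y)) := by
  choose t ht using fun j => hspan ((X : R[X]) • y j)
  let ε := Fintype.linearCombination R[X] y
  have hε : ∀ c, ε c = ∑ i, c i • y i := fun c => Fintype.linearCombination_apply _ y c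
  let w : Fin r → (Fin r → R[X]) := fun j i => (if i = j then X else 0) - C (t j i)
  let χ := Fintype.linearCombination R[X] w
  have hχ : ∀ v i, χ v i = X * v i - ∑ j, C (t j i) * v j := fun v i => by
    rw [show χ v = _ from Fintype.linearCombination_apply _ w v]
    simp [w, mul_sub, mul_comm]
  have hinj : Injective χ := by
    rw [injective_iff_map_eq_zero]
    intro v hv
    have h1 : ∀ i n, (v i).coeff n = ∑ j, t j i * (v j).coeff (n + 1) := fun i n => by
      have := congrArg (fun p => p.coeff (n + 1)) ((hχ v i).symm.trans (congrFun hv i))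
      simp only [coeff_sub, coeff_X_mul, finset_sum_coeff, coeff_C_mul, Pi.zero_apply,
        coeff_zero] at this
      exact sub_eq_zero.1 this
    let N := ∑ i, ((v i).natDegree + 1)
    have h2 : ∀ k n, N ≤ n + k → ∀ i, (v i).coeff n = 0 := by
      intro k
      induction k with
      | zero =>
        intro n hn i
        apply coeff_eq_zero_of_natDegree_lt
        have := Finset.single_le_sum (f := fun i => (v i).natDegree + 1) (fun _ _ => Nat.zero_le _)
          (Finset.mem_univ i)
        simp only [N] at hn this
        omega
      | succ k ih =>
        intro n hn i
        rw [h1]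
        exact Finset.sum_eq_zero fun j _ => by rw [ih (n + 1) (by omega) j, mul_zero]
    funext i
    ext n
    simpa using h2 N n (by omega) i
  have hεχ : ∀ v, ε (χ v) = 0 := by
    intro v
    rw [hε]
    simp only [hχ, sub_smul, Finset.sum_sub_distrib, Finset.sum_smul]
    rw [Finset.sum_comm, sub_eq_zero]
    refine Finset.sum_congr rfl fun j _ => ?_
    rw [mul_comm, mul_smul, ht, Finset.smul_sum]
    refine Finset.sum_congr rfl fun i _ => ?_
    rw [smul_smul, mul_comm]
  have hQ : ∀ g : Fin r → R[X], ∃ v, ∃ c : Fin r → R, g = χ v + fun i => C (c i) := by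
    let Q : Set (Fin r → R[X]) := {g | ∃ v, ∃ c : Fin r → R, g = χ v + fun i => C (c i)}
    have h0 : (0 : Fin r → R[X]) ∈ Q := ⟨0, 0, by funext i; simp⟩
    have ha : ∀ g ∈ Q, ∀ g' ∈ Q, g + g' ∈ Q := by
      rintro g ⟨v, c, rfl⟩ g' ⟨v', c', rfl⟩
      exact ⟨v + v', c + c', by funext i; simp; ring⟩
    have hX : ∀ g ∈ Q, (X : R[X]) • g ∈ Q := by
      rintro g ⟨v, c, rfl⟩
      refine ⟨(X : R[X]) • v + (fun i => C (c i)), fun i => ∑ j, t j i * c j, ?_⟩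
      funext i
      rw [map_add, map_smul]
      simp only [Pi.smul_apply, Pi.add_apply, hχ, smul_eq_mul, map_sum, map_mul]
      ring
    have hm : ∀ n (a : R) j, (monomial n a : R[X]) • (Pi.single j 1 : Fin r → R[X]) ∈ Q := by
      intro n a j
      induction n with
      | zero => exact ⟨0, Pi.single j a, by
          funext i; by_cases h : i = j
          · subst h; simp
          · simp [h]⟩
      | succ n ih =>
        have := hX _ ih
        rwa [smul_smul, X_mul_monomial] at this
    intro g
    rw [pi_eq_sum_univ' g]
    refine Finset.sum_induction _ (fun g => g ∈ Q) (fun a b h1 h2 => ha a h1 b h2) h0 fun j _ => ?_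
    generalize g j = p
    induction p using Polynomial.induction_on' with
    | add p q hp hq => rw [add_smul]; exact ha _ hp _ hq
    | monomial n a => exact hm n a j
  have hker : LinearMap.ker ε = LinearMap.range χ := by
    ext g; constructor
    · intro hg
      obtain ⟨v, c, rfl⟩ := hQ g
      have h1 := LinearMap.mem_ker.1 hg
      rw [map_add, hεχ, zero_add, hε] at h1
      have := hind c h1
      subst this
      exact ⟨v, by funext i; simp⟩
    · rintro ⟨v, rfl⟩; exact hεχ v
  show Module.Projective R[X] (LinearMap.ker ε)
  rw [hker]
  exact Module.Projective.of_equiv (LinearEquiv.ofInjective χ hinj)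

open Polynomial in
/-- Schanuel type lemma -/
lemma L3 {R F M : Type} [CommRing R] [AddCommGroup F] [Module R[X] F] [Module.Projective R[X] F]
    [AddCommGroup M] [Module R[X] M] (la : F →ₗ[R[X]] M) (hla : Surjective la)
    {r : ℕ} (y : Fin r → M)
    (hspan : ∀ x, ∃ c : Fin r → R, x = ∑ i, (C (c i) : R[X]) • y i)
    (hind : ∀ c : Fin r → R, ∑ i, (C (c i) : R[X]) • y i = 0 → c = 0) :
    Module.Projective R[X] (LinearMap.ker la) := by
  let ε := Fintype.linearCombination R[X] y
  have hε : ∀ c, ε c = ∑ i, c i • y i := fun c => Fintype.linearCombination_apply _ y c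
  haveI : Module.Projective R[X] (LinearMap.ker ε) := L3aux y hspan hind
  have hεs : Surjective ε := fun x => by
    obtain ⟨c, hc⟩ := hspan x; exact ⟨fun i => C (c i), by rw [hε, hc]⟩
  obtain ⟨h, hh⟩ := Module.projective_lifting_property ε la hεs
  obtain ⟨g, hg⟩ := Module.projective_lifting_property la ε hla
  have hh' : ∀ x, ε (h x) = la x := fun x => LinearMap.congr_fun hh x
  have hg' : ∀ x, la (g x) = ε x := fun x => LinearMap.congr_fun hg x
  let i : LinearMap.ker la →ₗ[R[X]] F × LinearMap.ker ε :=
    LinearMap.prod (LinearMap.ker la).subtype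
      (LinearMap.codRestrict _ (-(h ∘ₗ (LinearMap.ker la).subtype)) fun k => by
        simp [hh'])
  let s : F × LinearMap.ker ε →ₗ[R[X]] LinearMap.ker la :=
    LinearMap.codRestrict _ (LinearMap.fst _ _ _ - g ∘ₗ ((LinearMap.ker ε).subtype ∘ₗ
      LinearMap.snd _ _ _ + h ∘ₗ LinearMap.fst _ _ _)) fun k => by
        have := k.2.2
        rw [LinearMap.mem_ker] at this
        simp [hh', hg', this]
  refine Module.Projective.of_split i s ?_
  ext k
  have : ∀ z : LinearMap.ker ε, (z : Fin r → R[X]) = -h k →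
      (k : F) - g ((z : Fin r → R[X]) + h k) = k := fun z hz => by simp [hz]
  exact this ⟨-h k, by simp [hh']⟩ rfl

open Polynomial in
lemma L4 {R F M : Type} [CommRing R] [AddCommGroup F] [Module R[X] F]
    [AddCommGroup M] [Module R[X] M] (la : F →ₗ[R[X]] M) {ι : Type} [Fintype ι] (b : ι → F)
    (hspan : ∀ x, ∃ c : ι → R[X], x = ∑ i, c i • b i)
    (hind : ∀ c : ι → R[X], ∑ i, c i • b i = 0 → c = 0)
    (φ : M →+ R) (hφ : ∀ r y, φ ((C r : R[X]) • y) = r * φ y) :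
    ∃ u : F →+ R[X], (∀ r y, u ((C r : R[X]) • y) = C r * u y) ∧
      ∀ y, u ((X : R[X]) • y) = X * u y + C (φ (la y)) := by
  have hw : ∀ z : M, ∃ w : R[X] →ₗ[R] R[X], ∀ p, w (X * p) = X * w p + C (φ (p • z)) := by
    intro z
    let f : ℕ → R →ₗ[R] R[X] := fun n => LinearMap.toSpanSingleton R R[X]
      (∑ i ∈ Finset.range n, X ^ (n - 1 - i) * C (φ ((X ^ i : R[X]) • z)))
    have hm : ∀ n a, Polynomial.lsum f (monomial n a) =
        C a * ∑ i ∈ Finset.range n, X ^ (n - 1 - i) * C (φ ((X ^ i : R[X]) • z)) := fun n a => by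
      rw [Polynomial.lsum_apply, Polynomial.sum_monomial_index]
      · simp [f, LinearMap.toSpanSingleton_apply, smul_eq_C_mul]
      · simp
    refine ⟨Polynomial.lsum f, fun p => ?_⟩
    induction p using Polynomial.induction_on' with
    | add p q hp hq => rw [mul_add, map_add, hp, hq, map_add, add_smul, map_add, map_add]; ring
    | monomial n a =>
      rw [X_mul_monomial, hm, hm, Finset.sum_range_succ]
      have h1 : (monomial n a : R[X]) • z = (C a : R[X]) • ((X ^ n : R[X]) • z) := by
        rw [smul_smul, C_mul_X_pow_eq_monomial]
      rw [h1, hφ, mul_add]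
      congr 1
      · rw [mul_left_comm]
        congr 1
        rw [Finset.mul_sum]
        refine Finset.sum_congr rfl fun i hi => ?_
        have := Finset.mem_range.1 hi
        rw [← mul_assoc, ← pow_succ']
        congr 2
        omega
      · simp
  choose w hw using fun i => hw (la (b i))
  choose c hc using hspan
  have huniq : ∀ c c' : ι → R[X], (∑ i, c i • b i : F) = ∑ i, c' i • b i → c = c' := fun c c' h => by
    have := hind (c - c') (by simp [sub_smul, Finset.sum_sub_distrib, h])
    exact sub_eq_zero.1 this
  have hadd : ∀ x y, c (x + y) = c x + c y := fun x y => huniq _ _ (by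
    rw [← hc]; simp only [Pi.add_apply, add_smul, Finset.sum_add_distrib, ← hc])
  have hsm : ∀ (p : R[X]) x, c (p • x) = p • c x := fun p x => huniq _ _ (by
    rw [← hc]; simp only [Pi.smul_apply, smul_assoc, ← Finset.smul_sum, ← hc])
  refine ⟨AddMonoidHom.mk' (fun x => ∑ i, w i (c x i)) fun x y => by
    simp [hadd, Finset.sum_add_distrib], fun r y => ?_, fun y => ?_⟩
  · simp only [AddMonoidHom.mk'_apply, hsm, Pi.smul_apply, smul_eq_mul, Finset.mul_sum]
    refine Finset.sum_congr rfl fun i _ => ?_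
    rw [← smul_eq_C_mul, map_smul, smul_eq_C_mul]
  · simp only [AddMonoidHom.mk'_apply, hsm, Pi.smul_apply, smul_eq_mul, hw,
      Finset.sum_add_distrib, Finset.mul_sum]
    congr 1
    conv_rhs => rw [hc y]
    simp only [map_sum, map_smul]

lemma prod_dvd_of {R ι : Type} [CommRing R] [IsDomain R] (s : Finset ι) (h : ι → R)
    (hp : ∀ i ∈ s, Prime (h i)) (w : R)
    (H : ∀ i ∈ s, ∃ g, ¬ h i ∣ g ∧ ∏ j ∈ s, h j ∣ g * w) : ∏ j ∈ s, h j ∣ w := by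
  induction s using Finset.induction_on generalizing w with
  | empty => simp
  | insert j s hj ih =>
    have h1 : ∏ i ∈ s, h i ∣ w := ih (fun i hi => hp i (Finset.mem_insert_of_mem hi)) w fun i hi => by
      obtain ⟨g, hg, hd⟩ := H i (Finset.mem_insert_of_mem hi)
      rw [Finset.prod_insert hj] at hd
      exact ⟨g, hg, (Dvd.intro_left _ rfl).trans hd⟩
    obtain ⟨w', rfl⟩ := h1
    obtain ⟨g, hg, hd⟩ := H j (Finset.mem_insert_self _ _)
    rw [Finset.prod_insert hj] at hd ⊢
    have hne : ∏ i ∈ s, h i ≠ 0 :=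
      Finset.prod_ne_zero_iff.2 fun i hi => (hp i (Finset.mem_insert_of_mem hi)).ne_zero
    rw [mul_comm, mul_left_comm] at hd
    have h2 := (mul_dvd_mul_iff_left hne).1 hd
    have h3 := ((hp j (Finset.mem_insert_self _ _)).dvd_or_dvd h2).resolve_left hg
    rw [mul_comm]
    exact mul_dvd_mul_left _ h3

lemma descend {S Z K A : Type} [CommRing S] [AddCommGroup Z] [Module S Z] [AddCommGroup K]
    [Module S K] [AddCommGroup A] [Module S A] (p : Z →ₗ[S] K) (hp : Surjective p)
    (f : Z →ₗ[S] A) (h : ∀ z, p z = 0 → f z = 0) : ∃ g : K →ₗ[S] A, ∀ z, g (p z) = f z := by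
  choose s hs using hp
  have key : ∀ z z', p z = p z' → f z = f z' := fun z z' e => by
    have := h (z - z') (by rw [map_sub, e, sub_self])
    rwa [map_sub, sub_eq_zero] at this
  refine ⟨{ toFun := fun k => f (s k), map_add' := fun a b => ?_, map_smul' := fun c a => ?_ },
    fun z => key _ _ (hs _)⟩
  · rw [← map_add]; exact key _ _ (by rw [hs, map_add, hs, hs])
  · rw [RingHom.id_apply, ← map_smul]; exact key _ _ (by rw [hs, map_smul, hs])

end alg

section cfree
variable {V : Type} [AddCommGroup V] [Module ℝ V]
variable {M : Type} [AddCommGroup M] [Module ℝ M] [Module (PolyRing V) M]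

def CFree (I : Ideal (PolyRing V)) (d : ℤ → Submodule ℝ M) : Prop :=
  (∀ a ∈ I, ∀ x : M, a • x = 0) ∧ ∃ (n : ℕ) (b : Fin n → M) (e : Fin n → ℤ),
    (∀ i, b i ∈ d (e i)) ∧ (∀ x, ∃ c : Fin n → PolyRing V, x = ∑ i, c i • b i) ∧
    ∀ c : Fin n → PolyRing V, ∑ i, c i • b i = 0 → ∀ i, c i ∈ I

structure ParR {R : Type} [CommRing R] (φ : R →+* PolyRing V) (I : Ideal (PolyRing V)) : Prop where
  surj : ∀ a, ∃ r, a - φ r ∈ I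
  inj : ∀ r, φ r ∈ I → r = 0

def RFree {R : Type} [CommRing R] (φ : R →+* PolyRing V) (d : ℤ → Submodule ℝ M) : Prop :=
  ∃ (n : ℕ) (b : Fin n → M) (e : Fin n → ℤ),
    (∀ i, b i ∈ d (e i)) ∧ (∀ x, ∃ c : Fin n → R, x = ∑ i, φ (c i) • b i) ∧
    ∀ c : Fin n → R, ∑ i, φ (c i) • b i = 0 → c = 0

variable {R : Type} [CommRing R] {φ : R →+* PolyRing V} {I : Ideal (PolyRing V)}
  {d : ℤ → Submodule ℝ M}

lemma ParR.smul_eq (h : ParR φ I) (hI : ∀ a ∈ I, ∀ x : M, a • x = 0) (a : PolyRing V) :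
    ∃ r, ∀ x : M, a • x = φ r • x := by
  obtain ⟨r, hr⟩ := h.surj a
  refine ⟨r, fun x => ?_⟩
  have := hI _ hr x
  rwa [sub_smul, sub_eq_zero] at this

lemma CFree.toR (h : ParR φ I) (hd : CFree I d) : RFree φ d := by
  obtain ⟨hI, n, b, e, h1, h2, h3⟩ := hd
  refine ⟨n, b, e, h1, fun x => ?_, fun c hc => ?_⟩
  · obtain ⟨c, rfl⟩ := h2 x
    choose r hr using fun i => h.smul_eq hI (c i)
    exact ⟨r, Finset.sum_congr rfl fun i _ => hr i _⟩
  · funext i; exact h.inj _ (h3 _ hc i)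

def HomGen (V : Type) [AddCommGroup V] [Module ℝ V] {M : Type} [AddCommGroup M] [Module ℝ M]
    [Module (PolyRing V) M] (d : ℤ → Submodule ℝ M) (n : ℕ) : Prop :=
  ∃ (b : Fin n → M) (e : Fin n → ℤ), (∀ i, b i ∈ d (e i)) ∧
    ∀ x, ∃ c : Fin n → PolyRing V, x = ∑ i, c i • b i

lemma exists_homGen (h : Gr d) [Module.Finite (PolyRing V) M] : ∃ n, HomGen V d n := by
  obtain ⟨T, hT⟩ := (Module.Finite.fg_top : (⊤ : Submodule (PolyRing V) M).FG)
  choose s hs using pr_sum h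
  let U : Finset (M × ℤ) := T.biUnion fun t => (s t).image fun q => (t, q)
  refine ⟨U.card, fun i => pr d (U.equivFin.symm i).1.2 (U.equivFin.symm i).1.1,
    fun i => (U.equivFin.symm i).1.2, fun i => pr_mem h _ _, fun x => ?_⟩
  have hx : x ∈ Submodule.span (PolyRing V) (Set.range fun i =>
      pr d (U.equivFin.symm i).1.2 (U.equivFin.symm i).1.1) := by
    have : x ∈ Submodule.span (PolyRing V) (T : Set M) := by rw [hT]; trivial
    refine Submodule.span_le.2 ?_ this
    intro t ht
    show t ∈ _
    rw [hs t (s t) subset_rfl]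
    refine Submodule.sum_mem _ fun q hq => Submodule.subset_span ⟨U.equivFin ⟨(t, q), ?_⟩, by simp⟩
    exact Finset.mem_biUnion.2 ⟨t, ht, Finset.mem_image_of_mem _ hq⟩
  obtain ⟨c, hc⟩ := (Submodule.mem_span_range_iff_exists_fun _).1 hx
  exact ⟨c, hc.symm⟩

variable [IsScalarTower ℝ (PolyRing V) M]

lemma exists_min_gen (h : GrM V d) [Module.Finite (PolyRing V) M] :
    ∃ (n : ℕ) (b : Fin n → M) (e : Fin n → ℤ), (∀ i, b i ∈ d (e i)) ∧
    (∀ x, ∃ c : Fin n → PolyRing V, x = ∑ i, c i • b i) ∧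
    ∀ c : Fin n → PolyRing V, ∑ i, c i • b i = 0 → ∀ i, c i ∈ mId V := by
  have hex := exists_homGen (V := V) h.gr
  obtain ⟨b, e, hb, hs⟩ := Nat.find_spec hex
  have hmin := fun k => @Nat.find_min _ _ hex k
  generalize Nat.find hex = n at *
  refine ⟨n, b, e, hb, hs, fun c hc j => ?_⟩
  by_contra hj
  rw [mem_mId] at hj
  cases n with
  | zero => exact j.elim0
  | succ k =>
  refine hmin k (Nat.lt_succ_self k) ⟨b ∘ j.succAbove, e ∘ j.succAbove, fun i => hb _, fun x => ?_⟩
  have h1 := congrArg (pr d (e j)) hc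
  rw [map_sum, map_zero, Fin.sum_univ_succAbove _ j, pr_smul_left h _ (hb j), sub_self, pr_A_zero,
    algebraMap_smul] at h1
  have h2 : b j = ∑ i, (-((c j).1 0)⁻¹ • pr (Adeg V) (e j - e (j.succAbove i)) (c (j.succAbove i))) •
      b (j.succAbove i) := by
    have h3 : (c j).1 0 • b j = - ∑ i, pr (Adeg V) (e j - e (j.succAbove i)) (c (j.succAbove i)) •
      b (j.succAbove i) := by
      rw [eq_neg_iff_add_eq_zero, ← h1]
      congr 1
      exact Finset.sum_congr rfl fun i _ => (pr_smul_left h _ (hb _) _).symm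
    have h4 := congrArg (fun x => ((c j).1 0)⁻¹ • x) h3
    simp only [smul_smul, inv_mul_cancel₀ hj, one_smul] at h4
    rw [h4, smul_neg, Finset.smul_sum, ← Finset.sum_neg_distrib]
    refine Finset.sum_congr rfl fun i _ => ?_
    rw [smul_assoc, neg_smul]
  obtain ⟨a, ha⟩ := hs x
  refine ⟨fun i => a (j.succAbove i) + a j * (-((c j).1 0)⁻¹ • pr (Adeg V) (e j - e (j.succAbove i)) (c (j.succAbove i))), ?_⟩
  rw [ha, Fin.sum_univ_succAbove _ j]
  conv_lhs => rw [h2]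
  simp only [add_smul, Finset.sum_add_distrib, mul_smul, Finset.smul_sum, Function.comp]
  rw [add_comm]

/-- projective + graded ⇒ graded free -/
lemma L2 [IsDomain R] (h : GrM V d) [Module.Finite (PolyRing V) M] (hP : ParR φ I)
    (hI : ∀ a ∈ I, ∀ x : M, a • x = 0)
    (hproj : @Module.Projective R _ M _ (Module.compHom M φ)) : CFree I d := by
  obtain ⟨n, b, e, hb, hs, hrel⟩ := exists_min_gen h
  letI := Module.compHom M φ
  haveI := hproj
  have hsm : ∀ (r : R) (x : M), r • x = φ r • x := fun r x => rfl
  have key := L2abs (R := R) ((mId V).comap φ) (fun ht => by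
      have := (Ideal.eq_top_iff_one _).1 ht
      rw [Ideal.mem_comap, map_one, mem_mId] at this
      simp at this) b
    (fun x => by
      obtain ⟨c, rfl⟩ := hs x
      choose r hr using fun i => hP.smul_eq hI (c i)
      exact ⟨r, Finset.sum_congr rfl fun i _ => hr i _⟩)
    (fun c hc i => hrel _ hc i)
  refine ⟨hI, n, b, e, hb, hs, fun c hc i => ?_⟩
  choose r hr using fun i => hP.surj (c i)
  have h1 : ∑ i, r i • b i = 0 := by
    rw [← hc]
    refine Finset.sum_congr rfl fun i _ => ?_
    have := hI _ (hr i) (b i)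
    rw [sub_smul, sub_eq_zero] at this
    exact this.symm
  have := congrFun (key r h1) i
  have h2 := hr i
  rw [this] at h2
  simpa using h2

variable {N P : Type} [AddCommGroup N] [Module ℝ N] [Module (PolyRing V) N]
   [AddCommGroup P] [Module ℝ P] [Module (PolyRing V) P]
   {dN : ℤ → Submodule ℝ N} {dP : ℤ → Submodule ℝ P}

lemma lift_deg (h : Gr d) (hP : Gr dP) (f : M →ₗ[PolyRing V] P) (hf : Surjective f)
    (hfd : ∀ q, ∀ x ∈ d q, f x ∈ dP q) {q : ℤ} {y : P} (hy : y ∈ dP q) : ∃ x ∈ d q, f x = y := by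
  obtain ⟨x, rfl⟩ := hf y
  refine ⟨pr d q x, pr_mem h q x, ?_⟩
  rw [← pr_of_mem hP hy]
  exact (pr_comm0 h hP f.toAddMonoidHom hfd q x).symm

lemma RFree.ext (hM : Gr d) (hdP : Gr dP) (hN : RFree φ dN) (hPf : RFree φ dP)
    (i : N →ₗ[PolyRing V] M) (hi : Injective i) (hid : ∀ q, ∀ x ∈ dN q, i x ∈ d q)
    (f : M →ₗ[PolyRing V] P) (hf : Surjective f) (hfd : ∀ q, ∀ x ∈ d q, f x ∈ dP q)
    (hex : ∀ x, f x = 0 ↔ ∃ y, i y = x) : RFree φ d := by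
  obtain ⟨n, b, e, hb, hs, hr⟩ := hN
  obtain ⟨k, c, e', hc, hs', hr'⟩ := hPf
  choose c' hc' hfc using fun j => lift_deg hM hdP f hf hfd (hc j)
  refine ⟨n + k, Fin.append (fun j => i (b j)) c', Fin.append e e', fun j => ?_, fun x => ?_, fun a ha => ?_⟩
  · refine Fin.addCases (fun j => ?_) (fun j => ?_) j
    · simp only [Fin.append_left]; exact hid _ _ (hb j)
    · simp only [Fin.append_right]; exact hc' j
  · obtain ⟨a', ha'⟩ := hs' (f x)
    obtain ⟨y, hy⟩ := (hex (x - ∑ j, φ (a' j) • c' j)).1 (by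
      rw [map_sub, map_sum, ha', sub_eq_zero]
      exact Finset.sum_congr rfl fun j _ => by rw [map_smul, hfc])
    obtain ⟨a, rfl⟩ := hs y
    refine ⟨Fin.append a a', ?_⟩
    rw [Fin.sum_univ_add]
    simp only [Fin.append_left, Fin.append_right]
    rw [map_sum] at hy
    simp only [map_smul] at hy
    rw [hy]; abel
  · rw [Fin.sum_univ_add] at ha
    simp only [Fin.append_left, Fin.append_right] at ha
    have h1 := congrArg f ha
    rw [map_add, map_sum, map_sum, map_zero, Finset.sum_eq_zero (fun j _ => by
      rw [map_smul, (hex _).2 ⟨b j, rfl⟩, smul_zero]), zero_add] at h1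
    simp only [map_smul, hfc] at h1
    have h2 := hr' _ h1
    have h3 : ∀ j, a (Fin.natAdd n j) = 0 := fun j => congrFun h2 j
    simp only [h3, map_zero, zero_smul, Finset.sum_const_zero, add_zero] at ha
    have h4 : i (∑ j, φ (a (Fin.castAdd k j)) • b j) = i 0 := by
      rw [map_sum, map_zero, ← ha]; exact Finset.sum_congr rfl fun j _ => map_smul _ _ _
    have h5 := hr _ (hi h4)
    funext j
    refine Fin.addCases (fun j => ?_) (fun j => ?_) j
    · exact congrFun h5 j
    · exact h3 j

/-- definition of maps on a `CFree` module -/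
lemma CFree.lift (hb : ∀ a ∈ I, ∀ x : P, a • x = 0) {n : ℕ} {b : Fin n → M}
    (hs : ∀ x, ∃ c : Fin n → PolyRing V, x = ∑ i, c i • b i)
    (hr : ∀ c : Fin n → PolyRing V, ∑ i, c i • b i = 0 → ∀ i, c i ∈ I) (u : Fin n → P) :
    ∃ f : M →ₗ[PolyRing V] P, ∀ i, f (b i) = u i := by
  obtain ⟨g, hg⟩ := descend (Fintype.linearCombination (PolyRing V) b) (fun x => by
      obtain ⟨c, hc⟩ := hs x; exact ⟨c, by rw [Fintype.linearCombination_apply, hc]⟩)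
    (Fintype.linearCombination (PolyRing V) u) (fun c hc => by
      rw [Fintype.linearCombination_apply] at hc ⊢
      exact Finset.sum_eq_zero fun i _ => hb _ (hr c hc i) _)
  refine ⟨g, fun i => ?_⟩
  have := hg (Pi.single i 1)
  simpa [Fintype.linearCombination_apply_single] using this

lemma hom_comp (h : GrM V d) (hP : GrM V dP) (u : M →ₗ[PolyRing V] P) (e : ℤ) :
    ∃ u' : M →ₗ[PolyRing V] P, ∀ q, ∀ x ∈ d q, u' x = pr dP (q + e) (u x) := by
  choose s hs using pr_sum h.gr
  have hb : ∀ x q, q ∉ s x → pr d q x = 0 := fun x q hq => by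
    have h1 := hs x (insert q (s x)) (Finset.subset_insert _ _)
    rw [Finset.sum_insert hq, ← hs x (s x) subset_rfl] at h1
    exact left_eq_add.1 (by rw [add_comm]; exact h1)
  let F : M → P := fun x => ∑ q ∈ s x, pr dP (q + e) (u (pr d q x))
  have hF : ∀ x t, s x ⊆ t → F x = ∑ q ∈ t, pr dP (q + e) (u (pr d q x)) := fun x t ht =>
    Finset.sum_subset ht fun q _ hq => by rw [hb x q hq, map_zero, map_zero]
  have hF1 : ∀ q, ∀ x ∈ d q, F x = pr dP (q + e) (u x) := fun q x hx => by
    rw [hF x (insert q (s x)) (Finset.subset_insert _ _), Finset.sum_eq_single q, pr_of_mem h.gr hx]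
    · intro q' _ hne; rw [pr_of_ne h.gr hx hne, map_zero, map_zero]
    · intro h; exact absurd (Finset.mem_insert_self _ _) h
  have hadd : ∀ x y, F (x + y) = F x + F y := fun x y => by
    let t := s (x + y) ∪ s x ∪ s y
    rw [hF (x + y) t (fun a ha => by simp [t, ha]), hF x t (fun a ha => by simp [t, ha]),
      hF y t (fun a ha => by simp [t, ha]), ← Finset.sum_add_distrib]
    simp only [map_add]
  have h0 : F 0 = 0 := by simpa using hadd 0 0
  refine ⟨{ toFun := F, map_add' := hadd, map_smul' := ?_ }, hF1⟩
  intro a x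
  rw [RingHom.id_apply]
  revert x
  refine gr_ind h.gr ?_ ?_ ?_
  · rw [smul_zero, h0, smul_zero]
  · intro x y hx hy; rw [smul_add, hadd, hadd, smul_add, hx, hy]
  · intro q x hx
    revert a
    refine gr_ind gr_A ?_ ?_ ?_
    · rw [zero_smul, zero_smul, h0]
    · intro a b ha hb; rw [add_smul, add_smul, hadd, ha, hb]
    · intro p a ha
      rw [hF1 _ _ (h.smul p q a ha x hx), hF1 _ _ hx, map_smul, pr_smul_right hP ha]
      congr 2; ring

end cfree

/-! ### Sheaves: basic lemmas, MES implies Good -/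

section sheaf
variable {V : Type} [AddCommGroup V] [Module ℝ V]

lemma IsPar.parR {H : Type} [AddCommGroup H] [Module ℝ H] {q : V →ₗ[ℝ] H} {U : Submodule ℝ V}
    (h : IsPar q U) : ParR (pb q) (IV U) :=
  ⟨h.exists_pb, fun _ hr => h.pb_mem.1 hr⟩

lemma GAMod.grM (M : GAMod V) : GrM V M.deg := ⟨Gr.of_internal M.internal, M.smul_deg⟩

instance fanFinite (Δ : Fan V) : Finite Δ.cones := Δ.finite.to_subtype

namespace FanSheaf
variable {Δ : Fan V} (F : FanSheaf Δ)

/-- total restriction map -/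
def r (σ τ : Δ.cones) : (F.stalk σ).M →ₗ[PolyRing V] (F.stalk τ).M :=
  if h : Cone.IsFaceOf τ.1 σ.1 then (F.res σ τ h).toLin else 0

lemma r_res {σ τ : Δ.cones} (h : Cone.IsFaceOf τ.1 σ.1) : F.r σ τ = (F.res σ τ h).toLin := by
  rw [r, dif_pos h]

lemma r_not {σ τ : Δ.cones} (h : ¬ Cone.IsFaceOf τ.1 σ.1) : F.r σ τ = 0 := by
  rw [r, dif_neg h]

lemma r_self (σ : Δ.cones) (x : (F.stalk σ).M) : F.r σ σ x = x := by
  rw [F.r_res (Cone.face_refl _), F.res_self]; rfl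

lemma r_comp {σ τ υ : Δ.cones} (h1 : Cone.IsFaceOf τ.1 σ.1) (h2 : Cone.IsFaceOf υ.1 τ.1)
    (x : (F.stalk σ).M) : F.r τ υ (F.r σ τ x) = F.r σ υ x := by
  rw [F.r_res h1, F.r_res h2, F.r_res (h2.trans h1), ← F.res_comp σ τ υ h1 h2]; rfl

lemma r_deg {σ τ : Δ.cones} {q : ℤ} {x : (F.stalk σ).M} (hx : x ∈ (F.stalk σ).deg q) :
    F.r σ τ x ∈ (F.stalk τ).deg q := by
  by_cases h : Cone.IsFaceOf τ.1 σ.1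
  · rw [F.r_res h]; exact (F.res σ τ h).deg_mem q x hx
  · rw [F.r_not h]; exact zero_mem _

lemma r_pr (σ τ : Δ.cones) (q : ℤ) (x : (F.stalk σ).M) :
    F.r σ τ (pr (F.stalk σ).deg q x) = pr (F.stalk τ).deg q (F.r σ τ x) :=
  (pr_comm0 (F.stalk σ).grM.gr (F.stalk τ).grM.gr (F.r σ τ).toAddMonoidHom
    (fun _ _ h => F.r_deg h) q x).symm

lemma mem_sec {Λ : Set (Cone V)} {s : ∀ σ : Δ.cones, (F.stalk σ).M} :
    s ∈ F.secSub Λ ↔ (∀ σ : Δ.cones, σ.1 ∉ Λ → s σ = 0) ∧ ∀ σ τ : Δ.cones, σ.1 ∈ Λ → τ.1 ∈ Λ →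
      Cone.IsFaceOf τ.1 σ.1 → F.r σ τ (s σ) = s τ := by
  constructor
  · rintro ⟨h1, h2⟩
    exact ⟨h1, fun σ τ hσ hτ h => by rw [F.r_res h]; exact h2 σ τ hσ hτ h⟩
  · rintro ⟨h1, h2⟩
    exact ⟨h1, fun σ τ hσ hτ h => by rw [← F.r_res h]; exact h2 σ τ hσ hτ h⟩

lemma piGr : Gr (fun q => (Submodule.pi Set.univ (fun σ : Δ.cones => (F.stalk σ).deg q) :
    Submodule ℝ (∀ σ : Δ.cones, (F.stalk σ).M))) :=
  Gr.pi fun σ => (F.stalk σ).grM.gr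

lemma pi_pr (q : ℤ) (s : ∀ σ : Δ.cones, (F.stalk σ).M) (σ : Δ.cones) :
    pr (fun q => (Submodule.pi Set.univ (fun σ : Δ.cones => (F.stalk σ).deg q) :
      Submodule ℝ (∀ σ : Δ.cones, (F.stalk σ).M))) q s σ = pr (F.stalk σ).deg q (s σ) :=
  (pr_comm0 F.piGr (F.stalk σ).grM.gr
    (Pi.evalAddMonoidHom (fun σ : Δ.cones => (F.stalk σ).M) σ)
    (fun q x hx => hx σ (Set.mem_univ _)) q s).symm

lemma sec_grM (Λ : Set (Cone V)) : GrM V (F.secDeg Λ) := by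
  have e : F.secDeg Λ = fun q => (Submodule.pi Set.univ (fun σ : Δ.cones => (F.stalk σ).deg q) :
      Submodule ℝ (∀ σ : Δ.cones, (F.stalk σ).M)).comap ((F.secSub Λ).subtype.restrictScalars ℝ) := by
    funext q; ext s
    constructor
    · intro h σ _; exact h σ
    · intro h σ; exact h σ (Set.mem_univ _)
  refine ⟨?_, fun p q a ha x hx σ => (F.stalk σ).smul_deg p q a ha _ (hx σ)⟩
  rw [e]
  refine F.piGr.comap _ (Submodule.injective_subtype _) fun x q => ?_
  refine ⟨⟨_, F.mem_sec.2 ⟨fun σ hσ => ?_, fun σ τ hσ hτ h => ?_⟩⟩, rfl⟩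
  · show pr _ q x.1 σ = 0
    rw [F.pi_pr, x.2.1 σ hσ, map_zero]
  · show F.r σ τ (pr _ q x.1 σ) = pr _ q x.1 τ
    rw [F.pi_pr, F.pi_pr, F.r_pr, (F.mem_sec.1 x.2).2 σ τ hσ hτ h]

lemma sec_pr (Λ : Set (Cone V)) (q : ℤ) (s : F.Sec Λ) (σ : Δ.cones) :
    (pr (F.secDeg Λ) q s).1 σ = pr (F.stalk σ).deg q (s.1 σ) :=
  (pr_comm0 (F.sec_grM Λ).gr (F.stalk σ).grM.gr
    ((Pi.evalAddMonoidHom (fun σ : Δ.cones => (F.stalk σ).M) σ).comp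
      (F.secSub Λ).subtype.toAddMonoidHom) (fun q x hx => hx σ) q s).symm

lemma sec_finite [FiniteDimensional ℝ V] (Λ : Set (Cone V))
    (h : ∀ σ : Δ.cones, σ.1 ∈ Λ → Module.Finite (PolyRing V) (F.stalk σ).M) :
    Module.Finite (PolyRing V) (F.Sec Λ) := by
  let f : F.Sec Λ →ₗ[PolyRing V] (∀ σ : {σ : Δ.cones // σ.1 ∈ Λ}, (F.stalk σ.1).M) :=
    LinearMap.pi fun σ => LinearMap.proj σ.1 ∘ₗ (F.secSub Λ).subtype
  have hf : Injective f := by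
    intro s t hst
    apply Subtype.ext; funext σ
    by_cases hσ : σ.1 ∈ Λ
    · exact congrFun hst ⟨σ, hσ⟩
    · rw [s.2.1 σ hσ, t.2.1 σ hσ]
  haveI : ∀ σ : {σ : Δ.cones // σ.1 ∈ Λ}, Module.Finite (PolyRing V) (F.stalk σ.1).M :=
    fun σ => h σ.1 σ.2
  haveI : IsNoetherian (PolyRing V) (∀ σ : {σ : Δ.cones // σ.1 ∈ Λ}, (F.stalk σ.1).M) :=
    isNoetherian_of_isNoetherianRing_of_finite _ _
  exact Module.Finite.of_injective f hf

lemma bdRes_apply (σ τ : Δ.cones) (h : Cone.IsProperFaceOf τ.1 σ.1) (x : (F.stalk σ).M) :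
    (F.bdRes σ x).1 τ = F.r σ τ x := by
  rw [F.r_res h.1]; exact dif_pos h

lemma bdRes_deg (σ : Δ.cones) (q : ℤ) (x : (F.stalk σ).M) (hx : x ∈ (F.stalk σ).deg q) :
    F.bdRes σ x ∈ F.secDeg (bdFan σ) q := by
  intro τ
  by_cases h : Cone.IsProperFaceOf τ.1 σ.1
  · rw [F.bdRes_apply σ τ h]; exact F.r_deg hx
  · rw [(F.bdRes σ x).2.1 τ h]; exact zero_mem _

/-- the consequences of being a MES that we use -/
structure Good : Prop where
  free : ∀ σ : Δ.cones, CFree (IV σ.1.spanC) (F.stalk σ).deg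
  surj : ∀ σ : Δ.cones, ∀ s ∈ F.secSub (bdFan σ), ∃ x, ∀ τ : Δ.cones,
    Cone.IsProperFaceOf τ.1 σ.1 → F.r σ τ x = s τ
  ker : ∀ σ : Δ.cones, σ.1 ≠ zeroCone V → ∀ x, (∀ τ : Δ.cones,
    Cone.IsProperFaceOf τ.1 σ.1 → F.r σ τ x = 0) → x ∈ mSub V (F.stalk σ).M
  zero : ∃ e : (F.stalk Δ.ozero).M, e ∈ (F.stalk Δ.ozero).deg 0 ∧ e ≠ 0 ∧ ∀ x, ∃ c : ℝ, x = c • e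

variable {F}

lemma mk_eq_zero_iff {M : Type} [AddCommGroup M] [Module (PolyRing V) M] (x : M) :
    (mSub V M).mkQ x = 0 ↔ x ∈ mSub V M := by
  rw [Submodule.mkQ_apply, Submodule.Quotient.mk_eq_zero]

lemma IsMES.refl_m (hF : F.IsMES) (σ : Δ.cones) (hσ : σ.1 ≠ zeroCone V) (x : (F.stalk σ).M)
    (hx : F.bdRes σ x ∈ mSub V (F.Sec (bdFan σ))) : x ∈ mSub V (F.stalk σ).M := by
  obtain ⟨s, hs⟩ := pr_sum (F.stalk σ).grM.gr x
  rw [hs s subset_rfl]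
  refine Submodule.sum_mem _ fun q _ => ?_
  have h1 : F.bdRes σ (pr (F.stalk σ).deg q x) ∈ mSub V (F.Sec (bdFan σ)) := by
    rw [← LinearMap.toAddMonoidHom_coe, ← pr_comm0 (F.stalk σ).grM.gr (F.sec_grM (bdFan σ)).gr
      (F.bdRes σ).toAddMonoidHom (F.bdRes_deg σ)]
    exact mSub_gr (F.sec_grM _) _ hx q
  have h2 := (hF.2.2 σ hσ q).injOn
  have h3 := @h2 ((mSub V _).mkQ (pr (F.stalk σ).deg q x)) ⟨_, pr_mem (F.stalk σ).grM.gr q x, rfl⟩ 0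
    (zero_mem _) (by
      rw [map_zero]
      show mRedMap V (F.bdRes σ) _ = 0
      rw [mRedMap, Submodule.mkQ_apply, Submodule.mapQ_apply, Submodule.Quotient.mk_eq_zero]
      exact h1)
  exact (mk_eq_zero_iff _).1 h3

lemma IsMES.surj_m (hF : F.IsMES) (σ : Δ.cones) (hσ : σ.1 ≠ zeroCone V) (y : F.Sec (bdFan σ)) :
    ∃ z ∈ LinearMap.range (F.bdRes σ), y - z ∈ mSub V (F.Sec (bdFan σ)) := by
  revert y
  refine gr_ind (F.sec_grM _).gr ⟨0, zero_mem _, by simp⟩ ?_ ?_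
  · rintro x y ⟨a, ha, hx⟩ ⟨b, hb, hy⟩
    refine ⟨a + b, add_mem ha hb, ?_⟩
    rw [add_sub_add_comm]; exact add_mem hx hy
  · intro q y hy
    obtain ⟨_, ⟨x, hx, rfl⟩, hz2⟩ := (hF.2.2 σ hσ q).surjOn ⟨y, hy, rfl⟩
    refine ⟨F.bdRes σ x, ⟨x, rfl⟩, ?_⟩
    have h3 : (mSub V (F.Sec (bdFan σ))).mkQ (F.bdRes σ x) = (mSub V (F.Sec (bdFan σ))).mkQ y := hz2
    rw [← sub_eq_zero, ← map_sub, mk_eq_zero_iff] at h3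
    rw [← neg_sub]; exact neg_mem h3

lemma IsMES.finite [FiniteDimensional ℝ V] (hF : F.IsMES) (σ : Δ.cones) :
    Module.Finite (PolyRing V) (F.stalk σ).M := by
  suffices H : ∀ n, ∀ σ : Δ.cones, σ.1.dim = n → Module.Finite (PolyRing V) (F.stalk σ).M from
    H _ σ rfl
  intro n
  induction n using Nat.strong_induction_on with
  | _ n ih =>
  intro σ hσn
  by_cases hσ : σ.1 = zeroCone V
  · have : σ = Δ.ozero := Subtype.ext hσ
    subst this
    haveI : Module.Finite ℝ (F.stalk Δ.ozero).M :=
      Module.finite_of_finrank_pos (by rw [hF.1.2.1]; exact one_pos)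
    exact Module.Finite.of_restrictScalars_finite ℝ (PolyRing V) _
  haveI hfs : Module.Finite (PolyRing V) (F.Sec (bdFan σ)) := F.sec_finite _ fun τ hτ =>
    ih τ.1.dim (by rw [← hσn]; exact hτ.dim_lt) τ rfl
  haveI : IsNoetherian (PolyRing V) (F.Sec (bdFan σ)) := isNoetherian_of_isNoetherianRing_of_finite _ _
  obtain ⟨T, hT⟩ := (IsNoetherian.noetherian (LinearMap.range (F.bdRes σ)))
  have hTr : ∀ t : T, ∃ x, F.bdRes σ x = t.1 := fun t => by
    have : t.1 ∈ Submodule.span (PolyRing V) (T : Set (F.Sec (bdFan σ))) := Submodule.subset_span t.2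
    rw [hT] at this
    exact this
  choose g hg using hTr
  let N : Submodule (PolyRing V) (F.stalk σ).M := Submodule.span _ (Set.range g)
  have hN : ∀ x, ∃ y ∈ N, x - y ∈ mSub V (F.stalk σ).M := by
    intro x
    have h1 : F.bdRes σ x ∈ N.map (F.bdRes σ) := by
      rw [Submodule.map_span]
      have : F.bdRes σ x ∈ LinearMap.range (F.bdRes σ) := ⟨x, rfl⟩
      rw [← hT] at this
      refine Submodule.span_mono ?_ this
      intro t ht
      exact ⟨g ⟨t, ht⟩, ⟨_, rfl⟩, hg ⟨t, ht⟩⟩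
    obtain ⟨y, hy, hyx⟩ := h1
    refine ⟨y, hy, hF.refl_m σ hσ _ ?_⟩
    rw [map_sub, hyx, sub_self]; exact zero_mem _
  obtain ⟨ht, hfree⟩ := hF.2.1 σ
  letI := ht.module
  have hsm : ∀ (a : PolyRing V) (x : (F.stalk σ).M),
    (Ideal.Quotient.mk (vanishingIdeal V σ.1.carrier) a) • x = a • x := fun a x => rfl
  obtain ⟨ι, b⟩ := hfree.exists_basis.some
  haveI : Nontrivial (coneRing V σ.1) := Ideal.Quotient.nontrivial_iff.2 fun h => by
    have h1 := (Ideal.eq_top_iff_one _).1 h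
    rw [vanish_cone] at h1
    have := mem_IV.1 h1 0 (Submodule.zero_mem _)
    simp at this
  have hι : ∀ i : ι, ∃ t : T, i ∈ (b.repr (g t)).support := by
    intro i
    by_contra hne
    push Not at hne
    have hm : ∀ z ∈ mSub V (F.stalk σ).M, ∃ a ∈ mId V, b.repr z i = Ideal.Quotient.mk _ a := by
      intro z hz
      refine Submodule.smul_induction_on hz ?_ ?_
      · intro a ha x _
        obtain ⟨c, hc⟩ := Ideal.Quotient.mk_surjective (b.repr x i)
        refine ⟨a * c, Ideal.mul_mem_right _ _ ha, ?_⟩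
        rw [← hsm, map_smul, Finsupp.smul_apply, ← hc, map_mul]; rfl
      · rintro x y ⟨a, ha, hx⟩ ⟨c, hc, hy⟩
        exact ⟨a + c, add_mem ha hc, by rw [map_add, Finsupp.add_apply, hx, hy, map_add]⟩
    have hN0 : ∀ z ∈ N, b.repr z i = 0 := by
      intro z hz
      refine Submodule.span_induction ?_ ?_ ?_ ?_ hz
      · rintro _ ⟨t, rfl⟩
        simpa using hne t
      · simp
      · intro x y _ _ hx hy; rw [map_add, Finsupp.add_apply, hx, hy, add_zero]
      · intro a x _ hx; rw [← hsm, map_smul, Finsupp.smul_apply, hx, smul_zero]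
    obtain ⟨y, hy, hxy⟩ := hN (b i)
    obtain ⟨a, ha, hab⟩ := hm _ hxy
    rw [map_sub, Finsupp.sub_apply, hN0 y hy, sub_zero, b.repr_self, Finsupp.single_eq_same,
      ← map_one (Ideal.Quotient.mk _), Ideal.Quotient.eq, vanish_cone] at hab
    have h1 := mem_mId.1 (IV_le_mId _ hab)
    rw [mem_mId] at ha
    simp [ha] at h1
  choose f hf using hι
  haveI : Finite ι := by
    have : Set.Finite (⋃ t : T, ((b.repr (g t)).support : Set ι)) :=
      Set.finite_iUnion fun t => Finset.finite_toSet _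
    have h2 : (⋃ t : T, ((b.repr (g t)).support : Set ι)) = Set.univ := by
      ext i; simp only [Set.mem_iUnion, Set.mem_univ, iff_true]; exact ⟨f i, hf i⟩
    rw [h2] at this
    exact Set.finite_univ_iff.1 this
  haveI := Fintype.ofFinite ι
  refine ⟨⟨Finset.univ.image b, ?_⟩⟩
  rw [eq_top_iff]
  intro x _
  rw [← b.sum_repr x]
  refine Submodule.sum_mem _ fun i _ => ?_
  obtain ⟨c, hc⟩ := Ideal.Quotient.mk_surjective (b.repr x i)
  rw [← hc, hsm]
  exact Submodule.smul_mem _ _ (Submodule.subset_span (by simp))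

lemma exists_proj [FiniteDimensional ℝ V] (U : Submodule ℝ V) : ∃ p : V →ₗ[ℝ] U, IsPar p U := by
  obtain ⟨p, hp⟩ := U.subtype.exists_leftInverse_of_injective (by simp)
  refine ⟨p, ?_⟩
  have : p.domRestrict U = LinearMap.id := hp
  rw [IsPar, this]; exact Function.bijective_id

lemma IsMES.cfree [FiniteDimensional ℝ V] (hF : F.IsMES) (σ : Δ.cones) :
    CFree (IV σ.1.spanC) (F.stalk σ).deg := by
  obtain ⟨p, hp⟩ := exists_proj σ.1.spanC
  haveI := hF.finite σ
  obtain ⟨ht, hfree⟩ := hF.2.1 σ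
  refine L2 (φ := pb p) (F.stalk σ).grM hp.parR (fun a ha x => ?_) ?_
  · rw [← vanish_cone] at ha; exact @ht x ⟨a, ha⟩
  · letI := ht.module
    letI := Module.compHom (F.stalk σ).M (pb p)
    obtain ⟨ι, b⟩ := hfree.exists_basis.some
    let φ : PolyRing σ.1.spanC →+* coneRing V σ.1 := (Ideal.Quotient.mk _).comp (pb p)
    have hφ : Bijective φ := by
      constructor
      · rw [injective_iff_map_eq_zero]
        intro a ha
        have := Ideal.Quotient.eq_zero_iff_mem.1 ha
        rw [vanish_cone] at this
        exact hp.pb_mem.1 this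
      · intro y
        obtain ⟨a, rfl⟩ := Ideal.Quotient.mk_surjective y
        obtain ⟨r, hr⟩ := hp.exists_pb a
        refine ⟨r, ?_⟩
        show Ideal.Quotient.mk _ _ = _
        rw [eq_comm, Ideal.Quotient.eq, vanish_cone]; exact hr
    let e := RingEquiv.ofBijective φ hφ
    have b' := b.mapCoeffs e.symm (fun c x => by
      obtain ⟨c, rfl⟩ := e.surjective c
      rw [RingEquiv.symm_apply_apply]; rfl)
    haveI := Module.Free.of_basis b'
    infer_instance

lemma IsMES.good [FiniteDimensional ℝ V] (hF : F.IsMES) : F.Good := by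
  refine ⟨hF.cfree, fun σ s hs => ?_, fun σ hσ x hx => ?_, ?_⟩
  · by_cases hσ : σ.1 = zeroCone V
    · refine ⟨0, fun τ hτ => ?_⟩
      have := hτ.dim_lt
      rw [hσ, zeroCone_dim] at this
      omega
    · haveI := F.sec_finite (bdFan σ) fun τ _ => hF.finite τ
      have := gr_nak (F.sec_grM (bdFan σ)) (N := LinearMap.range (F.bdRes σ)) (by
        rintro _ ⟨x, rfl⟩ q
        refine ⟨pr (F.stalk σ).deg q x, ?_⟩
        exact (pr_comm0 (F.stalk σ).grM.gr (F.sec_grM (bdFan σ)).gr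
          (F.bdRes σ).toAddMonoidHom (F.bdRes_deg σ) q x).symm) (hF.surj_m σ hσ) ⟨s, hs⟩
      obtain ⟨x, hx⟩ := this
      exact ⟨x, fun τ hτ => by rw [← F.bdRes_apply σ τ hτ, hx]⟩
  · refine hF.refl_m σ hσ x ?_
    have : F.bdRes σ x = 0 := by
      apply Subtype.ext; funext τ
      by_cases h : Cone.IsProperFaceOf τ.1 σ.1
      · rw [F.bdRes_apply σ τ h]; exact hx τ h
      · exact (F.bdRes σ x).2.1 τ h
    rw [this]; exact zero_mem _
  · obtain ⟨e, he, hs⟩ := finrank_eq_one_iff'.1 hF.1.2.1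
    refine ⟨e, ?_, he, fun x => ?_⟩
    · refine gr_mem (F.stalk Δ.ozero).grM.gr fun q hq => ?_
      have := pr_mem (F.stalk Δ.ozero).grM.gr q e
      rw [hF.1.2.2 q hq] at this
      exact (Submodule.mem_bot _).1 this
    · obtain ⟨c, hc⟩ := hs x
      exact ⟨c, hc.symm⟩

lemma Good.kill (hF : F.Good) (σ : Δ.cones) {a : PolyRing V} (ha : a ∈ IV σ.1.spanC)
    (x : (F.stalk σ).M) : a • x = 0 := (hF.free σ).1 a ha x

lemma Good.finite (hF : F.Good) (σ : Δ.cones) : Module.Finite (PolyRing V) (F.stalk σ).M := by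
  obtain ⟨_, n, b, e, _, hs, _⟩ := hF.free σ
  refine ⟨⟨Finset.univ.image b, ?_⟩⟩
  rw [eq_top_iff]
  intro x _
  obtain ⟨c, rfl⟩ := hs x
  exact Submodule.sum_mem _ fun i _ => Submodule.smul_mem _ _ (Submodule.subset_span (by simp))

/-- face-closed sets -/
def FC (Λ : Set (Cone V)) : Prop := ∀ σ ∈ Λ, ∀ τ : Cone V, τ.IsFaceOf σ → τ ∈ Λ

lemma Good.flab [FiniteDimensional ℝ V] (hF : F.Good) {Λ : Set (Cone V)} (hΛ : FC Λ)
    {s : ∀ σ : Δ.cones, (F.stalk σ).M} (hs : s ∈ F.secSub Λ) :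
    ∃ s' ∈ F.secSub Set.univ, ∀ σ : Δ.cones, σ.1 ∈ Λ → s' σ = s σ := by
  suffices H : ∀ n, ∀ Λ : Set (Cone V), FC Λ → {σ : Δ.cones | σ.1 ∉ Λ}.ncard = n →
      ∀ s ∈ F.secSub Λ, ∃ s' ∈ F.secSub Set.univ, ∀ σ : Δ.cones, σ.1 ∈ Λ → s' σ = s σ from
    H _ Λ hΛ rfl s hs
  intro n
  induction n with
  | zero =>
    intro Λ _ hn s hs
    rw [Set.ncard_eq_zero] at hn
    have hall : ∀ σ : Δ.cones, σ.1 ∈ Λ := fun σ => by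
      by_contra h
      have : σ ∈ {σ : Δ.cones | σ.1 ∉ Λ} := h
      rw [hn] at this; exact this
    rw [mem_sec] at hs
    exact ⟨s, F.mem_sec.2 ⟨fun σ h => absurd (Set.mem_univ _) h,
      fun σ τ _ _ h => hs.2 σ τ (hall σ) (hall τ) h⟩, fun _ _ => rfl⟩
  | succ n ih =>
    intro Λ hΛ hn s hs
    have hne : {σ : Δ.cones | σ.1 ∉ Λ}.Nonempty := by
      rw [← Set.ncard_pos]; omega
    obtain ⟨σ, hσ, hmin⟩ := Set.exists_min_image _ (fun σ : Δ.cones => σ.1.dim) (Set.toFinite _) hne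
    have hsm := F.mem_sec.1 hs
    have hpf : ∀ τ : Cone V, τ.IsProperFaceOf σ.1 → τ ∈ Λ := fun τ hτ => by
      by_contra h
      have h1 := hmin ⟨τ, Δ.face_mem _ σ.2 _ hτ.1⟩ h
      have h2 := hτ.dim_lt
      simp only at h1
      omega
    obtain ⟨x, hx⟩ := hF.surj σ (fun τ => if τ.1.IsProperFaceOf σ.1 then s τ else 0) (by
      refine F.mem_sec.2 ⟨fun τ h => if_neg h, fun τ υ hτ hυ h => ?_⟩
      have hτ' : τ.1.IsProperFaceOf σ.1 := hτ
      have hυ' : υ.1.IsProperFaceOf σ.1 := hυ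
      rw [if_pos hτ', if_pos hυ']
      exact hsm.2 τ υ (hpf _ hτ) (hpf _ hυ) h)
    have hs1 : (Function.update s σ x) ∈ F.secSub (insert σ.1 Λ) := by
      refine F.mem_sec.2 ⟨fun τ h => ?_, fun τ υ hτ hυ h => ?_⟩
      · rw [Set.mem_insert_iff, not_or] at h
        rw [Function.update_of_ne (fun e => h.1 (congrArg Subtype.val e))]
        exact hsm.1 τ h.2
      · by_cases h1 : τ = σ
        · subst h1
          by_cases h2 : υ = τ
          · subst h2; rw [r_self]
          · have hp : Cone.IsProperFaceOf υ.1 τ.1 := ⟨h, fun e => h2 (Subtype.ext e)⟩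
            rw [Function.update_self, Function.update_of_ne h2, hx υ hp, if_pos hp]
        · have hτ' : τ.1 ∈ Λ := hτ.resolve_left (fun e => h1 (Subtype.ext e))
          have hυ' : υ.1 ∈ Λ := hΛ _ hτ' _ h
          have h2 : υ ≠ σ := fun e => hσ (e ▸ hυ')
          rw [Function.update_of_ne h1, Function.update_of_ne h2]
          exact hsm.2 τ υ hτ' hυ' h
    obtain ⟨s', hs', hss⟩ := ih (insert σ.1 Λ) (by
      rintro ρ (rfl | hρ) τ hτ
      · by_cases h : τ = σ.1
        · exact Or.inl h
        · exact Or.inr (hpf _ ⟨hτ, h⟩)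
      · exact Or.inr (hΛ _ hρ _ hτ)) (by
      have : {τ : Δ.cones | τ.1 ∉ insert σ.1 Λ} = {τ : Δ.cones | τ.1 ∉ Λ} \ {σ} := by
        ext τ
        simp only [Set.mem_setOf_eq, Set.mem_insert_iff, not_or, Set.mem_diff, Set.mem_singleton_iff]
        rw [and_comm, Subtype.ext_iff]
      rw [this, Set.ncard_diff_singleton_of_mem hσ, hn]; rfl) _ hs1
    refine ⟨s', hs', fun τ hτ => ?_⟩
    rw [hss τ (Or.inr hτ), Function.update_of_ne]
    rintro rfl; exact hσ hτ

end FanSheaf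
end sheaf

/-! ### Freeness via line shellings -/

section free
variable {V : Type} [AddCommGroup V] [Module ℝ V] [FiniteDimensional ℝ V]
variable {H : Type} [AddCommGroup H] [Module ℝ H]

/-- `q` is, on `V_σ`, a projection along `l` -/
structure Par (σ : Cone V) (l : V) (q : V →ₗ[ℝ] H) : Prop where
  zero : ∀ x ∈ σ.spanC, q x = 0 → ∃ c : ℝ, x = c • l
  ql : q l = 0
  surj : ∀ y, ∃ x ∈ σ.spanC, q x = y

lemma Par.facet {σ τ : Cone V} {l : V} {q : V →ₗ[ℝ] H} (h : Par σ l q) (hIl : IsInt σ l)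
    (hτ : IsFacet τ σ) : IsPar q τ.spanC := by
  have hp := hIl.2 τ hτ
  have hls : l ∈ σ.spanC := σ.mem_span hIl.1
  constructor
  · rw [injective_iff_map_eq_zero]
    rintro ⟨x, hx⟩ h0
    obtain ⟨c, hc⟩ := h.zero x (hτ.1.span_le hx) h0
    have h1 := hl_zero hτ hx
    rw [hc, map_smul, smul_eq_mul, mul_eq_zero] at h1
    apply Subtype.ext
    show x = 0
    rw [hc, h1.resolve_right hp.ne', zero_smul]
  · intro y
    obtain ⟨x, hx, rfl⟩ := h.surj y
    refine ⟨⟨x - (hl σ τ x / hl σ τ l) • l, ?_⟩, ?_⟩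
    · rw [← hl_zero_iff hτ (sub_mem hx (Submodule.smul_mem _ _ hls)), map_sub, map_smul, smul_eq_mul,
        div_mul_cancel₀ _ hp.ne', sub_self]
    · show q (x - _ • l) = q x
      rw [map_sub, map_smul, h.ql, smul_zero, sub_zero]

lemma Par.prod {σ : Cone V} {l : V} {q : V →ₗ[ℝ] H} (h : Par σ l q) (hls : l ∈ σ.spanC)
    (T : V →ₗ[ℝ] ℝ) (hT : T l ≠ 0) : IsPar (q.prod T) σ.spanC := by
  constructor
  · rw [injective_iff_map_eq_zero]
    rintro ⟨x, hx⟩ h0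
    obtain ⟨h1, h2⟩ := Prod.ext_iff.1 h0
    obtain ⟨c, hc⟩ := h.zero x hx h1
    have h3 : T x = 0 := h2
    rw [hc, map_smul, smul_eq_mul, mul_eq_zero] at h3
    apply Subtype.ext
    show x = 0
    rw [hc, h3.resolve_right hT, zero_smul]
  · rintro ⟨y, t⟩
    obtain ⟨x, hx, rfl⟩ := h.surj y
    refine ⟨⟨x + ((t - T x) / T l) • l, add_mem hx (Submodule.smul_mem _ _ hls)⟩, ?_⟩
    apply Prod.ext
    · show q (x + _ • l) = q x
      rw [map_add, map_smul, h.ql, smul_zero, add_zero]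
    · show T (x + _ • l) = t
      rw [map_add, map_smul, smul_eq_mul, div_mul_cancel₀ _ hT]; ring

lemma exists_Par (σ : Cone V) {l : V} (hls : l ∈ σ.spanC) (hl0 : l ≠ 0) :
    ∃ (H : Submodule ℝ V) (q : V →ₗ[ℝ] H) (T : V →ₗ[ℝ] ℝ), Par σ l q ∧ T l = 1 := by
  obtain ⟨T, hT⟩ : ∃ T : V →ₗ[ℝ] ℝ, T l = 1 := by
    refine ⟨(Bf l l)⁻¹ • Bf l, ?_⟩
    have := (Bf_pos hl0).ne'
    simp [this]
  obtain ⟨p, hp⟩ := σ.spanC.subtype.exists_leftInverse_of_injective (by simp)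
  have hp' : ∀ x (hx : x ∈ σ.spanC), p x = ⟨x, hx⟩ := fun x hx => LinearMap.congr_fun hp ⟨x, hx⟩
  let q : V →ₗ[ℝ] V := σ.spanC.subtype ∘ₗ p - (T ∘ₗ σ.spanC.subtype ∘ₗ p).smulRight l
  have hq : ∀ x ∈ σ.spanC, q x = x - T x • l := fun x hx => by simp [q, hp' x hx]
  refine ⟨LinearMap.range q, q.rangeRestrict, T, ⟨fun x hx h0 => ?_, ?_, ?_⟩, hT⟩
  · have : q x = 0 := congrArg Subtype.val h0
    rw [hq x hx, sub_eq_zero] at this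
    exact ⟨_, this⟩
  · apply Subtype.ext
    show q l = 0
    rw [hq l hls, hT, one_smul, sub_self]
  · rintro ⟨_, x, rfl⟩
    refine ⟨p x, (p x).2, Subtype.ext ?_⟩
    show q (p x) = q x
    simp [q, hp' _ (p x).2]

lemma IsInt.ne_zero {σ τ : Cone V} {l : V} (h : IsInt σ l) (hτ : IsFacet τ σ) : l ≠ 0 := by
  rintro rfl
  have := h.2 τ hτ
  simp at this

namespace FanSheaf
variable {Δ : Fan V} {F : FanSheaf Δ}

def kerV (F : FanSheaf Δ) (σ : Δ.cones) (v : V) : Submodule (PolyRing V) (F.stalk σ).M :=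
  ⨅ τ : {τ : Δ.cones // IsFacet τ.1 σ.1 ∧ hl σ.1 τ.1 v < 0}, LinearMap.ker (F.r σ τ.1)

lemma mem_kerV {σ : Δ.cones} {v : V} {x : (F.stalk σ).M} : x ∈ F.kerV σ v ↔
    ∀ τ : Δ.cones, IsFacet τ.1 σ.1 → hl σ.1 τ.1 v < 0 → F.r σ τ x = 0 := by
  simp [kerV]

lemma kerV_gr (σ : Δ.cones) (v : V) : GrSub (F.stalk σ).deg (F.kerV σ v) := by
  intro x hx q
  rw [mem_kerV] at *
  intro τ hτ hv
  rw [F.r_pr, hx τ hτ hv, map_zero]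

def gen (𝓢 : Finset (Cone V)) : Set (Cone V) := {ζ | ∃ τ ∈ 𝓢, ζ.IsFaceOf τ}

lemma gen_FC (𝓢 : Finset (Cone V)) : FC (gen 𝓢) := by
  rintro σ ⟨τ, hτ, h⟩ ζ hζ
  exact ⟨τ, hτ, hζ.trans h⟩

structure Init (σ : Cone V) (l v : V) (𝓢 : Finset (Cone V)) : Prop where
  sub : ∀ τ ∈ 𝓢, IsFacet τ σ
  inj : ∀ τ ∈ 𝓢, ∀ τ' ∈ 𝓢, kap σ l v τ = kap σ l v τ' → τ = τ'
  initl : ∀ τ ∈ 𝓢, ∀ τ', IsFacet τ' σ → kap σ l v τ' < kap σ l v τ → τ' ∈ 𝓢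

lemma S1 (hF : F.Good) {σ : Cone V} (hσ : ∀ τ, IsFacet τ σ → τ ∈ Δ.cones) {l v : V}
    (hIl : IsInt σ l) (hv : v ∈ σ.spanC) {q : V →ₗ[ℝ] H} (hq : Par σ l q)
    (hS2 : ∀ τ : Δ.cones, IsFacet τ.1 σ → ∀ w ∈ τ.1.spanC,
      CFree (IV τ.1.spanC) (subD (F.stalk τ).deg (F.kerV τ w)))
    (𝓢 : Finset (Cone V)) (h𝓢 : Init σ l v 𝓢) : RFree (pb q) (F.secDeg (gen 𝓢)) := by
  suffices Hn : ∀ n, ∀ 𝓢 : Finset (Cone V), Init σ l v 𝓢 → 𝓢.card = n →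
    RFree (pb q) (F.secDeg (gen 𝓢)) from Hn _ 𝓢 h𝓢 rfl
  intro n
  induction n with
  | zero =>
    intro 𝓢 _ hn
    rw [Finset.card_eq_zero] at hn
    subst hn
    have h0 : ∀ x : F.Sec (gen ∅), x = 0 := fun x => Subtype.ext <| funext fun σ =>
      x.2.1 σ (by rintro ⟨τ, hτ, _⟩; simp at hτ)
    exact ⟨0, Fin.elim0, Fin.elim0, fun i => i.elim0, fun x => ⟨Fin.elim0, by rw [h0 x]; simp⟩,
      fun c _ => funext fun i => i.elim0⟩
  | succ n ih =>
    intro 𝓢 h𝓢 hn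
    have hne : 𝓢.Nonempty := by rw [← Finset.card_pos]; omega
    obtain ⟨τ, hτ, hmax⟩ := Finset.exists_max_image 𝓢 (kap σ l v) hne
    have hτf := h𝓢.sub τ hτ
    let t : Δ.cones := ⟨τ, hσ τ hτf⟩
    let 𝓢' := 𝓢.erase τ
    have hlt : ∀ τ' ∈ 𝓢', kap σ l v τ' < kap σ l v τ := fun τ' h' => by
      obtain ⟨h1, h2⟩ := Finset.mem_erase.1 h'
      exact lt_of_le_of_ne (hmax τ' h2) fun e => h1 (h𝓢.inj _ h2 _ hτ e)
    have h𝓢' : Init σ l v 𝓢' := by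
      refine ⟨fun τ' h' => h𝓢.sub _ (Finset.mem_of_mem_erase h'),
        fun τ' h' τ'' h'' => h𝓢.inj _ (Finset.mem_of_mem_erase h') _ (Finset.mem_of_mem_erase h''),
        fun τ' h' τ'' h'' hk => Finset.mem_erase.2 ⟨?_, h𝓢.initl _ (Finset.mem_of_mem_erase h') _ h'' hk⟩⟩
      rintro rfl
      exact absurd (hlt τ' h') (not_lt.2 hk.le)
    have hIH := ih 𝓢' h𝓢' (by rw [Finset.card_erase_of_mem hτ, hn]; rfl)
    have hsub : gen 𝓢' ⊆ gen 𝓢 := by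
      rintro ζ ⟨τ', h', hζ⟩
      exact ⟨τ', Finset.mem_of_mem_erase h', hζ⟩
    let p := pt σ l v τ
    have hp : p ∈ τ.spanC := pt_mem hIl hv hτf
    -- vanishing on old faces
    have hvan : ∀ x ∈ F.kerV t p, ∀ ζ : Δ.cones, ζ.1 ∈ gen 𝓢' → F.r t ζ x = 0 := by
      rintro x hx ζ ⟨τ', h', hζ'⟩
      by_cases hζ : ζ.1.IsFaceOf τ
      · obtain ⟨ρ, hρ, hζρ, hneg⟩ := shell_a hIl hv hτf (h𝓢'.sub _ h') hζ hζ' (hlt _ h')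
        let ρ' : Δ.cones := ⟨ρ, Δ.face_mem _ t.2 _ hρ.1⟩
        rw [← F.r_comp (σ := t) (τ := ρ') (υ := ζ) hρ.1 hζρ, mem_kerV.1 hx ρ' hρ hneg, map_zero]
      · rw [F.r_not (σ := t) hζ]; rfl
    have hsplit : ∀ ζ ∈ gen 𝓢, ζ.IsFaceOf τ ∨ ζ ∈ gen 𝓢' := by
      rintro ζ ⟨τ', h', hζ⟩
      by_cases e : τ' = τ
      · subst e; exact Or.inl hζ
      · exact Or.inr ⟨τ', Finset.mem_erase.2 ⟨e, h'⟩, hζ⟩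
    have hsec : ∀ x : F.kerV t p, (fun ζ => F.r t ζ x.1) ∈ F.secSub (gen 𝓢) := by
      intro x
      refine F.mem_sec.2 ⟨fun ζ hζ => ?_, fun ζ ξ hζ hξ h => ?_⟩
      · rw [F.r_not (σ := t) (fun h => hζ ⟨τ, hτ, h⟩)]; rfl
      · by_cases hζτ : ζ.1.IsFaceOf τ
        · exact F.r_comp (σ := t) hζτ h x.1
        · have h1 := (hsplit _ hζ).resolve_left hζτ
          show F.r ζ ξ (F.r t ζ x.1) = F.r t ξ x.1
          rw [hvan x.1 x.2 ζ h1, hvan x.1 x.2 ξ (gen_FC _ _ h1 _ h), map_zero]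
    let i : F.kerV t p →ₗ[PolyRing V] F.Sec (gen 𝓢) := LinearMap.codRestrict _
      (LinearMap.pi (fun ζ => F.r t ζ) ∘ₗ (F.kerV t p).subtype) hsec
    have hi : ∀ x ζ, (i x).1 ζ = F.r t ζ x.1 := fun x ζ => rfl
    refine RFree.ext (F.sec_grM _).gr (F.sec_grM _).gr
      ((hS2 t hτf p hp).toR (hq.facet hIl hτf).parR) hIH i ?_ ?_
      (F.resSec (gen 𝓢) (gen 𝓢') hsub) ?_ ?_ ?_
    · rw [injective_iff_map_eq_zero]
      intro x hx
      have := hi x t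
      rw [hx, F.r_self] at this
      exact Subtype.ext this.symm
    · intro e x hx ζ
      exact F.r_deg hx
    · intro s
      obtain ⟨s', hs', hss⟩ := hF.flab (gen_FC 𝓢') s.2
      refine ⟨F.resSec Set.univ _ (Set.subset_univ _) ⟨s', hs'⟩, ?_⟩
      apply Subtype.ext; funext ζ
      show (if ζ.1 ∈ gen 𝓢' then (if ζ.1 ∈ gen 𝓢 then s' ζ else 0) else 0) = s.1 ζ
      split_ifs with h1 h2
      · exact hss ζ h1
      · exact absurd (hsub h1) h2
      · exact (s.2.1 ζ h1).symm
    · intro e x hx ζ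
      show (if ζ.1 ∈ gen 𝓢' then x.1 ζ else 0) ∈ _
      split_ifs
      · exact hx ζ
      · exact zero_mem _
    · intro s
      constructor
      · intro h0
        have h0' : ∀ ζ : Δ.cones, ζ.1 ∈ gen 𝓢' → s.1 ζ = 0 := fun ζ hζ => by
          have := congrFun (congrArg Subtype.val h0) ζ
          have e : (if ζ.1 ∈ gen 𝓢' then s.1 ζ else 0) = 0 := this
          rwa [if_pos hζ] at e
        have hsm := F.mem_sec.1 s.2
        have htg : t.1 ∈ gen 𝓢 := ⟨τ, hτ, Cone.face_refl _⟩
        refine ⟨⟨s.1 t, mem_kerV.2 fun ρ hρ hneg => ?_⟩, ?_⟩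
        · obtain ⟨τ', h', hne', hρ'⟩ := exists_other hτf hρ
          have hk := shell_b hIl hτf h' hne' hρ hρ' hneg hv
          have hm : τ' ∈ 𝓢' := Finset.mem_erase.2 ⟨hne', h𝓢.initl _ hτ _ h' hk⟩
          rw [hsm.2 t ρ htg ⟨τ, hτ, hρ.1⟩ hρ.1]
          exact h0' ρ ⟨τ', hm, hρ'.1⟩
        · apply Subtype.ext; funext ζ
          show F.r t ζ (s.1 t) = s.1 ζ
          by_cases hζτ : ζ.1.IsFaceOf τ
          · exact hsm.2 t ζ htg ⟨τ, hτ, hζτ⟩ hζτ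
          · rw [F.r_not (σ := t) hζτ]
            by_cases hζ : ζ.1 ∈ gen 𝓢
            · rw [h0' ζ ((hsplit _ hζ).resolve_left hζτ)]; rfl
            · rw [hsm.1 ζ hζ]; rfl
      · rintro ⟨x, rfl⟩
        apply Subtype.ext; funext ζ
        show (if ζ.1 ∈ gen 𝓢' then F.r t ζ x.1 else 0) = 0
        split_ifs with h
        · exact hvan x.1 x.2 ζ h
        · rfl

lemma S2 (hF : F.Good) (σ : Δ.cones) : ∀ v ∈ σ.1.spanC,
    CFree (IV σ.1.spanC) (subD (F.stalk σ).deg (F.kerV σ v)) := by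
  suffices Hn : ∀ n, ∀ σ : Δ.cones, σ.1.dim = n → ∀ v ∈ σ.1.spanC,
      CFree (IV σ.1.spanC) (subD (F.stalk σ).deg (F.kerV σ v)) from Hn _ σ rfl
  intro n
  induction n using Nat.strong_induction_on with
  | _ n ih =>
  intro σ hn v hv
  have hfac : ∀ τ, IsFacet τ σ.1 → τ ∈ Δ.cones := fun τ h => Δ.face_mem _ σ.2 _ h.1
  let 𝓥 : Finset (Cone V) := (facets σ.1).filter fun τ => hl σ.1 τ v < 0
  have h𝓥 : ∀ τ, τ ∈ 𝓥 ↔ IsFacet τ σ.1 ∧ hl σ.1 τ v < 0 := fun τ => by simp [𝓥]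
  haveI := hF.finite σ
  haveI : IsNoetherian (PolyRing V) (F.stalk σ).M := isNoetherian_of_isNoetherianRing_of_finite _ _
  haveI : Module.Finite (PolyRing V) (F.kerV σ v) := inferInstance
  obtain ⟨hk, N, b, e, hb, hbs, hbr⟩ := hF.free σ
  by_cases hemp : 𝓥 = ∅
  · have htop : ∀ x, x ∈ F.kerV σ v := fun x => mem_kerV.2 fun τ hτ hneg => by
      have := (h𝓥 τ).2 ⟨hτ, hneg⟩
      rw [hemp] at this; simp at this
    refine ⟨fun a ha x => Subtype.ext (hk a ha x.1), N, fun i => ⟨b i, htop _⟩, e, hb, fun x => ?_,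
      fun c hc => hbr c ?_⟩
    · obtain ⟨c, hc⟩ := hbs x.1
      exact ⟨c, Subtype.ext (by rw [hc]; simp)⟩
    · have := congrArg Subtype.val hc
      simpa using this
  obtain ⟨τ0, hτ0⟩ := Finset.nonempty_iff_ne_empty.2 hemp
  rw [h𝓥] at hτ0
  obtain ⟨l, hIl, hgen⟩ := exists_generic σ.1 hv
  have hls := σ.1.mem_span hIl.1
  obtain ⟨H, q, T, hq, hT⟩ := exists_Par σ.1 hls (hIl.ne_zero hτ0.1)
  have hkap : ∀ τ, IsFacet τ σ.1 → (kap σ.1 l v τ < 0 ↔ hl σ.1 τ v < 0) := fun τ hτ => by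
    rw [kap, div_neg_iff]
    have := hIl.2 τ hτ
    constructor
    · rintro (h | h) <;> linarith [h.1, h.2]
    · intro h; exact Or.inr ⟨h, this⟩
  have hIn0 : Init σ.1 l v 𝓥 := by
    refine ⟨fun τ h => ((h𝓥 τ).1 h).1, fun τ h τ' h' he => ?_, fun τ h τ' h' hlt => ?_⟩
    · rw [h𝓥] at h h'; exact hgen τ τ' h.1 h'.1 h.2 h'.2 he
    · rw [h𝓥] at h ⊢
      exact ⟨h', (hkap τ' h').1 (hlt.trans ((hkap τ h.1).2 h.2))⟩
  obtain ⟨k, y, e', hy, hys, hyr⟩ := S1 hF hfac hIl hv hq (fun τ hτ w hw =>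
    ih τ.1.dim (by rw [← hn]; exact hτ.proper.dim_lt) τ rfl w hw) 𝓥 hIn0
  have hpar := hq.prod hls T (by rw [hT]; exact one_ne_zero)
  have hPR : ParR (thetaP q T) (IV σ.1.spanC) := ⟨thetaP_exists hpar, fun p hp => (thetaP_mem hpar).1 hp⟩
  refine L2 (φ := thetaP q T) ((F.stalk σ).grM.sub (kerV_gr σ v)) hPR
    (fun a ha x => Subtype.ext (hk a ha x.1)) ?_
  letI i1 := Module.compHom (F.stalk σ).M (thetaP q T)
  letI i2 := Module.compHom (F.Sec (gen 𝓥)) (thetaP q T)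
  letI i3 := Module.compHom (F.kerV σ v) (thetaP q T)
  have hfree : Module.Free (Polynomial (PolyRing H)) (F.stalk σ).M := by
    refine Module.Free.of_basis (ι := Fin N) (Module.Basis.mk (v := b) ?_ ?_)
    · rw [Fintype.linearIndependent_iff]
      intro c hc i
      exact hPR.inj _ (hbr (fun i => thetaP q T (c i)) hc i)
    · intro x _
      obtain ⟨c, rfl⟩ := hbs x
      refine Submodule.sum_mem _ fun i _ => ?_
      obtain ⟨r, hr⟩ := hPR.smul_eq hk (c i)
      rw [hr]
      exact Submodule.smul_mem _ r (Submodule.subset_span ⟨i, rfl⟩)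
  let la0 : (F.stalk σ).M →ₗ[PolyRing V] F.Sec (gen 𝓥) :=
    { toFun := fun x => ⟨fun ζ => if ζ.1 ∈ gen 𝓥 then F.r σ ζ x else 0, by
        refine F.mem_sec.2 ⟨fun ζ h => if_neg h, fun ζ ξ hζ hξ h => ?_⟩
        rw [if_pos hζ, if_pos hξ]
        obtain ⟨τ, hτ, hζτ⟩ := hζ
        exact F.r_comp (hζτ.trans ((h𝓥 τ).1 hτ).1.1) h x⟩
      map_add' := fun x y => Subtype.ext (funext fun ζ => by
        by_cases h : ζ.1 ∈ gen 𝓥 <;> simp [h])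
      map_smul' := fun c x => Subtype.ext (funext fun ζ => by
        by_cases h : ζ.1 ∈ gen 𝓥 <;> simp [h]) }
  have hla0 : ∀ x (ζ : Δ.cones), (la0 x).1 ζ = if ζ.1 ∈ gen 𝓥 then F.r σ ζ x else 0 := fun x ζ => rfl
  let la : (F.stalk σ).M →ₗ[Polynomial (PolyRing H)] F.Sec (gen 𝓥) :=
    { toFun := la0, map_add' := la0.map_add, map_smul' := fun c x => la0.map_smul (thetaP q T c) x }
  have hsurj : Surjective la := by
    intro s
    obtain ⟨s', hs', hss⟩ := hF.flab (gen_FC 𝓥) s.2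
    refine ⟨s' σ, Subtype.ext (funext fun ζ => ?_)⟩
    show (la0 _).1 ζ = _
    rw [hla0]
    split_ifs with h
    · rw [← hss ζ h]
      obtain ⟨τ, hτ, hζτ⟩ := h
      exact (F.mem_sec.1 hs').2 σ ζ trivial trivial (hζτ.trans ((h𝓥 τ).1 hτ).1.1)
    · exact (s.2.1 ζ h).symm
  have hker : ∀ x, la x = 0 ↔ x ∈ F.kerV σ v := by
    intro x
    rw [mem_kerV]
    constructor
    · intro h τ hτ hneg
      have h1 : (la0 x).1 τ = 0 := by
        have h2 : la0 x = 0 := h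
        rw [h2]; rfl
      rw [hla0, if_pos ⟨τ.1, (h𝓥 _).2 ⟨hτ, hneg⟩, Cone.face_refl _⟩] at h1
      exact h1
    · intro h
      apply Subtype.ext; funext ζ
      show (la0 x).1 ζ = 0
      rw [hla0]
      split_ifs with hζ
      · obtain ⟨τ, hτ, hζτ⟩ := hζ
        rw [h𝓥] at hτ
        rw [← F.r_comp (τ := ⟨τ, hfac _ hτ.1⟩) hτ.1.1 hζτ, h ⟨τ, hfac _ hτ.1⟩ hτ.1 hτ.2, map_zero]
      · rfl
  haveI hproj : Module.Projective (Polynomial (PolyRing H)) (LinearMap.ker la) := by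
    refine L3 la hsurj y (fun x => ?_) (fun c hc => hyr c ?_)
    · obtain ⟨c, hc⟩ := hys x
      refine ⟨c, hc.trans (Finset.sum_congr rfl fun i _ => ?_)⟩
      show _ = thetaP q T (Polynomial.C (c i)) • y i
      rw [thetaP_C]
    · rw [← hc]
      refine Finset.sum_congr rfl fun i _ => ?_
      show _ = thetaP q T (Polynomial.C (c i)) • y i
      rw [thetaP_C]
  let eq : LinearMap.ker la ≃ₗ[Polynomial (PolyRing H)] F.kerV σ v :=
    { toFun := fun x => ⟨x.1, (hker x.1).1 x.2⟩
      invFun := fun x => ⟨x.1, (hker x.1).2 x.2⟩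
      left_inv := fun x => rfl
      right_inv := fun x => rfl
      map_add' := fun x y => rfl
      map_smul' := fun c x => rfl }
  exact Module.Projective.of_equiv eq

end FanSheaf
end free

/-! ### Quotient rings, kernels, and the gluing lemma -/

section quot
variable {V : Type} [AddCommGroup V] [Module ℝ V]

/-- polynomial functions on a subspace -/
abbrev AQ (U : Submodule ℝ V) : Type := PolyRing V ⧸ IV U

section instq
variable {U : Submodule ℝ V} {K : Type} [AddCommGroup K] [Module (PolyRing V) K]
@[reducible] def AQ_module : Module (PolyRing V) (AQ U) := Submodule.Quotient.module (IV U)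
@[reducible] def AQ_acm : AddCommMonoid (AQ U) := Submodule.Quotient.addCommMonoid (IV U)
@[reducible] def AQ_smul : SMul (PolyRing V) (AQ U) := Submodule.Quotient.instSMul (IV U)
@[reducible] def AQ_rmodule : Module ℝ (AQ U) := Submodule.Quotient.module' (IV U)
@[reducible] def AQ_rsmul : SMul ℝ (AQ U) := Submodule.Quotient.instSMul' (IV U)
lemma AQ_scc : SMulCommClass (PolyRing V) (PolyRing V) (AQ U) := inferInstance
lemma AQ_tower : IsScalarTower ℝ (PolyRing V) (AQ U) := inferInstance
@[reducible] def AQ_hmodule : Module (PolyRing V) (K →ₗ[PolyRing V] AQ U) := LinearMap.module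
@[reducible] def AQ_hsmul : SMul (PolyRing V) (K →ₗ[PolyRing V] AQ U) := LinearMap.instSMul
end instq
end quot

attribute [local instance] AQ_module AQ_acm AQ_smul AQ_rmodule AQ_rsmul AQ_scc AQ_tower AQ_hmodule AQ_hsmul

section quot
variable {V : Type} [AddCommGroup V] [Module ℝ V]

def mkA (U : Submodule ℝ V) (a : PolyRing V) : AQ U := Ideal.Quotient.mk (IV U) a

def qv {U : Submodule ℝ V} (a : AQ U) (x : V) : ℝ :=
  ((Ideal.Quotient.mk_surjective a).choose : PolyRing V).1 x

variable {U W : Submodule ℝ V}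

lemma mkA_surj (a : AQ U) : ∃ p, mkA U p = a := Ideal.Quotient.mk_surjective a

lemma mkA_eq {a b : PolyRing V} : mkA U a = mkA U b ↔ a - b ∈ IV U := Ideal.Quotient.eq

lemma mkA_eq' {a b : PolyRing V} : mkA U a = mkA U b ↔ ∀ x ∈ U, a.1 x = b.1 x := by
  rw [mkA_eq, mem_IV]
  simp only [poly_sub, sub_eq_zero]

lemma qv_mk (p : PolyRing V) {x : V} (hx : x ∈ U) : qv (mkA U p) x = p.1 x := by
  have := (Ideal.Quotient.mk_surjective (mkA U p)).choose_spec
  exact mkA_eq'.1 this x hx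

lemma mkA_add (a b : PolyRing V) : mkA U (a + b) = mkA U a + mkA U b := rfl
lemma mkA_mul (a b : PolyRing V) : mkA U (a * b) = mkA U a * mkA U b := rfl
lemma mkA_smul (a b : PolyRing V) : a • mkA U b = mkA U (a * b) := rfl
lemma mkA_zero : mkA U 0 = 0 := rfl

lemma mkA_zero_iff {a : PolyRing V} : mkA U a = 0 ↔ a ∈ IV U := Ideal.Quotient.eq_zero_iff_mem

lemma AQ_kill {a : PolyRing V} (ha : a ∈ IV U) (x : AQ U) : a • x = 0 := by
  obtain ⟨p, rfl⟩ := mkA_surj x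
  rw [mkA_smul, mkA_zero_iff]
  exact Ideal.mul_mem_right _ _ ha

lemma qv_add (a b : AQ U) {x : V} (hx : x ∈ U) : qv (a + b) x = qv a x + qv b x := by
  obtain ⟨p, rfl⟩ := mkA_surj a
  obtain ⟨p', rfl⟩ := mkA_surj b
  rw [← mkA_add, qv_mk _ hx, qv_mk _ hx, qv_mk _ hx, poly_add]

lemma qv_smul (a : PolyRing V) (b : AQ U) {x : V} (hx : x ∈ U) : qv (a • b) x = a.1 x * qv b x := by
  obtain ⟨p', rfl⟩ := mkA_surj b
  rw [mkA_smul, qv_mk _ hx, qv_mk _ hx, poly_mul]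

lemma qv_zero {x : V} (hx : x ∈ U) : qv (0 : AQ U) x = 0 := by
  rw [← mkA_zero, qv_mk _ hx, poly_zero]

lemma qv_sum {ι : Type*} (s : Finset ι) (a : ι → AQ U) {x : V} (hx : x ∈ U) :
    qv (∑ i ∈ s, a i) x = ∑ i ∈ s, qv (a i) x := by
  induction s using Finset.induction_on with
  | empty => simp [qv_zero hx]
  | insert i s hi ih => rw [Finset.sum_insert hi, Finset.sum_insert hi, qv_add _ _ hx, ih]

lemma qv_rsmul (c : ℝ) (b : AQ U) {x : V} (hx : x ∈ U) : qv (c • b) x = c * qv b x := by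
  rw [← algebraMap_smul (PolyRing V) c b, qv_smul _ _ hx, poly_algebraMap]

lemma qv_ext {a b : AQ U} (h : ∀ x ∈ U, qv a x = qv b x) : a = b := by
  obtain ⟨p, rfl⟩ := mkA_surj a
  obtain ⟨p', rfl⟩ := mkA_surj b
  rw [mkA_eq']
  intro x hx
  rw [← qv_mk p hx, ← qv_mk p' hx, h x hx]

instance AQ_domain (U : Submodule ℝ V) : IsDomain (AQ U) :=
  (Ideal.Quotient.isDomain_iff_prime _).2 (IV_prime U)

def AD (U : Submodule ℝ V) (q : ℤ) : Submodule ℝ (AQ U) :=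
  (Adeg V q).map (Ideal.Quotient.mkₐ ℝ (IV U)).toLinearMap

lemma mem_AD {q : ℤ} {a : AQ U} : a ∈ AD U q ↔ ∃ p ∈ Adeg V q, mkA U p = a := Iff.rfl

lemma IV_gr {a : PolyRing V} (ha : a ∈ IV U) (q : ℤ) : pr (Adeg V) q a ∈ IV U := by
  rw [mem_IV] at *
  intro x hx
  obtain ⟨s, hs⟩ := pr_sum gr_A a
  have h1 : ∀ (p : ℤ) (t : ℝ), (pr (Adeg V) p a).1 (t • x) = t ^ (p / 2).toNat * (pr (Adeg V) p a).1 x := by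
    intro p t
    rcases mem_Adeg.1 (pr_mem gr_A p a) with h | ⟨k, rfl, hk⟩
    · rw [h]; simp
    · have : ((2 * (k : ℤ)) / 2).toNat = k := by omega
      rw [this]; exact hk t x
  -- pass to polynomials in t
  let t0 := insert q s
  let P : Polynomial ℝ := ∑ p ∈ t0, Polynomial.C ((pr (Adeg V) p a).1 x) * Polynomial.X ^ (p / 2).toNat
  have hP : P = 0 := by
    apply poly_zero_of_large 0
    intro t _
    have e := congrArg (fun b : PolyRing V => b.1 (t • x)) (hs t0 (Finset.subset_insert _ _))
    simp only [poly_sum] at e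
    rw [ha _ (U.smul_mem t hx)] at e
    simp only [P, Polynomial.eval_finsetSum, Polynomial.eval_mul, Polynomial.eval_C, Polynomial.eval_pow,
      Polynomial.eval_X]
    rw [e]
    exact Finset.sum_congr rfl fun p _ => by rw [h1, mul_comm]
  rcases mem_Adeg.1 (pr_mem gr_A q a) with h | ⟨k, rfl, hk⟩
  · rw [h]; simp
  have e := congrArg (fun b : Polynomial ℝ => b.coeff k) hP
  simp only [P, Polynomial.finset_sum_coeff, Polynomial.coeff_C_mul_X_pow, Polynomial.coeff_zero] at e
  rw [Finset.sum_eq_single (2 * (k : ℤ))] at e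
  · rwa [if_pos (by omega)] at e
  · intro p _ hp
    split_ifs with h
    · rcases mem_Adeg.1 (pr_mem gr_A p a) with h' | ⟨k', rfl, hk'⟩
      · rw [h']; simp
      · exfalso; apply hp; omega
    · rfl
  · intro h; exact absurd (Finset.mem_insert_self _ _) h

lemma AD_gr (U : Submodule ℝ V) : GrM V (AD U) := by
  refine ⟨Gr.map gr_A _ (Ideal.Quotient.mk_surjective) fun x hx q => ?_, ?_⟩
  · exact mkA_zero_iff.2 (IV_gr (mkA_zero_iff.1 hx) q)
  · rintro p q a ha _ ⟨b, hb, rfl⟩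
    exact ⟨a * b, Adeg_mul ha hb, rfl⟩

/-- restriction of functions -/
def fac (h : U ≤ W) : AQ W →ₗ[PolyRing V] AQ U where
  toFun := Ideal.Quotient.factor (IV_mono h)
  map_add' := map_add _
  map_smul' := fun a x => by
    obtain ⟨p, rfl⟩ := mkA_surj x
    rfl

lemma fac_mk (h : U ≤ W) (p : PolyRing V) : fac h (mkA W p) = mkA U p := rfl

lemma qv_fac (h : U ≤ W) (a : AQ W) {x : V} (hx : x ∈ U) : qv (fac h a) x = qv a x := by
  obtain ⟨p, rfl⟩ := mkA_surj a
  rw [fac_mk, qv_mk _ hx, qv_mk _ (h hx)]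

lemma fac_deg (h : U ≤ W) {q : ℤ} {a : AQ W} (ha : a ∈ AD W q) : fac h a ∈ AD U q := by
  obtain ⟨p, hp, rfl⟩ := ha
  exact ⟨p, hp, rfl⟩

lemma fac_pr (h : U ≤ W) (q : ℤ) (a : AQ W) : fac h (pr (AD W) q a) = pr (AD U) q (fac h a) :=
  (pr_comm0 (AD_gr W).gr (AD_gr U).gr (fac h).toAddMonoidHom (fun _ _ h' => fac_deg h h') q a).symm

lemma fac_eq (h : U ≤ W) {a : AQ W} {b : AQ U} (hh : ∀ x ∈ U, qv a x = qv b x) : fac h a = b :=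
  qv_ext fun x hx => by rw [qv_fac h a hx, hh x hx]

end quot

section glue
variable {V : Type} [AddCommGroup V] [Module ℝ V] [FiniteDimensional ℝ V]

namespace FanSheaf
variable {Δ : Fan V} {F : FanSheaf Δ}

def bd (σ : Cone V) : Set (Cone V) := {ζ | ζ.IsProperFaceOf σ}

def K (F : FanSheaf Δ) (τ : Δ.cones) : Submodule (PolyRing V) (F.stalk τ).M :=
  ⨅ ρ : {ρ : Δ.cones // IsFacet ρ.1 τ.1}, LinearMap.ker (F.r τ ρ.1)

def W (F : FanSheaf Δ) (σ τ : Δ.cones) : Submodule (PolyRing V) (F.stalk σ).M :=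
  ⨅ ρ : {ρ : Δ.cones // IsFacet ρ.1 σ.1 ∧ ρ ≠ τ}, LinearMap.ker (F.r σ ρ.1)

lemma mem_K {τ : Δ.cones} {x : (F.stalk τ).M} : x ∈ F.K τ ↔
    ∀ ρ : Δ.cones, IsFacet ρ.1 τ.1 → F.r τ ρ x = 0 := by
  simp [K]

lemma mem_W {σ τ : Δ.cones} {x : (F.stalk σ).M} : x ∈ F.W σ τ ↔
    ∀ ρ : Δ.cones, IsFacet ρ.1 σ.1 → ρ ≠ τ → F.r σ ρ x = 0 := by
  simp [W]

lemma K_gr (τ : Δ.cones) : GrSub (F.stalk τ).deg (F.K τ) := by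
  intro x hx q
  rw [mem_K] at *
  intro τ hτ
  rw [F.r_pr, hx τ hτ, map_zero]

lemma W_gr (σ τ : Δ.cones) : GrSub (F.stalk σ).deg (F.W σ τ) := by
  intro x hx q
  rw [mem_W] at *
  intro τ hτ hne
  rw [F.r_pr, hx τ hτ hne, map_zero]

lemma K_zero {τ ζ : Δ.cones} {x : (F.stalk τ).M} (hx : x ∈ F.K τ) (hne : ζ ≠ τ) : F.r τ ζ x = 0 := by
  by_cases h : ζ.1.IsFaceOf τ.1
  · obtain ⟨ρ, hρ, hζ⟩ := exists_facet_of_proper (ζ := ζ.1) (σ := τ.1) ⟨h, fun e => hne (Subtype.ext e)⟩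
    rw [← F.r_comp (τ := ⟨ρ, Δ.face_mem _ τ.2 _ hρ.1⟩) hρ.1 hζ, mem_K.1 hx _ hρ, map_zero]
  · rw [F.r_not h]; rfl

lemma W_zero {σ τ ζ : Δ.cones} {x : (F.stalk σ).M} (hx : x ∈ F.W σ τ) (hne : ζ ≠ σ)
    (hn : ¬ ζ.1.IsFaceOf τ.1) : F.r σ ζ x = 0 := by
  by_cases h : ζ.1.IsFaceOf σ.1
  · obtain ⟨ρ, hρ, hζ⟩ := exists_facet_of_proper (ζ := ζ.1) (σ := σ.1) ⟨h, fun e => hne (Subtype.ext e)⟩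
    rw [← F.r_comp (τ := ⟨ρ, Δ.face_mem _ σ.2 _ hρ.1⟩) hρ.1 hζ, mem_W.1 hx _ hρ, map_zero]
    rintro rfl
    exact hn hζ
  · rw [F.r_not h]; rfl

lemma facet_of_face_facet {σ τ τ' : Cone V} (h : IsFacet τ σ) (h' : IsFacet τ' σ) (hh : τ.IsFaceOf τ') :
    τ = τ' := by
  by_contra hne
  have := Cone.IsProperFaceOf.dim_lt (ζ := τ) (σ := τ') ⟨hh, hne⟩
  have h1 := h.2
  have h2 := h'.2
  omega

/-- extension by zero -/
lemma ext_sec {σ : Cone V} {τ : Δ.cones} (h : IsFacet τ.1 σ) {k : (F.stalk τ).M} (hk : k ∈ F.K τ) :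
    (fun ζ => F.r τ ζ k) ∈ F.secSub (bd σ) := by
  refine F.mem_sec.2 ⟨fun ζ hζ => K_zero hk ?_, fun ζ ξ hζ hξ hf => ?_⟩
  · rintro rfl; exact hζ h.proper
  · by_cases e : ζ = τ
    · subst e; rw [F.r_self]
    · rw [K_zero hk e, map_zero, K_zero hk]
      rintro rfl
      have h1 := Cone.IsProperFaceOf.dim_lt (ζ := ξ.1) (σ := ζ.1) ⟨hf, fun e' => e (Subtype.ext e').symm⟩
      have h2 := Cone.IsProperFaceOf.dim_lt (ζ := ζ.1) (σ := σ) hζ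
      have h3 := h.2
      omega

def ext (F : FanSheaf Δ) {σ : Cone V} {τ : Δ.cones} (h : IsFacet τ.1 σ) : F.K τ →ₗ[PolyRing V] F.Sec (bd σ) where
  toFun k := ⟨fun ζ => F.r τ ζ k.1, ext_sec h k.2⟩
  map_add' := fun x y => Subtype.ext (funext fun ζ => map_add _ _ _)
  map_smul' := fun c x => Subtype.ext (funext fun ζ => map_smul _ _ _)

lemma ext_apply {σ : Cone V} {τ : Δ.cones} (h : IsFacet τ.1 σ) (k : F.K τ) (ζ : Δ.cones) :
    (F.ext h k).1 ζ = F.r τ ζ k.1 := rfl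

lemma rT_mem {σ τ : Δ.cones} (h : IsFacet τ.1 σ.1) {w : (F.stalk σ).M} (hw : w ∈ F.W σ τ) :
    F.r σ τ w ∈ F.K τ := mem_K.2 fun ρ hρ => by
  obtain ⟨τ', h', hne, hρ'⟩ := exists_other h hρ
  rw [F.r_comp h.1 hρ.1, ← F.r_comp (τ := ⟨τ', Δ.face_mem _ σ.2 _ h'.1⟩) h'.1 hρ'.1,
    mem_W.1 hw ⟨τ', Δ.face_mem _ σ.2 _ h'.1⟩ h' (fun e => hne (congrArg Subtype.val e)), map_zero]

def rT (F : FanSheaf Δ) {σ τ : Δ.cones} (h : IsFacet τ.1 σ.1) : F.W σ τ →ₗ[PolyRing V] F.K τ :=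
  ((F.r σ τ).comp (F.W σ τ).subtype).codRestrict _ fun w => rT_mem h w.2

lemma rT_val {σ τ : Δ.cones} (h : IsFacet τ.1 σ.1) (w : F.W σ τ) : (F.rT h w).1 = F.r σ τ w.1 := rfl

lemma rT_surj (hF : F.Good) {σ τ : Δ.cones} (h : IsFacet τ.1 σ.1) : Surjective (F.rT h) := by
  intro k
  obtain ⟨x, hx⟩ := hF.surj σ _ (ext_sec h k.2)
  refine ⟨⟨x, mem_W.2 fun ρ hρ hne => ?_⟩, Subtype.ext ?_⟩
  · rw [hx ρ hρ.proper, K_zero k.2 hne]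
  · rw [rT_val, hx τ h.proper, F.r_self]

lemma linP_hl_mem {σ τ : Cone V} (h : IsFacet τ σ) : linP (hl σ τ) ∈ IV τ.spanC :=
  mem_IV.2 fun x hx => by rw [linP_apply]; exact hl_zero h hx

def mH (hF : F.Good) {σ τ : Δ.cones} (h : IsFacet τ.1 σ.1) : F.W σ τ →ₗ[PolyRing V] F.K σ :=
  (LinearMap.lsmul _ _ (linP (hl σ.1 τ.1)) ∘ₗ (F.W σ τ).subtype).codRestrict _ fun w => mem_K.2 fun ρ hρ => by
    show F.r σ ρ (linP (hl σ.1 τ.1) • w.1) = 0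
    rw [map_smul]
    by_cases e : ρ = τ
    · subst e; exact hF.kill _ (linP_hl_mem h) _
    · rw [mem_W.1 w.2 ρ hρ e, smul_zero]

lemma mH_val (hF : F.Good) {σ τ : Δ.cones} (h : IsFacet τ.1 σ.1) (w : F.W σ τ) :
    (mH hF h w).1 = linP (hl σ.1 τ.1) • w.1 := rfl

/-- compatibility of a family of functionals on facets -/
def Compat (hF : F.Good) (σ : Cone V) (v : ∀ τ : Δ.cones, F.K τ →ₗ[PolyRing V] AQ τ.1.spanC) : Prop :=
  ∀ (τ τ' ρ : Δ.cones) (h : IsFacet τ.1 σ) (h' : IsFacet τ'.1 σ) (hne : τ' ≠ τ) (hρ : IsFacet ρ.1 τ.1)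
    (hρ' : IsFacet ρ.1 τ'.1) (w : F.W τ ρ) (w' : F.W τ' ρ), F.rT hρ w = F.rT hρ' w' →
    ∀ x ∈ ρ.1.spanC, qv (v τ (mH hF hρ w)) x = qv (v τ' (mH hF hρ' w')) x

def ResEq (hF : F.Good) (σ : Δ.cones) (u : F.K σ →ₗ[PolyRing V] AQ σ.1.spanC)
    (v : ∀ τ : Δ.cones, F.K τ →ₗ[PolyRing V] AQ τ.1.spanC) : Prop :=
  ∀ (τ : Δ.cones) (h : IsFacet τ.1 σ.1) (w : F.W σ τ), ∀ x ∈ τ.1.spanC,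
    qv (u (mH hF h w)) x = qv (v τ (F.rT h w)) x

variable {E G : FanSheaf Δ}

structure Dual (hG : G.Good) (n : ℕ)
    (D : ∀ τ : Δ.cones, (E.stalk τ).M →ₗ[PolyRing V] G.K τ →ₗ[PolyRing V] AQ τ.1.spanC) : Prop where
  inj : ∀ τ, τ.1.dim ≤ n → ∀ x, D τ x = 0 → x = 0
  surj : ∀ τ, τ.1.dim ≤ n → ∀ u, ∃ x, D τ x = u
  deg : ∀ τ, τ.1.dim ≤ n → ∀ p q : ℤ, ∀ x ∈ (E.stalk τ).deg p, ∀ y : G.K τ, y.1 ∈ (G.stalk τ).deg q →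
    D τ x y ∈ AD τ.1.spanC (p + q - 2 * τ.1.dim)
  res : ∀ τ, τ.1.dim ≤ n → ∀ x, ResEq hG τ (D τ x) (fun ρ => D ρ (E.r τ ρ x))

lemma exists_order (σ : Cone V) : ∃ l v, IsInt σ l ∧ v ∈ σ.spanC ∧
    ∀ τ τ', IsFacet τ σ → IsFacet τ' σ → kap σ l v τ = kap σ l v τ' → τ = τ' := by
  obtain ⟨l0, h0⟩ := exists_int σ
  obtain ⟨l, hl, hg⟩ := exists_generic σ (v := -l0) (neg_mem (σ.mem_span h0.1))
  refine ⟨l, -l0, hl, neg_mem (σ.mem_span h0.1), fun τ τ' h h' => hg τ τ' h h' ?_ ?_⟩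
  · rw [map_neg]; exact neg_lt_zero.2 (h0.2 τ h)
  · rw [map_neg]; exact neg_lt_zero.2 (h0.2 τ' h')

/-- a family on facets agreeing in codimension two glues -/
lemma glue_sec {σ : Cone V} (hσ : ∀ ζ, ζ.IsProperFaceOf σ → ζ ∈ Δ.cones) (x : ∀ τ : Δ.cones, (E.stalk τ).M)
    (hx : ∀ τ τ' ρ : Δ.cones, IsFacet τ.1 σ → IsFacet τ'.1 σ → τ' ≠ τ → IsFacet ρ.1 τ.1 → IsFacet ρ.1 τ'.1 →
      E.r τ ρ (x τ) = E.r τ' ρ (x τ')) :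
    ∃ s : E.Sec (bd σ), ∀ τ : Δ.cones, IsFacet τ.1 σ → s.1 τ = x τ := by
  obtain ⟨l, v, hIl, hv, hord⟩ := exists_order σ
  have key : ∀ (ζ τ τ' : Δ.cones), IsFacet τ.1 σ → IsFacet τ'.1 σ → ζ.1.IsFaceOf τ.1 → ζ.1.IsFaceOf τ'.1 →
      E.r τ ζ (x τ) = E.r τ' ζ (x τ') := by
    intro ζ
    by_contra hcon
    push Not at hcon
    obtain ⟨τ0, τ1, h0, h1, hζ0, hζ1, hne⟩ := hcon
    let S0 : Set Δ.cones := {τ | IsFacet τ.1 σ ∧ ζ.1.IsFaceOf τ.1}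
    obtain ⟨τm, hm, hmin⟩ := Set.exists_min_image S0 (fun τ => kap σ l v τ.1) (Set.toFinite _) ⟨τ0, h0, hζ0⟩
    let S1 : Set Δ.cones := {τ | τ ∈ S0 ∧ E.r τ ζ (x τ) ≠ E.r τm ζ (x τm)}
    have hS1 : S1.Nonempty := by
      by_contra hemp
      rw [Set.not_nonempty_iff_eq_empty] at hemp
      have hall : ∀ τ ∈ S0, E.r τ ζ (x τ) = E.r τm ζ (x τm) := fun τ hτ => by
        by_contra h
        have : τ ∈ S1 := ⟨hτ, h⟩
        rw [hemp] at this; exact this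
      exact hne ((hall τ0 ⟨h0, hζ0⟩).trans (hall τ1 ⟨h1, hζ1⟩).symm)
    obtain ⟨τ, ⟨⟨hτ, hζτ⟩, hτne⟩, hτmin⟩ := Set.exists_min_image S1 (fun τ => kap σ l v τ.1) (Set.toFinite _) hS1
    have hlt : kap σ l v τm.1 < kap σ l v τ.1 := by
      refine lt_of_le_of_ne (hmin τ ⟨hτ, hζτ⟩) fun e => hτne ?_
      have := Subtype.ext (hord _ _ hm.1 hτ e)
      subst this; rfl
    obtain ⟨ρ, hρ, hζρ, hneg⟩ := shell_a hIl hv hτ hm.1 hζτ hm.2 hlt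
    obtain ⟨τ'', h'', hne'', hρ''⟩ := exists_other hτ hρ
    have hk := shell_b hIl hτ h'' hne'' hρ hρ'' hneg hv
    let t : Δ.cones := ⟨τ'', hσ _ h''.proper⟩
    let ρ' : Δ.cones := ⟨ρ, Δ.face_mem _ τ.2 _ hρ.1⟩
    have e1 : E.r τ ζ (x τ) = E.r t ζ (x t) := by
      rw [← E.r_comp (σ := τ) (τ := ρ') hρ.1 hζρ, ← E.r_comp (σ := t) (τ := ρ') hρ''.1 hζρ,
        hx τ t ρ' hτ h'' (fun e => hne'' (congrArg Subtype.val e)) hρ hρ'']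
    have ht : t ∉ S1 := fun h => absurd (hτmin t h) (not_le.2 hk)
    apply ht
    exact ⟨⟨h'', hζρ.trans hρ''.1⟩, e1 ▸ hτne⟩
  have hch : ∀ ζ : Δ.cones, ∃ τ : Δ.cones, ζ.1 ∈ bd σ → IsFacet τ.1 σ ∧ ζ.1.IsFaceOf τ.1 := fun ζ => by
    by_cases h : ζ.1 ∈ bd σ
    · obtain ⟨τ, hτ, hζ⟩ := exists_facet_of_proper h
      exact ⟨⟨τ, hσ _ hτ.proper⟩, fun _ => ⟨hτ, hζ⟩⟩
    · exact ⟨ζ, fun h' => absurd h' h⟩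
  choose t ht using hch
  refine ⟨⟨fun ζ => if ζ.1 ∈ bd σ then E.r (t ζ) ζ (x (t ζ)) else 0,
    E.mem_sec.2 ⟨fun ζ h => if_neg h, fun ζ ξ hζ hξ h => ?_⟩⟩, fun τ hτ => ?_⟩
  · rw [if_pos hζ, if_pos hξ, E.r_comp (ht ζ hζ).2 h]
    exact key ξ _ _ (ht ζ hζ).1 (ht ξ hξ).1 (h.trans (ht ζ hζ).2) (ht ξ hξ).2
  · show (if τ.1 ∈ bd σ then E.r (t τ) τ (x (t τ)) else 0) = x τ
    have hb : τ.1 ∈ bd σ := hτ.proper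
    rw [if_pos hb, key τ (t τ) τ (ht τ hb).1 hτ (ht τ hb).2 (Cone.face_refl _), E.r_self]

lemma KC (hG : G.Good) {n : ℕ}
    {D : ∀ τ : Δ.cones, (E.stalk τ).M →ₗ[PolyRing V] G.K τ →ₗ[PolyRing V] AQ τ.1.spanC}
    (hD : Dual hG n D) {σ : Cone V} (hσ : ∀ ζ, ζ.IsProperFaceOf σ → ζ ∈ Δ.cones) (hdim : σ.dim = n + 1)
    {v : ∀ τ : Δ.cones, G.K τ →ₗ[PolyRing V] AQ τ.1.spanC} (hv : Compat hG σ v) :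
    ∃ s : E.Sec (bd σ), ∀ τ : Δ.cones, IsFacet τ.1 σ → D τ (s.1 τ) = v τ := by
  have hex : ∀ τ : Δ.cones, ∃ x, IsFacet τ.1 σ → D τ x = v τ := fun τ => by
    by_cases h : IsFacet τ.1 σ
    · obtain ⟨x, hx⟩ := hD.surj τ (by have := h.2; omega) (v τ)
      exact ⟨x, fun _ => hx⟩
    · exact ⟨0, fun h' => absurd h' h⟩
  choose x hx using hex
  obtain ⟨s, hs⟩ := glue_sec (E := E) hσ x (by
    intro τ τ' ρ h h' hne hρ hρ'
    rw [← sub_eq_zero]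
    apply hD.inj ρ (by have := h.2; have := hρ.2; omega)
    ext k
    obtain ⟨w, hw⟩ := rT_surj hG hρ k
    obtain ⟨w', hw'⟩ := rT_surj hG hρ' k
    rw [map_sub, LinearMap.sub_apply, LinearMap.zero_apply, sub_eq_zero]
    apply qv_ext
    intro z hz
    have h1 := hD.res τ (by have := h.2; omega) (x τ) ρ hρ w z hz
    have h2 := hD.res τ' (by have := h'.2; omega) (x τ') ρ hρ' w' z hz
    have h3 := hv τ τ' ρ h h' hne hρ hρ' w w' (hw.trans hw'.symm) z hz
    rw [hx τ h, hw] at h1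
    rw [hx τ' h', hw'] at h2
    rw [← h1, ← h2, h3])
  exact ⟨s, fun τ hτ => by rw [hs τ hτ, hx τ hτ]⟩

end FanSheaf
end glue

/-! ### Extending functionals to the boundary -/

section bdry
variable {V : Type} [AddCommGroup V] [Module ℝ V]
variable {H : Type} [AddCommGroup H] [Module ℝ H]

lemma Adeg_prod {ι : Type} (s : Finset ι) (a : ι → PolyRing H) (h : ∀ i ∈ s, a i ∈ Adeg H 2) :
    ∏ i ∈ s, a i ∈ Adeg H (2 * (s.card : ℤ)) := by
  induction s using Finset.induction_on with
  | empty =>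
    simp only [Finset.prod_empty, Finset.card_empty]
    have := algebraMap_deg (V := H) 1
    simpa using this
  | insert i s hi ih =>
    rw [Finset.prod_insert hi, Finset.card_insert_of_notMem hi]
    have := Adeg_mul (h i (Finset.mem_insert_self _ _)) (ih fun j hj => h j (Finset.mem_insert_of_mem hj))
    convert this using 1
    push_cast; ring

lemma Adeg_div {f a : PolyRing H} {e d : ℤ} (hf : f ∈ Adeg H e) (hf0 : f ≠ 0) (h : f * a ∈ Adeg H (e + d)) :
    a ∈ Adeg H d := by
  apply gr_mem gr_A
  intro q' hq
  have h1 := pr_smul_right grM_A hf a (e + q')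
  rw [smul_eq_mul, pr_of_ne gr_A h (by omega), add_sub_cancel_left, smul_eq_mul] at h1
  exact (mul_eq_zero.1 h1.symm).resolve_left hf0

lemma linP_dvd {f g : H →ₗ[ℝ] ℝ} (hf : f ≠ 0) (hg : g ≠ 0) (h : linP f ∣ linP g) : ∃ c : ℝ, c ≠ 0 ∧ g = c • f := by
  obtain ⟨n, hn⟩ : ∃ n, f n ≠ 0 := by
    by_contra hc; push Not at hc; exact hf (LinearMap.ext hc)
  obtain ⟨a, ha⟩ := h
  have hz : ∀ x, f x = 0 → g x = 0 := fun x hx => by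
    have := congrArg (fun b : PolyRing H => b.1 x) ha
    simp only [poly_mul, linP_apply, hx, zero_mul] at this
    exact this
  have e : g = (g n / f n) • f := by
    ext x
    have := hz (x - (f x / f n) • n) (by rw [map_sub, map_smul, smul_eq_mul, div_mul_cancel₀ _ hn, sub_self])
    rw [map_sub, map_smul, smul_eq_mul, sub_eq_zero] at this
    rw [this, LinearMap.smul_apply, smul_eq_mul]
    field_simp
  refine ⟨_, ?_, e⟩
  intro h0
  rw [h0, zero_smul] at e
  exact hg e

lemma linP_ne {f : H →ₗ[ℝ] ℝ} (hf : f ≠ 0) : linP f ≠ 0 := fun h => hf (LinearMap.ext fun x => by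
  have := congrArg (fun b : PolyRing H => b.1 x) h
  simpa using this)

lemma linP_dvd_of {f : H →ₗ[ℝ] ℝ} (hf : f ≠ 0) {a : PolyRing H} (h : ∀ x, f x = 0 → a.1 x = 0) : linP f ∣ a := by
  obtain ⟨n, hn⟩ : ∃ n, f n ≠ 0 := by
    by_contra hc; push Not at hc; exact hf (LinearMap.ext hc)
  obtain ⟨b, hb⟩ := IV_div ⊤ f ((f n)⁻¹ • n) trivial (by rw [map_smul, smul_eq_mul, inv_mul_cancel₀ hn]) a
    (fun x _ => h x)
  rw [IV_top, Ideal.mem_bot, sub_eq_zero] at hb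
  exact ⟨b, hb⟩

lemma linP_prime {f : H →ₗ[ℝ] ℝ} (hf : f ≠ 0) : Prime (linP f) := by
  refine ⟨linP_ne hf, fun hu => ?_, fun a b hab => ?_⟩
  · obtain ⟨b, hb⟩ := hu.exists_left_inv
    have := congrArg (fun b : PolyRing H => b.1 0) hb
    simp at this
  · have hp := IV_prime (LinearMap.ker f)
    have : a * b ∈ IV (LinearMap.ker f) := mem_IV.2 fun x hx => by
      obtain ⟨c, hc⟩ := hab
      rw [hc, poly_mul, linP_apply, LinearMap.mem_ker.1 hx, zero_mul]
    rcases hp.mem_or_mem this with h | h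
    · exact Or.inl (linP_dvd_of hf fun x hx => mem_IV.1 h x hx)
    · exact Or.inr (linP_dvd_of hf fun x hx => mem_IV.1 h x hx)

/-- transport of functions on `U` to `H` -/
def jj (q : V →ₗ[ℝ] H) (U : Submodule ℝ V) (a : AQ U) : PolyRing H :=
  if h : ∃ r : PolyRing H, ∀ x ∈ U, r.1 (q x) = qv a x then h.choose else 0

variable {q : V →ₗ[ℝ] H} {U : Submodule ℝ V}

lemma jj_spec (hq : IsPar q U) (a : AQ U) {x : V} (hx : x ∈ U) : (jj q U a).1 (q x) = qv a x := by
  have : ∃ r : PolyRing H, ∀ x ∈ U, r.1 (q x) = qv a x := by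
    obtain ⟨p, rfl⟩ := mkA_surj a
    obtain ⟨r, hr⟩ := hq.exists_pb p
    refine ⟨r, fun x hx => ?_⟩
    have := mem_IV.1 hr x hx
    rw [poly_sub, pb_apply, sub_eq_zero] at this
    rw [qv_mk _ hx, this]
  rw [jj, dif_pos this]
  exact this.choose_spec x hx

lemma par_ext (hq : IsPar q U) {a b : PolyRing H} (h : ∀ x ∈ U, a.1 (q x) = b.1 (q x)) : a = b := by
  apply poly_ext
  intro z
  obtain ⟨x, hx⟩ := hq.2 z
  have := h x.1 x.2
  have e : q x.1 = z := hx
  rwa [e] at this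

lemma jj_add (hq : IsPar q U) (a b : AQ U) : jj q U (a + b) = jj q U a + jj q U b :=
  par_ext hq fun x hx => by rw [poly_add, jj_spec hq _ hx, jj_spec hq _ hx, jj_spec hq _ hx, qv_add _ _ hx]

lemma jj_smul (hq : IsPar q U) (r : PolyRing H) (b : AQ U) : jj q U (pb q r • b) = r * jj q U b :=
  par_ext hq fun x hx => by rw [poly_mul, jj_spec hq _ hx, jj_spec hq _ hx, qv_smul _ _ hx, pb_apply]

lemma jj_deg (hq : IsPar q U) {e : ℤ} {a : AQ U} (ha : a ∈ AD U e) : jj q U a ∈ Adeg H e := by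
  obtain ⟨p, hp, rfl⟩ := mem_AD.1 ha
  rcases mem_Adeg.1 hp with h | ⟨k, rfl, hk⟩
  · subst h
    have : jj q U (mkA U 0) = 0 := par_ext hq fun x hx => by rw [jj_spec hq _ hx, qv_mk _ hx]; simp
    rw [this]; exact zero_mem _
  · refine mem_Adeg.2 (Or.inr ⟨k, rfl, fun t z => ?_⟩)
    obtain ⟨x, hx⟩ := hq.2 z
    have e : q x.1 = z := hx
    rw [← e, ← map_smul, jj_spec hq _ (U.smul_mem t x.2), jj_spec hq _ x.2, qv_mk _ (U.smul_mem t x.2), qv_mk _ x.2]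
    exact hk t x.1

variable [FiniteDimensional ℝ V] {σ : Cone V} {l : V}

lemma codim2 (hIl : IsInt σ l) (hq : Par σ l q) {τ ρ : Cone V} (h : IsFacet τ σ) (hρ : IsFacet ρ τ) :
    ∃ (g : H →ₗ[ℝ] ℝ) (τ' : Cone V) (γ : ℝ), IsFacet τ' σ ∧ τ' ≠ τ ∧ IsFacet ρ τ' ∧ 0 < γ ∧
      (∀ x ∈ τ.spanC, g (q x) = hl σ τ l * (γ * hl τ ρ x)) ∧
      ∀ x ∈ τ'.spanC, g (q x) = - (hl σ τ' l * (γ * hl τ' ρ x)) := by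
  obtain ⟨τ', h', hne, hρ'⟩ := exists_other h hρ
  obtain ⟨γ, hγ, d1, d2⟩ := diamond h h' hne hρ hρ'
  obtain ⟨s, hs1, hs2, hs3⟩ := (hq.facet hIl h).section'
  let m : V →ₗ[ℝ] ℝ := hl σ τ l • hl σ τ' - hl σ τ' l • hl σ τ
  have hm : ∀ x, m x = hl σ τ l * hl σ τ' x - hl σ τ' l * hl σ τ x := fun x => rfl
  have hml : m l = 0 := by rw [hm]; ring
  have hg : ∀ x ∈ σ.spanC, m (s (q x)) = m x := fun x hx => by
    obtain ⟨c, hc⟩ := hq.zero (x - s (q x)) (sub_mem hx (h.1.span_le (hs1 _))) (by rw [map_sub, hs2, sub_self])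
    have := congrArg m hc
    rw [map_sub, map_smul, hml, smul_zero, sub_eq_zero] at this
    exact this.symm
  refine ⟨m ∘ₗ s, τ', γ, h', hne, hρ', hγ, fun x hx => ?_, fun x hx => ?_⟩
  · show m (s (q x)) = _
    rw [hg x (h.1.span_le hx), hm, hl_zero h hx, d1 x hx]; ring
  · show m (s (q x)) = _
    rw [hg x (h'.1.span_le hx), hm, hl_zero h' hx, d2 x hx]; ring

def C2 (σ : Cone V) : Finset (Cone V) := (facets σ).biUnion facets

lemma mem_C2 {ρ : Cone V} : ρ ∈ C2 σ ↔ ∃ τ, IsFacet τ σ ∧ IsFacet ρ τ := by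
  simp [C2, mem_facets]

lemma C2data (hIl : IsInt σ l) (hq : Par σ l q) : ∃ g : Cone V → (H →ₗ[ℝ] ℝ),
    ∀ τ ρ, IsFacet τ σ → IsFacet ρ τ → ∃ (τ' : Cone V) (c : ℝ), c ≠ 0 ∧ IsFacet τ' σ ∧ τ' ≠ τ ∧ IsFacet ρ τ' ∧
      (∀ x ∈ τ.spanC, g ρ (q x) = hl σ τ l * (c * hl τ ρ x)) ∧
      ∀ x ∈ τ'.spanC, g ρ (q x) = - (hl σ τ' l * (c * hl τ' ρ x)) := by
  have : ∀ ρ, ∃ g : H →ₗ[ℝ] ℝ, ∀ τ, IsFacet τ σ → IsFacet ρ τ → ∃ (τ' : Cone V) (c : ℝ), c ≠ 0 ∧ IsFacet τ' σ ∧ τ' ≠ τ ∧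
      IsFacet ρ τ' ∧ (∀ x ∈ τ.spanC, g (q x) = hl σ τ l * (c * hl τ ρ x)) ∧
      ∀ x ∈ τ'.spanC, g (q x) = - (hl σ τ' l * (c * hl τ' ρ x)) := by
    intro ρ
    by_cases hex : ∃ τ, IsFacet τ σ ∧ IsFacet ρ τ
    · obtain ⟨τ, h, hρ⟩ := hex
      obtain ⟨g, τ', γ, h', hne, hρ', hγ, d1, d2⟩ := codim2 hIl hq h hρ
      refine ⟨g, fun τ'' h'' hρ'' => ?_⟩
      rcases other_unique h h' hne hρ hρ' h'' hρ''.1 with e | e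
      · rw [e]
        exact ⟨τ', γ, hγ.ne', h', hne, hρ', d1, d2⟩
      · rw [e]
        exact ⟨τ, -γ, neg_ne_zero.2 hγ.ne', h, hne.symm, hρ, fun x hx => by rw [d2 x hx]; ring,
          fun x hx => by rw [d1 x hx]; ring⟩
    · exact ⟨0, fun τ h hρ => absurd ⟨τ, h, hρ⟩ hex⟩
  choose g hg using this
  exact ⟨g, fun τ ρ => hg ρ τ⟩

namespace FanSheaf
variable {Δ : Fan V} {G : FanSheaf Δ}

def kk (G : FanSheaf Δ) (τ : Δ.cones) (z : (G.stalk τ).M) : G.K τ := if h : z ∈ G.K τ then ⟨z, h⟩ else 0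

lemma kk_val {τ : Δ.cones} {z : (G.stalk τ).M} (h : z ∈ G.K τ) : (G.kk τ z).1 = z := by
  rw [kk, dif_pos h]

def fs (Δ : Fan V) (σ : Cone V) : Finset Δ.cones := (Set.toFinite {τ : Δ.cones | IsFacet τ.1 σ}).toFinset

lemma mem_fs {τ : Δ.cones} : τ ∈ fs Δ σ ↔ IsFacet τ.1 σ := by simp [fs]

def exT (G : FanSheaf Δ) (σ : Cone V) (τ : Δ.cones) : G.K τ →ₗ[PolyRing V] G.Sec (bd σ) :=
  if h : IsFacet τ.1 σ then G.ext h else 0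

lemma exT_pos {τ : Δ.cones} (h : IsFacet τ.1 σ) : G.exT σ τ = G.ext h := dif_pos h

def tv (q : V →ₗ[ℝ] H) (σ : Cone V) (l : V) (v : ∀ τ : Δ.cones, G.K τ →ₗ[PolyRing V] AQ τ.1.spanC)
    (τ : Δ.cones) (k : G.K τ) : PolyRing H := (hl σ τ.1 l)⁻¹ • jj q τ.1.spanC (v τ k)

variable {v : ∀ τ : Δ.cones, G.K τ →ₗ[PolyRing V] AQ τ.1.spanC}

lemma tv_add {τ : Δ.cones} (hp : IsPar q τ.1.spanC) (k k' : G.K τ) :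
    tv q σ l v τ (k + k') = tv q σ l v τ k + tv q σ l v τ k' := by
  rw [tv, tv, tv, map_add, jj_add hp, smul_add]

lemma tv_smul {τ : Δ.cones} (hp : IsPar q τ.1.spanC) (r : PolyRing H) (k : G.K τ) :
    tv q σ l v τ (pb q r • k) = r * tv q σ l v τ k := by
  rw [tv, tv, map_smul, jj_smul hp, mul_smul_comm]

lemma tv_apply {τ : Δ.cones} (hp : IsPar q τ.1.spanC) (k : G.K τ) {x : V} (hx : x ∈ τ.1.spanC) :
    (tv q σ l v τ k).1 (q x) = (hl σ τ.1 l)⁻¹ * qv (v τ k) x := by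
  rw [tv, poly_smul, jj_spec hp _ hx]

/-- the product of the equations of the codimension two faces -/
lemma fdata (hG : G.Good) (hσ : ∀ ζ, ζ.IsProperFaceOf σ → ζ ∈ Δ.cones) (hIl : IsInt σ l) (hq : Par σ l q) :
    ∃ (f : PolyRing H) (e : ℤ), f ≠ 0 ∧ f ∈ Adeg H e ∧
      (∀ (y : G.Sec (bd σ)) (τ : Δ.cones), IsFacet τ.1 σ → pb q f • y.1 τ ∈ G.K τ) ∧
      (∀ y : G.Sec (bd σ), pb q f • y = ∑ τ ∈ fs Δ σ, G.exT σ τ (G.kk τ (pb q f • y.1 τ))) ∧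
      ∀ v : ∀ τ : Δ.cones, G.K τ →ₗ[PolyRing V] AQ τ.1.spanC, Compat hG σ v →
        ∀ y : G.Sec (bd σ), f ∣ ∑ τ ∈ fs Δ σ, tv q σ l v τ (G.kk τ (pb q f • y.1 τ)) := by
  obtain ⟨g, hg⟩ := C2data hIl hq
  have hg0 : ∀ ρ ∈ C2 σ, g ρ ≠ 0 := by
    intro ρ hρ h0
    obtain ⟨τ, h, hρ⟩ := mem_C2.1 hρ
    obtain ⟨τ', c, hc, h', hne, hρ', d1, d2⟩ := hg τ ρ h hρ
    have := d1 (nv τ ρ) (nv_mem hρ)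
    rw [h0, hl_nv hρ, LinearMap.zero_apply, mul_one] at this
    exact mul_ne_zero (hIl.2 τ h).ne' hc this.symm
  have hgv : ∀ τ ρ, IsFacet τ σ → IsFacet ρ τ → ∀ x ∈ ρ.spanC, g ρ (q x) = 0 := fun τ ρ h hρ x hx => by
    obtain ⟨τ', c, hc, h', hne, hρ', d1, d2⟩ := hg τ ρ h hρ
    rw [d1 x (hρ.1.span_le hx), hl_zero hρ hx]; ring
  let f : PolyRing H := ∏ ρ ∈ C2 σ, linP (g ρ)
  have hf0 : f ≠ 0 := Finset.prod_ne_zero_iff.2 fun ρ hρ => linP_ne (hg0 ρ hρ)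
  have hsec : ∀ (y : G.Sec (bd σ)) (τ ρ : Δ.cones), IsFacet τ.1 σ → IsFacet ρ.1 τ.1 → G.r τ ρ (y.1 τ) = y.1 ρ :=
    fun y τ ρ h hρ => (G.mem_sec.1 y.2).2 τ ρ h.proper (by
      refine ⟨hρ.1.trans h.1, fun e => ?_⟩
      have h1 := h.2
      have h2 := hρ.2
      rw [e] at h2; omega) hρ.1
  have hkill : ∀ (ρ : Δ.cones) (a : PolyRing H), (∀ x ∈ ρ.1.spanC, a.1 (q x) = 0) → ∀ z : (G.stalk ρ).M, pb q a • z = 0 :=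
    fun ρ a ha z => hG.kill ρ (mem_IV.2 fun x hx => by rw [pb_apply]; exact ha x hx) z
  have hfK : ∀ (y : G.Sec (bd σ)) (τ : Δ.cones), IsFacet τ.1 σ → pb q f • y.1 τ ∈ G.K τ := by
    intro y τ h
    refine mem_K.2 fun ρ hρ => ?_
    rw [map_smul]
    apply hkill
    intro x hx
    rw [poly_prod]
    exact Finset.prod_eq_zero (mem_C2.2 ⟨τ, h, hρ⟩) (by rw [linP_apply, hgv τ ρ h hρ x hx])
  refine ⟨f, _, hf0, Adeg_prod _ _ fun ρ _ => linP_deg _, hfK, ?_, ?_⟩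
  · intro y
    apply Subtype.ext
    funext ζ
    have hval : (∑ τ ∈ fs Δ σ, G.exT σ τ (G.kk τ (pb q f • y.1 τ))).1 ζ
        = ∑ τ ∈ fs Δ σ, G.r τ ζ (pb q f • y.1 τ) := by
      rw [AddSubmonoidClass.coe_finset_sum, Finset.sum_apply]
      refine Finset.sum_congr rfl fun τ hτ => ?_
      rw [mem_fs] at hτ
      rw [exT_pos hτ, ext_apply, kk_val (hfK y τ hτ)]
    rw [hval]
    show pb q f • y.1 ζ = _
    by_cases hζ : IsFacet ζ.1 σ
    · rw [Finset.sum_eq_single ζ, G.r_self]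
      · intro τ hτ hne
        rw [mem_fs] at hτ
        exact K_zero (hfK y τ hτ) hne.symm
      · intro h; exact absurd (mem_fs.2 hζ) h
    · rw [Finset.sum_eq_zero]
      · by_cases hb : ζ.1 ∈ bd σ
        · obtain ⟨τ, hτ, hζτ⟩ := exists_facet_of_proper hb
          let t : Δ.cones := ⟨τ, hσ _ hτ.proper⟩
          have hne : ζ ≠ t := by rintro rfl; exact hζ hτ
          have e := K_zero (hfK y t hτ) hne
          rwa [map_smul, (G.mem_sec.1 y.2).2 t ζ hτ.proper hb hζτ] at e
        · rw [y.2.1 ζ hb, smul_zero]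
      · intro τ hτ
        rw [mem_fs] at hτ
        exact K_zero (hfK y τ hτ) (by rintro rfl; exact hζ hτ)
  intro v hv y
  have hpar : ∀ τ : Δ.cones, IsFacet τ.1 σ → IsPar q τ.1.spanC := fun τ h => hq.facet hIl h
  have hkks : ∀ (τ : Δ.cones), IsFacet τ.1 σ → ∀ (a : PolyRing H) (z : (G.stalk τ).M), z ∈ G.K τ →
      tv q σ l v τ (G.kk τ (pb q a • z)) = a * tv q σ l v τ (G.kk τ z) := by
    intro τ h a z hz
    have : G.kk τ (pb q a • z) = pb q a • G.kk τ z := by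
      apply Subtype.ext
      rw [kk_val (Submodule.smul_mem _ _ hz)]
      show _ = pb q a • (G.kk τ z).1
      rw [kk_val hz]
    rw [this, tv_smul (hpar τ h)]
  refine prod_dvd_of (C2 σ) (fun ρ => linP (g ρ)) (fun ρ hρ => linP_prime (hg0 ρ hρ)) _ ?_
  intro ρ0 hρ0
  let NZ : Finset (Cone V) := (C2 σ).filter fun ρ => ¬ linP (g ρ0) ∣ linP (g ρ)
  let gg : PolyRing H := ∏ ρ ∈ NZ, linP (g ρ)
  refine ⟨gg, ?_, ?_⟩
  · intro hd
    obtain ⟨ρ, hρ, hd'⟩ := (Prime.dvd_finset_prod_iff (linP_prime (hg0 ρ0 hρ0)) _).1 hd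
    exact (Finset.mem_filter.1 hρ).2 hd'
  -- facets in Z
  have hZ : ∀ ρ ∈ C2 σ, ρ ∉ NZ → ∃ c : ℝ, c ≠ 0 ∧ g ρ = c • g ρ0 := fun ρ hρ hn => by
    apply linP_dvd (hg0 _ hρ0) (hg0 _ hρ)
    by_contra hc
    exact hn (Finset.mem_filter.2 ⟨hρ, hc⟩)
  have hgNZ : ∀ τ ρ : Δ.cones, IsFacet τ.1 σ → IsFacet ρ.1 τ.1 → ρ.1 ∈ NZ → ∀ z : (G.stalk τ).M,
      G.r τ ρ (pb q gg • z) = 0 := by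
    intro τ ρ h hρ hN z
    rw [map_smul]
    apply hkill
    intro x hx
    rw [poly_prod]
    exact Finset.prod_eq_zero hN (by rw [linP_apply, hgv τ ρ h hρ x hx])
  have hg0K : ∀ τ : Δ.cones, IsFacet τ.1 σ → ∀ z : (G.stalk τ).M, pb q (linP (g ρ0)) • pb q gg • z ∈ G.K τ := by
    intro τ h z
    refine mem_K.2 fun ρ hρ => ?_
    by_cases hN : ρ.1 ∈ NZ
    · rw [map_smul, hgNZ τ ρ h hρ hN, smul_zero]
    · obtain ⟨c, hc, e⟩ := hZ ρ.1 (mem_C2.2 ⟨τ, h, hρ⟩) hN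
      rw [map_smul]
      apply hkill
      intro x hx
      have := hgv τ ρ h hρ x hx
      rw [e, LinearMap.smul_apply, smul_eq_mul] at this
      rw [linP_apply]
      exact (mul_eq_zero.1 this).resolve_left hc
  -- reduction
  have hfe : f = (∏ ρ ∈ (C2 σ).erase ρ0, linP (g ρ)) * linP (g ρ0) := (Finset.prod_erase_mul _ _ hρ0).symm
  set f' := ∏ ρ ∈ (C2 σ).erase ρ0, linP (g ρ) with hf'
  have hsum : gg * ∑ τ ∈ fs Δ σ, tv q σ l v τ (G.kk τ (pb q f • y.1 τ)) =
      f' * ∑ τ ∈ fs Δ σ, tv q σ l v τ (G.kk τ (pb q (linP (g ρ0)) • pb q gg • y.1 τ)) := by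
    rw [Finset.mul_sum, Finset.mul_sum]
    refine Finset.sum_congr rfl fun τ hτ => ?_
    rw [mem_fs] at hτ
    rw [← hkks τ hτ _ _ (hfK y τ hτ), ← hkks τ hτ _ _ (hg0K τ hτ _), hfe]
    congr 2
    rw [map_mul, ← mul_smul, ← mul_smul, ← mul_smul]
    congr 1
    ring
  rw [hsum]
  show f ∣ _
  rw [hfe]
  apply mul_dvd_mul_left
  apply linP_dvd_of (hg0 _ hρ0)
  intro z hz
  rw [poly_sum]
  -- uniqueness of facets in Z
  have huniq : ∀ τ ρ ρ' : Δ.cones, IsFacet τ.1 σ → IsFacet ρ.1 τ.1 → IsFacet ρ'.1 τ.1 → ρ.1 ∉ NZ → ρ'.1 ∉ NZ → ρ = ρ' := by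
    intro τ ρ ρ' h hρ hρ' hN hN'
    obtain ⟨c, hc, e⟩ := hZ ρ.1 (mem_C2.2 ⟨τ, h, hρ⟩) hN
    obtain ⟨c', hc', e'⟩ := hZ ρ'.1 (mem_C2.2 ⟨τ, h, hρ'⟩) hN'
    obtain ⟨_, a, ha, _, _, _, d1, _⟩ := hg τ ρ h hρ
    obtain ⟨_, a', ha', _, _, _, d1', _⟩ := hg τ ρ' h hρ'
    have hp := (hIl.2 τ h).ne'
    apply Subtype.ext
    refine Cone.face_eq_of_span hρ.1 hρ'.1 ?_
    have aux : ∀ (x : V), x ∈ τ.1.spanC → (hl τ.1 ρ.1 x = 0 ↔ hl τ.1 ρ'.1 x = 0) := by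
      intro x hx
      have h1 := d1 x hx
      have h2 := d1' x hx
      rw [e, LinearMap.smul_apply, smul_eq_mul] at h1
      rw [e', LinearMap.smul_apply, smul_eq_mul] at h2
      constructor
      · intro h0
        rw [h0, mul_zero, mul_zero] at h1
        rw [(mul_eq_zero.1 h1).resolve_left hc, mul_zero] at h2
        have := (mul_eq_zero.1 h2.symm).resolve_left hp
        exact (mul_eq_zero.1 this).resolve_left ha'
      · intro h0
        rw [h0, mul_zero, mul_zero] at h2
        rw [(mul_eq_zero.1 h2).resolve_left hc', mul_zero] at h1
        have := (mul_eq_zero.1 h1.symm).resolve_left hp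
        exact (mul_eq_zero.1 this).resolve_left ha
    ext x
    constructor
    · intro hx
      exact (hl_zero_iff hρ' (hρ.1.span_le hx)).1 ((aux x (hρ.1.span_le hx)).1 (hl_zero hρ hx))
    · intro hx
      exact (hl_zero_iff hρ (hρ'.1.span_le hx)).1 ((aux x (hρ'.1.span_le hx)).2 (hl_zero hρ' hx))
  have hinv : ∀ τ : Δ.cones, ∃ τ' : Δ.cones, IsFacet τ.1 σ → IsFacet τ'.1 σ ∧
      (((∀ ρ : Δ.cones, IsFacet ρ.1 τ.1 → ρ.1 ∈ NZ) ∧ τ' = τ) ∨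
      ∃ ρ : Δ.cones, IsFacet ρ.1 τ.1 ∧ IsFacet ρ.1 τ'.1 ∧ ρ.1 ∉ NZ ∧ τ' ≠ τ) := by
    intro τ
    by_cases h : IsFacet τ.1 σ
    · by_cases hall : ∀ ρ : Δ.cones, IsFacet ρ.1 τ.1 → ρ.1 ∈ NZ
      · exact ⟨τ, fun _ => ⟨h, Or.inl ⟨hall, rfl⟩⟩⟩
      · push Not at hall
        obtain ⟨ρ, hρ, hN⟩ := hall
        obtain ⟨τ', h', hne, hρ'⟩ := exists_other h hρ
        exact ⟨⟨τ', hσ _ h'.proper⟩, fun _ => ⟨h', Or.inr ⟨ρ, hρ, hρ', hN, fun e => hne (congrArg Subtype.val e)⟩⟩⟩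
    · exact ⟨τ, fun h' => absurd h' h⟩
  choose inv hinv using hinv
  refine Finset.sum_involution (fun τ _ => inv τ) ?_ ?_ (fun τ hτ => mem_fs.2 (hinv τ (mem_fs.1 hτ)).1) ?_
  · intro τ hτ
    rw [mem_fs] at hτ
    obtain ⟨h', hcase⟩ := hinv τ hτ
    rcases hcase with ⟨hall, e⟩ | ⟨ρ, hρ, hρ', hN, hne⟩
    · have hK : pb q gg • y.1 τ ∈ G.K τ := mem_K.2 fun ρ hρ => hgNZ τ ρ hτ hρ (hall ρ hρ) _
      have : (tv q σ l v τ (G.kk τ (pb q (linP (g ρ0)) • pb q gg • y.1 τ))).1 z = 0 := by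
        rw [hkks τ hτ _ _ hK, poly_mul, linP_apply, hz, zero_mul]
      rw [e, this, add_zero]
    · generalize inv τ = τ' at *
      obtain ⟨τ2, a, ha, h2, hne2, hρ2, d1, d2⟩ := hg τ ρ hτ hρ
      have e2 : τ2 = τ'.1 := ((other_unique hτ h' (fun e => hne (Subtype.ext e)) hρ hρ' h2 hρ2.1).resolve_left hne2)
      subst e2
      obtain ⟨c, hc, e⟩ := hZ ρ.1 (mem_C2.2 ⟨τ, hτ, hρ⟩) hN
      -- the point
      obtain ⟨⟨x, hx⟩, hqx⟩ := (hpar τ hτ).2 z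
      have hqx : q x = z := hqx
      have hxρ : x ∈ ρ.1.spanC := by
        rw [← hl_zero_iff hρ hx]
        have := d1 x hx
        rw [hqx, e, LinearMap.smul_apply, hz, smul_zero] at this
        have := (mul_eq_zero.1 this.symm).resolve_left (hIl.2 τ hτ).ne'
        exact (mul_eq_zero.1 this).resolve_left ha
      let w : G.W τ ρ := ⟨pb q gg • y.1 τ, mem_W.2 fun ρ1 hρ1 hne1 => hgNZ τ ρ1 hτ hρ1 (by
        by_contra hN1; exact hne1 (huniq τ ρ1 ρ hτ hρ1 hρ hN1 hN)) _⟩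
      let w' : G.W τ' ρ := ⟨pb q gg • y.1 τ', mem_W.2 fun ρ1 hρ1 hne1 => hgNZ τ' ρ1 h' hρ1 (by
        by_contra hN1; exact hne1 (huniq τ' ρ1 ρ h' hρ1 hρ' hN1 hN)) _⟩
      have hww : G.rT hρ w = G.rT hρ' w' := by
        apply Subtype.ext
        rw [rT_val, rT_val]
        show G.r τ ρ (pb q gg • y.1 τ) = G.r τ' ρ (pb q gg • y.1 τ')
        rw [map_smul, map_smul, hsec y τ ρ hτ hρ, hsec y τ' ρ h' hρ']
      have hcompat := hv τ τ' ρ hτ h' hne hρ hρ' w w' hww x hxρ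
      have key : ∀ (t : Δ.cones) (ht : IsFacet t.1 σ) (hρt : IsFacet ρ.1 t.1) (b : ℝ)
          (hb : ∀ x ∈ t.1.spanC, g ρ.1 (q x) = hl σ t.1 l * (b * hl t.1 ρ.1 x)) (u : G.W t ρ),
          (tv q σ l v t (G.kk t (pb q (linP (g ρ0)) • u.1))).1 z = c⁻¹ * b * qv (v t (mH hG hρt u)) x := by
        intro t ht hρt b hb u
        have hxt := hρt.1.span_le hxρ
        have e3 : pb q (linP (g ρ0)) • u.1 = (algebraMap ℝ (PolyRing V) (c⁻¹ * (hl σ t.1 l * b))) • (mH hG hρt u).1 := by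
          rw [mH_val, ← mul_smul, ← sub_eq_zero, ← sub_smul]
          apply hG.kill
          refine mem_IV.2 fun x hx => ?_
          have h3 := hb x hx
          rw [e, LinearMap.smul_apply, smul_eq_mul] at h3
          rw [poly_sub, pb_apply, poly_mul, linP_apply, linP_apply, poly_algebraMap]
          have : g ρ0 (q x) = c⁻¹ * (hl σ t.1 l * (b * hl t.1 ρ.1 x)) := by
            rw [← h3]; field_simp
          rw [this]; ring
        have e4 : G.kk t (pb q (linP (g ρ0)) • u.1) = (algebraMap ℝ (PolyRing V) (c⁻¹ * (hl σ t.1 l * b))) • mH hG hρt u := by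
          apply Subtype.ext
          rw [kk_val]
          · exact e3
          · rw [e3]; exact Submodule.smul_mem _ _ (mH hG hρt u).2
        have hp := (hIl.2 t ht).ne'
        rw [e4, ← hqx, tv_apply (hpar t ht) _ hxt, map_smul, qv_smul _ _ hxt, poly_algebraMap]
        field_simp
      have k1 := key τ hτ hρ a d1 w
      have k2 := key τ' h' hρ' (-a) (fun x hx => by rw [d2 x hx]; ring) w'
      show (tv q σ l v τ (G.kk τ (pb q (linP (g ρ0)) • w.1))).1 z + (tv q σ l v τ' (G.kk τ' (pb q (linP (g ρ0)) • w'.1))).1 z = 0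
      rw [k1, k2, hcompat]; ring
  · intro τ hτ hnz
    rw [mem_fs] at hτ
    obtain ⟨h', hcase⟩ := hinv τ hτ
    rcases hcase with ⟨hall, e⟩ | ⟨ρ, hρ, hρ', hN, hne⟩
    · have hK : pb q gg • y.1 τ ∈ G.K τ := mem_K.2 fun ρ hρ => hgNZ τ ρ hτ hρ (hall ρ hρ) _
      exfalso; apply hnz
      rw [hkks τ hτ _ _ hK, poly_mul, linP_apply, hz, zero_mul]
    · exact hne
  · intro τ hτ
    rw [mem_fs] at hτ
    obtain ⟨h', hcase⟩ := hinv τ hτ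
    rcases hcase with ⟨hall, e⟩ | ⟨ρ, hρ, hρ', hN, hne⟩
    · show inv (inv τ) = τ
      rw [e, e]
    · show inv (inv τ) = τ
      obtain ⟨h'', hcase'⟩ := hinv _ h'
      rcases hcase' with ⟨hall, e⟩ | ⟨ρ1, hρ1, hρ1', hN1, hne1⟩
      · exact absurd (hall ρ hρ') hN
      · have e1 := huniq _ ρ ρ1 h' hρ' hρ1 hN hN1
        subst e1
        rcases other_unique hτ h' (fun e => hne (Subtype.ext e)) hρ hρ' h'' hρ1'.1 with e | e
        · exact Subtype.ext e
        · exact absurd (Subtype.ext e) hne1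

end FanSheaf
end bdry

/-! ### Extension of compatible families and lifting -/

section extlift
variable {V : Type} [AddCommGroup V] [Module ℝ V] [FiniteDimensional ℝ V]
variable {H : Type} [AddCommGroup H] [Module ℝ H]

namespace FanSheaf
variable {Δ : Fan V} {G : FanSheaf Δ} {σ : Cone V} {l : V} {q : V →ₗ[ℝ] H}
variable {v : ∀ τ : Δ.cones, G.K τ →ₗ[PolyRing V] AQ τ.1.spanC}

lemma kk_add {τ : Δ.cones} {x y : (G.stalk τ).M} (hx : x ∈ G.K τ) (hy : y ∈ G.K τ) :
    G.kk τ (x + y) = G.kk τ x + G.kk τ y :=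
  Subtype.ext (by
    rw [kk_val (add_mem hx hy)]
    show _ = (G.kk τ x).1 + (G.kk τ y).1
    rw [kk_val hx, kk_val hy])

lemma kk_smul {τ : Δ.cones} {x : (G.stalk τ).M} (hx : x ∈ G.K τ) (a : PolyRing V) :
    G.kk τ (a • x) = a • G.kk τ x :=
  Subtype.ext (by
    rw [kk_val ((G.K τ).smul_mem a hx)]
    show _ = a • (G.kk τ x).1
    rw [kk_val hx])

lemma kk_zero {τ : Δ.cones} : G.kk τ 0 = 0 := Subtype.ext (kk_val (zero_mem _))

lemma ext_deg {τ : Δ.cones} (h : IsFacet τ.1 σ) {k : G.K τ} {p : ℤ} (hk : k.1 ∈ (G.stalk τ).deg p) :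
    G.ext h k ∈ G.secDeg (bd σ) p := fun ζ => by
  rw [ext_apply]; exact G.r_deg hk

lemma EXT (hG : G.Good) (hσ : ∀ ζ, ζ.IsProperFaceOf σ → ζ ∈ Δ.cones) (hIl : IsInt σ l) (hq : Par σ l q)
    (hv : Compat hG σ v) : ∃ φ : G.Sec (bd σ) →+ PolyRing H, (∀ r y, φ (pb q r • y) = r * φ y) ∧
      (∀ (τ : Δ.cones) (h : IsFacet τ.1 σ) (k : G.K τ), φ (G.ext h k) = tv q σ l v τ k) ∧
      ∀ e : ℤ, (∀ τ : Δ.cones, IsFacet τ.1 σ → ∀ p : ℤ, ∀ k : G.K τ, k.1 ∈ (G.stalk τ).deg p →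
        v τ k ∈ AD τ.1.spanC (p + e)) → ∀ p : ℤ, ∀ y ∈ G.secDeg (bd σ) p, φ y ∈ Adeg H (p + e) := by
  obtain ⟨f, d, hf0, hfd, hK, hsum, hdiv⟩ := fdata hG hσ hIl hq
  have hpar : ∀ τ : Δ.cones, τ ∈ fs Δ σ → IsPar q τ.1.spanC := fun τ h => hq.facet hIl (mem_fs.1 h)
  have tv0 : ∀ τ : Δ.cones, τ ∈ fs Δ σ → tv q σ l v τ 0 = 0 := fun τ h => by
    have := tv_add (σ := σ) (l := l) (v := v) (hpar τ h) 0 0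
    rw [add_zero] at this
    simpa using this
  choose φ hφ using hdiv v hv
  have hadd : ∀ x y, φ (x + y) = φ x + φ y := fun x y => by
    apply mul_left_cancel₀ hf0
    rw [mul_add, ← hφ, ← hφ, ← hφ, ← Finset.sum_add_distrib]
    refine Finset.sum_congr rfl fun τ hτ => ?_
    have hτ' := mem_fs.1 hτ
    rw [← tv_add (hpar τ hτ), ← kk_add (hK x τ hτ') (hK y τ hτ'), ← smul_add]
    rfl
  have hsm : ∀ r y, φ (pb q r • y) = r * φ y := fun r y => by
    apply mul_left_cancel₀ hf0
    rw [mul_left_comm, ← hφ, ← hφ, Finset.mul_sum]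
    refine Finset.sum_congr rfl fun τ hτ => ?_
    have hτ' := mem_fs.1 hτ
    rw [← tv_smul (hpar τ hτ), ← kk_smul (hK y τ hτ'), smul_comm]
    rfl
  refine ⟨AddMonoidHom.mk' φ hadd, hsm, fun τ h k => ?_, fun e hv' p y hy => ?_⟩
  · show φ _ = _
    apply mul_left_cancel₀ hf0
    rw [← hφ, Finset.sum_eq_single τ]
    · rw [ext_apply, G.r_self, kk_smul k.2, tv_smul (hpar τ (mem_fs.2 h))]
      congr 2
      exact Subtype.ext (kk_val k.2)
    · intro τ' h' hne
      rw [ext_apply, K_zero k.2 hne, smul_zero, kk_zero, tv0 τ' h']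
    · intro h'; exact absurd (mem_fs.2 h) h'
  · show φ y ∈ _
    apply Adeg_div hfd hf0
    rw [← hφ]
    refine Submodule.sum_mem _ fun τ hτ => ?_
    have hτ' := mem_fs.1 hτ
    have h1 : pb q f ∈ Adeg V d := by
      rcases mem_Adeg.1 hfd with h | ⟨k, hk, h⟩
      · exact absurd h hf0
      · exact mem_Adeg.2 (Or.inr ⟨k, hk, fun t x => by rw [pb_apply, pb_apply, map_smul, h]⟩)
    have h2 : (G.kk τ (pb q f • y.1 τ)).1 ∈ (G.stalk τ).deg (d + p) := by
      rw [kk_val (hK y τ hτ')]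
      exact (G.stalk τ).grM.smul _ _ _ h1 _ (hy τ)
    have h3 := jj_deg (hpar τ hτ) (hv' τ hτ' _ _ h2)
    rw [tv, ← add_assoc]
    exact Submodule.smul_mem _ _ h3

lemma EXT_unique (hG : G.Good) (hσ : ∀ ζ, ζ.IsProperFaceOf σ → ζ ∈ Δ.cones) (hIl : IsInt σ l)
    (hq : Par σ l q) (φ φ' : G.Sec (bd σ) → PolyRing H) (ha : ∀ x y, φ (x + y) = φ x + φ y)
    (ha' : ∀ x y, φ' (x + y) = φ' x + φ' y)
    (h : ∀ r y, φ (pb q r • y) = r * φ y) (h' : ∀ r y, φ' (pb q r • y) = r * φ' y)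
    (he : ∀ (τ : Δ.cones) (h : IsFacet τ.1 σ) (k : G.K τ), φ (G.ext h k) = φ' (G.ext h k)) (y : G.Sec (bd σ)) :
    φ y = φ' y := by
  obtain ⟨f, d, hf0, hfd, hK, hsum, hdiv⟩ := fdata hG hσ hIl hq
  apply mul_left_cancel₀ hf0
  rw [← h, ← h', hsum y]
  let Φ := AddMonoidHom.mk' φ ha
  let Φ' := AddMonoidHom.mk' φ' ha'
  show Φ _ = Φ' _
  rw [map_sum, map_sum]
  refine Finset.sum_congr rfl fun τ hτ => ?_
  rw [exT_pos (mem_fs.1 hτ)]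
  exact he τ _ _

lemma LIFT (hG : G.Good) (σ : Δ.cones) (hd : σ.1 ≠ zeroCone V) (hv : Compat hG σ.1 v) :
    ∃ u : G.K σ →ₗ[PolyRing V] AQ σ.1.spanC, ResEq hG σ u v := by
  obtain ⟨l, hIl⟩ := exists_int σ.1
  have hσ : ∀ ζ, ζ.IsProperFaceOf σ.1 → ζ ∈ Δ.cones := fun ζ h => Δ.face_mem _ σ.2 _ h.1
  obtain ⟨τ0, hτ0, -⟩ := exists_facet_of_proper (σ := σ.1) ⟨zero_face σ.1, fun h => hd h.symm⟩
  have hls := σ.1.mem_span hIl.1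
  obtain ⟨H, q, T, hq, hT⟩ := exists_Par σ.1 hls (hIl.ne_zero hτ0)
  have hpar := hq.prod hls T (by rw [hT]; exact one_ne_zero)
  have hPR : ParR (thetaP q T) (IV σ.1.spanC) := ⟨thetaP_exists hpar, fun p hp => (thetaP_mem hpar).1 hp⟩
  obtain ⟨φ, hφ, hφe, -⟩ := EXT hG hσ hIl hq hv
  obtain ⟨hk, N, b, e, hb, hbs, hbr⟩ := hG.free σ
  letI i1 := Module.compHom (G.stalk σ).M (thetaP q T)
  letI i2 := Module.compHom (G.Sec (bd σ.1)) (thetaP q T)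
  have hs1 : ∀ (p : Polynomial (PolyRing H)) (x : (G.stalk σ).M), p • x = thetaP q T p • x := fun _ _ => rfl
  have hs2 : ∀ (p : Polynomial (PolyRing H)) (x : G.Sec (bd σ.1)), p • x = thetaP q T p • x := fun _ _ => rfl
  let la0 : (G.stalk σ).M →ₗ[PolyRing V] G.Sec (bd σ.1) := G.bdRes σ
  have hla0 : ∀ x (ζ : Δ.cones), ζ.1.IsProperFaceOf σ.1 → (la0 x).1 ζ = G.r σ ζ x :=
    fun x ζ h => G.bdRes_apply σ ζ h x
  let la : (G.stalk σ).M →ₗ[Polynomial (PolyRing H)] G.Sec (bd σ.1) :=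
    { toFun := la0, map_add' := la0.map_add, map_smul' := fun c x => la0.map_smul (thetaP q T c) x }
  obtain ⟨u, hu1, hu2⟩ := L4 la b (fun x => by
      obtain ⟨c, rfl⟩ := hbs x
      choose p hp using fun i => hPR.smul_eq hk (c i)
      exact ⟨p, Finset.sum_congr rfl fun i _ => hp i _⟩)
    (fun c hc => funext fun i => hPR.inj _ (hbr (fun i => thetaP q T (c i)) hc i)) φ
    (fun r y => by rw [hs2, thetaP_C, hφ])
  have hlaK : ∀ k ∈ G.K σ, la k = 0 := fun k hkk => by
    apply Subtype.ext; funext ζ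
    by_cases hz : ζ.1.IsProperFaceOf σ.1
    · rw [show (la k).1 ζ = _ from hla0 k ζ hz]
      exact K_zero hkk fun h => hz.2 (congrArg Subtype.val h)
    · exact (la k).2.1 ζ hz
  have huK : ∀ (p : Polynomial (PolyRing H)), ∀ k ∈ G.K σ, u (p • k) = p * u k := by
    intro p
    induction p using Polynomial.induction_on with
    | C a => intro k _; exact hu1 a k
    | add p p' h1 h2 => intro k hkk; rw [add_smul, map_add, h1 k hkk, h2 k hkk, add_mul]
    | monomial n a ih =>
      intro k hkk
      have h1 : (Polynomial.X : Polynomial (PolyRing H)) • k ∈ G.K σ := by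
        rw [hs1]; exact (G.K σ).smul_mem _ hkk
      rw [pow_succ, ← mul_assoc, mul_smul, ih _ h1, hu2, hlaK k hkk, map_zero, map_zero, add_zero, mul_assoc _ _ (u k)]
  let U : G.K σ →ₗ[PolyRing V] AQ σ.1.spanC :=
    { toFun := fun k => mkA _ (thetaP q T (u k.1))
      map_add' := fun x y => by
        rw [← mkA_add, ← map_add, ← map_add]; rfl
      map_smul' := fun a k => by
        obtain ⟨p, hp⟩ := hPR.surj a
        have h1 : (a • k).1 = p • k.1 := by
          show a • k.1 = p • k.1
          rw [hs1, ← sub_eq_zero, ← sub_smul]; exact hk _ hp _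
        rw [h1, huK p _ k.2, map_mul, RingHom.id_apply, mkA_smul, mkA_eq, ← sub_mul, ← neg_sub, neg_mul]
        exact neg_mem (Ideal.mul_mem_right _ _ hp) }
  refine ⟨U, fun τ h w x hx => ?_⟩
  have hxσ := h.1.span_le hx
  show qv (mkA _ (thetaP q T (u (mH hG h w).1))) x = _
  rw [qv_mk _ hxσ, mH_val]
  obtain ⟨s, hs⟩ := (hq.facet hIl h).section'
  let Tt : H →ₗ[ℝ] ℝ := T ∘ₗ s
  have hTt : ∀ y ∈ τ.1.spanC, Tt (q y) = T y := fun y hy => by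
    show T (s (q y)) = T y
    rw [hs.2.2 y hy]
  have hpos := hIl.2 _ h
  let c : PolyRing H := algebraMap ℝ _ (hl σ.1 τ.1 l)
  let P : Polynomial (PolyRing H) := Polynomial.C c * Polynomial.X - Polynomial.C (c * linP Tt)
  have hP : linP (hl σ.1 τ.1) - thetaP q T P ∈ IV σ.1.spanC := by
    refine mem_IV.2 fun z hz => ?_
    have h1 : z - (hl σ.1 τ.1 z / hl σ.1 τ.1 l) • l ∈ τ.1.spanC := by
      rw [← hl_zero_iff h (sub_mem hz (Submodule.smul_mem _ _ hls)), map_sub, map_smul, smul_eq_mul]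
      field_simp
      ring
    have h2 := hTt _ h1
    rw [map_sub, map_smul, hq.ql, smul_zero, sub_zero, map_sub, map_smul, hT, smul_eq_mul, mul_one] at h2
    simp only [P, c, map_sub, map_mul, thetaP_C, thetaP_X, poly_sub, poly_mul, linP_apply, pb_apply,
      poly_algebraMap, h2]
    field_simp
    ring
  have h1 : linP (hl σ.1 τ.1) • w.1 = P • w.1 := by
    rw [hs1, ← sub_eq_zero, ← sub_smul]; exact hk _ hP _
  have h2 : u (P • w.1) = P * u w.1 + Polynomial.C (c * φ (la w.1)) := by
    simp only [P]
    rw [sub_smul, map_sub, mul_smul, hu1, hu1, hu2, Polynomial.C_mul, Polynomial.C_mul]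
    ring
  have h3 : la w.1 = G.ext h (G.rT h w) := by
    apply Subtype.ext; funext ζ
    rw [ext_apply, rT_val]
    by_cases hz : ζ.1.IsProperFaceOf σ.1
    · rw [show (la w.1).1 ζ = _ from hla0 w.1 ζ hz]
      by_cases hzt : ζ.1.IsFaceOf τ.1
      · rw [G.r_comp h.1 hzt]
      · rw [G.r_not hzt, W_zero w.2 (fun h => hz.2 (congrArg Subtype.val h)) hzt]; rfl
    · rw [(la w.1).2.1 ζ hz, G.r_not]
      · rfl
      · intro hh
        refine hz ⟨hh.trans h.1, fun e => ?_⟩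
        have e1 := Cone.dim_le_of_sub (hh.sub)
        rw [e] at e1
        have := h.2; omega
  have h4 : (thetaP q T P).1 x = 0 := by
    have := mem_IV.1 hP x hxσ
    rw [poly_sub, linP_apply, hl_zero h hx] at this
    linarith
  rw [h1, h2, map_add, map_mul, poly_add, poly_mul, h4, thetaP_C, pb_apply, poly_mul, h3, hφe τ h,
    tv_apply (hq.facet hIl h) _ hx, poly_algebraMap]
  field_simp
  ring

end FanSheaf
end extlift

/-! ### Restriction of functionals -/

section restr
variable {V : Type} [AddCommGroup V] [Module ℝ V] [FiniteDimensional ℝ V]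

namespace FanSheaf
variable {Δ : Fan V} {G : FanSheaf Δ}
variable {v : ∀ τ : Δ.cones, G.K τ →ₗ[PolyRing V] AQ τ.1.spanC}

lemma AD_pr_of_mem {U : Submodule ℝ V} {e : ℤ} {a : AQ U} (h : a ∈ AD U e) : pr (AD U) e a = a :=
  pr_of_mem (AD_gr U).gr h

lemma fac_pr_eq {U W : Submodule ℝ V} (h : U ≤ W) {e : ℤ} {a : AQ W} {b : AQ U} (hab : fac h a = b)
    (hb : b ∈ AD U e) : fac h (pr (AD W) e a) = b := by
  rw [fac_pr, hab, AD_pr_of_mem hb]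

lemma AQ_prod_dvd_of {ι : Type} {U : Submodule ℝ V} (s : Finset ι) (h : ι → AQ U)
    (hp : ∀ i ∈ s, Prime (h i)) (w : AQ U)
    (H : ∀ i ∈ s, ∃ g, ¬ h i ∣ g ∧ ∏ j ∈ s, h j ∣ g * w) : ∏ j ∈ s, h j ∣ w := prod_dvd_of s h hp w H

lemma K_hom_comp {σ : Δ.cones} (u : G.K σ →ₗ[PolyRing V] AQ σ.1.spanC) (e : ℤ) :
    ∃ u' : G.K σ →ₗ[PolyRing V] AQ σ.1.spanC, ∀ p : ℤ, ∀ k : G.K σ,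
      k.1 ∈ (G.stalk σ).deg p → u' k = pr (AD σ.1.spanC) (p + e) (u k) := by
  obtain ⟨u', hu'⟩ := hom_comp ((G.stalk σ).grM.sub (K_gr (F := G) σ)) (AD_gr σ.1.spanC) u e
  exact ⟨u', fun p k hk => hu' p k hk⟩

lemma HOM (hG : G.Good) {σ : Δ.cones} {u : G.K σ →ₗ[PolyRing V] AQ σ.1.spanC} (hu : ResEq hG σ u v) {e : ℤ}
    (hv : ∀ τ : Δ.cones, IsFacet τ.1 σ.1 → ∀ p : ℤ, ∀ k : G.K τ, k.1 ∈ (G.stalk τ).deg p →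
        v τ k ∈ AD τ.1.spanC (p + e)) :
    ∃ u' : G.K σ →ₗ[PolyRing V] AQ σ.1.spanC, ResEq hG σ u' v ∧ ∀ p : ℤ, ∀ k : G.K σ,
      k.1 ∈ (G.stalk σ).deg p → u' k ∈ AD σ.1.spanC (p + e - 2) := by
  obtain ⟨u', hu'⟩ := K_hom_comp u (e - 2)
  refine ⟨u', fun τ h w => ?_, fun p k hk => ?_⟩
  · refine gr_ind ((G.stalk σ).grM.sub (W_gr (F := G) σ τ)).gr
      (P := fun w => ∀ x ∈ τ.1.spanC, qv (u' (mH hG h w)) x = qv (v τ (G.rT h w)) x) ?_ ?_ ?_ w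
    · intro x hx
      rw [map_zero, map_zero, map_zero, map_zero, qv_zero (h.1.span_le hx), qv_zero hx]
    · intro a b ha hb x hx
      rw [map_add, map_add, map_add, map_add, qv_add _ _ (h.1.span_le hx), qv_add _ _ hx, ha x hx, hb x hx]
    · intro p w hw x hx
      have h1 : (mH hG h w).1 ∈ (G.stalk σ).deg (2 + p) := by
        rw [mH_val]
        exact (G.stalk σ).grM.smul _ _ _ (linP_deg _) _ hw
      have h2 := hv τ h p (G.rT h w) (by rw [rT_val]; exact G.r_deg hw)
      have h3 : 2 + p + (e - 2) = p + e := by ring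
      have h4 := hu' _ _ h1
      rw [h3] at h4
      have h5 : fac h.1.span_le (u' (mH hG h w)) = v τ (G.rT h w) := by
        rw [h4]
        exact fac_pr_eq h.1.span_le (fac_eq h.1.span_le (hu τ h w)) h2
      rw [← h5, qv_fac _ _ hx]
  · rw [hu' p k hk]
    have := pr_mem (AD_gr σ.1.spanC).gr (p + (e - 2)) (u k)
    rw [← add_sub_assoc] at this ⊢
    exact this

lemma sec_eq {σ : Cone V} (hσ : ∀ ζ, ζ.IsProperFaceOf σ → ζ ∈ Δ.cones) {s t : G.Sec (bd σ)}
    (h : ∀ τ : Δ.cones, IsFacet τ.1 σ → s.1 τ = t.1 τ) : s = t := by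
  apply Subtype.ext; funext ζ
  by_cases hz : ζ.1.IsProperFaceOf σ
  · obtain ⟨τ, hτ, hζ⟩ := exists_facet_of_proper hz
    let t' : Δ.cones := ⟨τ, hσ _ hτ.proper⟩
    have h1 := (G.mem_sec.1 s.2).2 t' ζ hτ.proper hz hζ
    have h2 := (G.mem_sec.1 t.2).2 t' ζ hτ.proper hz hζ
    rw [← h1, ← h2, h t' hτ]
  · rw [(G.mem_sec.1 s.2).1 ζ hz, (G.mem_sec.1 t.2).1 ζ hz]

lemma face_facet_proper {σ τ ζ : Cone V} (h : IsFacet τ σ) (hz : ζ.IsFaceOf τ) : ζ.IsProperFaceOf σ := by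
  refine ⟨hz.trans h.1, fun e => ?_⟩
  have e1 := Cone.dim_le_of_sub (hz.sub)
  rw [e] at e1
  have := h.2; omega

lemma star2 {σ : Cone V} {τ τ' ρ : Δ.cones} (h : IsFacet τ.1 σ) (h' : IsFacet τ'.1 σ)
    (hne : τ' ≠ τ) (hρ : IsFacet ρ.1 τ.1) (hρ' : IsFacet ρ.1 τ'.1) (w : G.W τ ρ) (w' : G.W τ' ρ)
    (hw : G.rT hρ w = G.rT hρ' w') : ∃ y : G.Sec (bd σ), y.1 τ = w.1 ∧ y.1 τ' = w'.1 ∧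
      ∀ t : Δ.cones, IsFacet t.1 σ → t ≠ τ → t ≠ τ' → y.1 t = 0 := by
  have hne1 : τ'.1 ≠ τ.1 := fun e => hne (Subtype.ext e)
  have hnf : ∀ t : Δ.cones, IsFacet t.1 σ → t ≠ τ → ¬ t.1.IsFaceOf τ.1 := fun t ht hn hh =>
    hn (Subtype.ext (facet_of_face_facet ht h hh))
  have hnf' : ∀ t : Δ.cones, IsFacet t.1 σ → t ≠ τ' → ¬ t.1.IsFaceOf τ'.1 := fun t ht hn hh =>
    hn (Subtype.ext (facet_of_face_facet ht h' hh))
  have hboth : ∀ ζ : Δ.cones, ζ.1.IsFaceOf τ.1 → ζ.1.IsFaceOf τ'.1 → G.r τ ζ w.1 = G.r τ' ζ w'.1 := by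
    intro ζ hz hz'
    by_cases hzr : ζ.1.IsFaceOf ρ.1
    · rw [← G.r_comp hρ.1 hzr, ← G.r_comp hρ'.1 hzr, ← rT_val hρ, ← rT_val hρ', hw]
    · rw [W_zero w.2 _ hzr, W_zero w'.2 _ hzr]
      · rintro rfl; exact hnf _ h' hne hz
      · rintro rfl; exact hnf' _ h hne.symm hz'
  let y : ∀ ζ : Δ.cones, (G.stalk ζ).M := fun ζ => if ζ.1.IsFaceOf τ.1 then G.r τ ζ w.1 else G.r τ' ζ w'.1
  have y1 : ∀ ζ : Δ.cones, ζ.1.IsFaceOf τ.1 → y ζ = G.r τ ζ w.1 := fun ζ hz => if_pos hz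
  have y2 : ∀ ζ : Δ.cones, ζ.1.IsFaceOf τ'.1 → y ζ = G.r τ' ζ w'.1 := fun ζ hz => by
    by_cases hh : ζ.1.IsFaceOf τ.1
    · rw [y1 _ hh, hboth _ hh hz]
    · exact if_neg hh
  have y3 : ∀ ζ : Δ.cones, ¬ ζ.1.IsFaceOf τ.1 → ¬ ζ.1.IsFaceOf τ'.1 → y ζ = 0 := fun ζ hz hz' => by
    rw [show y ζ = _ from if_neg hz, G.r_not hz']; rfl
  have key : ∀ ζ ξ : Δ.cones, ζ.1.IsProperFaceOf σ → ξ.1.IsFaceOf ζ.1 → ¬ ζ.1.IsFaceOf τ.1 →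
      ¬ ζ.1.IsFaceOf τ'.1 → y ξ = 0 := by
    intro ζ ξ hζ hξ hn hn'
    have hgen : ∀ t : Δ.cones, ∀ ht : IsFacet ρ.1 t.1, ∀ z : G.W t ρ, ξ ≠ t → G.r t ξ z.1 = 0 := by
      intro t ht z hxt
      by_cases hxr : ξ.1.IsFaceOf ρ.1
      · rw [← G.r_comp ht.1 hxr]
        refine K_zero (rT_mem ht z.2) ?_
        rintro rfl
        obtain ⟨t2, ht2, hzt⟩ := exists_facet_of_proper hζ
        rcases other_unique h h' hne1 hρ hρ' ht2 (hξ.trans hzt) with e | e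
        · exact hn (e ▸ hzt)
        · exact hn' (e ▸ hzt)
      · exact W_zero z.2 hxt hxr
    have hmax : ∀ t : Δ.cones, IsFacet t.1 σ → ξ = t → ζ.1.IsFaceOf t.1 := by
      rintro t ht rfl
      obtain ⟨t2, ht2, hzt⟩ := exists_facet_of_proper hζ
      rw [facet_of_face_facet ht ht2 (hξ.trans hzt)]
      exact hzt
    by_cases hx : ξ.1.IsFaceOf τ.1
    · rw [y1 _ hx]
      exact hgen τ hρ w fun e => hn (hmax τ h e)
    · rw [show y ξ = _ from if_neg hx]
      exact hgen τ' hρ' w' fun e => hn' (hmax τ' h' e)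
  refine ⟨⟨y, G.mem_sec.2 ⟨fun ζ hζ => ?_, fun ζ ξ hζ hξ hh => ?_⟩⟩, ?_, ?_, fun t ht h1 h2 => ?_⟩
  · exact y3 ζ (fun hz => hζ (face_facet_proper h hz)) (fun hz => hζ (face_facet_proper h' hz))
  · by_cases h1 : ζ.1.IsFaceOf τ.1
    · rw [y1 _ h1, y1 _ (hh.trans h1), G.r_comp h1 hh]
    · by_cases h2 : ζ.1.IsFaceOf τ'.1
      · rw [y2 _ h2, y2 _ (hh.trans h2), G.r_comp h2 hh]
      · rw [y3 _ h1 h2, key ζ ξ hζ hh h1 h2, map_zero]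
  · show y τ = _
    rw [y1 _ (Cone.face_refl _), G.r_self]
  · show y τ' = _
    rw [y2 _ (Cone.face_refl _), G.r_self]
  · exact y3 _ (hnf t ht h1) (hnf' t ht h2)

lemma RC (hG : G.Good) {σ : Δ.cones} {u : G.K σ →ₗ[PolyRing V] AQ σ.1.spanC} (hu : ResEq hG σ u v) :
    Compat hG σ.1 v := by
  intro τ τ' ρ h h' hne hρ hρ' w w' hw x hx
  have hne1 : τ'.1 ≠ τ.1 := fun e => hne (Subtype.ext e)
  obtain ⟨y, hy1, hy2, hy3⟩ := star2 h h' hne hρ hρ' w w' hw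
  obtain ⟨Y, hY⟩ := hG.surj σ y.1 y.2
  have hYf : ∀ t : Δ.cones, IsFacet t.1 σ.1 → G.r σ t Y = y.1 t := fun t ht => hY t ht.proper
  obtain ⟨γ, hγ, hg1, hg2⟩ := diamond h h' hne1 hρ hρ'
  have hxt := hρ.1.span_le hx
  have hxt' := hρ'.1.span_le hx
  have m1 : linP (hl σ.1 τ'.1) • Y ∈ G.W σ τ := mem_W.2 fun t ht htn => by
    rw [map_smul]
    by_cases e : t = τ'
    · subst e; exact hG.kill _ (linP_hl_mem h') _
    · rw [hYf t ht, hy3 t ht htn e, smul_zero]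
  have m2 : linP (hl σ.1 τ.1) • Y ∈ G.W σ τ' := mem_W.2 fun t ht htn => by
    rw [map_smul]
    by_cases e : t = τ
    · subst e; exact hG.kill _ (linP_hl_mem h) _
    · rw [hYf t ht, hy3 t ht e htn, smul_zero]
  have e1 : G.rT h ⟨_, m1⟩ = algebraMap ℝ (PolyRing V) γ • mH hG hρ w := by
    apply Subtype.ext
    rw [rT_val]
    show G.r σ τ (linP (hl σ.1 τ'.1) • Y) = algebraMap ℝ (PolyRing V) γ • (mH hG hρ w).1
    rw [mH_val, map_smul, hYf τ h, hy1, ← mul_smul, ← sub_eq_zero, ← sub_smul]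
    refine hG.kill _ (mem_IV.2 fun z hz => ?_) _
    simp [hg1 z hz]
  have e2 : G.rT h' ⟨_, m2⟩ = algebraMap ℝ (PolyRing V) γ • mH hG hρ' w' := by
    apply Subtype.ext
    rw [rT_val]
    show G.r σ τ' (linP (hl σ.1 τ.1) • Y) = algebraMap ℝ (PolyRing V) γ • (mH hG hρ' w').1
    rw [mH_val, map_smul, hYf τ' h', hy2, ← mul_smul, ← sub_eq_zero, ← sub_smul]
    refine hG.kill _ (mem_IV.2 fun z hz => ?_) _
    simp [hg2 z hz]
  have e3 : mH hG h ⟨_, m1⟩ = mH hG h' ⟨_, m2⟩ := by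
    apply Subtype.ext
    rw [mH_val, mH_val]
    exact smul_comm _ _ _
  have r1 := hu τ h ⟨_, m1⟩ x hxt
  have r2 := hu τ' h' ⟨_, m2⟩ x hxt'
  rw [e1, map_smul, qv_smul _ _ hxt, poly_algebraMap] at r1
  rw [e2, map_smul, qv_smul _ _ hxt', poly_algebraMap, ← e3, r1] at r2
  exact mul_left_cancel₀ hγ.ne' r2

lemma exists_v (hG : G.Good) (σ : Δ.cones) (u : G.K σ →ₗ[PolyRing V] AQ σ.1.spanC) :
    ∃ v : ∀ τ : Δ.cones, G.K τ →ₗ[PolyRing V] AQ τ.1.spanC, ResEq hG σ u v := by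
  have key : ∀ τ : Δ.cones, ∃ g : G.K τ →ₗ[PolyRing V] AQ τ.1.spanC, ∀ h : IsFacet τ.1 σ.1,
      ∀ w, g (G.rT h w) = fac h.1.span_le (u (mH hG h w)) := by
    intro τ
    by_cases h : IsFacet τ.1 σ.1
    · obtain ⟨g, hg⟩ := descend (G.rT h) (rT_surj hG h) ((fac h.1.span_le) ∘ₗ u ∘ₗ mH hG h) (fun w hw => by
        have hk : w.1 ∈ G.K σ := mem_K.2 fun t ht => by
          by_cases e : t = τ
          · subst e
            rw [← rT_val h, hw]; rfl
          · exact mem_W.1 w.2 t ht e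
        have e : mH hG h w = linP (hl σ.1 τ.1) • (⟨w.1, hk⟩ : G.K σ) := Subtype.ext (mH_val hG h w)
        show fac h.1.span_le (u (mH hG h w)) = 0
        rw [e, map_smul, map_smul]
        exact AQ_kill (linP_hl_mem h) _)
      exact ⟨g, fun _ w => hg w⟩
    · exact ⟨0, fun h' => absurd h' h⟩
  choose v hv using key
  exact ⟨v, fun τ h w x hx => by rw [hv τ h w, qv_fac _ _ hx]⟩

lemma hl_dvd {σ τ : Cone V} (h : IsFacet τ σ) {a : AQ σ.spanC} :
    mkA σ.spanC (linP (hl σ τ)) ∣ a ↔ ∀ x ∈ τ.spanC, qv a x = 0 := by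
  obtain ⟨p, rfl⟩ := mkA_surj a
  constructor
  · rintro ⟨b, hb⟩ x hx
    obtain ⟨p', rfl⟩ := mkA_surj b
    rw [hb, ← mkA_mul, qv_mk _ (h.1.span_le hx), poly_mul, linP_apply, hl_zero h hx, zero_mul]
  · intro hh
    obtain ⟨b, hb⟩ := IV_div σ.spanC (hl σ τ) (nv σ τ) (nv_mem h) (hl_nv h) p (fun x hx h0 => by
      rw [hl_zero_iff h hx] at h0
      rw [← qv_mk p hx, hh x h0])
    exact ⟨mkA _ b, by rw [← mkA_mul, mkA_eq]; exact hb⟩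

lemma hl_prime {σ τ : Cone V} (h : IsFacet τ σ) : Prime (mkA σ.spanC (linP (hl σ τ))) := by
  refine ⟨fun h0 => ?_, fun hu => ?_, fun a b hab => ?_⟩
  · rw [mkA_zero_iff, mem_IV] at h0
    have := h0 _ (nv_mem h)
    rw [linP_apply, hl_nv h] at this
    exact one_ne_zero this
  · have h1 : mkA σ.spanC (linP (hl σ τ)) ∣ mkA σ.spanC 1 := hu.dvd
    have := (hl_dvd h).1 h1 0 (zero_mem _)
    rw [qv_mk _ (zero_mem _), poly_one] at this
    exact one_ne_zero this
  · rw [hl_dvd h, hl_dvd h]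
    rw [hl_dvd h] at hab
    obtain ⟨p, rfl⟩ := mkA_surj a
    obtain ⟨p', rfl⟩ := mkA_surj b
    rcases (IV_prime τ.spanC).mem_or_mem (x := p) (y := p') (mem_IV.2 fun x hx => by
      rw [← qv_mk (U := σ.spanC) _ (h.1.span_le hx), mkA_mul]; exact hab x hx) with h1 | h1
    · exact Or.inl fun x hx => by rw [qv_mk _ (h.1.span_le hx)]; exact mem_IV.1 h1 x hx
    · exact Or.inr fun x hx => by rw [qv_mk _ (h.1.span_le hx)]; exact mem_IV.1 h1 x hx

lemma RM (hG : G.Good) {σ : Δ.cones} (hσ : σ.1 ≠ zeroCone V) {u : G.K σ →ₗ[PolyRing V] AQ σ.1.spanC}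
    (hu : ResEq hG σ u 0) (k : G.K σ) : qv (u k) 0 = 0 := by
  have h0s := zero_mem σ.1.spanC
  let hh : Δ.cones → PolyRing V := fun τ => linP (hl σ.1 τ.1)
  let f : PolyRing V := ∏ τ ∈ fs Δ σ.1, hh τ
  have hfK : ∀ y : (G.stalk σ).M, f • y ∈ G.K σ := fun y => mem_K.2 fun t ht => by
    rw [map_smul]
    refine hG.kill _ (Ideal.mem_of_dvd _ (Finset.dvd_prod_of_mem hh (mem_fs.2 ht)) (linP_hl_mem ht)) _
  have hf0 : mkA σ.1.spanC f ≠ 0 := by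
    have : mkA σ.1.spanC f = ∏ τ ∈ fs Δ σ.1, mkA σ.1.spanC (hh τ) := map_prod (Ideal.Quotient.mk _) _ _
    rw [this, Finset.prod_ne_zero_iff]
    intro τ hτ
    exact (hl_prime (mem_fs.1 hτ)).ne_zero
  have hdiv : ∀ y, mkA σ.1.spanC f ∣ u ⟨_, hfK y⟩ := by
    intro y
    have e : mkA σ.1.spanC f = ∏ τ ∈ fs Δ σ.1, mkA σ.1.spanC (hh τ) := map_prod (Ideal.Quotient.mk _) _ _
    rw [e]
    have hpr : ∀ τ ∈ fs Δ σ.1, Prime (mkA σ.1.spanC (hh τ)) := fun τ hτ => by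
      have h1 := mem_fs.1 hτ
      exact hl_prime h1
    refine AQ_prod_dvd_of (fs Δ σ.1) (fun τ => mkA σ.1.spanC (hh τ)) hpr _ ?_
    intro τ hτ
    have hτ' := mem_fs.1 hτ
    let g : PolyRing V := ∏ t ∈ (fs Δ σ.1).erase τ, hh t
    have hg : f = hh τ * g := (Finset.mul_prod_erase _ _ hτ).symm
    refine ⟨mkA _ g, ?_, ?_⟩
    · have : mkA σ.1.spanC g = ∏ t ∈ (fs Δ σ.1).erase τ, mkA σ.1.spanC (hh t) :=
        map_prod (Ideal.Quotient.mk _) _ _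
      rw [this, (hl_prime hτ').dvd_finset_prod_iff]
      rintro ⟨t, ht, hd⟩
      rw [Finset.mem_erase] at ht
      rw [hl_dvd hτ'] at hd
      have hsub : τ.1.spanC ≤ t.1.spanC := fun x hx => by
        rw [← hl_zero_iff (mem_fs.1 ht.2) (hτ'.1.span_le hx)]
        have := hd x hx
        rwa [qv_mk _ (hτ'.1.span_le hx), linP_apply] at this
      have : τ.1 = t.1 := by
        refine facet_of_face_facet hτ' (mem_fs.1 ht.2) (Cone.IsFaceOf.of_sub hτ'.1 (mem_fs.1 ht.2).1 ?_)
        intro x hx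
        have h1 := hsub (τ.1.mem_span hx)
        have h2 := hτ'.1.sub hx
        rw [(mem_fs.1 ht.2).mem_iff h2, hl_zero (mem_fs.1 ht.2) h1]
      exact ht.1 (Subtype.ext this.symm)
    · rw [← e]
      have hgW : g • y ∈ G.W σ τ := mem_W.2 fun t ht hn => by
        rw [map_smul]
        exact hG.kill _ (Ideal.mem_of_dvd _ (Finset.dvd_prod_of_mem hh
          (Finset.mem_erase.2 ⟨hn, mem_fs.2 ht⟩)) (linP_hl_mem ht)) _
      have e1 : (⟨f • y, hfK y⟩ : G.K σ) = mH hG hτ' ⟨_, hgW⟩ := by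
        apply Subtype.ext
        rw [mH_val]
        show f • y = hh τ • g • y
        rw [hg, mul_smul]
      have e2 : mkA σ.1.spanC f = mkA σ.1.spanC g * mkA σ.1.spanC (linP (hl σ.1 τ.1)) := by
        rw [hg, mul_comm, mkA_mul]
      rw [e1, e2]
      refine mul_dvd_mul_left _ ((hl_dvd hτ').2 fun x hx => ?_)
      rw [hu τ hτ' _ x hx]
      exact qv_zero hx
  have hind : ∀ z ∈ mSub V (G.stalk σ).M, ∃ c : AQ σ.1.spanC, qv c 0 = 0 ∧ u ⟨_, hfK z⟩ = mkA _ f * c := by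
    intro z hz
    refine Submodule.smul_induction_on hz (fun a ha y _ => ?_) (fun y y' => ?_)
    · obtain ⟨c, hc⟩ := hdiv y
      refine ⟨a • c, ?_, ?_⟩
      · rw [qv_smul _ _ h0s, mem_mId.1 ha, zero_mul]
      · rw [mul_smul_comm, ← hc, ← map_smul]
        congr 1
        exact Subtype.ext (smul_comm _ _ _)
    · rintro ⟨c, hc, hc'⟩ ⟨d, hd, hd'⟩
      refine ⟨c + d, ?_, ?_⟩
      · rw [qv_add _ _ h0s, hc, hd, zero_add]
      · rw [mul_add, ← hc', ← hd', ← map_add]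
        congr 1
        exact Subtype.ext (smul_add _ _ _)
  obtain ⟨c, hc, hc'⟩ := hind k.1 (hG.ker σ hσ k.1 fun τ hτ => K_zero k.2 fun e => hτ.2 (congrArg Subtype.val e))
  have e : u ⟨_, hfK k.1⟩ = mkA _ f * u k := by
    have : (⟨_, hfK k.1⟩ : G.K σ) = f • k := rfl
    rw [this, map_smul]; rfl
  rw [e] at hc'
  rw [mul_left_cancel₀ hf0 hc', hc]

end FanSheaf
end restr

/-! ### The duality induction -/

section dual
variable {V : Type} [AddCommGroup V] [Module ℝ V] [FiniteDimensional ℝ V]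

lemma AD_pr_mk {U : Submodule ℝ V} (p : PolyRing V) (e : ℤ) :
    pr (AD U) e (mkA U p) = mkA U (pr (Adeg V) e p) :=
  pr_comm0 gr_A (AD_gr U).gr (Ideal.Quotient.mk (IV U)).toAddMonoidHom (fun q x hx => mem_AD.2 ⟨x, hx, rfl⟩) e p

lemma AD_pr_nonpos {U : Submodule ℝ V} {a : AQ U} (h : qv a 0 = 0) {e : ℤ} (he : e ≤ 0) : pr (AD U) e a = 0 := by
  obtain ⟨p, rfl⟩ := mkA_surj a
  rw [AD_pr_mk]
  rcases he.lt_or_eq with he | rfl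
  · rw [Adeg_neg (pr_mem gr_A e p) he, mkA_zero]
  · rw [qv_mk _ (zero_mem _)] at h
    rw [pr_A_zero, h, map_zero, mkA_zero]

section absdual
variable {M K : Type} [AddCommGroup M] [Module (PolyRing V) M] [AddCommGroup K] [Module (PolyRing V) K]
  [Module ℝ M] [Module ℝ K] {U : Submodule ℝ V} {N : ℕ} {b : Fin N → K} [IsScalarTower ℝ (PolyRing V) M] [IsScalarTower ℝ (PolyRing V) K]

lemma abs_basis (hbs : ∀ x, ∃ c : Fin N → PolyRing V, x = ∑ i, c i • b i)
    (hbr : ∀ c : Fin N → PolyRing V, ∑ i, c i • b i = 0 → ∀ i, c i ∈ IV U) :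
    ∃ st : Fin N → (K →ₗ[PolyRing V] AQ U), (∀ j i, st j (b i) = if i = j then mkA U 1 else 0) ∧
      ∀ (f : K →ₗ[PolyRing V] AQ U) (a : Fin N → PolyRing V), (∀ i, mkA U (a i) = f (b i)) → f = ∑ j, a j • st j := by
  have hst : ∀ j, ∃ f : K →ₗ[PolyRing V] AQ U, ∀ i, f (b i) = if i = j then mkA U 1 else 0 :=
    fun j => CFree.lift (I := IV U) (fun a ha x => AQ_kill ha x) hbs hbr
      (fun i => if i = j then mkA U 1 else 0)
  choose st hst using hst
  refine ⟨st, hst, fun f a ha => ?_⟩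
  ext1 y
  obtain ⟨c, rfl⟩ := hbs y
  rw [map_sum, map_sum]
  refine Finset.sum_congr rfl fun i _ => ?_
  rw [map_smul, map_smul]
  congr 1
  rw [LinearMap.sum_apply, Finset.sum_eq_single i]
  · rw [LinearMap.smul_apply, hst, if_pos rfl, mkA_smul, mul_one, ha]
  · intro j _ hne
    rw [LinearMap.smul_apply, hst, if_neg hne.symm, smul_zero]
  · intro h; exact absurd (Finset.mem_univ _) h

lemma abs_surj {e : Fin N → ℤ} (Dσ : M →ₗ[PolyRing V] K →ₗ[PolyRing V] AQ U)
    (hbs : ∀ x, ∃ c : Fin N → PolyRing V, x = ∑ i, c i • b i)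
    (hbr : ∀ c : Fin N → PolyRing V, ∑ i, c i • b i = 0 → ∀ i, c i ∈ IV U)
    (happ : ∀ (f : K →ₗ[PolyRing V] AQ U) (j : Fin N), (∀ i, f (b i) ∈ AD U (e i - e j)) →
      ∃ x, ∀ i, e i ≤ e j → Dσ x (b i) = f (b i)) (u : K →ₗ[PolyRing V] AQ U) : ∃ x, Dσ x = u := by
  obtain ⟨st, hst, hexp⟩ := abs_basis hbs hbr
  have hstd : ∀ j i, st j (b i) ∈ AD U (e i - e j) := fun j i => by
    rw [hst]
    split_ifs with h
    · rw [h, sub_self]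
      exact mem_AD.2 ⟨1, by simpa using algebraMap_deg (V := V) 1, rfl⟩
    · exact zero_mem _
  have main : ∀ j, ∃ x, Dσ x = st j := by
    intro j
    have wf : WellFounded (fun i j : Fin N => e j < e i) := by
      haveI : IsTrans (Fin N) (fun i j : Fin N => e j < e i) := ⟨fun a b c h1 h2 => h2.trans h1⟩
      haveI : Std.Irrefl (fun i j : Fin N => e j < e i) := ⟨fun a h => lt_irrefl _ h⟩
      exact Finite.wellFounded_of_trans_of_irrefl _
    induction j using wf.induction with
    | _ j ih =>
    obtain ⟨x, hx⟩ := happ (st j) j (hstd j)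
    choose a ha using fun i => mkA_surj ((st j - Dσ x) (b i))
    have h5 := hexp (st j - Dσ x) (fun i => if e j < e i then a i else 0) (fun i => by
      by_cases hi : e j < e i
      · rw [if_pos hi, ha]
      · rw [if_neg hi, LinearMap.sub_apply, hx i (not_lt.1 hi), sub_self, mkA_zero])
    choose x' hx' using fun (i : Fin N) (hi : e j < e i) => ih i hi
    refine ⟨x + ∑ i, if hi : e j < e i then a i • x' i hi else 0, ?_⟩
    rw [map_add, map_sum, eq_comm, ← sub_eq_iff_eq_add', h5]
    refine Finset.sum_congr rfl fun i _ => ?_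
    by_cases hi : e j < e i
    · rw [if_pos hi, dif_pos hi, map_smul, hx']
    · rw [if_neg hi, dif_neg hi, map_zero, zero_smul]
  choose x hx using main
  choose a ha using fun i => mkA_surj (u (b i))
  refine ⟨∑ i, a i • x i, ?_⟩
  rw [hexp u a ha, map_sum]
  exact Finset.sum_congr rfl fun i _ => by rw [map_smul, hx]

lemma abs_inj_aux (Dσ : M →ₗ[PolyRing V] K →ₗ[PolyRing V] AQ U)
    (hbs : ∀ x, ∃ c : Fin N → PolyRing V, x = ∑ i, c i • b i)
    (hbr : ∀ c : Fin N → PolyRing V, ∑ i, c i • b i = 0 → ∀ i, c i ∈ IV U)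
    (hsurj : ∀ u, ∃ x, Dσ x = u) (hkill : ∀ a ∈ IV U, ∀ x : M, a • x = 0)
    (X : Submodule (PolyRing V) M) (hX : ∀ x, x ∈ X ↔ Dσ x = 0)
    (hker : ∀ x ∈ X, x ∈ mSub V M) (z : X) : z ∈ mSub V X := by
  obtain ⟨st, hst, hexp⟩ := abs_basis hbs hbr
  choose ε hε using fun j => hsurj (st j)
  have hlin : ∀ (c : Fin N → PolyRing V), Dσ (∑ j, c j • ε j) = ∑ j, c j • st j := fun c => by
    rw [map_sum]
    exact Finset.sum_congr rfl fun i _ => by rw [map_smul, hε]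
  have hval : ∀ (c : Fin N → PolyRing V) i, Dσ (∑ j, c j • ε j) (b i) = mkA U (c i) := fun c i => by
    rw [hlin, LinearMap.sum_apply, Finset.sum_eq_single i]
    · rw [LinearMap.smul_apply, hst, if_pos rfl, mkA_smul, mul_one]
    · intro j _ hne
      rw [LinearMap.smul_apply, hst, if_neg hne.symm, smul_zero]
    · intro h; exact absurd (Finset.mem_univ _) h
  have hdec : ∀ y, ∃ (x' : X) (c : Fin N → PolyRing V), y = x'.1 + ∑ j, c j • ε j := fun y => by
    choose a ha using fun i => mkA_surj (Dσ y (b i))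
    refine ⟨⟨y - ∑ j, a j • ε j, (hX _).2 ?_⟩, a, (sub_add_cancel _ _).symm⟩
    rw [map_sub, hlin, ← hexp (Dσ y) a ha, sub_self]
  have hm : ∀ y ∈ mSub V M, ∃ (x' : X) (c : Fin N → PolyRing V), x' ∈ mSub V X ∧
      y = x'.1 + ∑ j, c j • ε j := by
    intro y hy
    refine Submodule.smul_induction_on hy (fun a ha y _ => ?_) (fun y y' => ?_)
    · obtain ⟨x', c, rfl⟩ := hdec y
      refine ⟨a • x', fun j => a * c j, Submodule.smul_mem_smul ha trivial, ?_⟩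
      rw [smul_add, Finset.smul_sum]
      simp only [mul_smul]
      rfl
    · rintro ⟨x', c, h1, rfl⟩ ⟨x'', c', h2, rfl⟩
      refine ⟨x' + x'', fun j => c j + c' j, add_mem h1 h2, ?_⟩
      simp only [add_smul, Finset.sum_add_distrib]
      show _ = x'.1 + x''.1 + _
      abel
  obtain ⟨x', c, h1, h2⟩ := hm z.1 (hker _ z.2)
  have h3 : ∀ i, c i ∈ IV U := fun i => by
    rw [← mkA_zero_iff, ← hval c i]
    have : ∑ j, c j • ε j = z.1 - x'.1 := by rw [h2]; abel
    rw [this, map_sub, (hX _).1 z.2, (hX _).1 x'.2, sub_zero]; rfl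
  have h4 : z = x' := Subtype.ext (by
    rw [h2, Finset.sum_eq_zero fun j _ => hkill _ (h3 j) (ε j), add_zero])
  rw [h4]; exact h1

lemma abs_nak {d : ℤ → Submodule ℝ M} (h : GrM V d)
    [Module.Finite (PolyRing V) M] (X : Submodule (PolyRing V) M) (hX : GrSub d X)
    (hm : ∀ z : X, z ∈ mSub V X) (x : M) (hx : x ∈ X) : x = 0 := by
  haveI : IsNoetherian (PolyRing V) M := isNoetherian_of_isNoetherianRing_of_finite _ _
  haveI : Module.Finite (PolyRing V) X := inferInstance
  have := gr_nak (h.sub hX) (N := ⊥) (fun y hy p => by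
    rw [(Submodule.mem_bot _).1 hy, map_zero]; exact zero_mem _)
    (fun y => ⟨0, zero_mem _, by rw [sub_zero]; exact hm y⟩) (⟨x, hx⟩ : X)
  exact congrArg Subtype.val ((Submodule.mem_bot _).1 this)

end absdual

namespace FanSheaf
variable {Δ : Fan V} {E G : FanSheaf Δ}

lemma K_cfree (hG : G.Good) (σ : Δ.cones) : CFree (IV σ.1.spanC) (subD (G.stalk σ).deg (G.K σ)) := by
  obtain ⟨l, hIl⟩ := exists_int σ.1
  have h := S2 hG σ (-l) (neg_mem (σ.1.mem_span hIl.1))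
  have e : G.kerV σ (-l) = G.K σ := by
    ext x
    rw [mem_kerV, mem_K]
    refine forall_congr' fun τ => ⟨fun hh hτ => hh hτ ?_, fun hh hτ _ => hh hτ⟩
    rw [map_neg, neg_lt_zero]
    exact hIl.2 _ hτ
  rwa [e] at h

section pieces
variable {n : ℕ} {D : ∀ τ : Δ.cones, (E.stalk τ).M →ₗ[PolyRing V] G.K τ →ₗ[PolyRing V] AQ τ.1.spanC}

lemma Dual.compat {hG : G.Good} (hD : Dual hG n D) {σ : Cone V} (hdim : σ.dim = n + 1)
    (x : ∀ τ : Δ.cones, (E.stalk τ).M)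
    (hx : ∀ τ ρ : Δ.cones, IsFacet τ.1 σ → IsFacet ρ.1 τ.1 → E.r τ ρ (x τ) = x ρ) :
    Compat hG σ (fun τ => D τ (x τ)) := by
  intro τ τ' ρ h h' hne hρ hρ' w w' hw z hz
  have d1 : τ.1.dim ≤ n := by have := h.2; omega
  have d2 : τ'.1.dim ≤ n := by have := h'.2; omega
  have h1 := hD.res τ d1 (x τ) ρ hρ w z hz
  have h2 := hD.res τ' d2 (x τ') ρ hρ' w' z hz
  rw [h1, h2]
  show qv (D ρ (E.r τ ρ (x τ)) _) z = qv (D ρ (E.r τ' ρ (x τ')) _) z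
  rw [hx τ ρ h hρ, hx τ' ρ h' hρ', hw]

lemma ne_zeroCone {σ : Cone V} (hdim : σ.dim = n + 1) : σ ≠ zeroCone V := fun h => by
  rw [h, zeroCone_dim] at hdim; omega

lemma exists_D (hE : E.Good) {hG : G.Good} (hD : Dual hG n D) (σ : Δ.cones) (hdim : σ.1.dim = n + 1) :
    ∃ Dσ : (E.stalk σ).M →ₗ[PolyRing V] G.K σ →ₗ[PolyRing V] AQ σ.1.spanC,
      (∀ x, ResEq hG σ (Dσ x) (fun ρ => D ρ (E.r σ ρ x))) ∧
      ∀ p q : ℤ, ∀ x ∈ (E.stalk σ).deg p, ∀ y : G.K σ, y.1 ∈ (G.stalk σ).deg q →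
        Dσ x y ∈ AD σ.1.spanC (p + q - 2 * σ.1.dim) := by
  obtain ⟨hk, N, b, e, hb, hbs, hbr⟩ := hE.free σ
  have key : ∀ i, ∃ u : G.K σ →ₗ[PolyRing V] AQ σ.1.spanC,
      ResEq hG σ u (fun ρ => D ρ (E.r σ ρ (b i))) ∧ ∀ p : ℤ, ∀ k : G.K σ,
      k.1 ∈ (G.stalk σ).deg p → u k ∈ AD σ.1.spanC (p + (e i - 2 * n) - 2) := fun i => by
    have hc : Compat hG σ.1 (fun ρ => D ρ (E.r σ ρ (b i))) :=
      hD.compat hdim (fun ρ => E.r σ ρ (b i)) fun τ ρ h1 h2 => E.r_comp h1.1 h2.1 _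
    obtain ⟨u, hu⟩ := LIFT hG σ (ne_zeroCone hdim) hc
    refine HOM hG hu fun τ h p k hk' => ?_
    have hd : τ.1.dim = n := by have := h.2; omega
    have := hD.deg τ hd.le (e i) p _ (E.r_deg (hb i)) k hk'
    rw [hd] at this
    have e1 : p + (e i - 2 * n) = e i + p - 2 * n := by ring
    rw [e1]; exact this
  choose u hu hud using key
  obtain ⟨Dσ, hDσ⟩ := CFree.lift (I := IV σ.1.spanC) (P := G.K σ →ₗ[PolyRing V] AQ σ.1.spanC)
    (fun a ha f => LinearMap.ext fun k => AQ_kill ha _) hbs hbr u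
  refine ⟨Dσ, fun x => ?_, fun p q x hx y hy => ?_⟩
  · obtain ⟨c, rfl⟩ := hbs x
    intro τ h w z hz
    have hzs := h.1.span_le hz
    show qv (Dσ _ _) z = qv (D τ (E.r σ τ _) _) z
    simp only [map_sum, map_smul, hDσ, LinearMap.sum_apply, LinearMap.smul_apply]
    rw [qv_sum _ _ hzs, qv_sum _ _ hz]
    refine Finset.sum_congr rfl fun i _ => ?_
    rw [qv_smul _ _ hzs, qv_smul _ _ hz, hu i τ h w z hz]
  · obtain ⟨c, hc⟩ := hbs x
    have h1 : x = ∑ i, pr (Adeg V) (p - e i) (c i) • b i := by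
      conv_lhs => rw [← pr_of_mem (E.stalk σ).grM.gr hx, hc, map_sum]
      exact Finset.sum_congr rfl fun i _ => pr_smul_left (E.stalk σ).grM _ (hb i) _
    rw [h1]
    simp only [map_sum, map_smul, hDσ, LinearMap.sum_apply, LinearMap.smul_apply]
    refine Submodule.sum_mem _ fun i _ => ?_
    have h2 := (AD_gr σ.1.spanC).smul _ _ _ (pr_mem gr_A (p - e i) (c i)) _ (hud i q y hy)
    have h3 : p - e i + (q + (e i - 2 * n) - 2) = p + q - 2 * σ.1.dim := by rw [hdim]; push_cast; ring
    rw [h3] at h2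
    exact h2

variable {σ : Δ.cones} {Dσ : (E.stalk σ).M →ₗ[PolyRing V] G.K σ →ₗ[PolyRing V] AQ σ.1.spanC}

lemma D_pr (hdeg : ∀ p q : ℤ, ∀ x ∈ (E.stalk σ).deg p, ∀ y : G.K σ, y.1 ∈ (G.stalk σ).deg q →
        Dσ x y ∈ AD σ.1.spanC (p + q - 2 * σ.1.dim)) (p q : ℤ) (x : (E.stalk σ).M) (y : G.K σ)
    (hy : y.1 ∈ (G.stalk σ).deg q) :
    Dσ (pr (E.stalk σ).deg p x) y = pr (AD σ.1.spanC) (p + q - 2 * σ.1.dim) (Dσ x y) := by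
  let f : (E.stalk σ).M →+ AQ σ.1.spanC :=
    { toFun := fun x => Dσ x y, map_zero' := by simp, map_add' := fun a b => by simp }
  have := pr_comm (E.stalk σ).grM.gr (AD_gr σ.1.spanC).gr f (q - 2 * σ.1.dim) (fun p' x hx => by
    rw [← add_sub_assoc]; exact hdeg p' q x hx y hy) p x
  rw [← add_sub_assoc] at this
  exact this.symm

/-- any functional is, up to one with zero restriction, in the image -/
lemma D_approx (hE : E.Good) {hG : G.Good} (hD : Dual hG n D) (hdim : σ.1.dim = n + 1)
    (hres : ∀ x, ResEq hG σ (Dσ x) (fun ρ => D ρ (E.r σ ρ x))) (u : G.K σ →ₗ[PolyRing V] AQ σ.1.spanC) :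
    ∃ x, ∀ k, qv (u k - Dσ x k) 0 = 0 := by
  obtain ⟨v, hv⟩ := exists_v hG σ u
  obtain ⟨s, hs⟩ := KC (E := E) hG hD (σ := σ.1) (fun ζ h => Δ.face_mem _ σ.2 _ h.1) hdim (RC hG hv)
  obtain ⟨x, hx⟩ := hE.surj σ s.1 s.2
  refine ⟨x, fun k => ?_⟩
  refine RM hG (ne_zeroCone hdim) (u := u - Dσ x) (fun τ h w z hz => ?_) k
  have hzs := h.1.span_le hz
  have h1 := hres x τ h w z hz
  have h2 := hv τ h w z hz
  have h3 : D τ (E.r σ τ x) = v τ := by rw [hx τ h.proper, hs τ h]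
  simp only [h3] at h1
  show qv (u (mH hG h w) - Dσ x (mH hG h w)) z = qv (0 : AQ _) z
  rw [qv_zero hz, sub_eq_add_neg, qv_add _ _ hzs, h2, ← h1]
  have h4 : - (Dσ x) (mH hG h w) = (-1 : ℝ) • (Dσ x) (mH hG h w) := by rw [neg_one_smul]
  rw [h4, qv_rsmul _ _ hzs]
  ring

lemma D_surj (hE : E.Good) {hG : G.Good} (hD : Dual hG n D) (hdim : σ.1.dim = n + 1)
    (hres : ∀ x, ResEq hG σ (Dσ x) (fun ρ => D ρ (E.r σ ρ x)))
    (hdeg : ∀ p q : ℤ, ∀ x ∈ (E.stalk σ).deg p, ∀ y : G.K σ, y.1 ∈ (G.stalk σ).deg q →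
        Dσ x y ∈ AD σ.1.spanC (p + q - 2 * σ.1.dim)) (u : G.K σ →ₗ[PolyRing V] AQ σ.1.spanC) :
    ∃ x, Dσ x = u := by
  obtain ⟨hk, N, b, e, hb, hbs, hbr⟩ := K_cfree hG σ
  refine abs_surj (e := e) Dσ hbs hbr (fun f j hf => ?_) u
  obtain ⟨x, hx⟩ := D_approx hE hD hdim hres f
  refine ⟨pr (E.stalk σ).deg (2 * σ.1.dim - e j) x, fun i hi => ?_⟩
  have h2 := D_pr hdeg (2 * σ.1.dim - e j) (e i) x (b i) (hb i)
  have h3 : (2 * σ.1.dim - e j) + e i - 2 * σ.1.dim = e i - e j := by ring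
  rw [h3] at h2
  have h4 := AD_pr_nonpos (hx (b i)) (e := e i - e j) (by linarith)
  rw [map_sub, AD_pr_of_mem (hf i), sub_eq_zero] at h4
  rw [h2, h4]

lemma D_ker_m (hE : E.Good) {hG : G.Good} (hD : Dual hG n D) (hdim : σ.1.dim = n + 1)
    (hres : ∀ x, ResEq hG σ (Dσ x) (fun ρ => D ρ (E.r σ ρ x))) {x : (E.stalk σ).M} (hx : Dσ x = 0) :
    x ∈ mSub V (E.stalk σ).M := by
  have hK : x ∈ E.K σ := mem_K.2 fun τ h => by
    have hd : τ.1.dim ≤ n := by have := h.2; omega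
    apply hD.inj τ hd
    ext1 k
    obtain ⟨w, rfl⟩ := rT_surj hG h k
    apply qv_ext
    intro z hz
    have := hres x τ h w z hz
    rw [hx, LinearMap.zero_apply, qv_zero (h.1.span_le hz)] at this
    rw [LinearMap.zero_apply, qv_zero hz]
    exact this.symm
  exact hE.ker σ (ne_zeroCone hdim) x fun τ hτ => K_zero hK fun e => hτ.2 (congrArg Subtype.val e)

lemma D_inj (hE : E.Good) {hG : G.Good} (hD : Dual hG n D) (hdim : σ.1.dim = n + 1)
    (hres : ∀ x, ResEq hG σ (Dσ x) (fun ρ => D ρ (E.r σ ρ x)))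
    (hdeg : ∀ p q : ℤ, ∀ x ∈ (E.stalk σ).deg p, ∀ y : G.K σ, y.1 ∈ (G.stalk σ).deg q →
        Dσ x y ∈ AD σ.1.spanC (p + q - 2 * σ.1.dim)) (x : (E.stalk σ).M) (hx : Dσ x = 0) : x = 0 := by
  obtain ⟨hk, N, b, e, hb, hbs, hbr⟩ := K_cfree hG σ
  have hX : ∀ x, x ∈ LinearMap.ker Dσ ↔ Dσ x = 0 := fun x => LinearMap.mem_ker
  generalize LinearMap.ker Dσ = X at hX
  have h1 : ∀ z : X, z ∈ mSub V X := abs_inj_aux Dσ hbs hbr (D_surj hE hD hdim hres hdeg)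
    (fun a ha y => hE.kill σ ha y) X hX (fun y hy => D_ker_m hE hD hdim hres ((hX y).1 hy))
  have hXg : GrSub (E.stalk σ).deg X := fun y hy p => by
    rw [hX] at hy ⊢
    ext1 z
    obtain ⟨c, rfl⟩ := hbs z
    rw [map_sum, LinearMap.zero_apply]
    refine Finset.sum_eq_zero fun i _ => ?_
    have h2 := D_pr hdeg p (e i) y (b i) (hb i)
    rw [hy, LinearMap.zero_apply, map_zero] at h2
    rw [map_smul, h2, smul_zero]
  haveI := hE.finite σ
  exact abs_nak (E.stalk σ).grM X hXg h1 x ((hX x).2 hx)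

end pieces

lemma zero_lift (hE : E.Good) : ∃ (e : (E.stalk Δ.ozero).M) (α : (E.stalk Δ.ozero).M →ₗ[PolyRing V]
    AQ Δ.ozero.1.spanC), e ∈ (E.stalk Δ.ozero).deg 0 ∧ e ≠ 0 ∧ (∀ x, ∃ c : ℝ, x = c • e) ∧ α e = mkA _ 1 := by
  obtain ⟨e, he, he0, hs⟩ := hE.zero
  have h0 : Δ.ozero.1.spanC = ⊥ := zeroCone_span
  obtain ⟨α, hα⟩ := CFree.lift (I := IV Δ.ozero.1.spanC) (M := (E.stalk Δ.ozero).M) (P := AQ Δ.ozero.1.spanC) (n := 1)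
    (b := fun _ => e) (fun a ha x => AQ_kill ha x) (fun x => by
      obtain ⟨c, rfl⟩ := hs x
      exact ⟨fun _ => algebraMap ℝ _ c, by simp⟩)
    (fun c hc i => by
      rw [Fin.sum_univ_one] at hc
      have h1 : c 0 - algebraMap ℝ _ ((c 0).1 0) ∈ IV Δ.ozero.1.spanC := mem_IV.2 fun x hx => by
        rw [h0, Submodule.mem_bot] at hx
        rw [hx, poly_sub, poly_algebraMap, sub_self]
      have h2 := hE.kill Δ.ozero h1 e
      rw [sub_smul, hc, zero_sub, neg_eq_zero, algebraMap_smul] at h2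
      have h3 := (smul_eq_zero.1 h2).resolve_right he0
      have : i = 0 := Subsingleton.elim _ _
      rw [this]
      rw [h3, map_zero, sub_zero] at h1
      exact h1) (fun _ => mkA _ 1)
  exact ⟨e, α, he, he0, hs, hα 0⟩

lemma dual_zero (hE : E.Good) (hG : G.Good) :
    ∃ D : ∀ τ : Δ.cones, (E.stalk τ).M →ₗ[PolyRing V] G.K τ →ₗ[PolyRing V] AQ τ.1.spanC, Dual hG 0 D := by
  have key : ∀ τ : Δ.cones, ∃ D : (E.stalk τ).M →ₗ[PolyRing V] G.K τ →ₗ[PolyRing V] AQ τ.1.spanC,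
      τ.1.dim ≤ 0 → (∀ x, D x = 0 → x = 0) ∧ (∀ u, ∃ x, D x = u) ∧
      (∀ p q : ℤ, ∀ x ∈ (E.stalk τ).deg p, ∀ y : G.K τ, y.1 ∈ (G.stalk τ).deg q →
        D x y ∈ AD τ.1.spanC (p + q - 2 * τ.1.dim)) := by
    intro τ
    by_cases h : τ.1.dim ≤ 0
    swap
    · exact ⟨0, fun h' => absurd h' h⟩
    have hτ : τ = Δ.ozero := Subtype.ext (dim_eq_zero_iff.1 (Nat.le_zero.1 h))
    subst hτ
    have hd : (Δ.ozero).1.dim = 0 := Nat.le_zero.1 h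
    have h0 : Δ.ozero.1.spanC = ⊥ := zeroCone_span
    obtain ⟨e, α, he, he0, hs, hα⟩ := zero_lift hE
    obtain ⟨e', β, he', he0', hs', hβ⟩ := zero_lift hG
    have hK : e' ∈ G.K Δ.ozero := mem_K.2 fun ρ hρ => by have := hρ.2; omega
    have hs2 : ∀ y : G.K Δ.ozero, ∃ c : ℝ, y = algebraMap ℝ (PolyRing V) c • ⟨e', hK⟩ := fun y => by
      obtain ⟨c, hc⟩ := hs' y.1
      exact ⟨c, Subtype.ext (by rw [hc]; simp)⟩
    have hs1 : ∀ x, ∃ c : ℝ, x = algebraMap ℝ (PolyRing V) c • e := fun x => by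
      obtain ⟨c, hc⟩ := hs x
      exact ⟨c, by rw [hc]; simp⟩
    let D : (E.stalk Δ.ozero).M →ₗ[PolyRing V] G.K Δ.ozero →ₗ[PolyRing V] AQ Δ.ozero.1.spanC :=
      (LinearMap.mul (PolyRing V) (AQ Δ.ozero.1.spanC)).compl₁₂ α (β ∘ₗ (G.K Δ.ozero).subtype)
    have hDe : D e ⟨e', hK⟩ = mkA _ 1 := by
      show α e * β e' = _
      rw [hα, hβ, ← mkA_mul, mul_one]
    have hinj : ∀ c : ℝ, algebraMap ℝ (PolyRing V) c • mkA Δ.ozero.1.spanC 1 = 0 → c = 0 := fun c hc => by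
      rw [mkA_smul, mul_one, mkA_zero_iff, mem_IV] at hc
      simpa using hc 0 (zero_mem _)
    refine ⟨D, fun _ => ⟨fun x hx => ?_, fun u => ?_, fun p q x hx y hy => ?_⟩⟩
    · obtain ⟨c, rfl⟩ := hs1 x
      have := congrArg (fun f => f ⟨e', hK⟩) hx
      simp only [map_smul, LinearMap.smul_apply, hDe, LinearMap.zero_apply] at this
      rw [hinj c this, map_zero, zero_smul]
    · refine ⟨algebraMap ℝ (PolyRing V) (qv (u ⟨e', hK⟩) 0) • e, ?_⟩
      ext1 y
      obtain ⟨c, rfl⟩ := hs2 y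
      rw [map_smul, map_smul, LinearMap.smul_apply, map_smul, hDe]
      congr 1
      apply qv_ext
      intro z hz
      rw [qv_smul _ _ hz, qv_mk _ hz, poly_algebraMap, poly_one, mul_one]
      rw [h0, Submodule.mem_bot] at hz
      rw [hz]
    · obtain ⟨c, rfl⟩ := hs1 x
      obtain ⟨c', rfl⟩ := hs2 y
      have hx0 := (E.stalk Δ.ozero).grM.smul _ _ _ (algebraMap_deg (V := V) c) _ he
      have hy0 := (G.stalk Δ.ozero).grM.smul _ _ _ (algebraMap_deg (V := V) c') _ he'
      by_cases hp : 0 + 0 = p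
      · by_cases hq : 0 + 0 = q
        · simp only [map_smul, LinearMap.smul_apply]
          rw [hDe, mkA_smul, mkA_smul, mul_one, hd, ← hp, ← hq, ← map_mul]
          exact mem_AD.2 ⟨_, by simpa only [Nat.cast_zero, mul_zero, sub_zero, add_zero, mul_comm c' c] using algebraMap_deg (V := V) (c * c'), rfl⟩
        · have : algebraMap ℝ (PolyRing V) c' • (⟨e', hK⟩ : G.K Δ.ozero) = 0 := Subtype.ext (by
            have h1 := pr_of_ne (G.stalk Δ.ozero).grM.gr hy0 (fun h => hq h.symm)
            have h2 := pr_of_mem (G.stalk Δ.ozero).grM.gr hy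
            exact h2.symm.trans h1)
          rw [this, map_zero]; exact zero_mem _
      · have h1 := pr_of_ne (E.stalk Δ.ozero).grM.gr hx0 (fun h => hp h.symm)
        rw [pr_of_mem (E.stalk Δ.ozero).grM.gr hx] at h1
        rw [h1, map_zero, LinearMap.zero_apply]; exact zero_mem _
  choose D hD using key
  exact ⟨D, fun τ h => (hD τ h).1, fun τ h => (hD τ h).2.1, fun τ h => (hD τ h).2.2, fun τ h x ρ hρ => by
    have := hρ.2; omega⟩

lemma dual_exists (hE : E.Good) (hG : G.Good) (n : ℕ) :
    ∃ D : ∀ τ : Δ.cones, (E.stalk τ).M →ₗ[PolyRing V] G.K τ →ₗ[PolyRing V] AQ τ.1.spanC, Dual hG n D := by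
  induction n with
  | zero => exact dual_zero hE hG
  | succ n ih =>
    obtain ⟨D, hD⟩ := ih
    have key : ∀ σ : Δ.cones, ∃ Dσ : (E.stalk σ).M →ₗ[PolyRing V] G.K σ →ₗ[PolyRing V] AQ σ.1.spanC,
      (σ.1.dim ≠ n + 1 → Dσ = D σ) ∧ (σ.1.dim = n + 1 →
      (∀ x, ResEq hG σ (Dσ x) (fun ρ => D ρ (E.r σ ρ x))) ∧
      ∀ p q : ℤ, ∀ x ∈ (E.stalk σ).deg p, ∀ y : G.K σ, y.1 ∈ (G.stalk σ).deg q →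
        Dσ x y ∈ AD σ.1.spanC (p + q - 2 * σ.1.dim)) := fun σ => by
      by_cases h : σ.1.dim = n + 1
      · obtain ⟨Dσ, h1, h2⟩ := exists_D hE hD σ h
        exact ⟨Dσ, fun h' => absurd h h', fun _ => ⟨h1, h2⟩⟩
      · exact ⟨D σ, fun _ => rfl, fun h' => absurd h' h⟩
    choose D' h1 h2 using key
    have hlow : ∀ σ : Δ.cones, σ.1.dim ≤ n → D' σ = D σ := fun σ h => h1 σ (by omega)
    refine ⟨D', fun τ h => ?_, fun τ h => ?_, fun τ h => ?_, fun τ h x => ?_⟩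
    · rcases Nat.le_succ_iff.1 h with h | h
      · rw [hlow τ h]; exact hD.inj τ h
      · exact D_inj hE hD h (h2 τ h).1 (h2 τ h).2
    · rcases Nat.le_succ_iff.1 h with h | h
      · rw [hlow τ h]; exact hD.surj τ h
      · exact D_surj hE hD h (h2 τ h).1 (h2 τ h).2
    · rcases Nat.le_succ_iff.1 h with h | h
      · rw [hlow τ h]; exact hD.deg τ h
      · exact (h2 τ h).2
    · have hr : ∀ ρ : Δ.cones, IsFacet ρ.1 τ.1 → D' ρ = D ρ := fun ρ hρ => hlow ρ (by have := hρ.2; omega)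
      rcases Nat.le_succ_iff.1 h with h | h
      · intro ρ hρ w z hz
        have := hD.res τ h x ρ hρ w z hz
        rw [hlow τ h]
        show _ = qv (D' ρ (E.r τ ρ x) _) z
        rw [hr ρ hρ]; exact this
      · intro ρ hρ w z hz
        have := (h2 τ h).1 x ρ hρ w z hz
        show _ = qv (D' ρ (E.r τ ρ x) _) z
        rw [hr ρ hρ]; exact this

end FanSheaf
end dual

/-! ### Perfect pairings and the abstract Lefschetz argument -/

section perf
variable {V : Type} [AddCommGroup V] [Module ℝ V]
variable {H : Type} [AddCommGroup H] [Module ℝ H]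

def mB (q : V →ₗ[ℝ] H) (X : Type) [AddCommGroup X] [Module (PolyRing V) X] : Submodule (PolyRing V) X :=
  Ideal.map (pb q) (mId H) • ⊤

section
variable {q : V →ₗ[ℝ] H} {X : Type} [AddCommGroup X] [Module (PolyRing V) X]

lemma mB_smul {r : PolyRing H} (hr : r.1 0 = 0) (x : X) : pb q r • x ∈ mB q X :=
  Submodule.smul_mem_smul (Ideal.mem_map_of_mem _ (mem_mId.2 hr)) trivial

lemma mB_sub (r : PolyRing H) (x : X) : pb q r • x - pb q (algebraMap ℝ _ (r.1 0)) • x ∈ mB q X := by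
  rw [← sub_smul, ← map_sub]
  apply mB_smul
  simp

lemma mB_ind {P : X → Prop} (h0 : P 0) (ha : ∀ x y, P x → P y → P (x + y))
    (hs : ∀ r : PolyRing H, r.1 0 = 0 → ∀ x, P (pb q r • x)) {x : X} (hx : x ∈ mB q X) : P x := by
  refine Submodule.smul_induction_on hx ?_ ha
  intro a haI z _
  suffices HH : ∀ z : X, P (a • z) from HH z
  refine Submodule.span_induction (p := fun a _ => ∀ z : X, P (a • z)) ?_ ?_ ?_ ?_ haI
  · rintro _ ⟨r, hr, rfl⟩ z
    exact hs r (mem_mId.1 hr) z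
  · intro z; rw [zero_smul]; exact h0
  · intro a b _ _ h1 h2 z
    rw [add_smul]; exact ha _ _ (h1 z) (h2 z)
  · intro a b _ h1 z
    rw [smul_eq_mul, mul_comm, mul_smul]; exact h1 _
end

variable {X Y : Type} [AddCommGroup X] [Module (PolyRing V) X] [Module ℝ X]
  [AddCommGroup Y] [Module (PolyRing V) Y] [Module ℝ Y]

structure Perf (q : V →ₗ[ℝ] H) (dX : ℤ → Submodule ℝ X) (dY : ℤ → Submodule ℝ Y) (m : ℤ)
    (Φ : X → Y → PolyRing H) : Prop where
  addl : ∀ x x' y, Φ (x + x') y = Φ x y + Φ x' y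
  addr : ∀ x y y', Φ x (y + y') = Φ x y + Φ x y'
  sr : ∀ (r : PolyRing H) x y, Φ x (pb q r • y) = r * Φ x y
  bal : ∀ (a : PolyRing V) x y, Φ (a • x) y = Φ x (a • y)
  deg : ∀ p p', ∀ x ∈ dX p, ∀ y ∈ dY p', Φ x y ∈ Adeg H (p + p' - 2 * m)
  inj : ∀ x, (∀ y, Φ x y = 0) → x = 0
  surj : ∀ φ : Y → PolyRing H, (∀ y y', φ (y + y') = φ y + φ y') → (∀ r y, φ (pb q r • y) = r * φ y) →
    ∃ x, ∀ y, Φ x y = φ y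

variable {q : V →ₗ[ℝ] H} {dX : ℤ → Submodule ℝ X} {dY : ℤ → Submodule ℝ Y} {m : ℤ}
    {Φ : X → Y → PolyRing H}

lemma Perf.sl (h : Perf q dX dY m Φ) (r : PolyRing H) (x y) : Φ (pb q r • x) y = r * Φ x y := by
  rw [h.bal, h.sr]

lemma Perf.zl (h : Perf q dX dY m Φ) (y) : Φ 0 y = 0 := by
  have := h.addl 0 0 y
  rw [add_zero] at this; simpa using this

lemma Perf.zr (h : Perf q dX dY m Φ) (x) : Φ x 0 = 0 := by
  have := h.addr x 0 0
  rw [add_zero] at this; simpa using this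

lemma Perf.mr (h : Perf q dX dY m Φ) (x) {y} (hy : y ∈ mB q Y) : (Φ x y).1 0 = 0 := by
  refine mB_ind (P := fun y => (Φ x y).1 0 = 0) ?_ ?_ ?_ hy
  · rw [h.zr]; simp
  · intro a b ha hb
    rw [h.addr, poly_add, ha, hb, add_zero]
  · intro r hr z
    rw [h.sr, poly_mul, hr, zero_mul]

lemma Perf.ml (h : Perf q dX dY m Φ) {x} (y) (hx : x ∈ mB q X) : (Φ x y).1 0 = 0 := by
  refine mB_ind (P := fun x => (Φ x y).1 0 = 0) ?_ ?_ ?_ hx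
  · rw [h.zl]; simp
  · intro a b ha hb
    rw [h.addl, poly_add, ha, hb, add_zero]
  · intro r hr z
    rw [h.sl, poly_mul, hr, zero_mul]

lemma Perf.pr (h : Perf q dX dY m Φ) (hX : GrM V dX) {p : ℤ} {y} (hy : y ∈ dY p) (x) :
    (Φ (pr dX (2 * m - p) x) y).1 0 = (Φ x y).1 0 := by
  refine gr_ind (P := fun x => (Φ (_root_.pr dX (2 * m - p) x) y).1 0 = (Φ x y).1 0) hX.gr ?_ ?_ ?_ x
  · simp [h.zl]
  · intro a b ha hb
    rw [map_add, h.addl, h.addl, poly_add, poly_add, ha, hb]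
  · intro p' z hz
    by_cases e : 2 * m - p = p'
    · subst e
      rw [pr_of_mem hX.gr hz]
    · rw [pr_of_ne hX.gr hz e, h.zl, Adeg_pos (h.deg _ _ _ hz _ hy) (by omega)]
      simp

/-- coordinates with respect to a homogeneous basis -/
lemma RFree.coord (hY : RFree (pb q) dY) : ∃ (n : ℕ) (b : Fin n → Y) (c : Fin n → Y → PolyRing H),
    (∀ y, y = ∑ i, pb q (c i y) • b i) ∧ (∀ i y y', c i (y + y') = c i y + c i y') ∧
    (∀ i r y, c i (pb q r • y) = r * c i y) := by
  obtain ⟨n, b, e, hb, hs, hi⟩ := hY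
  choose c hc using hs
  have huniq : ∀ y (d : Fin n → PolyRing H), y = ∑ i, pb q (d i) • b i → c y = d := fun y d hd => by
    have := hi (c y - d) (by
      simp only [Pi.sub_apply, map_sub, sub_smul, Finset.sum_sub_distrib]
      rw [← hc y, ← hd, sub_self])
    exact sub_eq_zero.1 this
  refine ⟨n, b, fun i y => c y i, hc, fun i y y' => ?_, fun i r y => ?_⟩
  · have := huniq (y + y') (c y + c y') (by
      simp only [Pi.add_apply, map_add, add_smul, Finset.sum_add_distrib]
      rw [← hc y, ← hc y'])
    exact congrFun this i
  · have := huniq (pb q r • y) (fun i => r * c y i) (by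
      simp only [map_mul, mul_smul]
      rw [← Finset.smul_sum, ← hc y])
    exact congrFun this i

lemma mB_of_coord {n : ℕ} {b : Fin n → Y} {d : Fin n → PolyRing H} (h : ∀ i, (d i).1 0 = 0) :
    ∑ i, pb q (d i) • b i ∈ mB q Y := sum_mem fun i _ => mB_smul (h i) _

lemma Perf.inj_low (h : Perf q dX dY m Φ) (hX : GrM V dX) (hY : RFree (pb q) dY) (t : PolyRing V)
    (hs : ∀ p : ℤ, m + 1 ≤ p → ∀ x ∈ dX p, ∃ z ∈ mB q X, ∃ w, x = z + t • w)
    {p : ℤ} (hp : p ≤ m - 1) {y : Y} (hy : y ∈ dY p) (hty : t • y ∈ mB q Y) : y ∈ mB q Y := by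
  obtain ⟨n, b, c, hc, hca, hcs⟩ := hY.coord
  by_contra hcon
  have : ∃ i, (c i y).1 0 ≠ 0 := by
    by_contra hno
    push Not at hno
    apply hcon
    rw [hc y]
    exact mB_of_coord hno
  obtain ⟨i, hi⟩ := this
  obtain ⟨x, hx⟩ := h.surj (c i) (hca i) (hcs i)
  apply hi
  rw [← hx, ← h.pr hX hy]
  obtain ⟨z, hz, w, hw⟩ := hs (2 * m - p) (by omega) _ (pr_mem hX.gr (2 * m - p) x)
  rw [hw, h.addl, poly_add, h.ml _ hz, h.bal, h.mr _ hty, add_zero]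

lemma Perf.surj_high [IsScalarTower ℝ (PolyRing V) Y] (h : Perf q dX dY m Φ) (hX : GrM V dX) (hYg : GrM V dY) (hY : RFree (pb q) dY)
    (t : PolyRing V) (ht : t ∈ Adeg V 2)
    (hs : ∀ p : ℤ, p ≤ m - 1 → ∀ x ∈ dX p, t • x ∈ mB q X → x ∈ mB q X)
    {p : ℤ} (hp : m ≤ p + 1) {y : Y} (hy : y ∈ dY (p + 2)) : ∃ w ∈ dY p, y - t • w ∈ mB q Y := by
  obtain ⟨n, b, c, hc, hca, hcs⟩ := hY.coord
  let N : Submodule ℝ Y :=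
    { carrier := {u | ∃ w ∈ dY p, u - t • w ∈ mB q Y}
      zero_mem' := ⟨0, zero_mem _, by simp⟩
      add_mem' := by
        rintro u u' ⟨w, hw, h1⟩ ⟨w', hw', h2⟩
        refine ⟨w + w', add_mem hw hw', ?_⟩
        have := add_mem h1 h2
        rw [smul_add]; convert this using 1; abel
      smul_mem' := by
        rintro a u ⟨w, hw, h1⟩
        refine ⟨a • w, (dY p).smul_mem a hw, ?_⟩
        have := (mB q Y).smul_mem (algebraMap ℝ (PolyRing V) a) h1
        rw [algebraMap_smul, smul_sub] at this
        rwa [← algebraMap_smul (PolyRing V) a w, smul_comm, algebraMap_smul] }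
  by_contra hcon
  have hyN : y ∉ N := hcon
  obtain ⟨lam, hl1, hl2⟩ := Submodule.exists_le_ker_of_notMem hyN
  have hlm : ∀ z ∈ mB q Y, lam z = 0 := fun z hz => hl2 (show z ∈ N from ⟨0, zero_mem _, by simpa using hz⟩)
  have hlt : ∀ z ∈ dY p, lam (t • z) = 0 := fun z hz => hl2 (show t • z ∈ N from ⟨z, hz, by simp⟩)
  obtain ⟨x, hx⟩ := h.surj (fun z => ∑ i, c i z * algebraMap ℝ _ (lam (b i)))
    (fun y y' => by simp only [hca, add_mul, Finset.sum_add_distrib])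
    (fun r y => by simp only [hcs, Finset.mul_sum, mul_assoc])
  have hx0 : ∀ z, (Φ x z).1 0 = lam z := fun z => by
    rw [hx z]
    have e1 : z - ∑ i, (c i z).1 0 • b i ∈ mB q Y := by
      have e0 : z - ∑ i, (c i z).1 0 • b i = ∑ i, (pb q (c i z) • b i - (c i z).1 0 • b i) := by
        rw [Finset.sum_sub_distrib, ← hc z]
      rw [e0]
      refine sum_mem fun i _ => ?_
      have := mB_sub (q := q) (c i z) (b i)
      rwa [pb_algebraMap, algebraMap_smul] at this
    have e2 := hlm _ e1
    rw [map_sub, sub_eq_zero] at e2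
    rw [e2, map_sum, poly_sum]
    refine Finset.sum_congr rfl fun i _ => ?_
    rw [map_smul]; simp
  let x' := _root_.pr dX (2 * m - (p + 2)) x
  have hx' : x' ∈ dX (2 * m - (p + 2)) := pr_mem hX.gr _ _
  have e1 : ∀ z ∈ dY (p + 2), (Φ x' z).1 0 = lam z := fun z hz => by
    rw [h.pr hX hz, hx0]
  have e2 : ∀ z, (Φ (t • x') z).1 0 = 0 := fun z => by
    rw [h.bal]
    refine gr_ind (P := fun z => (Φ x' (t • z)).1 0 = 0) hYg.gr ?_ ?_ ?_ z
    · rw [smul_zero, h.zr]; simp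
    · intro a b ha hb
      rw [smul_add, h.addr, poly_add, ha, hb, add_zero]
    · intro p' z hz
      have htz := hYg.smul 2 p' t ht z hz
      by_cases e : p' = p
      · subst e
        rw [e1 _ (by rwa [add_comm]), hlt z hz]
      · exact Adeg_pos (h.deg _ _ _ hx' _ htz) (by omega)
  have e3 : t • x' ∈ mB q X := by
    choose xb hxb using fun i => h.surj (c i) (hca i) (hcs i)
    have : t • x' = ∑ i, pb q (Φ (t • x') (b i)) • xb i := by
      rw [← sub_eq_zero]
      apply h.inj
      intro z
      let Ψ : X →+ PolyRing H := AddMonoidHom.mk' (fun x => Φ x z) fun a b => h.addl a b z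
      let Θ : Y →+ PolyRing H := AddMonoidHom.mk' (fun z => Φ (t • x') z) fun a b => h.addr _ a b
      show Ψ (_ - _) = 0
      rw [map_sub, map_sum, sub_eq_zero]
      show Θ z = _
      conv_lhs => rw [hc z]
      rw [map_sum]
      refine Finset.sum_congr rfl fun i _ => ?_
      show Φ _ (pb q _ • _) = Φ (pb q _ • _) z
      rw [h.sr, h.sl, hxb, mul_comm]
    rw [this]
    exact mB_of_coord fun i => e2 _
  have e4 := hs _ (by omega) x' hx' e3
  apply hl1
  rw [← e1 y hy]
  exact h.ml y e4
end perf

/-! ### The perfect pairing on the boundary -/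

section bdpair
variable {V : Type} [AddCommGroup V] [Module ℝ V] [FiniteDimensional ℝ V]
variable {H : Type} [AddCommGroup H] [Module ℝ H]

namespace FanSheaf
variable {Δ : Fan V} {E G : FanSheaf Δ} {σ : Cone V} {l : V} {q : V →ₗ[ℝ] H}

lemma bd_gen (σ : Cone V) : bd σ = gen (facets σ) := by
  ext ζ
  constructor
  · intro h
    obtain ⟨τ, hτ, hz⟩ := exists_facet_of_proper h
    exact ⟨τ, mem_facets.2 hτ, hz⟩
  · rintro ⟨τ, hτ, hz⟩
    exact face_facet_proper (mem_facets.1 hτ) hz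

lemma bd_free (hG : G.Good) (hσ : ∀ ζ, ζ.IsProperFaceOf σ → ζ ∈ Δ.cones) (hIl : IsInt σ l) (hq : Par σ l q) :
    RFree (pb q) (G.secDeg (bd σ)) := by
  obtain ⟨l1, h1, hg⟩ := exists_generic σ (v := -l) (neg_mem (σ.mem_span hIl.1))
  rw [bd_gen]
  refine S1 hG (fun τ h => hσ τ h.proper) hIl (v := -l1) (neg_mem (σ.mem_span h1.1)) hq
    (fun τ _ w hw => S2 hG τ w hw) (facets σ) ⟨fun τ h => mem_facets.1 h, fun τ h τ' h' e => ?_,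
      fun _ _ τ' h _ => mem_facets.2 h⟩
  rw [mem_facets] at h h'
  refine hg τ τ' h h' ?_ ?_ ?_
  · rw [map_neg]; exact neg_lt_zero.2 (hIl.2 τ h)
  · rw [map_neg]; exact neg_lt_zero.2 (hIl.2 τ' h')
  · simp only [kap, map_neg] at e ⊢
    have a1 := hIl.2 τ h
    have a2 := hIl.2 τ' h'
    have a3 := h1.2 τ h
    have a4 := h1.2 τ' h'
    rw [div_eq_div_iff a1.ne' a2.ne'] at e
    rw [div_eq_div_iff a3.ne' a4.ne']
    linarith

lemma surj_v (hG : G.Good) (hIl : IsInt σ l) (hq : Par σ l q) (φ : G.Sec (bd σ) → PolyRing H)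
    (ha : ∀ y y', φ (y + y') = φ y + φ y') (hs : ∀ r y, φ (pb q r • y) = r * φ y) :
    ∃ v : ∀ τ : Δ.cones, G.K τ →ₗ[PolyRing V] AQ τ.1.spanC, ∀ (τ : Δ.cones) (h : IsFacet τ.1 σ) (k : G.K τ),
      ∀ z ∈ τ.1.spanC, qv (v τ k) z = hl σ τ.1 l * (φ (G.ext h k)).1 (q z) := by
  have : ∀ τ : Δ.cones, ∃ u : G.K τ →ₗ[PolyRing V] AQ τ.1.spanC, ∀ (h : IsFacet τ.1 σ) (k : G.K τ),
      ∀ z ∈ τ.1.spanC, qv (u k) z = hl σ τ.1 l * (φ (G.ext h k)).1 (q z) := by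
    intro τ
    by_cases h : IsFacet τ.1 σ
    · have hp := hq.facet hIl h
      have hqv : ∀ k : G.K τ, ∀ z ∈ τ.1.spanC, qv (mkA τ.1.spanC (pb q (hl σ τ.1 l • φ (G.ext h k)))) z =
          hl σ τ.1 l * (φ (G.ext h k)).1 (q z) := fun k z hz => by
        rw [qv_mk _ hz, pb_apply, poly_smul]
      refine ⟨{ toFun := fun k => mkA τ.1.spanC (pb q (hl σ τ.1 l • φ (G.ext h k)))
                map_add' := fun k k' => qv_ext fun z hz => ?_
                map_smul' := fun a k => qv_ext fun z hz => ?_ }, fun _ k z hz => hqv k z hz⟩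
      · rw [qv_add _ _ hz, hqv _ z hz, hqv _ z hz, hqv _ z hz, map_add, ha, poly_add, mul_add]
      · rw [RingHom.id_apply, qv_smul _ _ hz, hqv _ z hz, hqv _ z hz]
        obtain ⟨r, hr⟩ := hp.exists_pb a
        have e1 : a • k = pb q r • k := by
          rw [← sub_eq_zero, ← sub_smul]
          exact Subtype.ext (hG.kill τ hr k.1)
        have e2 := mem_IV.1 hr z hz
        rw [poly_sub, sub_eq_zero, pb_apply] at e2
        rw [e1, map_smul, hs, poly_mul, e2]; ring
    · exact ⟨0, fun h' => absurd h' h⟩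
  choose v hv using this
  exact ⟨v, hv⟩

lemma surj_compat (hG : G.Good) (hσ : ∀ ζ, ζ.IsProperFaceOf σ → ζ ∈ Δ.cones) (hIl : IsInt σ l) (hq : Par σ l q)
    (φ : G.Sec (bd σ) → PolyRing H)
    (ha : ∀ y y', φ (y + y') = φ y + φ y') (hs : ∀ r y, φ (pb q r • y) = r * φ y)
    {v : ∀ τ : Δ.cones, G.K τ →ₗ[PolyRing V] AQ τ.1.spanC}
    (hv : ∀ (τ : Δ.cones) (h : IsFacet τ.1 σ) (k : G.K τ),
      ∀ z ∈ τ.1.spanC, qv (v τ k) z = hl σ τ.1 l * (φ (G.ext h k)).1 (q z)) : Compat hG σ v := by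
  intro τ τ' ρ h h' hne hρ hρ' w w' hw x hx
  have hne1 : τ'.1 ≠ τ.1 := fun e => hne (Subtype.ext e)
  rw [hv τ h _ x (hρ.1.span_le hx), hv τ' h' _ x (hρ'.1.span_le hx)]
  obtain ⟨y, hy1, hy2, hy3⟩ := star2 h h' hne hρ hρ' w w' hw
  obtain ⟨g, hg⟩ := C2data hIl hq
  obtain ⟨t, c, hc, ht, htn, hρt, g1, g2⟩ := hg τ.1 ρ.1 h hρ
  have htt : t = τ'.1 := (other_unique h h' hne1 hρ hρ' ht hρt.1).resolve_left htn
  subst htt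
  have key : pb q (linP (g ρ.1)) • y + pb q (algebraMap ℝ _ (hl σ τ'.1 l * c)) • G.ext h' (mH hG hρ' w') =
      pb q (algebraMap ℝ _ (hl σ τ.1 l * c)) • G.ext h (mH hG hρ w) := by
    refine sec_eq hσ fun s hs => ?_
    show pb q (linP (g ρ.1)) • y.1 s + pb q (algebraMap ℝ _ (hl σ τ'.1 l * c)) • G.r τ' s (linP (hl τ'.1 ρ.1) • w'.1) =
      pb q (algebraMap ℝ _ (hl σ τ.1 l * c)) • G.r τ s (linP (hl τ.1 ρ.1) • w.1)
    by_cases e : s = τ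
    · subst e
      have hn : ¬ s.1.IsFaceOf τ'.1 := fun hh => hne1 (facet_of_face_facet h h' hh).symm
      rw [hy1, G.r_not hn, LinearMap.zero_apply, smul_zero, add_zero, G.r_self, ← sub_eq_zero, smul_smul, ← sub_smul]
      apply hG.kill
      rw [mem_IV]
      intro z hz
      simp only [poly_sub, pb_apply, poly_mul, linP_apply, poly_algebraMap, g1 z hz]
      ring
    · by_cases e' : s = τ'
      · subst e'
        have hn : ¬ s.1.IsFaceOf τ.1 := fun hh => hne1 (facet_of_face_facet h' h hh)
        rw [hy2, G.r_not hn, LinearMap.zero_apply, smul_zero, G.r_self, smul_smul, ← add_smul]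
        apply hG.kill
        rw [mem_IV]
        intro z hz
        simp only [poly_add, pb_apply, poly_mul, linP_apply, poly_algebraMap, g2 z hz]
        ring
      · have hn : ¬ s.1.IsFaceOf τ.1 := fun hh => e (Subtype.ext (facet_of_face_facet hs h hh))
        have hn' : ¬ s.1.IsFaceOf τ'.1 := fun hh => e' (Subtype.ext (facet_of_face_facet hs h' hh))
        rw [hy3 s hs e e', G.r_not hn, G.r_not hn']
        simp
  have k2 := congrArg (fun s => (φ s).1 (q x)) key
  simp only [ha, hs, poly_add, poly_mul, linP_apply, poly_algebraMap, g1 x (hρ.1.span_le hx), hl_zero hρ hx] at k2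
  have k3 : c * (hl σ τ.1 l * (φ (G.ext h (mH hG hρ w))).1 (q x)) =
    c * (hl σ τ'.1 l * (φ (G.ext h' (mH hG hρ' w'))).1 (q x)) := by linarith
  exact mul_left_cancel₀ hc k3

lemma sec_r {x : E.Sec (bd σ)} {τ ρ : Δ.cones} (h : τ.1.IsProperFaceOf σ) (hρ : ρ.1.IsProperFaceOf σ)
    (hf : ρ.1.IsFaceOf τ.1) : E.r τ ρ (x.1 τ) = x.1 ρ := (E.mem_sec.1 x.2).2 τ ρ h hρ hf

lemma pairing (hE : E.Good) (hG : G.Good) (hσ : ∀ ζ, ζ.IsProperFaceOf σ → ζ ∈ Δ.cones) {n : ℕ}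
    (hdim : σ.dim = n + 1) (hIl : IsInt σ l) (hq : Par σ l q) :
    ∃ Φ, Perf q (E.secDeg (bd σ)) (G.secDeg (bd σ)) n Φ := by
  obtain ⟨D, hD⟩ := dual_exists hE hG n
  have hfd : ∀ τ : Δ.cones, IsFacet τ.1 σ → τ.1.dim = n := fun τ h => by have := h.2; omega
  have hpar : ∀ τ : Δ.cones, IsFacet τ.1 σ → IsPar q τ.1.spanC := fun τ h => hq.facet hIl h
  have hcomp : ∀ x : E.Sec (bd σ), Compat hG σ (fun τ => D τ (x.1 τ)) := fun x =>
    hD.compat hdim x.1 fun τ ρ h hρ => sec_r h.proper (face_facet_proper h hρ.1) hρ.1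
  choose φ hs he hdeg using fun x => EXT hG hσ hIl hq (hcomp x)
  refine ⟨fun x y => φ x y, ⟨fun x x' y => ?_, fun x y y' => map_add _ _ _, fun r x y => hs x r y,
    fun a x y => ?_, fun p p' x hx y hy => ?_, fun x hx => ?_, fun ψ ha hψ => ?_⟩⟩
  · refine EXT_unique hG hσ hIl hq (fun y => φ (x + x') y) (fun y => φ x y + φ x' y) (fun a b => map_add _ _ _)
      (fun a b => ?_) (fun r y => hs _ _ _) (fun r y => ?_) (fun τ h k => ?_) y
    · simp only [map_add]; ring
    · simp only [hs]; ring
    · simp only [he]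
      refine par_ext (hpar τ h) fun z hz => ?_
      rw [poly_add, tv_apply (hpar τ h) _ hz, tv_apply (hpar τ h) _ hz, tv_apply (hpar τ h) _ hz, ← mul_add,
        ← qv_add _ _ hz, ← LinearMap.add_apply, ← map_add]
      rfl
  · refine EXT_unique hG hσ hIl hq (fun y => φ (a • x) y) (fun y => φ x (a • y)) (fun a b => map_add _ _ _)
      (fun u v => ?_) (fun r y => hs _ _ _) (fun r y => ?_) (fun τ h k => ?_) y
    · rw [smul_add, map_add]
    · rw [smul_comm, hs]
    · simp only [← map_smul (G.ext h), he]
      rw [tv, tv, map_smul]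
      show _ • jj q _ (D τ (a • x.1 τ) k) = _
      rw [map_smul]; rfl
  · have := hdeg x (p - 2 * n) (fun τ h p'' k hk => by
      have := hD.deg τ (hfd τ h).le p p'' (x.1 τ) (hx τ) k hk
      rw [hfd τ h] at this
      rwa [show p'' + (p - 2 * (n : ℤ)) = p + p'' - 2 * n by ring]) p' y hy
    rwa [show p' + (p - 2 * (n : ℤ)) = p + p' - 2 * n by ring] at this
  · refine sec_eq hσ fun τ h => ?_
    refine hD.inj τ (hfd τ h).le _ (LinearMap.ext fun k => qv_ext fun z hz => ?_)
    have := he x τ h k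
    rw [hx] at this
    have h2 := tv_apply (σ := σ) (l := l) (v := fun τ => D τ (x.1 τ)) (hpar τ h) k hz
    rw [← this, poly_zero, zero_eq_mul] at h2
    rw [LinearMap.zero_apply, qv_zero hz]
    exact h2.resolve_left (inv_ne_zero (hIl.2 _ h).ne')
  · obtain ⟨v, hv⟩ := surj_v hG hIl hq ψ ha hψ
    obtain ⟨s, hsv⟩ := KC hG hD hσ hdim (surj_compat hG hσ hIl hq ψ ha hψ hv)
    refine ⟨s, fun y => EXT_unique hG hσ hIl hq (fun y => φ s y) ψ (fun a b => map_add _ _ _) ha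
      (fun r y => hs _ _ _) hψ (fun τ h k => ?_) y⟩
    simp only [he]
    refine par_ext (hpar τ h) fun z hz => ?_
    rw [tv_apply (hpar τ h) _ hz, hsv τ h, hv τ h k z hz, ← mul_assoc, inv_mul_cancel₀ (hIl.2 _ h).ne', one_mul]

/-- the Lefschetz argument on the boundary, given the vanishing condition in the form `hvan` -/
lemma lefschetz (hE : E.Good) (hG : G.Good) (hσ : ∀ ζ, ζ.IsProperFaceOf σ → ζ ∈ Δ.cones) {n : ℕ}
    (hdim : σ.dim = n + 1) (hIl : IsInt σ l) (hq : Par σ l q) {t : PolyRing V} (ht : t ∈ Adeg V 2)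
    (hvan : ∀ p : ℤ, (n : ℤ) + 1 ≤ p → ∀ x ∈ E.secDeg (bd σ) p, ∃ z ∈ mB q (E.Sec (bd σ)), ∃ w, x = z + t • w) :
    (∀ p : ℤ, p ≤ (n : ℤ) - 1 → ∀ y ∈ G.secDeg (bd σ) p, t • y ∈ mB q (G.Sec (bd σ)) → y ∈ mB q (G.Sec (bd σ))) ∧
    (∀ p : ℤ, (n : ℤ) ≤ p + 1 → ∀ y ∈ G.secDeg (bd σ) (p + 2), ∃ w ∈ G.secDeg (bd σ) p,
      y - t • w ∈ mB q (G.Sec (bd σ))) := by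
  obtain ⟨Φ, hΦ⟩ := pairing hE hG hσ hdim hIl hq
  obtain ⟨Φ', hΦ'⟩ := pairing hE hE hσ hdim hIl hq
  have fG := bd_free hG hσ hIl hq
  have fE := bd_free hE hσ hIl hq
  have gE := E.sec_grM (bd σ)
  have gG := G.sec_grM (bd σ)
  exact ⟨fun p hp y hy h => hΦ.inj_low gE fG t hvan hp hy h,
    fun p hp y hy => hΦ.surj_high gE gG fG t ht
      (fun p hp x hx h => hΦ'.inj_low gE fE t hvan hp hx h) hp hy⟩

end FanSheaf
end bdpair

/-! ### Transport of sheaves along isomorphisms of fans induced by linear maps -/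

section transport
variable {V : Type} [AddCommGroup V] [Module ℝ V]
variable {W : Type} [AddCommGroup W] [Module ℝ W]

lemma pb_deg (f : V →ₗ[ℝ] W) {p : ℤ} {a : PolyRing W} (h : a ∈ Adeg W p) : pb f a ∈ Adeg V p := by
  rcases mem_Adeg.1 h with rfl | ⟨k, rfl, hk⟩
  · rw [map_zero]; exact zero_mem _
  · rw [Adeg_two]
    refine mem_AdegN.2 fun t x => ?_
    rw [pb_apply, pb_apply, map_smul]
    exact mem_AdegN.1 hk t _

structure Tr (Δ : Fan V) (Λ : Fan W) (p : V →ₗ[ℝ] W) (e : Δ.cones → Λ.cones) (s : Δ.cones → (W →ₗ[ℝ] V)) : Prop where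
  inj : Injective e
  face : ∀ τ τ' : Δ.cones, (e τ').1.IsFaceOf (e τ).1 ↔ τ'.1.IsFaceOf τ.1
  clos : ∀ (τ : Δ.cones) (c : Λ.cones), c.1.IsFaceOf (e τ).1 → ∃ τ', e τ' = c
  span : ∀ τ : Δ.cones, ∀ y ∈ (e τ).1.spanC, ∃ x ∈ τ.1.spanC, p x = y
  span' : ∀ τ : Δ.cones, ∀ x ∈ τ.1.spanC, p x ∈ (e τ).1.spanC
  sec : ∀ τ : Δ.cones, ∀ x ∈ τ.1.spanC, s τ (p x) = x

variable {Δ : Fan V} {Λ : Fan W} {p : V →ₗ[ℝ] W} {e : Δ.cones → Λ.cones} {s : Δ.cones → (W →ₗ[ℝ] V)}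

lemma Tr.pb_sub (h : Tr Δ Λ p e s) {τ τ' : Δ.cones} (hf : τ'.1.IsFaceOf τ.1) (a : PolyRing V) :
    pb (s τ) a - pb (s τ') a ∈ IV (e τ').1.spanC := mem_IV.2 fun y hy => by
  obtain ⟨x, hx, rfl⟩ := h.span τ' y hy
  rw [poly_sub, pb_apply, pb_apply, h.sec τ x (hf.span_le hx), h.sec τ' x hx, sub_self]

lemma Tr.pb_pb (h : Tr Δ Λ p e s) (τ : Δ.cones) (a : PolyRing W) :
    pb (s τ) (pb p a) - a ∈ IV (e τ).1.spanC := mem_IV.2 fun y hy => by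
  obtain ⟨x, hx, rfl⟩ := h.span τ y hy
  rw [poly_sub, pb_apply, pb_apply, h.sec τ x hx, sub_self]

lemma Tr.pb_mem (h : Tr Δ Λ p e s) (τ : Δ.cones) {a : PolyRing V} :
    pb (s τ) a ∈ IV (e τ).1.spanC ↔ a ∈ IV τ.1.spanC := by
  rw [mem_IV, mem_IV]
  constructor
  · intro hh x hx
    have := hh (p x) (h.span' τ x hx)
    rwa [pb_apply, h.sec τ x hx] at this
  · intro hh y hy
    obtain ⟨x, hx, rfl⟩ := h.span τ y hy
    rw [pb_apply, h.sec τ x hx]; exact hh x hx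

lemma Tr.proper (h : Tr Δ Λ p e s) (τ τ' : Δ.cones) :
    (e τ').1.IsProperFaceOf (e τ).1 ↔ τ'.1.IsProperFaceOf τ.1 := by
  have : (e τ').1 = (e τ).1 ↔ τ'.1 = τ.1 :=
    ⟨fun hh => congrArg Subtype.val (h.inj (Subtype.ext hh)), fun hh => by rw [show τ' = τ from Subtype.ext hh]⟩
  unfold Cone.IsProperFaceOf
  rw [h.face, ne_eq, ne_eq, this]

/-- `F` is the pull-back of `G`. -/
structure TrIso (s : Δ.cones → (W →ₗ[ℝ] V)) (e : Δ.cones → Λ.cones) (G : FanSheaf Λ) (F : FanSheaf Δ) where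
  ι : ∀ τ, (F.stalk τ).M ≃+ (G.stalk (e τ)).M
  smul : ∀ τ (a : PolyRing V) x, ι τ (a • x) = pb (s τ) a • ι τ x
  rsmul : ∀ τ (c : ℝ) x, ι τ (c • x) = c • ι τ x
  deg : ∀ τ (q : ℤ) x, ι τ x ∈ (G.stalk (e τ)).deg q ↔ x ∈ (F.stalk τ).deg q
  r : ∀ τ τ' x, ι τ' (F.r τ τ' x) = G.r (e τ) (e τ') (ι τ x)

def trStalk (s : W →ₗ[ℝ] V) (N : GAMod W) : GAMod V :=
  letI : Module (PolyRing V) N.M := Module.compHom N.M (pb s)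
  { M := N.M
    acg := N.acg
    modR := N.modR
    tower := ⟨fun c a x => by
      show pb s (c • a) • x = c • (pb s a • x)
      rw [pb_smul, smul_assoc]⟩
    deg := N.deg
    internal := N.internal
    smul_deg := fun p q a ha x hx => N.smul_deg p q (pb s a) (pb_deg s ha) x hx }

def trSheaf (h : Tr Δ Λ p e s) {G : FanSheaf Λ} (hG : G.Good) : FanSheaf Δ where
  stalk τ := trStalk (s τ) (G.stalk (e τ))
  res τ τ' hf :=
    { toLin :=
        { toFun := fun x => G.r (e τ) (e τ') x
          map_add' := fun x y => map_add (G.r (e τ) (e τ')) x y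
          map_smul' := fun a x => by
            have e1 : G.r (e τ) (e τ') (pb (s τ) a • (show (G.stalk (e τ)).M from x)) =
                pb (s τ') a • G.r (e τ) (e τ') (show (G.stalk (e τ)).M from x) := by
              rw [map_smul, ← sub_eq_zero, ← sub_smul]
              exact hG.kill _ (h.pb_sub hf a) _
            exact e1 }
      deg_mem := fun q x hx => G.r_deg (σ := e τ) (τ := e τ') hx }
  res_self τ hf := LinearMap.ext fun x => G.r_self (e τ) x
  res_comp τ τ' τ'' h1 h2 h3 := LinearMap.ext fun x =>
    G.r_comp (σ := e τ) (τ := e τ') (υ := e τ'') ((h.face _ _).2 h1) ((h.face _ _).2 h2) x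

def trSheafIso (h : Tr Δ Λ p e s) {G : FanSheaf Λ} (hG : G.Good) : TrIso s e G (trSheaf h hG) where
  ι τ := AddEquiv.refl (G.stalk (e τ)).M
  smul τ a x := rfl
  rsmul τ c x := rfl
  deg τ q x := Iff.rfl
  r τ τ' x := by
    by_cases hf : τ'.1.IsFaceOf τ.1
    · rw [FanSheaf.r_res _ hf]; rfl
    · rw [FanSheaf.r_not _ hf, FanSheaf.r_not _ (fun hh => hf ((h.face _ _).1 hh))]; rfl

namespace TrIso
variable {G : FanSheaf Λ} {F : FanSheaf Δ} (I : TrIso s e G F)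

lemma pull {S : Set (Cone V)} {S' : Set (Cone W)} (h : Tr Δ Λ p e s)
    (hS : ∀ τ : Δ.cones, (e τ).1 ∈ S' ↔ τ.1 ∈ S) {t : ∀ c, (G.stalk c).M} (ht : t ∈ G.secSub S') :
    (fun τ => (I.ι τ).symm (t (e τ))) ∈ F.secSub S := by
  rw [G.mem_sec] at ht
  rw [F.mem_sec]
  refine ⟨fun τ hτ => ?_, fun τ τ' hτ hτ' hf => ?_⟩
  · rw [ht.1 _ (fun hh => hτ ((hS _).1 hh)), map_zero]
  · apply (I.ι τ').injective
    rw [I.r, AddEquiv.apply_symm_apply, AddEquiv.apply_symm_apply]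
    exact ht.2 _ _ ((hS _).2 hτ) ((hS _).2 hτ') ((h.face _ _).2 hf)

lemma push {S : Set (Cone V)} {S' : Set (Cone W)} (h : Tr Δ Λ p e s)
    (hS : ∀ τ : Δ.cones, (e τ).1 ∈ S' ↔ τ.1 ∈ S) (himg : ∀ c : Λ.cones, c.1 ∈ S' → ∃ τ, e τ = c)
    {x : ∀ τ, (F.stalk τ).M} (hx : x ∈ F.secSub S) :
    ∃ t ∈ G.secSub S', ∀ τ, t (e τ) = I.ι τ (x τ) := by
  have hex : ∀ c : Λ.cones, ∃ u : (G.stalk c).M, (∀ τ, ∀ hh : e τ = c, hh ▸ I.ι τ (x τ) = u) ∧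
      ((∀ τ, e τ ≠ c) → u = 0) := by
    intro c
    by_cases hc : ∃ τ, e τ = c
    · obtain ⟨τ, rfl⟩ := hc
      refine ⟨I.ι τ (x τ), fun τ' hh => ?_, fun hh => absurd rfl (hh τ)⟩
      obtain rfl := h.inj hh
      rfl
    · push Not at hc
      exact ⟨0, fun τ hh => absurd hh (hc τ), fun _ => rfl⟩
  choose t ht ht0 using hex
  have ht1 : ∀ τ, t (e τ) = I.ι τ (x τ) := fun τ => (ht (e τ) τ rfl).symm
  rw [F.mem_sec] at hx
  refine ⟨t, ?_, ht1⟩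
  rw [G.mem_sec]
  refine ⟨fun c hc => ?_, fun c c' hc hc' hf => ?_⟩
  · by_cases hh : ∃ τ, e τ = c
    · obtain ⟨τ, rfl⟩ := hh
      rw [ht1, hx.1 τ (fun h' => hc ((hS τ).2 h')), map_zero]
    · push Not at hh
      exact ht0 c hh
  · obtain ⟨τ, rfl⟩ := himg c hc
    obtain ⟨τ', rfl⟩ := himg c' hc'
    rw [ht1, ht1, ← I.r, hx.2 τ τ' ((hS _).1 hc) ((hS _).1 hc') ((h.face _ _).1 hf)]


lemma good [FiniteDimensional ℝ V] [FiniteDimensional ℝ W] (I : TrIso s e G F) (h : Tr Δ Λ p e s) (hG : G.Good) : F.Good := by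
  have hbd : ∀ τ τ' : Δ.cones, (e τ').1 ∈ FanSheaf.bdFan (e τ) ↔ τ'.1 ∈ FanSheaf.bdFan τ := fun τ τ' => h.proper τ τ'
  have hclos : ∀ (τ : Δ.cones) (c : Λ.cones), c.1 ∈ FanSheaf.bdFan (e τ) → ∃ τ', e τ' = c := fun τ c hc => by
    have hc' : c.1.IsProperFaceOf (e τ).1 := hc
    exact h.clos τ c hc'.1
  refine ⟨fun τ => ?_, fun τ x hx => ?_, fun τ hτ x hx => ?_, ?_⟩
  · obtain ⟨hk, n, b, d, hb, hs, hr⟩ := hG.free (e τ)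
    refine ⟨fun a ha x => ?_, n, fun i => (I.ι τ).symm (b i), d, fun i => ?_, fun x => ?_, fun c hc i => ?_⟩
    · apply (I.ι τ).injective
      rw [I.smul, map_zero]
      exact hk _ ((h.pb_mem τ).2 ha) _
    · rw [← I.deg, AddEquiv.apply_symm_apply]; exact hb i
    · obtain ⟨c, hc⟩ := hs (I.ι τ x)
      refine ⟨fun i => pb p (c i), ?_⟩
      apply (I.ι τ).injective
      rw [map_sum, hc]
      refine Finset.sum_congr rfl fun i _ => ?_
      rw [I.smul, AddEquiv.apply_symm_apply, eq_comm, ← sub_eq_zero, ← sub_smul]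
      exact hk _ (h.pb_pb τ _) _
    · rw [← h.pb_mem τ]
      refine hr (fun i => pb (s τ) (c i)) ?_ i
      have := congrArg (I.ι τ) hc
      rw [map_sum, map_zero] at this
      rw [← this]
      refine Finset.sum_congr rfl fun i _ => ?_
      rw [I.smul, AddEquiv.apply_symm_apply]
  · obtain ⟨t, ht, hte⟩ := I.push h (hbd τ) (hclos τ) hx
    obtain ⟨y, hy⟩ := hG.surj (e τ) t ht
    refine ⟨(I.ι τ).symm y, fun τ' hτ' => ?_⟩
    apply (I.ι τ').injective
    rw [I.r, AddEquiv.apply_symm_apply, hy _ ((h.proper _ _).2 hτ'), hte]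
  · have hne : (e τ).1 ≠ zeroCone W := fun hz => hτ (by
      have h0 : ∀ x ∈ τ.1.spanC, x = 0 := fun x hx => by
        have := h.span' τ x hx
        rw [hz, zeroCone_span, Submodule.mem_bot] at this
        rw [← h.sec τ x hx, this, map_zero]
      apply Cone.ext'
      apply Set.Subset.antisymm
      · intro x hx
        exact h0 x (τ.1.mem_span hx)
      · intro x hx
        have : x = 0 := hx
        rw [this]; exact τ.1.zero_mem)
    have := hG.ker (e τ) hne (I.ι τ x) (fun c hc => by
      obtain ⟨τ', rfl⟩ := hclos τ c hc
      rw [← I.r, hx τ' ((h.proper _ _).1 hc), map_zero])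
    have key : ∀ y ∈ mSub W (G.stalk (e τ)).M, (I.ι τ).symm y ∈ mSub V (F.stalk τ).M := fun y hy => by
      refine Submodule.smul_induction_on hy ?_ ?_
      · intro a ha z _
        have e1 : (I.ι τ).symm (a • z) = pb p a • (I.ι τ).symm z := by
          apply (I.ι τ).injective
          rw [I.smul, AddEquiv.apply_symm_apply, AddEquiv.apply_symm_apply, eq_comm, ← sub_eq_zero, ← sub_smul]
          exact hG.kill _ (h.pb_pb τ _) _
        rw [e1]
        refine Submodule.smul_mem_smul (mem_mId.2 ?_) trivial
        rw [pb_apply, map_zero]; exact mem_mId.1 ha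
      · intro a b ha hb
        rw [map_add]; exact add_mem ha hb
    have := key _ this
    rwa [AddEquiv.symm_apply_apply] at this
  · have hz : e Δ.ozero = Λ.ozero := by
      apply Subtype.ext
      apply Cone.ext'
      have h0 : ∀ y ∈ (e Δ.ozero).1.spanC, y = 0 := fun y hy => by
        obtain ⟨x, hx, rfl⟩ := h.span _ y hy
        have : x ∈ (zeroCone V).spanC := hx
        rw [zeroCone_span, Submodule.mem_bot] at this
        rw [this, map_zero]
      apply Set.Subset.antisymm
      · intro x hx
        exact h0 x ((e Δ.ozero).1.mem_span hx)
      · intro x hx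
        have : x = 0 := hx
        rw [this]; exact (e Δ.ozero).1.zero_mem
    have h0 := hG.zero
    rw [← hz] at h0
    obtain ⟨u, hu, hu0, hx⟩ := h0
    refine ⟨(I.ι _).symm u, ?_, fun hh => hu0 ?_, fun x => ?_⟩
    · rw [← I.deg, AddEquiv.apply_symm_apply]; exact hu
    · have := congrArg (I.ι _) hh
      rwa [AddEquiv.apply_symm_apply, map_zero] at this
    · obtain ⟨c, hc⟩ := hx (I.ι _ x)
      refine ⟨c, ?_⟩
      apply (I.ι _).injective
      rw [hc, I.rsmul, AddEquiv.apply_symm_apply]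

end TrIso
end transport

/-! ### Geometry of the flattened boundary fan and the final theorem -/

section final1
variable {V : Type} [AddCommGroup V] [Module ℝ V] [FiniteDimensional ℝ V]
variable {W : Type} [AddCommGroup W] [Module ℝ W] [FiniteDimensional ℝ W]

lemma bd_sign {σ τ : Cone V} {l : V} (hIl : IsInt σ l) (hτ : τ.IsProperFaceOf σ) {x x' : V} {c : ℝ}
    (hx : x ∈ τ.carrier) (hx' : x' ∈ σ.carrier) (h : x = x' + c • l) : c ≤ 0 := by
  obtain ⟨ρ, hρ, hf⟩ := exists_facet_of_proper hτ
  have h1 : hl σ ρ x = 0 := hl_zero hρ (hf.span_le (τ.mem_span hx))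
  have h2 := hl_nonneg hρ hx'
  have h3 := hIl.2 ρ hρ
  rw [h, map_add, map_smul, smul_eq_mul] at h1
  by_contra hc
  push Not at hc
  nlinarith [mul_pos hc h3]

lemma bd_span_inj {σ τ : Cone V} {l : V} (hIl : IsInt σ l) (hτ : τ.IsProperFaceOf σ) {x : V} {c : ℝ}
    (hx : x ∈ τ.spanC) (h : x = c • l) : x = 0 := by
  obtain ⟨ρ, hρ, hf⟩ := exists_facet_of_proper hτ
  have h1 : hl σ ρ x = 0 := hl_zero hρ (hf.span_le hx)
  have h3 := hIl.2 ρ hρ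
  rw [h, map_smul, smul_eq_mul] at h1
  rcases mul_eq_zero.1 h1 with h0 | h0
  · rw [h, h0, zero_smul]
  · exact absurd h0 h3.ne'

lemma bd_inj {σ τ τ' : Cone V} {l : V} (hIl : IsInt σ l) {p : V →ₗ[ℝ] W}
    (hker : ∀ x, p x = 0 → ∃ c : ℝ, x = c • l) (hτ : τ.IsProperFaceOf σ) (hτ' : τ'.IsProperFaceOf σ)
    {x x' : V} (hx : x ∈ τ.carrier) (hx' : x' ∈ τ'.carrier) (h : p x = p x') : x = x' := by
  obtain ⟨c, hc⟩ := hker (x - x') (by rw [map_sub, h, sub_self])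
  have e1 : x = x' + c • l := by rw [← hc]; abel
  have e2 : x' = x + (-c) • l := by rw [neg_smul, ← hc]; abel
  have := bd_sign hIl hτ hx (hτ'.1.sub hx') e1
  have := bd_sign hIl hτ' hx' (hτ.1.sub hx) e2
  have : c = 0 := by linarith
  rw [e1, this, zero_smul, add_zero]

lemma exists_leftinv {p : V →ₗ[ℝ] W} {U : Submodule ℝ V} (h : ∀ x ∈ U, p x = 0 → x = 0) :
    ∃ s : W →ₗ[ℝ] V, ∀ x ∈ U, s (p x) = x := by
  obtain ⟨g, hg⟩ := LinearMap.exists_leftInverse_of_injective (p.domRestrict U) (by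
    rw [LinearMap.ker_eq_bot']
    intro x hx
    exact Subtype.ext (h x.1 x.2 hx))
  refine ⟨U.subtype ∘ₗ g, fun x hx => ?_⟩
  have := LinearMap.congr_fun hg ⟨x, hx⟩
  exact congrArg Subtype.val this

lemma exists_imgCone {p : V →ₗ[ℝ] W} (τ : Cone V) (h : ∀ x ∈ τ.spanC, p x = 0 → x = 0) :
    ∃ c : Cone W, c.carrier = p '' τ.carrier := by
  obtain ⟨g, hg⟩ := τ.isPoly
  refine ⟨⟨p '' τ.carrier, ⟨g.image p, ?_⟩, ?_⟩, rfl⟩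
  · have hgen : ∀ v ∈ g, v ∈ τ.carrier := fun v hv => by
      rw [hg]
      refine ⟨fun w => if w = v then 1 else 0, fun w _ => by dsimp only; split_ifs <;> norm_num, ?_⟩
      simp [Finset.sum_ite_eq', hv]
    apply Set.Subset.antisymm
    · rintro _ ⟨x, hx, rfl⟩
      rw [hg] at hx
      obtain ⟨c, hc, rfl⟩ := hx
      refine ⟨fun w => ∑ v ∈ g with p v = w, c v, fun w _ => Finset.sum_nonneg fun v hv => hc v (Finset.mem_filter.1 hv).1, ?_⟩
      rw [map_sum, ← Finset.sum_fiberwise_of_maps_to (g := p) (t := g.image p)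
        (fun v hv => Finset.mem_image_of_mem p hv)]
      refine Finset.sum_congr rfl fun w _ => ?_
      rw [Finset.sum_smul]
      refine Finset.sum_congr rfl fun v hv => ?_
      rw [map_smul, (Finset.mem_filter.1 hv).2]
    · rintro y ⟨c, hc, rfl⟩
      have hmem : ∀ w ∈ g.image p, c w • w ∈ p '' τ.carrier := fun w hw => by
        obtain ⟨v, hv, rfl⟩ := Finset.mem_image.1 hw
        exact ⟨c (p v) • v, τ.smul_mem (hgen v hv) (hc _ hw), by rw [map_smul]⟩
      have : ∀ S : Finset W, S ⊆ g.image p → ∑ w ∈ S, c w • w ∈ p '' τ.carrier := by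
        intro S
        induction S using Finset.induction_on with
        | empty => intro _; exact ⟨0, τ.zero_mem, by simp⟩
        | insert a S ha ih =>
          intro hS
          rw [Finset.sum_insert ha]
          obtain ⟨x, hx, hxe⟩ := hmem a (hS (Finset.mem_insert_self a S))
          obtain ⟨y, hy, hye⟩ := ih (fun w hw => hS (Finset.mem_insert_of_mem hw))
          exact ⟨x + y, τ.add_mem hx hy, by rw [map_add, hxe, hye]⟩
      exact this _ (Finset.Subset.refl _)
  · rintro _ ⟨x, hx, rfl⟩ ⟨x', hx', he⟩
    have h0 := h (x + x') (τ.mem_span (τ.add_mem hx hx')) (by rw [map_add, he, add_neg_cancel])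
    have : -x = x' := by rw [eq_comm, ← sub_eq_zero, sub_neg_eq_add, add_comm]; exact h0
    have hx0 := τ.pointed x hx (this ▸ hx')
    rw [hx0, map_zero]

lemma Tr.mk' {Δ : Fan V} {Λ : Fan W} {p : V →ₗ[ℝ] W} {e : Δ.cones → Λ.cones} {s : Δ.cones → (W →ₗ[ℝ] V)}
    (hc : ∀ τ, (e τ).1.carrier = p '' τ.1.carrier)
    (binj : ∀ τ τ' : Δ.cones, ∀ x ∈ τ.1.carrier, ∀ x' ∈ τ'.1.carrier, p x = p x' → x = x')
    (hs : ∀ τ : Δ.cones, ∀ x ∈ τ.1.spanC, s τ (p x) = x)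
    (surj : ∀ c, ∃ τ, e τ = c) : Tr Δ Λ p e s := by
  have hsp : ∀ τ, (e τ).1.spanC = τ.1.spanC.map p := fun τ => by
    show Submodule.span ℝ (e τ).1.carrier = Submodule.map p (Submodule.span ℝ τ.1.carrier)
    rw [hc, Submodule.map_span]
  have hsub : ∀ τ τ', e τ = e τ' → τ.1.carrier ⊆ τ'.1.carrier := fun τ τ' h x hx => by
    have : p x ∈ (e τ').1.carrier := by rw [← h, hc]; exact ⟨x, hx, rfl⟩
    rw [hc] at this
    obtain ⟨y, hy, hye⟩ := this
    rwa [binj τ τ' x hx y hy hye.symm]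
  refine ⟨fun τ τ' h => ?_, fun τ τ' => ⟨?_, ?_⟩, fun _ c _ => surj c, fun τ y hy => ?_, fun τ x hx => ?_, hs⟩
  · exact Subtype.ext (Cone.ext' (Set.Subset.antisymm (hsub _ _ h) (hsub _ _ h.symm)))
  · rintro ⟨f, hf, hfe⟩
    rw [hc, hc] at hfe
    refine ⟨f ∘ₗ p, fun x hx => hf _ (by rw [hc]; exact ⟨x, hx, rfl⟩), ?_⟩
    apply Set.Subset.antisymm
    · intro x hx
      have : p x ∈ p '' τ'.1.carrier := ⟨x, hx, rfl⟩
      rw [hfe] at this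
      obtain ⟨⟨y, hy, hye⟩, h0⟩ := this
      have := binj τ' τ x hx y hy hye.symm
      exact ⟨by rw [this]; exact hy, h0⟩
    · rintro x ⟨hx, h0⟩
      have : p x ∈ p '' τ'.1.carrier := by rw [hfe]; exact ⟨⟨x, hx, rfl⟩, h0⟩
      obtain ⟨y, hy, hye⟩ := this
      rwa [binj τ τ' x hx y hy hye.symm]
  · intro hface
    obtain ⟨f, hf, hfe⟩ := id hface
    have hval : ∀ x ∈ τ.1.carrier, f (s τ (p x)) = f x := fun x hx => by rw [hs τ x (τ.1.mem_span hx)]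
    refine ⟨f ∘ₗ s τ, ?_, ?_⟩
    · rw [hc]
      rintro _ ⟨x, hx, rfl⟩
      show 0 ≤ f (s τ (p x))
      rw [hval x hx]; exact hf x hx
    · rw [hc, hc]
      apply Set.Subset.antisymm
      · rintro _ ⟨x, hx, rfl⟩
        rw [hfe] at hx
        refine ⟨⟨x, hx.1, rfl⟩, ?_⟩
        show f (s τ (p x)) = 0
        rw [hval x hx.1]; exact hx.2
      · rintro _ ⟨⟨x, hx, rfl⟩, h0⟩
        refine ⟨x, ?_, rfl⟩
        rw [hfe]
        refine ⟨hx, ?_⟩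
        have h0' : f (s τ (p x)) = 0 := h0
        rwa [hval x hx] at h0'
  · rw [hsp] at hy
    obtain ⟨x, hx, rfl⟩ := hy
    exact ⟨x, hx, rfl⟩
  · rw [hsp]; exact ⟨x, hx, rfl⟩

/-- The boundary fan of `σ`. -/
def bdF {σ : Cone V} {m : ℕ} (hm : σ.dim = m + 1) {Δσ : Fan V} (hΔσ : Δσ.cones = {τ : Cone V | τ.IsFaceOf σ}) : Fan V where
  cones := FanSheaf.bd σ
  finite := Δσ.finite.subset (by
    intro τ hτ
    have : τ.IsProperFaceOf σ := hτ
    rw [hΔσ]; exact this.1)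
  zero_mem := by
    refine ⟨zero_face σ, fun h => ?_⟩
    rw [← h, zeroCone_dim] at hm
    omega
  face_mem := by
    intro τ hτ ρ hρ
    have h : τ.IsProperFaceOf σ := hτ
    refine ⟨hρ.trans h.1, fun he => h.2 ?_⟩
    rw [he] at hρ
    exact h.1.antisymm hρ
  inter_mem := by
    intro τ hτ τ' hτ'
    have h : τ.IsProperFaceOf σ := hτ
    have h' : τ'.IsProperFaceOf σ := hτ'
    obtain ⟨ρ, _, h1, h2, h3⟩ := Δσ.inter_mem τ (by rw [hΔσ]; exact h.1) τ' (by rw [hΔσ]; exact h'.1)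
    refine ⟨ρ, ⟨h1.trans h.1, fun he => h.2 ?_⟩, h1, h2, h3⟩
    rw [he] at h1
    exact h.1.antisymm h1

lemma mId_split {H : Type} [AddCommGroup H] [Module ℝ H] {q : V →ₗ[ℝ] H} {T : V →ₗ[ℝ] ℝ} {U : Submodule ℝ V}
    (h : IsPar (q.prod T) U) {a : PolyRing V} (ha : a.1 0 = 0) :
    ∃ (r : PolyRing H) (r' : PolyRing V), r.1 0 = 0 ∧ a - (pb q r + linP T * r') ∈ IV U := by
  obtain ⟨P, hP⟩ := thetaP_exists h a
  have e1 : thetaP q T P = pb q (P.coeff 0) + linP T * thetaP q T P.divX := by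
    conv_lhs => rw [← Polynomial.divX_mul_X_add P]
    rw [map_add, map_mul, thetaP_C, thetaP_X, add_comm, mul_comm]
  refine ⟨P.coeff 0, thetaP q T P.divX, ?_, e1 ▸ hP⟩
  have h0 := mem_IV.1 hP 0 (zero_mem U)
  rw [e1, poly_sub, poly_add, poly_mul, pb_apply, linP_apply, ha, map_zero, map_zero] at h0
  linarith

end final1

section final2
variable {V : Type} [AddCommGroup V] [Module ℝ V] [FiniteDimensional ℝ V]
variable {W : Type} [AddCommGroup W] [Module ℝ W] [FiniteDimensional ℝ W]

/-- The vanishing condition in terms of sections over the boundary. -/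
lemma van_step {σ : Cone V} {m : ℕ} (hm : σ.dim = m + 1) {l : V} (hIl : IsInt σ l)
    {H : Type} [AddCommGroup H] [Module ℝ H] {q : V →ₗ[ℝ] H} (hq : Par σ l q)
    {T : V →ₗ[ℝ] ℝ} (hTl : T l ≠ 0)
    {Δσ Δ' : Fan V} (hmem : σ ∈ Δσ.cones) (hΔ' : Δ'.cones = FanSheaf.bd σ)
    {E : FanSheaf Δσ} (hE : E.Good)
    (hvan : ∀ q : ℤ, (σ.dim : ℤ) ≤ q → mRedPiece V ((E.stalk ⟨σ, hmem⟩).deg q) = ⊥)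
    {e : Δ'.cones → Δσ.cones} (he : ∀ τ, (e τ).1 = τ.1)
    (hTr : Tr Δ' Δσ LinearMap.id e (fun _ => LinearMap.id))
    {F : FanSheaf Δ'} (I : TrIso (fun _ => LinearMap.id) e E F) :
    ∀ p : ℤ, (m : ℤ) + 1 ≤ p → ∀ x ∈ F.secDeg (FanSheaf.bd σ) p,
      ∃ z ∈ mB q (F.Sec (FanSheaf.bd σ)), ∃ w, x = z + linP T • w := by
  have hbd : ∀ τ : Δ'.cones, τ.1.IsProperFaceOf σ := fun τ => by
    have : τ.1 ∈ FanSheaf.bd σ := by rw [← hΔ']; exact τ.2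
    exact this
  have hS : ∀ τ : Δ'.cones, (e τ).1 ∈ FanSheaf.bdFan (⟨σ, hmem⟩ : Δσ.cones) ↔ τ.1 ∈ FanSheaf.bd σ := fun τ => by
    rw [he]; exact Iff.rfl
  have himg : ∀ c : Δσ.cones, c.1 ∈ FanSheaf.bdFan (⟨σ, hmem⟩ : Δσ.cones) → ∃ τ, e τ = c := fun c hc =>
    ⟨⟨c.1, by rw [hΔ']; exact hc⟩, Subtype.ext (he _)⟩
  have hid : ∀ a : PolyRing V, pb (LinearMap.id : V →ₗ[ℝ] V) a = a := fun a => poly_ext fun x => rfl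
  have key : ∀ ξ ∈ mSub V (E.stalk ⟨σ, hmem⟩).M, ∃ z ∈ mB q (F.Sec (FanSheaf.bd σ)), ∃ w : F.Sec (FanSheaf.bd σ),
      ∀ τ, E.r ⟨σ, hmem⟩ (e τ) ξ = I.ι τ ((z + linP T • w).1 τ) := by
    intro ξ hξ
    refine Submodule.smul_induction_on hξ ?_ ?_
    · intro a ha η _
      obtain ⟨r, r', hr, hrr⟩ := mId_split (hq.prod (σ.mem_span hIl.1) T hTl) (mem_mId.1 ha)
      have hx0 := I.pull hTr hS (t := (E.bdRes ⟨σ, hmem⟩ η).1) (E.bdRes ⟨σ, hmem⟩ η).2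
      let x0 : F.Sec (FanSheaf.bd σ) := ⟨_, hx0⟩
      refine ⟨pb q r • x0, mB_smul hr x0, r' • x0, fun τ => ?_⟩
      have e0 : I.ι τ (x0.1 τ) = E.r ⟨σ, hmem⟩ (e τ) η := by
        show I.ι τ ((I.ι τ).symm ((E.bdRes ⟨σ, hmem⟩ η).1 (e τ))) = _
        rw [AddEquiv.apply_symm_apply]
        exact E.bdRes_apply _ _ (by rw [he]; exact hbd τ) _
      have e2 : (pb q r • x0 + linP T • r' • x0).1 τ = (pb q r + linP T * r') • x0.1 τ := by
        rw [add_smul, mul_smul]; rfl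
      rw [e2, I.smul, hid, e0, map_smul, ← sub_eq_zero, ← sub_smul]
      refine hE.kill _ (IV_mono ?_ hrr) _
      rw [he]; exact (hbd τ).1.span_le
    · rintro a b ⟨z, hz, w, h⟩ ⟨z', hz', w', h'⟩
      refine ⟨z + z', add_mem hz hz', w + w', fun τ => ?_⟩
      rw [map_add, h, h', ← map_add]
      congr 1
      rw [smul_add, add_add_add_comm]; rfl
  intro p hp x hx
  obtain ⟨t, ht, hte⟩ := I.push hTr hS himg x.2
  obtain ⟨ξ, hξ⟩ := hE.surj ⟨σ, hmem⟩ t ht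
  have hξm : pr (E.stalk ⟨σ, hmem⟩).deg p ξ ∈ mSub V (E.stalk ⟨σ, hmem⟩).M := by
    have h1 : (mSub V (E.stalk ⟨σ, hmem⟩).M).mkQ (pr (E.stalk ⟨σ, hmem⟩).deg p ξ) ∈
        mRedPiece V ((E.stalk ⟨σ, hmem⟩).deg p) := ⟨_, pr_mem (E.stalk ⟨σ, hmem⟩).grM.gr p ξ, rfl⟩
    rw [hvan p (by rw [hm]; push_cast; exact hp)] at h1
    exact (FanSheaf.mk_eq_zero_iff _).1 ((Submodule.mem_bot ℝ).1 h1)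
  obtain ⟨z, hz, w, hzw⟩ := key _ hξm
  refine ⟨z, hz, w, Subtype.ext (funext fun τ => ?_)⟩
  apply (I.ι τ).injective
  have hd : I.ι τ (x.1 τ) ∈ (E.stalk (e τ)).deg p := (I.deg τ p _).2 (hx τ)
  rw [← hzw, E.r_pr, hξ (e τ) (by rw [he]; exact hbd τ), hte, pr_of_mem (E.stalk (e τ)).grM.gr hd]

section core
variable {σ : Cone V} {Δ' : Fan V} {Λ : Fan W} {p : V →ₗ[ℝ] W}
  {e : Δ'.cones → Λ.cones} {s : Δ'.cones → (W →ₗ[ℝ] V)} {G : FanSheaf Λ} {F : FanSheaf Δ'}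

/-- Pull-back of global sections. -/
def pullS (I : TrIso s e G F) (h : Tr Δ' Λ p e s) (hΔ' : Δ'.cones = FanSheaf.bd σ) (y : G.globalSec) :
    F.Sec (FanSheaf.bd σ) :=
  ⟨fun τ => (I.ι τ).symm (y.1 (e τ)), I.pull h (fun τ => iff_of_true (e τ).2 (hΔ' ▸ τ.2)) y.2⟩

variable (I : TrIso s e G F) (h : Tr Δ' Λ p e s) (hΔ' : Δ'.cones = FanSheaf.bd σ)

lemma pullS_ι (y : G.globalSec) (τ) : I.ι τ ((pullS I h hΔ' y).1 τ) = y.1 (e τ) :=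
  AddEquiv.apply_symm_apply _ _

lemma pullS_surj (surj : ∀ c, ∃ τ, e τ = c) (x : F.Sec (FanSheaf.bd σ)) : ∃ y, pullS I h hΔ' y = x := by
  obtain ⟨t, ht, hte⟩ := I.push h (S' := Λ.cones) (S := FanSheaf.bd σ)
    (fun τ => iff_of_true (e τ).2 (hΔ' ▸ τ.2)) (fun c _ => surj c) x.2
  refine ⟨⟨t, ht⟩, Subtype.ext (funext fun τ => ?_)⟩
  apply (I.ι τ).injective
  rw [pullS_ι]; exact hte τ

lemma pullS_deg (surj : ∀ c, ∃ τ, e τ = c) (y : G.globalSec) (d : ℤ) :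
    pullS I h hΔ' y ∈ F.secDeg (FanSheaf.bd σ) d ↔ y ∈ G.secDeg Λ.cones d := by
  constructor
  · intro hy c
    obtain ⟨τ, rfl⟩ := surj c
    rw [← pullS_ι I h hΔ', I.deg]
    exact hy τ
  · intro hy τ
    rw [← I.deg, pullS_ι]
    exact hy (e τ)

lemma pullS_inj (surj : ∀ c, ∃ τ, e τ = c) {y y' : G.globalSec} (hy : pullS I h hΔ' y = pullS I h hΔ' y') : y = y' := by
  refine Subtype.ext (funext fun c => ?_)
  obtain ⟨τ, rfl⟩ := surj c
  rw [← pullS_ι I h hΔ', ← pullS_ι I h hΔ', hy]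

lemma pullS_add (y y' : G.globalSec) : pullS I h hΔ' (y + y') = pullS I h hΔ' y + pullS I h hΔ' y' := by
  refine Subtype.ext (funext fun τ => (I.ι τ).injective ?_)
  rw [pullS_ι]
  have : I.ι τ ((pullS I h hΔ' y + pullS I h hΔ' y').1 τ) =
    I.ι τ ((pullS I h hΔ' y).1 τ) + I.ι τ ((pullS I h hΔ' y').1 τ) := map_add _ _ _
  rw [this, pullS_ι, pullS_ι]; rfl

lemma pullS_sub (y y' : G.globalSec) : pullS I h hΔ' (y - y') = pullS I h hΔ' y - pullS I h hΔ' y' := by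
  rw [eq_sub_iff_add_eq, ← pullS_add, sub_add_cancel]

lemma pullS_zero : pullS I h hΔ' (0 : G.globalSec) = 0 := by
  refine Subtype.ext (funext fun τ => (I.ι τ).injective ?_)
  rw [pullS_ι]; exact (map_zero (I.ι τ)).symm

lemma pullS_smul (hG : G.Good) (a : PolyRing W) (b : PolyRing V)
    (hab : ∀ τ, pb (s τ) b - a ∈ IV (e τ).1.spanC) (y : G.globalSec) :
    pullS I h hΔ' (a • y) = b • pullS I h hΔ' y := by
  refine Subtype.ext (funext fun τ => (I.ι τ).injective ?_)
  rw [pullS_ι]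
  have : I.ι τ ((b • pullS I h hΔ' y).1 τ) = pb (s τ) b • y.1 (e τ) := by
    rw [← pullS_ι I h hΔ', ← I.smul]; rfl
  rw [this, eq_comm, ← sub_eq_zero]
  have e2 : (a • y).1 (e τ) = a • y.1 (e τ) := rfl
  rw [e2, ← sub_smul]
  exact hG.kill _ (hab τ) _

lemma pullS_m (hG : G.Good) (surj : ∀ c, ∃ τ, e τ = c) {H : Submodule ℝ W} {ϱ : W →ₗ[ℝ] H} (hϱ : ∀ y : H, ϱ y.1 = y)
    (hH : ∀ τ : Δ'.cones, ∀ x ∈ τ.1.spanC, p x ∈ H) (y : G.globalSec) :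
    pullS I h hΔ' y ∈ mB (ϱ ∘ₗ p) (F.Sec (FanSheaf.bd σ)) ↔ y ∈ mSub W G.globalSec := by
  constructor
  · intro hy
    suffices HH : ∃ y' ∈ mSub W G.globalSec, pullS I h hΔ' y' = pullS I h hΔ' y by
      obtain ⟨y', hy', he⟩ := HH
      rwa [← pullS_inj I h hΔ' surj he]
    refine mB_ind (P := fun x => ∃ y' ∈ mSub W G.globalSec, pullS I h hΔ' y' = x) ?_ ?_ ?_ hy
    · exact ⟨0, zero_mem _, pullS_zero I h hΔ'⟩
    · rintro x x' ⟨y, hy, rfl⟩ ⟨y', hy', rfl⟩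
      exact ⟨y + y', add_mem hy hy', pullS_add I h hΔ' y y'⟩
    · intro r hr x
      obtain ⟨y, rfl⟩ := pullS_surj I h hΔ' surj x
      refine ⟨pb ϱ r • y, Submodule.smul_mem_smul (mem_mId.2 ?_) trivial, ?_⟩
      · rw [pb_apply, map_zero]; exact hr
      · refine pullS_smul I h hΔ' hG _ _ (fun τ => ?_) y
        refine mem_IV.2 fun w hw => ?_
        obtain ⟨x, hx, rfl⟩ := h.span τ w hw
        rw [poly_sub, pb_apply, pb_apply, pb_apply, h.sec τ x hx]
        exact sub_self _
  · intro hy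
    refine Submodule.smul_induction_on hy ?_ ?_
    · intro a ha z _
      rw [pullS_smul I h hΔ' hG a (pb (ϱ ∘ₗ p) (pb H.subtype a)) (fun τ => ?_) z]
      · refine mB_smul ?_ _
        rw [pb_apply, map_zero]; exact mem_mId.1 ha
      · refine mem_IV.2 fun w hw => ?_
        obtain ⟨x, hx, rfl⟩ := h.span τ w hw
        rw [poly_sub, pb_apply, pb_apply, pb_apply, h.sec τ x hx]
        have : H.subtype ((ϱ ∘ₗ p) x) = p x := congrArg Subtype.val (hϱ ⟨p x, hH τ x hx⟩)
        rw [this, sub_self]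
    · intro x x' hx hx'
      rw [pullS_add]; exact add_mem hx hx'

lemma pullS_T (hG : G.Good) {Tmul : G.globalSec →ₗ[PolyRing W] G.globalSec} {ψc : Λ.cones → PolyRing W}
    (hT : ∀ (s : G.globalSec) (c : Λ.cones), (Tmul s).1 c = ψc c • s.1 c) {b : PolyRing V}
    (hab : ∀ τ, pb (s τ) b - ψc (e τ) ∈ IV (e τ).1.spanC) (y : G.globalSec) :
    pullS I h hΔ' (Tmul y) = b • pullS I h hΔ' y := by
  refine Subtype.ext (funext fun τ => (I.ι τ).injective ?_)
  rw [pullS_ι]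
  have : I.ι τ ((b • pullS I h hΔ' y).1 τ) = pb (s τ) b • y.1 (e τ) := by
    rw [← pullS_ι I h hΔ', ← I.smul]; rfl
  rw [this, eq_comm, hT, ← sub_eq_zero, ← sub_smul]
  exact hG.kill _ (hab τ) _

end core
end final2

section final3
variable {V : Type} [AddCommGroup V] [Module ℝ V] [FiniteDimensional ℝ V]
variable {W : Type} [AddCommGroup W] [Module ℝ W] [FiniteDimensional ℝ W]

lemma core_thm {σ : Cone V} {m : ℕ} (hm : σ.dim = m + 1)
    {Δσ : Fan V} (hΔσ : Δσ.cones = {τ : Cone V | τ.IsFaceOf σ}) (hmem : σ ∈ Δσ.cones)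
    (E : FanSheaf Δσ) (hE : E.IsMES)
    (hvan : ∀ q : ℤ, (σ.dim : ℤ) ≤ q → mRedPiece V ((E.stalk ⟨σ, hmem⟩).deg q) = ⊥)
    (l : V) (hl : l ∈ σ.carrier) (hlrel : ∀ τ : Cone V, τ.IsProperFaceOf σ → l ∉ τ.carrier)
    (p : V →ₗ[ℝ] W) (hpl : p l = 0) (hker : ∀ x, p x = 0 → ∃ c : ℝ, x = c • l)
    (Λ : Fan W)
    (hΛ : Λ.cones = {c : Cone W | ∃ τ : Cone V, τ.IsProperFaceOf σ ∧ c.carrier = p '' τ.carrier})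
    (G : FanSheaf Λ) (hG : G.IsMES)
    (ψ : W → ℝ) (ψc : Λ.cones → PolyRing W)
    (hψ : ∀ c : Λ.cones, ∀ x ∈ c.1.carrier, ψ x = (ψc c).1 x)
    (T : V →ₗ[ℝ] ℝ) (hT : ∀ τ : Cone V, τ.IsProperFaceOf σ → ∀ x ∈ τ.carrier, T x = ψ (p x))
    (hTl : T l ≠ 0) (Tmul : G.globalSec →ₗ[PolyRing W] G.globalSec)
    (hTm : ∀ (s : G.globalSec) (c : Λ.cones), (Tmul s).1 c = ψc c • s.1 c) :
    (∀ d : ℤ, d ≤ (m : ℤ) - 1 → ∀ y ∈ G.secDeg Λ.cones d, Tmul y ∈ mSub W G.globalSec → y ∈ mSub W G.globalSec) ∧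
    (∀ d : ℤ, (m : ℤ) ≤ d + 1 → ∀ y ∈ G.secDeg Λ.cones (d + 2), ∃ w ∈ G.secDeg Λ.cones d,
      y - Tmul w ∈ mSub W G.globalSec) := by
  have hEg := hE.good
  have hGg := hG.good
  have hIl : IsInt σ l := isInt_of hl fun τ hτ => hlrel τ hτ.proper
  let Δ' : Fan V := bdF hm hΔσ
  have hΔ' : Δ'.cones = FanSheaf.bd σ := rfl
  have hbd : ∀ τ : Δ'.cones, τ.1.IsProperFaceOf σ := fun τ => τ.2
  have hspan0 : ∀ τ : Cone V, τ.IsProperFaceOf σ → ∀ x ∈ τ.spanC, p x = 0 → x = 0 := fun τ hτ x hx h0 => by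
    obtain ⟨c, hc⟩ := hker x h0
    exact bd_span_inj hIl hτ hx hc
  -- restriction of `E`
  let eE : Δ'.cones → Δσ.cones := fun τ => ⟨τ.1, by rw [hΔσ]; exact (hbd τ).1⟩
  have hTrE : Tr Δ' Δσ LinearMap.id eE (fun _ => LinearMap.id) := by
    refine ⟨fun τ τ' h => Subtype.ext (congrArg (fun c : Δσ.cones => c.1) h), fun τ τ' => Iff.rfl, fun τ c hc => ?_,
      fun τ y hy => ⟨y, hy, rfl⟩, fun τ x hx => hx, fun τ x hx => rfl⟩
    exact ⟨⟨c.1, Δ'.face_mem τ.1 τ.2 c.1 hc⟩, rfl⟩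
  let IE := trSheafIso hTrE hEg
  have hE'g := IE.good hTrE hEg
  -- pull-back of `G`
  have hex : ∀ τ : Δ'.cones, ∃ c : Λ.cones, c.1.carrier = p '' τ.1.carrier := fun τ => by
    obtain ⟨c, hc⟩ := exists_imgCone τ.1 (hspan0 τ.1 (hbd τ))
    exact ⟨⟨c, by rw [hΛ]; exact ⟨τ.1, hbd τ, hc⟩⟩, hc⟩
  choose e he using hex
  have hexs : ∀ τ : Δ'.cones, ∃ s : W →ₗ[ℝ] V, ∀ x ∈ τ.1.spanC, s (p x) = x := fun τ =>
    exists_leftinv (hspan0 τ.1 (hbd τ))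
  choose s hs using hexs
  have surj : ∀ c, ∃ τ, e τ = c := fun c => by
    have hc := (Set.ext_iff.1 hΛ c.1).1 c.2
    obtain ⟨τ, hτ, hce⟩ := hc
    exact ⟨⟨τ, hτ⟩, Subtype.ext (Cone.ext' ((he _).trans hce.symm))⟩
  have hTrG : Tr Δ' Λ p e s := Tr.mk' he
    (fun τ τ' x hx x' hx' h => bd_inj hIl hker (hbd τ) (hbd τ') hx hx' h) hs surj
  let IG := trSheafIso hTrG hGg
  have hG'g := IG.good hTrG hGg
  -- the parameters
  let H : Submodule ℝ W := σ.spanC.map p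
  obtain ⟨ϱ, hϱ0⟩ := LinearMap.exists_leftInverse_of_injective H.subtype (Submodule.ker_subtype H)
  have hϱ : ∀ y : H, ϱ y.1 = y := fun y => LinearMap.congr_fun hϱ0 y
  have hq : Par σ l (ϱ ∘ₗ p) := by
    refine ⟨fun x hx h0 => hker x ?_, ?_, fun y => ?_⟩
    · have h1 := hϱ ⟨p x, ⟨x, hx, rfl⟩⟩
      have h2 : ϱ (p x) = 0 := h0
      have h3 : (⟨p x, ⟨x, hx, rfl⟩⟩ : H) = 0 := h1.symm.trans h2
      exact congrArg Subtype.val h3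
    · show ϱ (p l) = 0
      rw [hpl, map_zero]
    · obtain ⟨x, hx, hxy⟩ := y.2
      refine ⟨x, hx, ?_⟩
      show ϱ (p x) = y
      rw [hxy, hϱ]
  have hH : ∀ τ : Δ'.cones, ∀ x ∈ τ.1.spanC, p x ∈ H := fun τ x hx => ⟨x, (hbd τ).1.span_le hx, rfl⟩
  have hvan' := van_step hm hIl hq hTl hmem hΔ' hEg hvan (fun τ => rfl) hTrE IE
  have hlef := FanSheaf.lefschetz hE'g hG'g (fun ζ hζ => hζ) hm hIl hq (linP_deg T) hvan'
  have hab : ∀ τ, pb (s τ) (linP T) - ψc (e τ) ∈ IV (e τ).1.spanC := fun τ => by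
    rw [← vanish_cone, mem_vanish]
    intro w hw
    have hw' := hw
    rw [he] at hw'
    obtain ⟨x, hx, rfl⟩ := hw'
    rw [poly_sub, pb_apply, linP_apply, hs τ x (τ.1.mem_span hx), hT τ.1 (hbd τ) x hx, hψ (e τ) _ hw, sub_self]
  have hTp := pullS_T IG hTrG hΔ' hGg hTm hab
  have hmB := pullS_m IG hTrG hΔ' hGg surj hϱ hH
  have hdeg := pullS_deg IG hTrG hΔ' surj
  refine ⟨fun d hd y hy hTy => ?_, fun d hd y hy => ?_⟩
  · rw [← hmB]
    refine hlef.1 d hd _ ((hdeg y d).2 hy) ?_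
    rw [← hTp, hmB]; exact hTy
  · obtain ⟨w, hw, hyw⟩ := hlef.2 d hd _ ((hdeg y (d + 2)).2 hy)
    obtain ⟨w, rfl⟩ := pullS_surj IG hTrG hΔ' surj w
    refine ⟨w, (hdeg w d).1 hw, ?_⟩
    rw [← hmB, pullS_sub, hTp]; exact hyw

lemma red_inj {M : Type} [AddCommGroup M] [Module (PolyRing W) M] [Module ℝ M]
    [IsScalarTower ℝ (PolyRing W) M] {f : M →ₗ[PolyRing W] M} {d : Submodule ℝ M}
    (h : ∀ y ∈ d, f y ∈ mSub W M → y ∈ mSub W M) : Set.InjOn (mRedMap W f) (mRedPiece W d) := by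
  rintro _ ⟨a, ha, rfl⟩ _ ⟨b, hb, rfl⟩ hab
  have h1 : (mSub W M).mkQ (f a) = (mSub W M).mkQ (f b) := hab
  rw [← sub_eq_zero, ← map_sub, ← map_sub, FanSheaf.mk_eq_zero_iff] at h1
  have h2 := h _ (sub_mem ha hb) h1
  rw [← FanSheaf.mk_eq_zero_iff, map_sub, sub_eq_zero] at h2
  exact h2

lemma red_surj {M : Type} [AddCommGroup M] [Module (PolyRing W) M] [Module ℝ M]
    [IsScalarTower ℝ (PolyRing W) M] {f : M →ₗ[PolyRing W] M} {d d' : Submodule ℝ M}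
    (h : ∀ y ∈ d', ∃ w ∈ d, y - f w ∈ mSub W M) : Set.SurjOn (mRedMap W f) (mRedPiece W d) (mRedPiece W d') := by
  rintro _ ⟨y, hy, rfl⟩
  obtain ⟨w, hw, hyw⟩ := h y hy
  refine ⟨(mSub W M).mkQ w, ⟨w, hw, rfl⟩, ?_⟩
  rw [← FanSheaf.mk_eq_zero_iff, map_sub, sub_eq_zero] at hyw
  exact hyw.symm

end final3

end helpers

/-- Combinatorial Hard Lefschetz theorem: let `Λ = Λ_σ` be the flattened boundary fan
of a cone `σ` of dimension `m+1`, `G•` a minimal extension sheaf on `Λ`, and `ψ` the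
strictly convex piecewise linear function on `Λ` induced by the projection.  If the
vanishing condition `V(σ)` holds, then multiplication by `ψ` induces maps
`μ̄ : Ḡ^{2q}_Λ → Ḡ^{2q+2}_Λ` that are injective for `2q ≤ m−1` and surjective for
`2q ≥ m−1`. -/
theorem combinatorial_hard_lefschetz
    {V : Type} [AddCommGroup V] [Module ℝ V] [FiniteDimensional ℝ V]
    {σ : Cone V} {m : ℕ} (hm : σ.dim = m + 1)
    {Δσ : Fan V} (hΔσ : Δσ.cones = {τ : Cone V | τ.IsFaceOf σ}) (hmem : σ ∈ Δσ.cones)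
    (E : FanSheaf Δσ) (hE : E.IsMES)
    -- the vanishing condition V(σ)
    (hvan : ∀ q : ℤ, (σ.dim : ℤ) ≤ q → mRedPiece V ((E.stalk ⟨σ, hmem⟩).deg q) = ⊥)
    -- a line `L = ℝ·l` through the relative interior of `σ`
    (l : V) (hl : l ∈ σ.carrier) (hlrel : ∀ τ : Cone V, τ.IsProperFaceOf σ → l ∉ τ.carrier)
    -- the flattened boundary fan `Λ_σ = π(∂σ)` in `V_σ/L`
    (Λ : Fan (V ⧸ Submodule.span ℝ {l}))
    (hΛ : Λ.cones = {c : Cone (V ⧸ Submodule.span ℝ {l}) |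
      ∃ τ : Cone V, τ.IsProperFaceOf σ ∧
        c.carrier = (Submodule.span ℝ {l}).mkQ '' τ.carrier})
    (G : FanSheaf Λ) (hG : G.IsMES)
    -- the piecewise linear function `ψ`, given on each cone `c` of `Λ` by a linear
    -- form `ψc c`
    (ψ : (V ⧸ Submodule.span ℝ {l}) → ℝ) (ψc : Λ.cones → PolyRing (V ⧸ Submodule.span ℝ {l}))
    (hψlin : ∀ c : Λ.cones, ψc c ∈ Adeg (V ⧸ Submodule.span ℝ {l}) 2)
    (hψ : ∀ c : Λ.cones, ∀ x ∈ c.1.carrier, ψ x = (ψc c : (V ⧸ Submodule.span ℝ {l}) → ℝ) x)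
    -- strict convexity of `ψ`
    (hconv : ∀ c : Λ.cones, c.1.dim = m → ∀ x ∈ Λ.support, x ∉ c.1.carrier →
      (ψc c : (V ⧸ Submodule.span ℝ {l}) → ℝ) x < ψ x)
    -- `ψ = T ∘ (π|_{∂σ})⁻¹` for a linear form `T` with kernel complementary to `L`
    (T : V →ₗ[ℝ] ℝ) (hT : ∀ τ : Cone V, τ.IsProperFaceOf σ → ∀ x ∈ τ.carrier,
      T x = ψ ((Submodule.span ℝ {l}).mkQ x))
    (hTl : T l ≠ 0) :
    -- multiplication `μ : G•_Λ → G•_Λ[2]` by `ψ` induces `μ̄` on `Ḡ•_Λ`, injective in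
    -- degrees `2q ≤ m−1` and surjective in degrees `2q ≥ m−1`
    ∀ Tmul : G.globalSec →ₗ[PolyRing (V ⧸ Submodule.span ℝ {l})] G.globalSec,
      (∀ (s : G.globalSec) (c : Λ.cones), (Tmul s).1 c = ψc c • s.1 c) →
      (∀ q : ℕ, 2 * q + 1 ≤ m →
        Set.InjOn (mRedMap (V ⧸ Submodule.span ℝ {l}) Tmul)
          (mRedPiece (V ⧸ Submodule.span ℝ {l}) (M := G.globalSec)
            (G.secDeg Λ.cones (2 * q)))) ∧
      (∀ q : ℕ, m ≤ 2 * q + 1 →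
        Set.SurjOn (mRedMap (V ⧸ Submodule.span ℝ {l}) Tmul)
          (mRedPiece (V ⧸ Submodule.span ℝ {l}) (M := G.globalSec)
            (G.secDeg Λ.cones (2 * q)))
          (mRedPiece (V ⧸ Submodule.span ℝ {l}) (M := G.globalSec)
            (G.secDeg Λ.cones (2 * q + 2)))) := by
  intro Tmul hTm
  have hker : ∀ x, (Submodule.span ℝ {l}).mkQ x = 0 → ∃ c : ℝ, x = c • l := fun x hx => by
    rw [Submodule.mkQ_apply, Submodule.Quotient.mk_eq_zero, Submodule.mem_span_singleton] at hx
    obtain ⟨c, hc⟩ := hx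
    exact ⟨c, hc.symm⟩
  have hpl : (Submodule.span ℝ {l}).mkQ l = 0 := by
    rw [Submodule.mkQ_apply, Submodule.Quotient.mk_eq_zero]
    exact Submodule.mem_span_singleton_self l
  have hcore := core_thm hm hΔσ hmem E hE hvan l hl hlrel (Submodule.span ℝ {l}).mkQ hpl hker Λ hΛ G hG
    ψ ψc hψ T hT hTl Tmul hTm
  refine ⟨fun q hq => red_inj (hcore.1 _ ?_), fun q hq => red_surj (hcore.2 _ ?_)⟩
  · omega
  · omega

end
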